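/- For every A > 0 there exist constants C_A > 0 and x_0(A) such that the following holds. Let x ≥ x_0(A), let p be a prime with p ≤ (log x)^{2/3}, and let n, d be positive integers with d | n and n ≤ (log x)^{1/6}/log_2(x). Let L_{p,n,d} be the subfield of C generated over Q by a primitive n-th root of unity and the real d-th root p^{1/d}, and let D = [L_{p,n,d} : Q]. Then the number ϖ_p(x; n, d) of primes r ≤ x with r ≠ p, r ≡ 1 (mod n), and d | (r−1)/ℓ_p(r) satisfies |ϖ_p(x; n, d) − li(x)/D| ≤ C_A·x/(log x)^A. -/

import Mathlib

open scoped Classical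

/-- The iterated logarithm: `logI 0 x = x`, `logI (ν+1) x = max (log (logI ν x)) 1`,
so that `logI 1 x = log_1 x = max (log x, 1)` and `logI ν x = log_ν x`. -/
noncomputable def logI : ℕ → ℝ → ℝ
  | 0, x => x
  | ν + 1, x => max (Real.log (logI ν x)) 1


section Landau
open Metric Complex Set

/-- A nonvanishing analytic function on a disc is a constant times an exponential. -/
lemma exists_log_on_ball {g : ℂ → ℂ} {c : ℂ} {R : ℝ} (hR : 0 < R)
    (hg : DifferentiableOn ℂ g (ball c R)) (hne : ∀ z ∈ ball c R, g z ≠ 0) :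
    ∃ l : ℂ → ℂ, (∀ z ∈ ball c R, HasDerivAt l (deriv g z / g z) z) ∧ l c = 0 ∧
      ∀ z ∈ ball c R, g z = g c * exp (l z) := by
  have hd : DifferentiableOn ℂ (fun z => deriv g z / g z) (ball c R) :=
    (hg.deriv isOpen_ball).div hg hne
  obtain ⟨l0, hl0⟩ := hd.isExactOn_ball
  have hl : ∀ z ∈ ball c R, HasDerivAt (fun z => l0 z - l0 c) (deriv g z / g z) z :=
    fun z hz => (hl0 z hz).sub_const _
  refine ⟨fun z => l0 z - l0 c, hl, by simp, fun z hz => ?_⟩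
  have hder : ∀ w ∈ ball c R, HasDerivAt (fun z => g z * exp (-(l0 z - l0 c))) 0 w := by
    intro w hw
    have h1 := (hg.differentiableAt (isOpen_ball.mem_nhds hw)).hasDerivAt.mul
      (hl w hw).neg.cexp
    refine h1.congr_deriv ?_
    have := hne w hw
    field_simp
    ring
  have hcon : g z * exp (-(l0 z - l0 c)) = g c * exp (-(l0 c - l0 c)) := by
    refine (convex_ball c R).is_const_of_fderivWithin_eq_zero (𝕜 := ℂ)
      (f := fun z => g z * exp (-(l0 z - l0 c))) (s := ball c R)
      (fun w hw => (hder w hw).differentiableAt.differentiableWithinAt) ?_ hz (mem_ball_self hR)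
    intro w hw
    rw [fderivWithin_of_isOpen isOpen_ball hw]
    ext
    rw [fderiv_apply_one_eq_deriv, (hder w hw).deriv]
    rfl
  have h2 : g z = g z * exp (-(l0 z - l0 c)) * exp (l0 z - l0 c) := by
    rw [mul_assoc, ← exp_add]; simp
  rw [h2, hcon]; simp

lemma exists_log_bound {g : ℂ → ℂ} {c : ℂ} {R M : ℝ} (hR : 0 < R) (hM : 0 < M)
    (hg : DifferentiableOn ℂ g (ball c R)) (hne : ∀ z ∈ ball c R, g z ≠ 0)
    (hb : ∀ z ∈ ball c R, ‖g z‖ ≤ Real.exp M * ‖g c‖) :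
    ∃ l : ℂ → ℂ, (∀ z ∈ ball c R, HasDerivAt l (deriv g z / g z) z) ∧ l c = 0 ∧
      ∀ z ∈ ball c R, ‖l z‖ ≤ 2 * M * ‖z - c‖ / (R - ‖z - c‖) := by
  obtain ⟨l, hl, hlc, hgl⟩ := exists_log_on_ball hR hg hne
  refine ⟨l, hl, hlc, fun z hz => ?_⟩
  have hmem : ∀ w ∈ ball (0 : ℂ) R, w + c ∈ ball c R := by
    intro w hw; simpa using hw
  have := borelCaratheodory_zero (f := fun w => l (w + c)) (z := z - c) hM ?_ ?_ hR ?_ ?_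
  · simpa using this
  · intro w hw
    exact ((hl _ (hmem w hw)).comp_add_const w c).differentiableAt.differentiableWithinAt
  · intro w hw
    have h1 := hb _ (hmem w hw)
    rw [hgl _ (hmem w hw), norm_mul, norm_exp, mul_comm] at h1
    have hc : 0 < ‖g c‖ := norm_pos_iff.2 (hne c (mem_ball_self hR))
    have h2 := le_of_mul_le_mul_right h1 hc
    exact Real.exp_le_exp.1 h2
  · simpa [dist_eq_norm] using hz
  · simpa using hlc

/-- Weight of a zero in Landau's lemma. -/
noncomputable def zeroWeight (c : ℂ) (R : ℝ) (ρ : ℂ) : ℝ :=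
  (c - ρ).re * (1 / ‖c - ρ‖ ^ 2 - 1 / R ^ 2)

lemma zeroWeight_nonneg {c ρ : ℂ} {R : ℝ} (hρ : ‖ρ - c‖ ≤ R) (hne : ρ ≠ c)
    (hre : ρ.re ≤ c.re) : 0 ≤ zeroWeight c R ρ := by
  unfold zeroWeight
  have h0 : 0 < ‖c - ρ‖ := norm_pos_iff.2 (sub_ne_zero.2 hne.symm)
  rw [norm_sub_rev] at hρ
  apply mul_nonneg (by simpa using hre)
  rw [sub_nonneg]
  gcongr

lemma remove_zero {F : ℂ → ℂ} {U : Set ℂ} (hU : IsOpen U) {c ρ : ℂ} {R R' M : ℝ} (hR : 0 < R)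
    (hR' : R' < R) (hUR : closedBall c R ⊆ U) (hF : DifferentiableOn ℂ F U) (hFc : F c ≠ 0)
    (hb : ∀ z ∈ closedBall c R, ‖F z‖ ≤ Real.exp M * ‖F c‖)
    (hρ : ρ ∈ closedBall c R') (hFρ : F ρ = 0) :
    ∃ F1 : ℂ → ℂ, DifferentiableOn ℂ F1 U ∧ F1 c ≠ 0 ∧
      (∀ z ∈ closedBall c R, ‖F1 z‖ ≤ Real.exp (M - Real.log (R / R')) * ‖F1 c‖) ∧
      (∀ z ∈ closedBall c R', F1 z = 0 → F z = 0) ∧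
      (∀ z, z ≠ ρ → F z = 0 → F1 z = 0) ∧ (deriv F ρ = 0 → F1 ρ = 0) ∧
      -(deriv F c / F c).re = -(deriv F1 c / F1 c).re - zeroWeight c R ρ := by
  have hρc : ρ ≠ c := by rintro rfl; exact hFc hFρ
  have hnρ : 0 < ‖ρ - c‖ := norm_pos_iff.2 (sub_ne_zero.2 hρc)
  have hρR' : ‖ρ - c‖ ≤ R' := by simpa [dist_eq_norm] using hρ
  have hR'0 : 0 < R' := hnρ.trans_le hρR'
  have hρU : ρ ∈ U := hUR (closedBall_subset_closedBall hR'.le hρ)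
  have hcU : c ∈ U := hUR (mem_closedBall_self hR.le)
  set B : ℂ → ℂ := fun z => ((R : ℂ) ^ 2 - (starRingEnd ℂ) (ρ - c) * (z - c)) / R with hB
  have hRc : (R : ℂ) ≠ 0 := by exact_mod_cast hR.ne'
  have hBd : Differentiable ℂ B := by intro z; simp only [hB]; fun_prop
  have hBc : B c = R := by simp only [hB]; field_simp; simp
  have hFd : ∀ z, F z = (z - ρ) * dslope F ρ z := by
    intro z
    have := sub_smul_dslope F ρ z
    rw [smul_eq_mul] at this; rw [this, hFρ, sub_zero]
  have hdd : DifferentiableOn ℂ (dslope F ρ) U :=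
    (differentiableOn_dslope (hU.mem_nhds hρU)).2 hF
  have hBsph : ∀ z ∈ sphere c R, ‖B z‖ = ‖z - ρ‖ := by
    intro z hz
    have hz' : ‖z - c‖ = R := by simpa [dist_eq_norm] using hz
    have h1 : (R : ℂ) ^ 2 = (starRingEnd ℂ) (z - c) * (z - c) := by
      rw [← Complex.normSq_eq_conj_mul_self, Complex.normSq_eq_norm_sq, hz']; push_cast; ring
    simp only [hB]
    rw [h1, ← sub_mul, ← map_sub, norm_div, norm_mul, norm_conj, hz', norm_real,
      Real.norm_of_nonneg hR.le, mul_div_cancel_right₀ _ hR.ne']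
    congr 1; ring
  have hF1c : dslope F ρ c * B c = F c / (c - ρ) * R := by
    rw [hBc, hFd c, mul_div_cancel_left₀ _ (sub_ne_zero.2 hρc.symm)]
  have hBne : ∀ z ∈ closedBall c R', B z ≠ 0 := by
    intro z hz h0
    have hz' : ‖z - c‖ ≤ R' := by simpa [dist_eq_norm] using hz
    simp only [hB, div_eq_zero_iff, hRc, or_false, sub_eq_zero] at h0
    have := congrArg norm h0
    rw [norm_mul, norm_conj, norm_pow, norm_real, Real.norm_of_nonneg hR.le] at this
    nlinarith [norm_nonneg (z - c)]
  refine ⟨fun z => dslope F ρ z * B z, hdd.mul hBd.differentiableOn, ?_, ?_, ?_, ?_, ?_, ?_⟩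
  · change dslope F ρ c * B c ≠ 0
    rw [hF1c]
    exact mul_ne_zero (div_ne_zero hFc (sub_ne_zero.2 hρc.symm)) hRc
  · have hbd : ∀ z ∈ closedBall c R, ‖dslope F ρ z * B z‖ ≤ Real.exp M * ‖F c‖ := by
      intro z hz
      rw [← closure_ball c hR.ne'] at hz
      refine Complex.norm_le_of_forall_mem_frontier_norm_le (U := ball c R) isBounded_ball
        (f := fun z => dslope F ρ z * B z) ?_ ?_ hz
      · apply DifferentiableOn.diffContOnCl
        rw [closure_ball c hR.ne']
        exact (hdd.mul hBd.differentiableOn).mono hUR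
      · intro w hw
        rw [frontier_ball c hR.ne'] at hw
        rw [norm_mul, hBsph w hw, mul_comm, ← norm_mul, ← hFd]
        exact hb w (sphere_subset_closedBall hw)
    intro z hz
    refine (hbd z hz).trans ?_
    change _ ≤ _ * ‖dslope F ρ c * B c‖
    rw [hF1c, Real.exp_sub, Real.exp_log (by positivity), norm_mul, norm_div, norm_real,
      Real.norm_of_nonneg hR.le, norm_sub_rev c ρ]
    have : Real.exp M / (R / R') * (‖F c‖ / ‖ρ - c‖ * R)
      = Real.exp M * ‖F c‖ * (R' / ‖ρ - c‖) := by field_simp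
    rw [this]
    apply le_mul_of_one_le_right (by positivity)
    rwa [one_le_div hnρ]
  · intro z hz h0
    rw [hFd]
    rcases mul_eq_zero.1 h0 with h | h
    · rw [h, mul_zero]
    · exact absurd h (hBne z hz)
  · intro z hz h0
    rw [hFd, mul_eq_zero, or_iff_right (sub_ne_zero.2 hz)] at h0
    simp only [h0, zero_mul]
  · intro h
    simp only [dslope_same, h, zero_mul]
  · have hdc : DifferentiableAt ℂ (dslope F ρ) c := hdd.differentiableAt (hU.mem_nhds hcU)
    have hBder : HasDerivAt B (-(starRingEnd ℂ) (ρ - c) / R) c := by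
      have := ((((hasDerivAt_id c).sub_const c).const_mul
        ((starRingEnd ℂ) (ρ - c))).const_sub ((R : ℂ) ^ 2)).div_const (R : ℂ)
      simp only [mul_one] at this
      exact this.congr_deriv (by simp)
    have hFder : deriv F c = dslope F ρ c + (c - ρ) * deriv (dslope F ρ) c := by
      have h2 : F = fun z => (z - ρ) * dslope F ρ z := funext hFd
      conv_lhs => rw [h2]
      have := (((hasDerivAt_id c).sub_const ρ).mul hdc.hasDerivAt).deriv
      simp only [id_eq, one_mul] at this
      exact this
    have hF1der : deriv (fun z => dslope F ρ z * B z) c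
        = deriv (dslope F ρ) c * R + dslope F ρ c * (-(starRingEnd ℂ) (ρ - c) / R) := by
      have := (hdc.hasDerivAt.mul hBder).deriv
      rw [hBc] at this
      exact this
    have hcr : c - ρ ≠ 0 := sub_ne_zero.2 hρc.symm
    have hdn : dslope F ρ c ≠ 0 := by
      intro h; rw [hFd c, h, mul_zero] at hFc; exact hFc rfl
    have key : deriv F c / F c = deriv (fun z => dslope F ρ z * B z) c / (dslope F ρ c * B c)
        + (1 / (c - ρ) - (starRingEnd ℂ) (c - ρ) / R ^ 2) := by
      rw [hF1der, hBc, hFder]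
      conv_lhs => rw [hFd c]
      have : (starRingEnd ℂ) (ρ - c) = - (starRingEnd ℂ) (c - ρ) := by
        rw [← map_neg]; congr 1; ring
      rw [this]
      field_simp
      ring
    have hw : (1 / (c - ρ) - (starRingEnd ℂ) (c - ρ) / R ^ 2).re = zeroWeight c R ρ := by
      rw [one_div, sub_re, inv_re, normSq_eq_norm_sq, ← ofReal_pow, div_ofReal_re, conj_re]
      unfold zeroWeight
      ring
    rw [key, add_re, hw]
    ring

lemma landau_aux {R R' : ℝ} (hR' : 0 < R') (hR : R' < R) {U : Set ℂ} (hU : IsOpen U) {c : ℂ}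
    (hUR : closedBall c R ⊆ U) (K : ℕ) : ∀ (F : ℂ → ℂ) (M : ℝ), M < K * Real.log (R / R') →
    DifferentiableOn ℂ F U → F c ≠ 0 →
    (∀ z ∈ closedBall c R, ‖F z‖ ≤ Real.exp M * ‖F c‖) →
    (∀ z ∈ closedBall c R', F z = 0 → z.re ≤ c.re) →
    -(deriv F c / F c).re ≤ 2 * M / R' := by
  have hlog : 0 < Real.log (R / R') := Real.log_pos (by rwa [one_lt_div hR'])
  induction K with
  | zero =>
    intro F M hM hF hFc hb
    exfalso
    have h1 := hb c (mem_closedBall_self (hR'.trans hR).le)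
    have h2 : Real.exp M < 1 := by rw [Real.exp_lt_one_iff]; simpa using hM
    nlinarith [norm_pos_iff.2 hFc]
  | succ K ih =>
    intro F M hM hF hFc hb hz
    by_cases hex : ∃ ρ ∈ closedBall c R', F ρ = 0
    · obtain ⟨ρ, hρ, hFρ⟩ := hex
      obtain ⟨F1, h1, h2, h3, h4, -, -, h7⟩ := remove_zero hU (hR'.trans hR) hR hUR hF hFc hb hρ hFρ
      have := ih F1 (M - Real.log (R / R')) (by push_cast at hM; linarith) h1 h2 h3
        (fun z hz' h0 => hz z hz' (h4 z hz' h0))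
      rw [h7]
      have hw : 0 ≤ zeroWeight c R ρ := zeroWeight_nonneg
        (by have : ‖ρ - c‖ ≤ R' := by simpa [dist_eq_norm] using hρ
            linarith) (by rintro rfl; exact hFc hFρ) (hz ρ hρ hFρ)
      have : 2 * (M - Real.log (R / R')) / R' ≤ 2 * M / R' := by gcongr; linarith
      linarith
    · push Not at hex
      have hsub : ball c R' ⊆ closedBall c R :=
        ball_subset_closedBall.trans (closedBall_subset_closedBall hR.le)
      have hM0 : 0 ≤ M := by
        have h1 := hb c (mem_closedBall_self (hR'.trans hR).le)
        rw [← Real.one_le_exp_iff]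
        nlinarith [norm_pos_iff.2 hFc]
      apply le_of_forall_pos_le_add
      intro ε hε
      set M' := M + ε * R' / 2
      have hM' : 0 < M' := by positivity
      obtain ⟨l, hl, hlc, hlb⟩ := exists_log_bound (g := F) hR' hM'
        (hF.mono (hsub.trans hUR)) (fun z hz => hex z (ball_subset_closedBall hz))
        (fun z hz => (hb z (hsub hz)).trans (by gcongr; simp only [M']; nlinarith))
      have hder := hl c (mem_ball_self hR')
      have hle : ‖deriv F c / F c‖ ≤ 2 * M' / R' := by
        have hs := (hasDerivAt_iff_tendsto_slope.1 hder).norm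
        have ht : Filter.Tendsto (fun z => 2 * M' / (R' - ‖z - c‖)) (nhdsWithin c {c}ᶜ)
            (nhds (2 * M' / R')) := by
          have : ContinuousAt (fun z : ℂ => 2 * M' / (R' - ‖z - c‖)) c := by
            apply ContinuousAt.div (by fun_prop) (by fun_prop)
            simp [hR'.ne']
          have h3 := this.tendsto.mono_left (nhdsWithin_le_nhds (s := {c}ᶜ))
          simpa using h3
        refine le_of_tendsto_of_tendsto hs ht ?_
        filter_upwards [self_mem_nhdsWithin,
          mem_nhdsWithin_of_mem_nhds (ball_mem_nhds c hR')] with z hz hzb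
        have hz0 : 0 < ‖z - c‖ := norm_pos_iff.2 (sub_ne_zero.2 hz)
        rw [slope_def_field, hlc, sub_zero, norm_div, div_le_iff₀ hz0]
        refine (hlb z hzb).trans (le_of_eq ?_)
        ring
      have h4 := (abs_le.1 (abs_re_le_norm (deriv F c / F c))).1
      have h5 : 2 * M' / R' = 2 * M / R' + ε := by simp only [M']; field_simp
      linarith

/-- **Landau's lemma**: no zero taken into account. -/
lemma landau_zero {R R' M : ℝ} (hR' : 0 < R') (hR : R' < R) {U : Set ℂ} (hU : IsOpen U) {c : ℂ}
    (hUR : closedBall c R ⊆ U) {F : ℂ → ℂ} (hF : DifferentiableOn ℂ F U) (hFc : F c ≠ 0)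
    (hb : ∀ z ∈ closedBall c R, ‖F z‖ ≤ Real.exp M * ‖F c‖)
    (hz : ∀ z ∈ closedBall c R', F z = 0 → z.re ≤ c.re) :
    -(deriv F c / F c).re ≤ 2 * M / R' := by
  have hlog : 0 < Real.log (R / R') := Real.log_pos (by rwa [one_lt_div hR'])
  obtain ⟨K, hK⟩ := exists_nat_gt (M / Real.log (R / R'))
  rw [div_lt_iff₀ hlog] at hK
  exact landau_aux hR' hR hU hUR K F M hK hF hFc hb hz

lemma landau_one {R R' M : ℝ} (hR' : 0 < R') (hR : R' < R) {U : Set ℂ} (hU : IsOpen U) {c : ℂ}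
    (hUR : closedBall c R ⊆ U) {F : ℂ → ℂ} (hF : DifferentiableOn ℂ F U) (hFc : F c ≠ 0)
    (hb : ∀ z ∈ closedBall c R, ‖F z‖ ≤ Real.exp M * ‖F c‖)
    (hz : ∀ z ∈ closedBall c R', F z = 0 → z.re ≤ c.re) {ρ : ℂ} (hρ : ρ ∈ closedBall c R')
    (hFρ : F ρ = 0) :
    -(deriv F c / F c).re ≤ 2 * M / R' - zeroWeight c R ρ := by
  obtain ⟨F1, h1, h2, h3, h4, -, -, h7⟩ := remove_zero hU (hR'.trans hR) hR hUR hF hFc hb hρ hFρ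
  have hlog : 0 < Real.log (R / R') := Real.log_pos (by rwa [one_lt_div hR'])
  have := landau_zero hR' hR hU hUR h1 h2 h3 (fun z hz' h0 => hz z hz' (h4 z hz' h0))
  have : 2 * (M - Real.log (R / R')) / R' ≤ 2 * M / R' := by gcongr; linarith
  linarith

/-- Landau's lemma for two distinct zeros or one double zero. -/
lemma landau_two {R R' M : ℝ} (hR' : 0 < R') (hR : R' < R) {U : Set ℂ} (hU : IsOpen U) {c : ℂ}
    (hUR : closedBall c R ⊆ U) {F : ℂ → ℂ} (hF : DifferentiableOn ℂ F U) (hFc : F c ≠ 0)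
    (hb : ∀ z ∈ closedBall c R, ‖F z‖ ≤ Real.exp M * ‖F c‖)
    (hz : ∀ z ∈ closedBall c R', F z = 0 → z.re ≤ c.re) {ρ ρ' : ℂ} (hρ : ρ ∈ closedBall c R')
    (hFρ : F ρ = 0) (hρ' : ρ' ∈ closedBall c R') (hFρ' : F ρ' = 0)
    (h : ρ' ≠ ρ ∨ deriv F ρ = 0 ∧ ρ' = ρ) :
    -(deriv F c / F c).re ≤ 2 * M / R' - zeroWeight c R ρ - zeroWeight c R ρ' := by
  obtain ⟨F1, h1, h2, h3, h4, h5, h6, h7⟩ :=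
    remove_zero hU (hR'.trans hR) hR hUR hF hFc hb hρ hFρ
  have hlog : 0 < Real.log (R / R') := Real.log_pos (by rwa [one_lt_div hR'])
  have h8 : F1 ρ' = 0 := by
    rcases h with h | ⟨h, rfl⟩
    · exact h5 ρ' h hFρ'
    · exact h6 h
  have := landau_one hR' hR hU hUR h1 h2 h3 (fun z hz' h0 => hz z hz' (h4 z hz' h0)) hρ' h8
  have : 2 * (M - Real.log (R / R')) / R' ≤ 2 * M / R' := by gcongr; linarith
  linarith

end Landau

section ZeroFree
open Metric Complex Set

/-- `f` behaves like `(s - 1) ζ(s)`, where `-ζ'/ζ` has nonnegative coefficients `Λ`; `R` is the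
radius of continuation and `M` a growth exponent. -/
structure ZetaLike (f : ℂ → ℂ) (Λ : ℕ → ℝ) (R M Q : ℝ) : Prop where
  R_pos : 0 < R
  R_le : R ≤ 1 / 4
  M_ge : 1 ≤ M
  Q_ge : 1 ≤ Q
  le_Q : M / R * (1 + Real.log Q) ≤ Q
  diff : DifferentiableOn ℂ f {s | 1 - 2 * R < s.re}
  ne_zero : ∀ s : ℂ, 1 < s.re → f s ≠ 0
  nonneg : ∀ m, 0 ≤ Λ m
  summable : ∀ s : ℂ, 1 < s.re → LSeriesSummable (fun m => (Λ m : ℂ)) s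
  logDeriv : ∀ s : ℂ, 1 < s.re →
    deriv f s / f s = 1 / (s - 1) - LSeries (fun m => (Λ m : ℂ)) s
  growth : ∀ z₀ z : ℂ, 1 < z₀.re → z₀.re ≤ 2 → ‖z - z₀‖ ≤ R →
    ‖f z‖ ≤ Real.exp (M * Real.log ((|z₀.im| + 3) / (z₀.re - 1))) * ‖f z₀‖

namespace ZetaLike
variable {f : ℂ → ℂ} {Λ : ℕ → ℝ} {R M Q : ℝ}

lemma isOpen_dom : IsOpen {s : ℂ | 1 - 2 * R < s.re} :=
  isOpen_lt continuous_const continuous_re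

lemma MR_le (h : ZetaLike f Λ R M Q) : M / R ≤ Q := by
  have := h.le_Q
  have h0 : 0 ≤ Real.log Q := Real.log_nonneg h.Q_ge
  have h1 : 0 ≤ M / R := div_nonneg (by linarith [h.M_ge]) h.R_pos.le
  nlinarith

lemma MR_log_le (h : ZetaLike f Λ R M Q) : M / R * Real.log Q ≤ Q := by
  have := h.le_Q
  have h1 : 0 ≤ M / R := div_nonneg (by linarith [h.M_ge]) h.R_pos.le
  nlinarith

lemma inv_R_le (h : ZetaLike f Λ R M Q) : 1 / R ≤ Q := by
  refine le_trans ?_ h.MR_le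
  have := h.R_pos
  have := h.M_ge
  gcongr

lemma closedBall_sub (h : ZetaLike f Λ R M Q) {c : ℂ} (hc : 1 < c.re) :
    closedBall c R ⊆ {s : ℂ | 1 - 2 * R < s.re} := by
  intro z hz
  have h1 : ‖z - c‖ ≤ R := by simpa [dist_eq_norm] using hz
  have h2 := (abs_le.1 ((abs_re_le_norm (z - c)).trans h1)).1
  have := h.R_pos
  simp only [sub_re, mem_ofPred_eq] at *
  linarith

lemma re_le_of_zero (h : ZetaLike f Λ R M Q) {z : ℂ} (hz : f z = 0) : z.re ≤ 1 := by
  by_contra hc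
  exact h.ne_zero z (not_le.1 hc) hz

lemma re_LSeries (h : ZetaLike f Λ R M Q) {s : ℂ} (hs : 1 < s.re) :
    (LSeries (fun m => (Λ m : ℂ)) s).re = -(deriv f s / f s).re + (1 / (s - 1)).re := by
  rw [h.logDeriv s hs, sub_re]; ring

lemma landau_growth (h : ZetaLike f Λ R M Q) {c : ℂ} (hc : 1 < c.re) (hc2 : c.re ≤ 2) :
    -(deriv f c / f c).re ≤ 4 * (M / R) * Real.log ((|c.im| + 3) / (c.re - 1)) := by
  have hR := h.R_pos
  have := landau_zero (R' := R / 2) (by linarith) (by linarith) isOpen_dom (h.closedBall_sub hc)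
    h.diff (h.ne_zero c hc) (fun z hz => h.growth c z hc hc2 (by simpa [dist_eq_norm] using hz))
    (fun z _ hz => (h.re_le_of_zero hz).trans hc.le)
  refine this.trans (le_of_eq ?_)
  field_simp; ring

lemma landau_growth_one (h : ZetaLike f Λ R M Q) {c ρ : ℂ} (hc : 1 < c.re) (hc2 : c.re ≤ 2)
    (hρ : ‖ρ - c‖ ≤ R / 2) (hfρ : f ρ = 0) :
    -(deriv f c / f c).re ≤ 4 * (M / R) * Real.log ((|c.im| + 3) / (c.re - 1))
      - zeroWeight c R ρ := by
  have hR := h.R_pos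
  have := landau_one (R' := R / 2) (by linarith) (by linarith) isOpen_dom (h.closedBall_sub hc)
    h.diff (h.ne_zero c hc) (fun z hz => h.growth c z hc hc2 (by simpa [dist_eq_norm] using hz))
    (fun z _ hz => (h.re_le_of_zero hz).trans hc.le)
    (by simpa [dist_eq_norm] using hρ) hfρ
  refine this.trans (le_of_eq ?_)
  field_simp; ring

lemma landau_growth_two (h : ZetaLike f Λ R M Q) {c ρ ρ' : ℂ} (hc : 1 < c.re) (hc2 : c.re ≤ 2)
    (hρ : ‖ρ - c‖ ≤ R / 2) (hfρ : f ρ = 0) (hρ' : ‖ρ' - c‖ ≤ R / 2) (hfρ' : f ρ' = 0)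
    (hd : ρ' ≠ ρ ∨ deriv f ρ = 0 ∧ ρ' = ρ) :
    -(deriv f c / f c).re ≤ 4 * (M / R) * Real.log ((|c.im| + 3) / (c.re - 1))
      - zeroWeight c R ρ - zeroWeight c R ρ' := by
  have hR := h.R_pos
  have := landau_two (R' := R / 2) (by linarith) (by linarith) isOpen_dom (h.closedBall_sub hc)
    h.diff (h.ne_zero c hc) (fun z hz => h.growth c z hc hc2 (by simpa [dist_eq_norm] using hz))
    (fun z _ hz => (h.re_le_of_zero hz).trans hc.le)
    (by simpa [dist_eq_norm] using hρ) hfρ (by simpa [dist_eq_norm] using hρ') hfρ' hd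
  refine this.trans (le_of_eq ?_)
  field_simp; ring

lemma LSeries_re_eq (h : ZetaLike f Λ R M Q) {s : ℂ} (hs : 1 < s.re) :
    HasSum (fun m => Λ m * (((m : ℂ) ^ (-s)).re)) (LSeries (fun m => (Λ m : ℂ)) s).re := by
  have h1 := (h.summable s hs).hasSum
  have h2 := Complex.hasSum_re h1
  refine h2.congr_fun fun m => ?_
  rcases eq_or_ne m 0 with rfl | hm
  · have : Λ 0 * ((0 : ℂ) ^ (-s)).re = 0 := by
      rw [zero_cpow (by intro h0; rw [neg_eq_zero] at h0; rw [h0] at hs; norm_num at hs)]; simp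
    simp [this]
  · rw [LSeries.term_of_ne_zero hm, cpow_neg, div_eq_mul_inv, re_ofReal_mul]

/-- The `3-4-1` inequality. -/
lemma three_four_one (h : ZetaLike f Λ R M Q) {σ : ℝ} (hσ : 1 < σ) (t : ℝ) :
    0 ≤ 3 * (LSeries (fun m => (Λ m : ℂ)) σ).re + 4 * (LSeries (fun m => (Λ m : ℂ)) (σ + t * I)).re
      + (LSeries (fun m => (Λ m : ℂ)) (σ + (2 * t : ℝ) * I)).re := by
  have h0 := h.LSeries_re_eq (s := (σ : ℂ)) (by simpa using hσ)
  have h1 := h.LSeries_re_eq (s := (σ + t * I : ℂ)) (by simpa using hσ)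
  have h2 := h.LSeries_re_eq (s := (σ + (2 * t : ℝ) * I : ℂ)) (by simpa using hσ)
  refine ((h0.mul_left 3).add (h1.mul_left 4) |>.add h2).nonneg fun m => ?_
  rcases Nat.eq_zero_or_pos m with rfl | hm
  · have e : ∀ s : ℂ, 1 < s.re → ((0 : ℕ) : ℂ) ^ (-s) = 0 := by
      intro s hs
      rw [Nat.cast_zero, zero_cpow]
      intro h0; rw [neg_eq_zero] at h0; rw [h0] at hs; norm_num at hs
    rw [e _ (by simpa using hσ), e _ (by simpa using hσ), e _ (by simpa using hσ)]
    simp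
  · have key : ∀ u : ℝ, ((m : ℂ) ^ (-(σ + u * I : ℂ))).re
        = (m : ℝ) ^ (-σ) * Real.cos (u * Real.log m) := by
      intro u
      have hm' : (m : ℂ) ≠ 0 := by exact_mod_cast hm.ne'
      rw [cpow_def_of_ne_zero hm', ← natCast_log, exp_re,
        Real.rpow_def_of_pos (by exact_mod_cast hm)]
      simp only [mul_re, mul_im, neg_re, neg_im, add_re, add_im, ofReal_re, ofReal_im, I_re, I_im]
      rw [← Real.cos_neg (u * Real.log m)]
      congr 2 <;> ring
    have k0 := key 0
    simp only [ofReal_zero, zero_mul, add_zero, Real.cos_zero, mul_one] at k0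
    rw [k0, key t, key (2 * t), mul_assoc 2 t, Real.cos_two_mul]
    have hp : 0 ≤ (m : ℝ) ^ (-σ) := by positivity
    have := mul_nonneg (mul_nonneg (h.nonneg m) hp) (sq_nonneg (1 + Real.cos (t * Real.log m)))
    nlinarith

lemma log_ten_le : Real.log 10 ≤ 5 / 2 := by
  rw [Real.log_le_iff_le_exp (by norm_num)]
  have h1 := Real.exp_one_gt_d9
  have h2 : Real.exp (5 / 2) = Real.exp 1 ^ 2 * Real.exp (1 / 2) := by
    rw [← Real.exp_nat_mul, ← Real.exp_add]; norm_num
  have h3 : (1 : ℝ) / 2 + 1 ≤ Real.exp (1 / 2) := Real.add_one_le_exp _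
  rw [h2]
  nlinarith [sq_nonneg (Real.exp 1 - 2.7)]

/-- Near `1` there is at most one zero, counted with multiplicity. -/
theorem zeros_near_one (h : ZetaLike f Λ R M Q) {ρ ρ' : ℂ} (hρ : ‖ρ - 1‖ ≤ 1 / (10 ^ 4 * Q))
    (hρ' : ‖ρ' - 1‖ ≤ 1 / (10 ^ 4 * Q)) (hfρ : f ρ = 0) (hfρ' : f ρ' = 0) :
    ¬ (ρ' ≠ ρ ∨ deriv f ρ = 0 ∧ ρ' = ρ) := by
  intro hd
  set ε : ℝ := 1 / (10 ^ 4 * Q) with hε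
  have hQ := h.Q_ge
  have hR := h.R_pos
  have hε0 : 0 < ε := by positivity
  have hεQ : ε * Q = 1 / 10 ^ 4 := by rw [hε]; field_simp
  have hRQ := h.inv_R_le
  rw [div_le_iff₀ hR] at hRQ
  have hεR : ε * 10 ^ 4 ≤ R := by
    have : ε * 10 ^ 4 * 1 ≤ ε * 10 ^ 4 * (Q * R) := by gcongr
    calc ε * 10 ^ 4 ≤ (ε * Q) * 10 ^ 4 * R := by linarith
      _ = R := by rw [hεQ]; norm_num
  have hε1 : ε ≤ 1 / 10 ^ 4 := by
    have := h.R_le; linarith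
  set c : ℂ := ((1 + 10 * ε : ℝ) : ℂ) with hc
  have hcre : c.re = 1 + 10 * ε := by simp [hc]
  have hcim : c.im = 0 := by rw [hc]; exact ofReal_im _
  have hc1 : 1 < c.re := by rw [hcre]; linarith
  have hc2 : c.re ≤ 2 := by rw [hcre]; linarith
  have hdist : ∀ z : ℂ, ‖z - 1‖ ≤ ε → ‖z - c‖ ≤ 11 * ε := by
    intro z hz
    calc ‖z - c‖ = ‖(z - 1) - ((10 * ε : ℝ) : ℂ)‖ := by rw [hc]; push_cast; ring_nf
      _ ≤ ‖z - 1‖ + ‖((10 * ε : ℝ) : ℂ)‖ := norm_sub_le _ _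
      _ ≤ ε + 10 * ε := by
        rw [norm_real, Real.norm_of_nonneg (by positivity)]; linarith
      _ = 11 * ε := by ring
  have hw : ∀ z : ℂ, ‖z - 1‖ ≤ ε → f z = 0 → 8 / 100 / ε ≤ zeroWeight c R z := by
    intro z hz hfz
    have h1 : z.re ≤ 1 := h.re_le_of_zero hfz
    have h2 : 10 * ε ≤ (c - z).re := by rw [sub_re, hcre]; linarith
    have h3 : 0 < ‖c - z‖ := by
      refine lt_of_lt_of_le (by positivity) (h2.trans (re_le_norm _))
    have h4 : ‖c - z‖ ≤ 11 * ε := by rw [norm_sub_rev]; exact hdist z hz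
    have h5 : 1 / (11 * ε) ^ 2 - 1 / (ε * 10 ^ 4) ^ 2 ≤ 1 / ‖c - z‖ ^ 2 - 1 / R ^ 2 := by
      gcongr
    have h6 : 8 / 100 / ε = 10 * ε * (8 / 1000 / ε ^ 2) := by field_simp; norm_num
    have h7 : 8 / 1000 / ε ^ 2 ≤ 1 / (11 * ε) ^ 2 - 1 / (ε * 10 ^ 4) ^ 2 := by
      have : 1 / (11 * ε) ^ 2 - 1 / (ε * 10 ^ 4) ^ 2 = (1 / 121 - 1 / 10 ^ 8) / ε ^ 2 := by
        field_simp; norm_num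
      rw [this]; gcongr; norm_num
    unfold zeroWeight
    rw [h6]
    exact mul_le_mul h2 (h7.trans h5) (by positivity) ((by positivity : 0 ≤ 10 * ε).trans h2)
  have hl := h.landau_growth_two hc1 hc2 ((hdist ρ hρ).trans (by linarith)) hfρ
    ((hdist ρ' hρ').trans (by linarith)) hfρ' hd
  have hD : 0 ≤ (LSeries (fun m => (Λ m : ℂ)) c).re := by
    refine (h.LSeries_re_eq hc1).nonneg fun m => mul_nonneg (h.nonneg m) ?_
    rw [hc, ← ofReal_neg, ← ofReal_natCast, ← ofReal_cpow (by positivity), ofReal_re]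
    positivity
  rw [h.re_LSeries hc1] at hD
  have hone : (1 / (c - 1)).re = 1 / (10 * ε) := by
    have : 1 / (c - 1) = ((1 / (10 * ε) : ℝ) : ℂ) := by rw [hc]; push_cast; ring_nf
    rw [this, ofReal_re]
  rw [hone] at hD
  have hlog : Real.log ((|c.im| + 3) / (c.re - 1)) ≤ Real.log Q + 10 := by
    rw [hcim, hcre]
    have : (|(0 : ℝ)| + 3) / (1 + 10 * ε - 1) ≤ Q * 10 ^ 4 := by
      rw [hε, abs_zero]
      field_simp
      norm_num
    refine (Real.log_le_log (by rw [abs_zero]; apply div_pos <;> linarith) this).trans ?_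
    rw [Real.log_mul (by positivity) (by norm_num), Real.log_pow]
    have := log_ten_le
    push_cast
    linarith
  have hMR : 0 ≤ M / R := div_nonneg (by linarith [h.M_ge]) hR.le
  have h1 : 4 * (M / R) * Real.log ((|c.im| + 3) / (c.re - 1)) ≤ 44 * Q := by
    have h2 := h.MR_le
    have h3 := h.MR_log_le
    calc _ ≤ 4 * (M / R) * (Real.log Q + 10) := by gcongr
      _ = 4 * (M / R * Real.log Q) + 40 * (M / R) := by ring
      _ ≤ _ := by linarith
  have hwρ := hw ρ hρ hfρ
  have hwρ' := hw ρ' hρ' hfρ'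
  have hQε : Q = 1 / 10 ^ 4 / ε := by rw [eq_div_iff hε0.ne', mul_comm]; exact hεQ
  have h2 : 1 / (10 * ε) = 1 / 10 / ε := by field_simp
  rw [h2] at hD
  rw [hQε] at h1
  have : 0 < 1 / ε := by positivity
  have e1 : 44 * (1 / 10 ^ 4 / ε) = 44 / 10 ^ 4 * (1 / ε) := by ring
  have e2 : 8 / 100 / ε = 8 / 100 * (1 / ε) := by ring
  have e3 : 1 / 10 / ε = 1 / 10 * (1 / ε) := by ring
  rw [e1] at h1
  rw [e2] at hwρ hwρ'
  rw [e3] at hD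
  linarith

set_option maxHeartbeats 1000000 in
/-- The zero-free region away from the point `1`. -/
theorem zero_free (h : ZetaLike f Λ R M Q) {ρ : ℂ} (hfρ : f ρ = 0)
    (hfar : 1 / (10 ^ 4 * Q) ≤ ‖ρ - 1‖) :
    1 / (10 ^ 6 * Q * Real.log (|ρ.im| + 3)) ≤ 1 - ρ.re := by
  by_contra! hlt
  set ℒ := Real.log (|ρ.im| + 3) with hℒ
  set ε : ℝ := 1 / (10 ^ 6 * Q * ℒ) with hε
  have hQ := h.Q_ge
  have hR := h.R_pos
  have hℒ1 : 1 ≤ ℒ := by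
    rw [hℒ, Real.le_log_iff_exp_le (by positivity)]
    have := Real.exp_one_lt_d9
    have := abs_nonneg ρ.im
    linarith
  have hε0 : 0 < ε := by positivity
  have hεQ : ε * (Q * ℒ) = 1 / 10 ^ 6 := by rw [hε]; field_simp
  have hQQ : Q ≤ Q * ℒ := le_mul_of_one_le_right (by linarith) hℒ1
  have hεQ' : ε * Q ≤ 1 / 10 ^ 6 := by rw [← hεQ]; gcongr
  have hRQ := h.inv_R_le
  rw [div_le_iff₀ hR] at hRQ
  have hεR : ε * 10 ^ 6 ≤ R := by
    have : ε * 10 ^ 6 * 1 ≤ ε * 10 ^ 6 * (Q * R) := by gcongr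
    calc ε * 10 ^ 6 ≤ (ε * Q) * 10 ^ 6 * R := by linarith
      _ ≤ 1 / 10 ^ 6 * 10 ^ 6 * R := by gcongr
      _ = R := by norm_num
  have hε1 : ε ≤ 1 / 10 ^ 6 := by have := h.R_le; linarith
  have hβ1 : ρ.re ≤ 1 := h.re_le_of_zero hfρ
  set γ := ρ.im with hγ
  have hγ1 : 1 / (2 * 10 ^ 4 * Q) ≤ |γ| := by
    have h1 : ‖ρ - 1‖ ≤ |(ρ - 1).re| + |(ρ - 1).im| := norm_le_abs_re_add_abs_im _
    have h2 : |(ρ - 1).re| = 1 - ρ.re := by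
      rw [sub_re, one_re, abs_of_nonpos (by linarith)]; ring
    have h3 : (ρ - 1).im = γ := by simp [hγ]
    have h4 : ε ≤ 1 / (2 * 10 ^ 4 * Q) := by
      rw [le_div_iff₀ (by positivity)]; linarith
    have h5 : 1 / (10 ^ 4 * Q) = 1 / (2 * 10 ^ 4 * Q) + 1 / (2 * 10 ^ 4 * Q) := by
      field_simp; norm_num
    rw [h2, h3] at h1
    linarith
  have hγ2 : 1 / γ ^ 2 ≤ 4 * 10 ^ 8 * Q ^ 2 := by
    have h1 : 0 < 1 / (2 * 10 ^ 4 * Q) := by positivity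
    rw [← sq_abs]
    calc 1 / |γ| ^ 2 ≤ 1 / (1 / (2 * 10 ^ 4 * Q)) ^ 2 := by gcongr
      _ = _ := by field_simp; norm_num
  have hγ0 : 0 < γ ^ 2 := by
    rw [← sq_abs]
    have h1 : 0 < 1 / (2 * 10 ^ 4 * Q) := by positivity
    have : 0 < |γ| := by linarith
    positivity
  set δ : ℝ := 5 * ε with hδ
  have hδ0 : 0 < δ := by positivity
  set σ : ℝ := 1 + δ with hσ
  have hσ1 : 1 < σ := by linarith
  have hσ2 : σ ≤ 2 := by linarith
  have hsre : ∀ t : ℝ, ((σ : ℂ) + (t : ℝ) * I).re = σ := by intro t; simp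
  have hsim : ∀ t : ℝ, ((σ : ℂ) + (t : ℝ) * I).im = t := by intro t; simp
  have hMR : 0 ≤ M / R := div_nonneg (by linarith [h.M_ge]) hR.le
  -- the growth term
  have hgr : ∀ t : ℝ, |t| ≤ 2 * |γ| →
      4 * (M / R) * Real.log ((|t| + 3) / (σ - 1)) ≤ 76 * (Q * ℒ) := by
    intro t ht
    have h1 : (|t| + 3) / (σ - 1) ≤ (|γ| + 3) ^ 2 * (Q * ℒ * 10 ^ 6) := by
      have : σ - 1 = 5 * ε := by rw [hσ]; ring
      rw [this, hε]
      have e : (|t| + 3) / (5 * (1 / (10 ^ 6 * Q * ℒ))) = (|t| + 3) / 5 * (Q * ℒ * 10 ^ 6) := by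
        field_simp
      rw [e]
      gcongr
      nlinarith [abs_nonneg γ]
    have h2 : Real.log ((|t| + 3) / (σ - 1)) ≤ 2 * ℒ + (Real.log Q + ℒ + 15) := by
      refine (Real.log_le_log (by apply div_pos; positivity; linarith) h1).trans ?_
      rw [Real.log_mul (by positivity) (by positivity), Real.log_mul (by positivity) (by norm_num),
        Real.log_mul (by positivity) (by positivity), Real.log_pow, Real.log_pow]
      have := log_ten_le
      have := Real.log_le_sub_one_of_pos (show 0 < ℒ by linarith)
      push_cast
      linarith
    have h3 := h.MR_le
    have h4 := h.MR_log_le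
    calc _ ≤ 4 * (M / R) * (2 * ℒ + (Real.log Q + ℒ + 15)) := by gcongr
      _ = 4 * (M / R * Real.log Q) + 4 * (M / R) * (3 * ℒ + 15) := by ring
      _ ≤ 4 * Q + 4 * Q * (3 * ℒ + 15) := by gcongr
      _ ≤ 76 * (Q * ℒ) := by nlinarith
  -- the pole term
  have hpole : ∀ t : ℝ, γ ^ 2 ≤ t ^ 2 →
      (1 / ((σ : ℂ) + (t : ℝ) * I - 1)).re ≤ 2000 * (Q * ℒ) := by
    intro t ht
    have e1 : (1 / ((σ : ℂ) + (t : ℝ) * I - 1)).re = δ / (δ ^ 2 + t ^ 2) := by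
      have e : (σ : ℂ) + (t : ℝ) * I - 1 = (δ : ℂ) + (t : ℝ) * I := by
        rw [hσ]; push_cast; ring
      rw [e, one_div, inv_re, normSq_apply]
      simp [sq]
    rw [e1]
    calc δ / (δ ^ 2 + t ^ 2) ≤ δ / γ ^ 2 := by gcongr; nlinarith [sq_nonneg δ]
      _ = δ * (1 / γ ^ 2) := by ring
      _ ≤ δ * (4 * 10 ^ 8 * Q ^ 2) := by gcongr
      _ = 20 * 10 ^ 8 * (ε * Q) * Q := by rw [hδ]; ring
      _ ≤ 20 * 10 ^ 8 * (1 / 10 ^ 6) * (Q * ℒ) := by gcongr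
      _ = _ := by ring
  have hm := h.three_four_one hσ1 γ
  have hσ0 : 1 < (σ : ℂ).re := by simpa using hσ1
  rw [h.re_LSeries (s := (σ : ℂ)) hσ0, h.re_LSeries (by rw [hsre]; exact hσ1),
    h.re_LSeries (by rw [hsre]; exact hσ1)] at hm
  have b0 := h.landau_growth (c := (σ : ℂ)) hσ0 (by simpa using hσ2)
  have b2 := h.landau_growth (c := (σ : ℂ) + (2 * γ : ℝ) * I) (by rw [hsre]; exact hσ1)
    (by rw [hsre]; exact hσ2)
  rw [hsre, hsim] at b2
  rw [ofReal_re, ofReal_im] at b0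
  have hdist : ρ - ((σ : ℂ) + γ * I) = ((ρ.re - σ : ℝ) : ℂ) := by
    apply Complex.ext
    · simp
    · simp [hγ]
  have hnd : ‖ρ - ((σ : ℂ) + γ * I)‖ = σ - ρ.re := by
    rw [hdist, norm_real, Real.norm_eq_abs, abs_of_nonpos (by linarith)]; ring
  have b1 := h.landau_growth_one (c := (σ : ℂ) + γ * I) (ρ := ρ) (by rw [hsre]; exact hσ1)
    (by rw [hsre]; exact hσ2) (by rw [hnd]; linarith) hfρ
  rw [hsre, hsim] at b1
  have hwt : 1 / (6 * ε) - 6 * ε / R ^ 2 ≤ zeroWeight ((σ : ℂ) + γ * I) R ρ := by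
    unfold zeroWeight
    rw [norm_sub_rev, hnd, sub_re, hsre]
    have hpos : 0 < σ - ρ.re := by linarith
    have : (σ - ρ.re) * (1 / (σ - ρ.re) ^ 2 - 1 / R ^ 2) = 1 / (σ - ρ.re) - (σ - ρ.re) / R ^ 2 := by
      field_simp
    rw [this]
    have : σ - ρ.re ≤ 6 * ε := by linarith
    gcongr
  have g0 := hgr 0 (by simp)
  have g1 := hgr γ (by linarith [abs_nonneg γ])
  have g2 := hgr (2 * γ) (by rw [abs_mul]; simp)
  have p1 := hpole γ le_rfl
  have p2 := hpole (2 * γ) (by nlinarith)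
  have p0 : (1 / ((σ : ℂ) - 1)).re = 1 / (5 * ε) := by
    have : 1 / ((σ : ℂ) - 1) = ((1 / (5 * ε) : ℝ) : ℂ) := by
      rw [hσ, hδ]; push_cast; ring_nf
    rw [this, ofReal_re]
  rw [p0] at hm
  have hRR : 6 * ε / R ^ 2 ≤ Q * ℒ := by
    have h1 : 1 / R ≤ Q := h.inv_R_le
    have : 6 * ε / R ^ 2 = 6 * ε * (1 / R) * (1 / R) := by ring
    rw [this]
    calc 6 * ε * (1 / R) * (1 / R) ≤ 6 * ε * Q * Q := by gcongr
      _ = 6 * (ε * Q) * Q := by ring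
      _ ≤ 6 * (1 / 10 ^ 6) * (Q * ℒ) := by gcongr
      _ ≤ Q * ℒ := by nlinarith
  rw [abs_zero] at g0 b0
  have e1 : 1 / (5 * ε) = 1 / 5 * (1 / ε) := by ring
  have e2 : 1 / (6 * ε) = 1 / 6 * (1 / ε) := by ring
  have e3 : 1 / ε = 10 ^ 6 * (Q * ℒ) := by rw [hε]; field_simp
  rw [e1, e3] at hm
  rw [e2, e3] at hwt
  have : 0 < Q * ℒ := by positivity
  linarith only [hm, b0, b1, b2, hwt, g0, g1, g2, p1, p2, hRR, this]

lemma ne_zero_of_near (h : ZetaLike f Λ R M Q)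
    (hex : ∀ ρ : ℂ, ‖ρ - 1‖ < 1 / (10 ^ 4 * Q) → f ρ ≠ 0) {z : ℂ}
    (hz : 1 - z.re < 1 / (10 ^ 6 * Q * Real.log (|z.im| + 3))) : f z ≠ 0 := by
  intro h0
  rcases lt_or_ge ‖z - 1‖ (1 / (10 ^ 4 * Q)) with h1 | h1
  · exact hex z h1 h0
  · exact absurd (h.zero_free h0 h1) (not_le.2 hz)

theorem iteratedDeriv_logDeriv_le (h : ZetaLike f Λ R M Q)
    (hex : ∀ ρ : ℂ, ‖ρ - 1‖ < 1 / (10 ^ 4 * Q) → f ρ ≠ 0) (k : ℕ) {c : ℂ} (hc : 1 < c.re)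
    (hc2 : c.re ≤ 2) :
    ‖iteratedDeriv k (fun s => deriv f s / f s) c‖ ≤
      (k + 1).factorial * (2 * (M * Real.log ((|c.im| + 3) / (c.re - 1)))) *
        (4 * 10 ^ 6 * Q * Real.log (|c.im| + 4)) ^ (k + 1) := by
  set ℒ := Real.log (|c.im| + 4) with hℒ
  have hQ := h.Q_ge
  have hR := h.R_pos
  have hM := h.M_ge
  have hℒ1 : 1 ≤ ℒ := by
    rw [hℒ, Real.le_log_iff_exp_le (by positivity)]
    have := Real.exp_one_lt_d9
    have := abs_nonneg c.im
    linarith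
  set w : ℝ := 1 / (2 * 10 ^ 6 * Q * ℒ) with hw
  have hw0 : 0 < w := by positivity
  have hwQ : w * Q ≤ 1 / (2 * 10 ^ 6) := by
    rw [hw, div_mul_eq_mul_div, div_le_div_iff₀ (by positivity) (by positivity)]
    nlinarith
  have hwR : w ≤ R := by
    have hRQ := h.inv_R_le
    rw [div_le_iff₀ hR] at hRQ
    nlinarith
  have hw1 : w ≤ 1 := by have := h.R_le; linarith
  set M' := M * Real.log ((|c.im| + 3) / (c.re - 1)) with hM'
  have hM'0 : 0 < M' := by
    apply mul_pos (by linarith) (Real.log_pos _)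
    rw [one_lt_div (by linarith)]
    have := abs_nonneg c.im
    linarith
  have hsub : ball c w ⊆ {s : ℂ | 1 - 2 * R < s.re} :=
    (ball_subset_closedBall.trans (closedBall_subset_closedBall hwR)).trans (h.closedBall_sub hc)
  obtain ⟨l, hl, hlc, hlb⟩ := exists_log_bound (g := f) hw0 hM'0 (h.diff.mono hsub) (by
    intro z hz
    apply h.ne_zero_of_near hex
    have hz' : ‖z - c‖ < w := by simpa [dist_eq_norm] using hz
    have h1 := (abs_lt.1 ((abs_re_le_norm (z - c)).trans_lt hz')).1
    have h2 := ((abs_im_le_norm (z - c)).trans_lt hz')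
    rw [sub_re] at h1
    rw [sub_im] at h2
    have h3 : |z.im| ≤ |c.im| + 1 := by
      have := abs_sub_abs_le_abs_sub z.im c.im
      linarith
    have h4 : w ≤ 1 / (10 ^ 6 * Q * Real.log (|z.im| + 3)) := by
      have h5 : Real.log (|z.im| + 3) ≤ ℒ := Real.log_le_log (by positivity) (by linarith)
      have h6 : 0 < Real.log (|z.im| + 3) :=
        Real.log_pos (by have := abs_nonneg z.im; linarith)
      rw [hw]
      gcongr
      linarith
    linarith)
    (fun z hz => h.growth c z hc hc2 (by
      have : ‖z - c‖ < w := by simpa [dist_eq_norm] using hz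
      linarith))
  have hev : deriv l =ᶠ[nhds c] fun s => deriv f s / f s := by
    filter_upwards [ball_mem_nhds c hw0] with z hz
    exact (hl z hz).deriv
  have h1 : iteratedDeriv k (fun s => deriv f s / f s) c = iteratedDeriv (k + 1) l c := by
    rw [iteratedDeriv_succ']
    exact (hev.iteratedDeriv_eq k).symm
  rw [h1]
  have hd : DiffContOnCl ℂ l (ball c (w / 2)) := by
    apply DifferentiableOn.diffContOnCl
    rw [closure_ball c (by positivity)]
    intro z hz
    exact (hl z (closedBall_subset_ball (by linarith) hz)).differentiableAt.differentiableWithinAt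
  refine (Complex.norm_iteratedDeriv_le_of_forall_mem_sphere_norm_le (k + 1) (C := 2 * M')
    (by positivity) hd ?_).trans (le_of_eq ?_)
  · intro z hz
    have hz' : ‖z - c‖ = w / 2 := by simpa [dist_eq_norm] using hz
    refine (hlb z (by rw [mem_ball, dist_eq_norm, hz']; linarith)).trans (le_of_eq ?_)
    rw [hz']; field_simp; ring
  · have : 4 * 10 ^ 6 * Q * ℒ = (w / 2)⁻¹ := by rw [hw]; field_simp; norm_num
    rw [this, inv_pow, div_eq_mul_inv]

end ZetaLike
end ZeroFree

section
open MeasureTheory Set Complex Filter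

lemma setIntegral_Ioi_cumulative {A : ℝ → ℝ} (hA : Measurable A) {c : ℝ} (hc : 0 < c)
    (hintg : IntegrableOn (fun u => |A u| * u ^ (-(c + 1))) (Ioi 1)) (y : ℝ) :
    IntegrableOn (fun x : ℝ => ((∫ u in (1:ℝ)..x, A u : ℝ) : ℂ) * (x : ℂ) ^ (-(c + y * I + 2))) (Ioi 1) ∧
    ∫ x in Ioi (1:ℝ), ((∫ u in (1:ℝ)..x, A u : ℝ) : ℂ) * (x : ℂ) ^ (-(c + y * I + 2)) =
      (∫ u in Ioi (1:ℝ), (A u : ℂ) * (u : ℂ) ^ (-(c + y * I + 1))) / (c + y * I + 1) := by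
  set s : ℂ := c + y * I with hs
  have hsre : s.re = c := by simp [hs]
  set μ := (volume : Measure ℝ).restrict (Ioi 1)
  let F : ℝ × ℝ → ℂ := fun p => {q : ℝ × ℝ | q.1 < q.2}.indicator (fun q => (A q.1 : ℂ) * (q.2 : ℂ) ^ (-(s + 2))) p
  have hFm : Measurable F := by
    refine Measurable.indicator ?_ (measurableSet_lt measurable_fst measurable_snd)
    exact ((Complex.measurable_ofReal.comp (hA.comp measurable_fst))).mul
      ((Complex.measurable_ofReal.comp measurable_snd).pow_const _)
  have hval : ∀ u ∈ Ioi (1:ℝ), IntegrableOn (fun x : ℝ => (x : ℂ) ^ (-(s + 2))) (Ioi u) ∧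
      ∫ x in Ioi u, (x : ℂ) ^ (-(s + 2)) = (u : ℂ) ^ (-(s + 1)) / (s + 1) := by
    intro u hu
    have hu0 : 0 < u := lt_trans one_pos hu
    have hre : (-(s + 2)).re < -1 := by simp [hsre]; linarith
    refine ⟨integrableOn_Ioi_cpow_of_lt hre hu0, ?_⟩
    rw [integral_Ioi_cpow_of_lt hre hu0]
    have : -(s + 2) + 1 = -(s + 1) := by ring
    rw [this, neg_div_neg_eq]
  have hnorm : ∀ u ∈ Ioi (1:ℝ), IntegrableOn (fun x : ℝ => x ^ (-(c + 2))) (Ioi u) ∧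
      ∫ x in Ioi u, x ^ (-(c + 2)) = u ^ (-(c + 1)) / (c + 1) := by
    intro u hu
    have hu0 : 0 < u := lt_trans one_pos hu
    have hre : -(c + 2) < -1 := by linarith
    refine ⟨integrableOn_Ioi_rpow_of_lt hre hu0, ?_⟩
    rw [integral_Ioi_rpow_of_lt hre hu0]
    have : -(c + 2) + 1 = -(c + 1) := by ring
    rw [this, neg_div_neg_eq]
  have hsec : ∀ u, (fun x => F (u, x)) = (Ioi u).indicator (fun x : ℝ => (A u : ℂ) * (x : ℂ) ^ (-(s + 2))) := by
    intro u; ext x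
    simp only [F, indicator, mem_ofPred_eq, mem_Ioi]
  have hint1 : ∀ u ∈ Ioi (1:ℝ), ∀ g : ℝ → ℂ, ∫ x in Ioi (1:ℝ), (Ioi u).indicator g x = ∫ x in Ioi u, g x := by
    intro u hu g
    rw [setIntegral_indicator measurableSet_Ioi, inter_eq_right.mpr (Ioi_subset_Ioi (le_of_lt hu))]
  have hFi : Integrable F (μ.prod μ) := by
    rw [integrable_prod_iff hFm.aestronglyMeasurable]
    constructor
    · refine (ae_restrict_iff' measurableSet_Ioi).mpr (Eventually.of_forall fun u hu => ?_)
      rw [hsec]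
      exact ((integrable_indicator_iff measurableSet_Ioi).mpr ((hval u hu).1.const_mul _)).mono_measure Measure.restrict_le_self
    · have : ∀ u ∈ Ioi (1:ℝ), ∫ x, ‖F (u, x)‖ ∂μ = |A u| * u ^ (-(c + 1)) / (c + 1) := by
        intro u hu
        have e : (fun x => ‖F (u, x)‖) = (Ioi u).indicator (fun x : ℝ => ‖(A u : ℂ) * (x : ℂ) ^ (-(s + 2))‖) := by
          ext x; rw [← norm_indicator_eq_indicator_norm, ← hsec]
        rw [e, setIntegral_indicator measurableSet_Ioi, inter_eq_right.mpr (Ioi_subset_Ioi (le_of_lt hu)), mul_div_assoc, ← (hnorm u hu).2, ← integral_const_mul]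
        refine setIntegral_congr_fun measurableSet_Ioi fun x hx => ?_
        have hx0 : 0 < x := lt_trans one_pos (lt_trans hu hx)
        simp only [norm_mul, Complex.norm_real, Real.norm_eq_abs]
        rw [Complex.norm_cpow_eq_rpow_re_of_pos hx0]
        simp [hsre]
      refine IntegrableOn.congr_fun (hintg.div_const (c + 1)) (fun u hu => (this u hu).symm) measurableSet_Ioi
  have hsw := integral_integral_swap (f := fun u x => F (u, x)) hFi
  have hr : ∀ x ∈ Ioi (1:ℝ), ∫ u, F (u, x) ∂μ = ((∫ u in (1:ℝ)..x, A u : ℝ) : ℂ) * (x : ℂ) ^ (-(s + 2)) := by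
    intro x hx
    have e : (fun u => F (u, x)) = (Iio x).indicator (fun u : ℝ => (A u : ℂ) * (x : ℂ) ^ (-(s + 2))) := by
      ext u; simp only [F, indicator, mem_ofPred_eq, mem_Iio]
    rw [e, setIntegral_indicator measurableSet_Iio, integral_mul_const, intervalIntegral.integral_of_le (le_of_lt hx),
      Ioi_inter_Iio, integral_Ioc_eq_integral_Ioo, ← integral_complex_ofReal]
  have hl : ∀ u ∈ Ioi (1:ℝ), ∫ x, F (u, x) ∂μ = (A u : ℂ) * (u : ℂ) ^ (-(s + 1)) / (s + 1) := by
    intro u hu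
    rw [hsec, hint1 u hu, integral_const_mul, (hval u hu).2, mul_div_assoc]
  constructor
  · exact IntegrableOn.congr_fun hFi.integral_prod_right hr measurableSet_Ioi
  · rw [← setIntegral_congr_fun measurableSet_Ioi hr, ← integral_div, ← setIntegral_congr_fun measurableSet_Ioi hl]
    exact hsw.symm

lemma abs_cumulative_le {A : ℝ → ℝ} (hA : Measurable A) {c : ℝ} (hc : 0 < c)
    (hloc : ∀ b, IntervalIntegrable A volume 1 b)
    (hintg : IntegrableOn (fun u => |A u| * u ^ (-(c + 1))) (Ioi 1)) {F : ℝ → ℂ} (hFc : Continuous F)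
    (hF : ∀ y : ℝ, ∫ u in Ioi (1:ℝ), (A u : ℂ) * (u : ℂ) ^ (-((c + y * I : ℂ) + 1)) = F y)
    {g : ℝ → ℝ} (hg : Integrable g) (hFg : ∀ y : ℝ, ‖F y‖ / ‖(c + y * I + 1 : ℂ)‖ ≤ g y) {x : ℝ} (hx : 1 < x) :
    |∫ u in (1:ℝ)..x, A u| ≤ x ^ (c + 1) * ∫ y, g y := by
  have hx0 : 0 < x := one_pos.trans hx
  set H : ℝ → ℂ := (Ioi 1).indicator (fun x => ((∫ u in (1:ℝ)..x, A u : ℝ) : ℂ) / x) with hH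
  have key : ∀ (y : ℝ), ∀ t ∈ Ioi (1:ℝ), (t : ℂ) ^ (-(c + y * I : ℂ) - 1) • (((∫ u in (1:ℝ)..t, A u : ℝ) : ℂ) / t) =
      ((∫ u in (1:ℝ)..t, A u : ℝ) : ℂ) * (t : ℂ) ^ (-(c + y * I + 2 : ℂ)) := by
    intro y t ht
    have ht0 : (t : ℂ) ≠ 0 := by exact_mod_cast (one_pos.trans ht).ne'
    have : -(c + y * I + 2 : ℂ) = (-(c + y * I : ℂ) - 1) - 1 := by ring
    rw [this, cpow_sub (-(c + y * I : ℂ) - 1) 1 ht0, cpow_one, smul_eq_mul]; ring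
  have hHe : ∀ (y : ℝ), (fun t : ℝ => (t : ℂ) ^ (-(c + y * I : ℂ) - 1) • H t) =
      (Ioi 1).indicator (fun t : ℝ => (t : ℂ) ^ (-(c + y * I : ℂ) - 1) • (((∫ u in (1:ℝ)..t, A u : ℝ) : ℂ) / t)) := by
    intro y; ext t; by_cases ht : t ∈ Ioi (1:ℝ)
    · simp only [hH, indicator_of_mem ht]
    · simp only [hH, indicator_of_notMem ht, smul_zero]
  have hsub : Ioi (1:ℝ) ⊆ Ioi 0 := Ioi_subset_Ioi zero_le_one
  have hmel : ∀ y : ℝ, mellin H (-(c + y * I : ℂ)) = F y / (c + y * I + 1) := by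
    intro y
    rw [mellin, hHe, setIntegral_indicator measurableSet_Ioi, inter_eq_right.mpr hsub,
      setIntegral_congr_fun measurableSet_Ioi (key y), (setIntegral_Ioi_cumulative hA hc hintg y).2, hF]
  have hne : ∀ y : ℝ, (c + y * I + 1 : ℂ) ≠ 0 := by
    intro y h
    have := congrArg Complex.re h
    simp at this; linarith
  have hcont : Continuous (fun y : ℝ => F y / (c + y * I + 1)) := by
    refine hFc.div (by fun_prop) hne
  have hconv : MellinConvergent H ((-c : ℝ) : ℂ) := by
    have h0 := hHe 0
    simp only [ofReal_zero, zero_mul, add_zero] at h0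
    rw [MellinConvergent]
    push_cast
    rw [h0]
    refine Integrable.mono_measure ((integrable_indicator_iff measurableSet_Ioi).mpr ?_) Measure.restrict_le_self
    have := (setIntegral_Ioi_cumulative hA hc hintg 0).1
    refine this.congr_fun (fun t ht => ?_) measurableSet_Ioi
    have k := (key 0 t ht).symm
    simp only [ofReal_zero, zero_mul, add_zero] at k ⊢
    exact k
  have hcontx : ContinuousAt H x := by
    have : H =ᶠ[nhds x] fun x => ((∫ u in (1:ℝ)..x, A u : ℝ) : ℂ) / x := by
      filter_upwards [Ioi_mem_nhds hx] with t ht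
      simp only [hH, indicator_of_mem ht]
    rw [continuousAt_congr this]
    refine ContinuousAt.div ?_ (by fun_prop) (by exact_mod_cast hx0.ne')
    refine Complex.continuous_ofReal.continuousAt.comp ?_
    exact (intervalIntegral.continuous_primitive (fun a b => ((hloc a).symm.trans (hloc b))) 1).continuousAt
  have hline : ∀ y : ℝ, ((-c : ℝ) : ℂ) + y * I = -(c + (-y : ℝ) * I : ℂ) := by intro y; push_cast; ring
  have hbd : ∀ y : ℝ, ‖F y / (c + y * I + 1)‖ ≤ g y := fun y => by rw [norm_div]; exact hFg y
  have hvert : VerticalIntegrable (mellin H) (-c) := by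
    rw [VerticalIntegrable]
    have : (fun y : ℝ => mellin H (((-c : ℝ) : ℂ) + y * I)) = fun y : ℝ => (fun y : ℝ => F y / (c + y * I + 1)) (-y) := by
      ext y; rw [hline, hmel]
    rw [this]
    exact Integrable.comp_neg (hg.mono' hcont.aestronglyMeasurable (Eventually.of_forall hbd))
  have inv := mellinInv_mellin_eq (-c) H hx0 hconv hvert hcontx
  have hHx : H x = ((∫ u in (1:ℝ)..x, A u : ℝ) : ℂ) / x := by simp only [hH, indicator_of_mem (show x ∈ Ioi 1 from hx)]
  rw [hHx, mellinInv] at inv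
  have hb : ‖∫ y : ℝ, (x : ℂ) ^ (-(((-c : ℝ) : ℂ) + y * I)) • mellin H (((-c : ℝ) : ℂ) + y * I)‖ ≤ x ^ c * ∫ y, g y := by
    have h1 : ∫ y, g y = ∫ y, g (-y) := (integral_neg_eq_self g volume).symm
    rw [h1, ← integral_const_mul]
    refine norm_integral_le_of_norm_le (hg.comp_neg.const_mul _) (Eventually.of_forall fun y => ?_)
    rw [hline, hmel, norm_smul, Complex.norm_cpow_eq_rpow_re_of_pos hx0]
    have := hbd (-y)
    simp only [neg_neg, add_re, ofReal_re, mul_re, I_re, mul_zero, ofReal_im, I_im, mul_one, sub_self, add_zero]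
    gcongr
  have hgn : 0 ≤ ∫ y, g y := integral_nonneg fun y => (norm_nonneg _).trans (hbd y)
  have h2 : ‖((∫ u in (1:ℝ)..x, A u : ℝ) : ℂ) / x‖ ≤ 1 * (x ^ c * ∫ y, g y) := by
    rw [← inv, norm_smul]
    refine mul_le_mul ?_ hb (norm_nonneg _) zero_le_one
    rw [Real.norm_eq_abs, abs_of_pos (by positivity), div_le_one (by positivity)]
    linarith [Real.pi_gt_three]
  rw [norm_div, Complex.norm_real, Complex.norm_real, Real.norm_eq_abs, Real.norm_eq_abs, abs_of_pos hx0, div_le_iff₀ hx0] at h2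
  rw [Real.rpow_add_one hx0.ne']
  linarith
end

section
open MeasureTheory Set Complex Filter

lemma log_pow_le_rpow (k : ℕ) {ε : ℝ} (hε : 0 < ε) : ∃ C > 0, ∀ u : ℝ, 1 ≤ u → Real.log u ^ k ≤ C * u ^ ε := by
  refine ⟨((k + 1) / ε) ^ k, by positivity, fun u hu => ?_⟩
  have hu0 : 0 < u := by linarith
  have h1 : Real.log u ≤ u ^ (ε / (k + 1)) / (ε / (k + 1)) := Real.log_le_rpow_div hu0.le (by positivity)
  have h2 : (u ^ (ε / (k + 1)) / (ε / (k + 1))) ^ k = ((k + 1) / ε) ^ k * (u ^ (ε / (k + 1))) ^ k := by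
    rw [← mul_pow]; congr 1; field_simp
  calc Real.log u ^ k ≤ (u ^ (ε / (k + 1)) / (ε / (k + 1))) ^ k := pow_le_pow_left₀ (Real.log_nonneg hu) h1 k
    _ = _ := h2
    _ ≤ ((k + 1) / ε) ^ k * u ^ ε := by
      gcongr
      rw [← Real.rpow_natCast, ← Real.rpow_mul hu0.le]
      apply Real.rpow_le_rpow_of_exponent_le hu
      rw [div_mul_eq_mul_div, div_le_iff₀ (by positivity)]
      nlinarith

lemma integrableOn_log_pow_mul_rpow (k : ℕ) {c : ℝ} (hc : 1 < c) :
    IntegrableOn (fun u : ℝ => Real.log u ^ k * u ^ (-c)) (Ioi 1) := by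
  obtain ⟨C, hC, h⟩ := log_pow_le_rpow k (ε := (c - 1) / 2) (by linarith)
  refine Integrable.mono' ((integrableOn_Ioi_rpow_of_lt (a := (c - 1) / 2 - c) (by linarith) one_pos).const_mul C) ?_ ?_
  · exact ((Real.measurable_log.pow_const _).mul (measurable_id.pow_const _)).aestronglyMeasurable
  · refine (ae_restrict_iff' measurableSet_Ioi).mpr (Eventually.of_forall fun u hu => ?_)
    have hu0 : 0 < u := one_pos.trans hu
    rw [Real.norm_eq_abs, abs_of_nonneg (mul_nonneg (pow_nonneg (Real.log_nonneg (le_of_lt hu)) _) (by positivity)),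
      sub_eq_add_neg, Real.rpow_add hu0, ← mul_assoc]
    gcongr
    exact h u (le_of_lt hu)

lemma integrableOn_log_pow_mul_cpow (k : ℕ) {s : ℂ} (hs : 1 < s.re) :
    IntegrableOn (fun u : ℝ => ((Real.log u : ℝ) : ℂ) ^ k * (u : ℂ) ^ (-s)) (Ioi 1) := by
  refine Integrable.mono' (integrableOn_log_pow_mul_rpow k hs) ?_ ?_
  · exact (((Complex.measurable_ofReal.comp Real.measurable_log).pow_const _).mul (Complex.measurable_ofReal.pow_const _)).aestronglyMeasurable
  · refine (ae_restrict_iff' measurableSet_Ioi).mpr (Eventually.of_forall fun u hu => ?_)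
    have hu0 : 0 < u := one_pos.trans hu
    rw [norm_mul, norm_pow, Complex.norm_real, Complex.norm_cpow_eq_rpow_re_of_pos hu0, Real.norm_eq_abs,
      abs_of_nonneg (Real.log_nonneg (le_of_lt hu)), neg_re]

lemma integral_log_pow_mul_cpow (k : ℕ) {s : ℂ} (hs : 1 < s.re) :
    ∫ u in Ioi (1:ℝ), ((Real.log u : ℝ) : ℂ) ^ k * (u : ℂ) ^ (-s) = k.factorial / (s - 1) ^ (k + 1) := by
  have hs1 : s - 1 ≠ 0 := by
    intro h
    have := congrArg Complex.re h
    simp at this; linarith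
  induction k with
  | zero =>
    simp only [pow_zero, one_mul]
    rw [integral_Ioi_cpow_of_lt (by simpa using hs) one_pos]
    simp only [ofReal_one, one_cpow, Nat.factorial, Nat.cast_one, zero_add, pow_one]
    have h2 : -s + 1 = -(s - 1) := by ring
    rw [h2, neg_div_neg_eq]
  | succ k ih =>
    have hd : ∀ x ∈ Ioi (1:ℝ), HasDerivAt (fun u : ℝ => ((Real.log u : ℝ) : ℂ) ^ (k + 1) * (u : ℂ) ^ (1 - s))
        ((k + 1 : ℂ) * (((Real.log x : ℝ) : ℂ) ^ k * (x : ℂ) ^ (-s)) - (s - 1) * (((Real.log x : ℝ) : ℂ) ^ (k + 1) * (x : ℂ) ^ (-s))) x := by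
      intro x hx
      have hx0 : 0 < x := one_pos.trans hx
      have hxc : (x : ℂ) ≠ 0 := by exact_mod_cast hx0.ne'
      have h1 : HasDerivAt (fun u : ℝ => ((Real.log u : ℝ) : ℂ) ^ (k + 1)) (((k + 1 : ℕ) : ℂ) * ((Real.log x : ℝ) : ℂ) ^ k * ((x⁻¹ : ℝ) : ℂ)) x := by
        simpa using ((Real.hasDerivAt_log hx0.ne').ofReal_comp.fun_pow (k + 1))
      have h2 : HasDerivAt (fun u : ℝ => (u : ℂ) ^ (1 - s)) ((1 - s) * (x : ℂ) ^ (-s)) x := by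
        have := (hasDerivAt_id (x : ℂ)).cpow_const (c := 1 - s) (Or.inl (by simpa using hx0))
        have := this.comp_ofReal
        refine this.congr_deriv ?_
        simp only [id_eq, mul_one]; congr 2; ring
      refine (h1.mul h2).congr_deriv ?_
      have h3 : (x : ℂ) ^ (1 - s) = x * (x : ℂ) ^ (-s) := by
        rw [sub_eq_add_neg, cpow_add _ _ hxc, cpow_one]
      rw [h3]; push_cast; field_simp; ring
    have hi := (integrableOn_log_pow_mul_cpow k hs).const_mul (k + 1 : ℂ)
    have hi' := (integrableOn_log_pow_mul_cpow (k + 1) hs).const_mul (s - 1)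
    have hlim : Tendsto (fun u : ℝ => ((Real.log u : ℝ) : ℂ) ^ (k + 1) * (u : ℂ) ^ (1 - s)) atTop (nhds 0) := by
      obtain ⟨C, hC, h⟩ := log_pow_le_rpow (k + 1) (ε := (s.re - 1) / 2) (by linarith)
      have h0 : Tendsto (fun u : ℝ => C * u ^ (-((s.re - 1) / 2))) atTop (nhds 0) := by
        simpa using (tendsto_rpow_neg_atTop (y := (s.re - 1) / 2) (by linarith)).const_mul C
      refine squeeze_zero_norm' ?_ h0
      filter_upwards [eventually_ge_atTop 1] with u hu
      have hu0 : 0 < u := by linarith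
      rw [norm_mul, norm_pow, Complex.norm_real, Complex.norm_cpow_eq_rpow_re_of_pos hu0, Real.norm_eq_abs,
        abs_of_nonneg (Real.log_nonneg hu), sub_re, one_re]
      have : 1 - s.re = (s.re - 1) / 2 * (-1) + -((s.re - 1) / 2) := by ring
      calc Real.log u ^ (k + 1) * u ^ (1 - s.re) ≤ (C * u ^ ((s.re - 1) / 2)) * u ^ (1 - s.re) := by
            gcongr; exact h u hu
        _ = C * u ^ (-((s.re - 1) / 2)) := by
            rw [mul_assoc, ← Real.rpow_add hu0]; congr 2; ring
    have hcw : ContinuousWithinAt (fun u : ℝ => ((Real.log u : ℝ) : ℂ) ^ (k + 1) * (u : ℂ) ^ (1 - s)) (Ici 1) 1 := by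
      apply ContinuousAt.continuousWithinAt
      refine ContinuousAt.mul (ContinuousAt.pow (Complex.continuous_ofReal.continuousAt.comp (Real.continuousAt_log one_ne_zero)) _) ?_
      exact (continuousAt_ofReal_cpow_const 1 _ (Or.inr one_ne_zero))
    have := integral_Ioi_of_hasDerivAt_of_tendsto hcw hd (hi.sub hi') hlim
    rw [integral_sub hi hi', integral_const_mul, integral_const_mul, ih] at this
    simp only [Real.log_one, ofReal_zero, ofReal_one, one_cpow, mul_one, zero_pow (Nat.succ_ne_zero k), sub_zero] at this
    rw [eq_div_iff (pow_ne_zero _ hs1), pow_succ, Nat.factorial_succ]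
    have h5 := sub_eq_zero.mp this
    rw [pow_succ (s - 1)] at h5 ⊢
    field_simp at h5 ⊢
    push_cast
    linear_combination -h5
end

section
open MeasureTheory Set Complex Filter

/-- The partial sums of `m ↦ a m * (log m) ^ k`. -/
noncomputable def logSum (a : ℕ → ℝ) (k : ℕ) (u : ℝ) : ℝ := ∑ m ∈ Finset.Icc 1 ⌊u⌋₊, a m * Real.log m ^ k

lemma logSum_mono {a : ℕ → ℝ} (ha : ∀ m, 0 ≤ a m) (k : ℕ) : Monotone (logSum a k) := by
  intro u v h
  refine Finset.sum_le_sum_of_subset_of_nonneg (Finset.Icc_subset_Icc_right (Nat.floor_mono h)) fun m _ _ => ?_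
  exact mul_nonneg (ha m) (pow_nonneg (Real.log_natCast_nonneg m) _)

lemma logSum_nonneg {a : ℕ → ℝ} (ha : ∀ m, 0 ≤ a m) (k : ℕ) (u : ℝ) : 0 ≤ logSum a k u :=
  Finset.sum_nonneg fun m _ => mul_nonneg (ha m) (pow_nonneg (Real.log_natCast_nonneg m) _)

/-- The error term in the asymptotics of `logSum`. -/
noncomputable def logError (a : ℕ → ℝ) (k : ℕ) (u : ℝ) : ℝ := logSum a k u - ∫ t in (1:ℝ)..u, Real.log (max t 1) ^ k

lemma continuous_log_max_pow (k : ℕ) : Continuous fun t : ℝ => Real.log (max t 1) ^ k :=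
  (Continuous.log (by fun_prop) fun t => (lt_of_lt_of_le one_pos (le_max_right t 1)).ne').pow k

namespace ZetaLike
variable {f : ℂ → ℂ} {Λ : ℕ → ℝ} {R M Q : ℝ}

lemma abscissa_le (h : ZetaLike f Λ R M Q) : LSeries.abscissaOfAbsConv (fun m => (Λ m : ℂ)) ≤ 1 := by
  have := LSeries.abscissaOfAbsConv_le_of_forall_lt_LSeriesSummable (f := fun m => (Λ m : ℂ)) (x := 1)
    (fun y hy => h.summable _ (by simpa using hy))
  exact_mod_cast this

lemma logMul_iterate (a : ℕ → ℝ) (k : ℕ) :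
    LSeries.logMul^[k] (fun m => (a m : ℂ)) = fun m => ((a m * Real.log m ^ k : ℝ) : ℂ) := by
  induction k with
  | zero => ext m; simp
  | succ k ih =>
    rw [Function.iterate_succ_apply', ih]
    ext m
    rw [LSeries.logMul, ← Complex.natCast_log]
    push_cast; ring

lemma abscissa_lt (h : ZetaLike f Λ R M Q) {s : ℂ} (hs : 1 < s.re) :
    LSeries.abscissaOfAbsConv (fun m => (Λ m : ℂ)) < s.re :=
  h.abscissa_le.trans_lt (by exact_mod_cast hs)

lemma summable_log (h : ZetaLike f Λ R M Q) (k : ℕ) {s : ℂ} (hs : 1 < s.re) :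
    LSeriesSummable (fun m => ((Λ m * Real.log m ^ k : ℝ) : ℂ)) s := by
  rw [← logMul_iterate]
  apply LSeriesSummable_of_abscissaOfAbsConv_lt_re
  rw [LSeries.absicssaOfAbsConv_logPowMul]
  exact h.abscissa_lt hs

lemma iteratedDeriv_logDeriv (h : ZetaLike f Λ R M Q) (k : ℕ) {s : ℂ} (hs : 1 < s.re) :
    iteratedDeriv k (fun s => deriv f s / f s) s =
      (-1) ^ k * (k.factorial / (s - 1) ^ (k + 1) - LSeries (fun m => ((Λ m * Real.log m ^ k : ℝ) : ℂ)) s) := by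
  have hs1 : s - 1 ≠ 0 := by
    intro h
    have := congrArg Complex.re h
    simp at this; linarith
  have he : (fun s => deriv f s / f s) =ᶠ[nhds s] (fun s => (1 * s - 1)⁻¹ - LSeries (fun m => (Λ m : ℂ)) s) := by
    have : {s : ℂ | 1 < s.re} ∈ nhds s := (isOpen_lt continuous_const Complex.continuous_re).mem_nhds hs
    filter_upwards [this] with z hz
    rw [h.logDeriv z hz]; simp
  rw [he.iteratedDeriv_eq k]
  have hL : ContDiffAt ℂ k (LSeries (fun m => (Λ m : ℂ))) s := by
    apply AnalyticAt.contDiffAt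
    exact LSeries_analyticOnNhd _ s (h.abscissa_lt hs)
  have hi : ContDiffAt ℂ k (fun s : ℂ => (1 * s - 1)⁻¹) s := by
    refine ContDiffAt.inv (by fun_prop) (by simpa using hs1)
  rw [iteratedDeriv_fun_sub hi hL, LSeries_iteratedDeriv k (h.abscissa_lt hs), logMul_iterate,
    iteratedDeriv_eq_iterate, iter_deriv_inv_linear_sub]
  simp only [one_pow, mul_one, one_mul]
  have : (s - 1) ^ (-1 - (k : ℤ)) = ((s - 1) ^ (k + 1))⁻¹ := by
    rw [← zpow_natCast, ← zpow_neg]; congr 1; push_cast; ring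
  rw [this]; ring

lemma logSum_le_rpow (h : ZetaLike f Λ R M Q) (k : ℕ) {r : ℝ} (hr : 1 < r) :
    ∃ C > 0, ∀ u : ℝ, 1 ≤ u → logSum Λ k u ≤ C * u ^ r := by
  have hs := h.summable_log k (s := r) (by simpa using hr)
  have hs' := hs.norm
  refine ⟨(∑' m, ‖LSeries.term (fun m => ((Λ m * Real.log m ^ k : ℝ) : ℂ)) r m‖) + 1, by positivity, fun u hu => ?_⟩
  have hu0 : 0 < u := by linarith
  have h1 : logSum Λ k u ≤ (∑ m ∈ Finset.Icc 1 ⌊u⌋₊, ‖LSeries.term (fun m => ((Λ m * Real.log m ^ k : ℝ) : ℂ)) r m‖) * u ^ r := by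
    rw [logSum, Finset.sum_mul]
    refine Finset.sum_le_sum fun m hm => ?_
    rw [Finset.mem_Icc] at hm
    have hm0 : (0:ℝ) < m := by exact_mod_cast hm.1
    have hmu : (m:ℝ) ≤ u := (Nat.le_floor_iff hu0.le).mp hm.2
    have hnn : 0 ≤ Λ m * Real.log m ^ k := mul_nonneg (h.nonneg m) (pow_nonneg (Real.log_natCast_nonneg m) _)
    rw [LSeries.term_of_ne_zero (by omega), norm_div, Complex.norm_real, Real.norm_eq_abs, abs_of_nonneg hnn,
      Complex.norm_natCast_cpow_of_pos (by omega), ofReal_re, div_mul_eq_mul_div, le_div_iff₀ (by positivity)]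
    gcongr
  refine h1.trans ?_
  gcongr
  have := hs'.sum_le_tsum (Finset.Icc 1 ⌊u⌋₊) (fun _ _ => norm_nonneg _)
  linarith

lemma measurable_logError (h : ZetaLike f Λ R M Q) (k : ℕ) : Measurable (logError Λ k) := by
  refine (logSum_mono h.nonneg k).measurable.sub ?_
  exact (intervalIntegral.continuous_primitive (fun a b => (continuous_log_max_pow k).intervalIntegrable a b) 1).measurable

lemma intervalIntegrable_logError (h : ZetaLike f Λ R M Q) (k : ℕ) (a b : ℝ) :
    IntervalIntegrable (logError Λ k) volume a b :=
  ((logSum_mono h.nonneg k).intervalIntegrable).sub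
    ((intervalIntegral.continuous_primitive (fun a b => (continuous_log_max_pow k).intervalIntegrable a b) 1).intervalIntegrable a b)

lemma integral_log_max_le (k : ℕ) {u : ℝ} (hu : 1 ≤ u) : ∫ t in (1:ℝ)..u, Real.log (max t 1) ^ k ≤ u * Real.log u ^ k := by
  have : ∫ t in (1:ℝ)..u, Real.log (max t 1) ^ k ≤ ∫ t in (1:ℝ)..u, Real.log u ^ k := by
    refine intervalIntegral.integral_mono_on hu ((continuous_log_max_pow k).intervalIntegrable _ _) (by simp) fun t ht => ?_
    rw [max_eq_left ht.1]
    exact pow_le_pow_left₀ (Real.log_nonneg ht.1) (Real.log_le_log (by linarith [ht.1]) ht.2) k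
  rw [intervalIntegral.integral_const, smul_eq_mul] at this
  nlinarith [pow_nonneg (Real.log_nonneg hu) k]

lemma integral_log_max_nonneg (k : ℕ) {u : ℝ} (hu : 1 ≤ u) : 0 ≤ ∫ t in (1:ℝ)..u, Real.log (max t 1) ^ k :=
  intervalIntegral.integral_nonneg hu fun _ _ => pow_nonneg (Real.log_nonneg (le_max_right _ _)) k

lemma abs_logError_le_rpow (h : ZetaLike f Λ R M Q) (k : ℕ) {r : ℝ} (hr : 1 < r) :
    ∃ C > 0, ∀ u : ℝ, 1 ≤ u → |logError Λ k u| ≤ C * u ^ r := by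
  obtain ⟨C, hC, h1⟩ := h.logSum_le_rpow k hr
  obtain ⟨C', hC', h2⟩ := log_pow_le_rpow k (ε := r - 1) (by linarith)
  refine ⟨C + C', by positivity, fun u hu => ?_⟩
  have hu0 : 0 < u := by linarith
  have h3 := integral_log_max_le k hu
  have h4 : u * Real.log u ^ k ≤ C' * u ^ r := by
    calc u * Real.log u ^ k ≤ u * (C' * u ^ (r - 1)) := by gcongr; exact h2 u hu
      _ = C' * u ^ r := by rw [Real.rpow_sub_one hu0.ne']; field_simp
  have h5 := integral_log_max_nonneg k hu
  have h6 := logSum_nonneg h.nonneg k u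
  rw [logError, abs_le]
  constructor <;> nlinarith [h1 u hu, Real.rpow_pos_of_pos hu0 r]

lemma integrableOn_logError (h : ZetaLike f Λ R M Q) (k : ℕ) {c : ℝ} (hc : 1 < c) :
    IntegrableOn (fun u => |logError Λ k u| * u ^ (-(c + 1))) (Ioi 1) := by
  obtain ⟨C, hC, hb⟩ := h.abs_logError_le_rpow k (r := (c + 1) / 2) (by linarith)
  refine Integrable.mono' ((integrableOn_Ioi_rpow_of_lt (a := (c + 1) / 2 - (c + 1)) (by linarith) one_pos).const_mul C) ?_ ?_
  · exact ((h.measurable_logError k).abs.mul (measurable_id.pow_const _)).aestronglyMeasurable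
  · refine (ae_restrict_iff' measurableSet_Ioi).mpr (Eventually.of_forall fun u hu => ?_)
    have hu0 : 0 < u := one_pos.trans hu
    rw [Real.norm_eq_abs, abs_of_nonneg (by positivity), sub_eq_add_neg ((c + 1) / 2), Real.rpow_add hu0, ← mul_assoc]
    gcongr
    exact hb u (le_of_lt hu)

lemma integral_logError (h : ZetaLike f Λ R M Q) (k : ℕ) {c : ℝ} (hc : 1 < c) (y : ℝ) :
    ∫ u in Ioi (1:ℝ), (logError Λ k u : ℂ) * (u : ℂ) ^ (-((c + y * I : ℂ) + 1)) =
      (LSeries (fun m => ((Λ m * Real.log m ^ k : ℝ) : ℂ)) (c + y * I) - k.factorial / ((c + y * I : ℂ) - 1) ^ (k + 1)) / (c + y * I) := by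
  have hre : (c + y * I : ℂ).re = c := by simp
  have hs0 : (c + y * I : ℂ) ≠ 0 := by
    intro h0
    have := congrArg Complex.re h0
    rw [hre] at this; simp at this; linarith
  obtain ⟨C, hC, h1⟩ := h.logSum_le_rpow k (r := (c + 1) / 2) (by linarith)
  have hO : (fun n : ℕ => ∑ m ∈ Finset.Icc 1 n, Λ m * Real.log m ^ k) =O[atTop] fun n : ℕ => (n : ℝ) ^ ((c + 1) / 2) := by
    refine Asymptotics.IsBigO.of_bound C ?_
    filter_upwards [eventually_ge_atTop 1] with n hn
    have := h1 n (by exact_mod_cast hn)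
    have hnn := logSum_nonneg h.nonneg k n
    rw [logSum, Nat.floor_natCast] at this hnn
    rw [Real.norm_eq_abs, Real.norm_eq_abs, abs_of_nonneg hnn, abs_of_nonneg (by positivity)]
    exact this
  have hB := LSeries_eq_mul_integral_of_nonneg (fun m => Λ m * Real.log m ^ k) (r := (c + 1) / 2) (s := c + y * I) (by linarith)
    (by rw [hre]; linarith) hO (fun m => mul_nonneg (h.nonneg m) (pow_nonneg (Real.log_natCast_nonneg m) _))
  have hBi : ∀ u : ℝ, (∑ m ∈ Finset.Icc 1 ⌊u⌋₊, ((Λ m * Real.log m ^ k : ℝ) : ℂ)) = (logSum Λ k u : ℂ) := by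
    intro u; rw [logSum]; push_cast; rfl
  simp_rw [hBi] at hB
  obtain ⟨hi1, hi2⟩ := setIntegral_Ioi_cumulative (A := fun t => Real.log (max t 1) ^ k) (continuous_log_max_pow k).measurable
    (c := c - 1) (by linarith) (by
      refine (integrableOn_log_pow_mul_rpow k hc).congr_fun (fun u hu => ?_) measurableSet_Ioi
      have hu1 : 1 ≤ u := le_of_lt hu
      simp only [max_eq_left hu1]
      rw [abs_of_nonneg (pow_nonneg (Real.log_nonneg hu1) k)]; congr 2; ring) y
  have e1 : (((c - 1 : ℝ) : ℂ) + y * I + 2) = (c + y * I) + 1 := by push_cast; ring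
  have e2 : (((c - 1 : ℝ) : ℂ) + y * I + 1) = (c + y * I) := by push_cast; ring
  rw [e1] at hi1 hi2
  rw [e2] at hi2
  have hJ : ∫ u in Ioi (1:ℝ), ((Real.log (max u 1) ^ k : ℝ) : ℂ) * (u : ℂ) ^ (-(c + y * I : ℂ)) = k.factorial / ((c + y * I : ℂ) - 1) ^ (k + 1) := by
    rw [← integral_log_pow_mul_cpow k (s := c + y * I) (by rw [hre]; exact hc)]
    refine setIntegral_congr_fun measurableSet_Ioi fun u hu => ?_
    have hu1 : 1 ≤ u := le_of_lt hu
    simp only [max_eq_left hu1]; push_cast; rfl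
  rw [hJ] at hi2
  have hAi : IntegrableOn (fun u : ℝ => (logError Λ k u : ℂ) * (u : ℂ) ^ (-((c + y * I : ℂ) + 1))) (Ioi 1) := by
    refine (h.integrableOn_logError k hc).mono' ?_ ?_
    · exact ((Complex.measurable_ofReal.comp (h.measurable_logError k)).mul (Complex.measurable_ofReal.pow_const _)).aestronglyMeasurable
    · refine (ae_restrict_iff' measurableSet_Ioi).mpr (Eventually.of_forall fun u hu => ?_)
      have hu0 : 0 < u := one_pos.trans hu
      rw [norm_mul, Complex.norm_real, Complex.norm_cpow_eq_rpow_re_of_pos hu0, Real.norm_eq_abs, neg_re, add_re, hre, one_re]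
  have hsplit : ∫ u in Ioi (1:ℝ), (logSum Λ k u : ℂ) * (u : ℂ) ^ (-((c + y * I : ℂ) + 1)) =
      (∫ u in Ioi (1:ℝ), (logError Λ k u : ℂ) * (u : ℂ) ^ (-((c + y * I : ℂ) + 1))) +
      ∫ u in Ioi (1:ℝ), ((∫ t in (1:ℝ)..u, Real.log (max t 1) ^ k : ℝ) : ℂ) * (u : ℂ) ^ (-((c + y * I : ℂ) + 1)) := by
    rw [← integral_add hAi hi1]
    congr 1; ext u
    rw [logError]; push_cast; ring
  rw [hsplit, hi2] at hB
  rw [eq_div_iff hs0, hB]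
  field_simp
  ring

end ZetaLike
end

section
open MeasureTheory Set Complex Filter

lemma integrable_log_pow_div (k : ℕ) : Integrable fun y : ℝ => Real.log (|y| + 4) ^ k / (1 + y ^ 2) := by
  obtain ⟨C, hC, h⟩ := log_pow_le_rpow k (ε := 1 / 2) (by norm_num)
  have hi := (integrable_one_add_norm (E := ℝ) (μ := volume) (r := 3 / 2) (by norm_num)).const_mul (C * 4)
  refine hi.mono' ?_ (Eventually.of_forall fun y => ?_)
  · refine Continuous.aestronglyMeasurable ?_
    refine Continuous.div ((Continuous.log (by fun_prop) fun y => by positivity).pow k) (by fun_prop) fun y => by positivity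
  · have hy := abs_nonneg y
    have h1 := h (|y| + 4) (by linarith)
    have hl : 0 ≤ Real.log (|y| + 4) := Real.log_nonneg (by linarith)
    rw [Real.norm_eq_abs, abs_of_nonneg (by positivity), Real.norm_eq_abs, div_le_iff₀ (by positivity)]
    refine h1.trans ?_
    have h2 : (|y| + 4) ^ (1 / 2 : ℝ) ≤ 2 * (1 + |y|) ^ (1 / 2 : ℝ) := by
      have : (2:ℝ) = 4 ^ (1 / 2 : ℝ) := by
        rw [show (4:ℝ) = 2 ^ (2:ℝ) by norm_num, ← Real.rpow_mul (by norm_num)]; norm_num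
      calc (|y| + 4) ^ (1 / 2 : ℝ) ≤ (4 * (1 + |y|)) ^ (1 / 2 : ℝ) := Real.rpow_le_rpow (by linarith) (by linarith) (by norm_num)
        _ = 2 * (1 + |y|) ^ (1 / 2 : ℝ) := by rw [Real.mul_rpow (by norm_num) (by linarith), ← this]
    have h3 : (1 + |y|) ^ (-(3 / 2) : ℝ) * (1 + |y|) ^ 2 = (1 + |y|) ^ (1 / 2 : ℝ) := by
      rw [← Real.rpow_natCast, ← Real.rpow_add (by linarith)]; norm_num
    have h4 : (1 + |y|) ^ 2 ≤ 2 * (1 + y ^ 2) := by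
      rw [← sq_abs y]; nlinarith [sq_nonneg (1 - |y|)]
    have hp : 0 < (1 + |y|) ^ (-(3 / 2) : ℝ) := by positivity
    calc C * (|y| + 4) ^ (1 / 2 : ℝ) ≤ C * (2 * ((1 + |y|) ^ (-(3 / 2) : ℝ) * (1 + |y|) ^ 2)) := by rw [h3]; gcongr
      _ ≤ C * (2 * ((1 + |y|) ^ (-(3 / 2) : ℝ) * (2 * (1 + y ^ 2)))) := by gcongr
      _ = C * 4 * (1 + |y|) ^ (-(3 / 2) : ℝ) * (1 + y ^ 2) := by ring

namespace ZetaLike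

lemma M_le_Q {f : ℂ → ℂ} {Λ : ℕ → ℝ} {R M Q : ℝ} (h : ZetaLike f Λ R M Q) : M ≤ Q := by
  have h1 := h.le_Q
  have hR := h.R_pos
  have hM := h.M_ge
  have h2 : 0 ≤ Real.log Q := Real.log_nonneg h.Q_ge
  have h3 : M ≤ M / R := by rw [le_div_iff₀ hR]; nlinarith [h.R_le]
  nlinarith [mul_nonneg (by linarith : 0 ≤ M / R) h2]

theorem abs_integral_logError_le (k : ℕ) : ∃ C > 0, ∀ {f : ℂ → ℂ} {Λ : ℕ → ℝ} {R M Q : ℝ},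
    ZetaLike f Λ R M Q → (∀ ρ : ℂ, ‖ρ - 1‖ < 1 / (10 ^ 4 * Q) → f ρ ≠ 0) →
    ∀ x : ℝ, Real.exp 1 ≤ x → Real.log (Real.log x) ≤ Q → ∀ u : ℝ, 1 ≤ u → u ≤ x ^ 2 →
    |∫ t in (1:ℝ)..u, logError Λ k t| ≤ C * u ^ 2 * Q ^ (k + 3) := by
  set J := ∫ y : ℝ, Real.log (|y| + 4) ^ (k + 2) / (1 + y ^ 2) with hJ
  have hJ0 : 0 ≤ J := integral_nonneg fun y => by
    have := Real.log_nonneg (show 1 ≤ |y| + 4 by linarith [abs_nonneg y])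
    positivity
  set K : ℝ := (k + 1).factorial * 4 * (4 * 10 ^ 6) ^ (k + 1) with hK
  have hK0 : 0 < K := by positivity
  refine ⟨Real.exp 2 * (K * J + 1), by positivity, ?_⟩
  intro f Λ R M Q h hex x hx hlogx u hu1 hux
  have hQ := h.Q_ge
  rcases hu1.eq_or_lt with rfl | hu1
  · simp; positivity
  have hx0 : 0 < x := (Real.exp_pos 1).trans_le hx
  set ℓ := Real.log x with hℓ
  have hℓ1 : 1 ≤ ℓ := by rw [hℓ, Real.le_log_iff_exp_le hx0]; exact hx
  set c := 1 + 1 / ℓ with hc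
  have hc1 : 1 < c := by have : 0 < 1 / ℓ := by positivity
                         linarith
  have hc2 : c ≤ 2 := by have : 1 / ℓ ≤ 1 := by rw [div_le_one (by linarith)]; exact hℓ1
                         linarith
  have hre : ∀ y : ℝ, (c + y * I : ℂ).re = c := by simp
  have him : ∀ y : ℝ, (c + y * I : ℂ).im = y := by simp
  have hn1 : ∀ y : ℝ, (1 + y ^ 2) ≤ ‖(c + y * I : ℂ)‖ ^ 2 := by
    intro y
    rw [← Complex.normSq_eq_norm_sq, Complex.normSq_apply, hre, him]; nlinarith
  have hn2 : ∀ y : ℝ, ‖(c + y * I : ℂ)‖ ≤ ‖(c + y * I + 1 : ℂ)‖ := by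
    intro y
    rw [← sq_le_sq₀ (norm_nonneg _) (norm_nonneg _), ← Complex.normSq_eq_norm_sq, ← Complex.normSq_eq_norm_sq,
      Complex.normSq_apply, Complex.normSq_apply]
    simp only [add_re, add_im, one_re, one_im, hre, him]
    simp
    nlinarith
  have hne : ∀ y : ℝ, (c + y * I : ℂ) ≠ 0 := by
    intro y h0
    have := hn1 y
    rw [h0] at this; simp at this; nlinarith
  have hne1 : ∀ y : ℝ, (c + y * I : ℂ) - 1 ≠ 0 := by
    intro y h0
    have := congrArg Complex.re h0
    rw [sub_re, hre] at this; simp at this; linarith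
  set F : ℝ → ℂ := fun y => (LSeries (fun m => ((Λ m * Real.log m ^ k : ℝ) : ℂ)) (c + y * I) - k.factorial / ((c + y * I : ℂ) - 1) ^ (k + 1)) / (c + y * I) with hF
  have hFc : Continuous F := by
    refine Continuous.div (Continuous.sub ?_ (Continuous.div (by fun_prop) (by fun_prop) fun y => pow_ne_zero _ (hne1 y))) (by fun_prop) hne
    rw [continuous_iff_continuousAt]
    intro y
    have ha : LSeries.abscissaOfAbsConv (fun m => ((Λ m * Real.log m ^ k : ℝ) : ℂ)) < (c + y * I : ℂ).re := by
      rw [← logMul_iterate, LSeries.absicssaOfAbsConv_logPowMul]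
      exact h.abscissa_lt (by rw [hre]; exact hc1)
    have := (LSeries_analyticOnNhd _ _ ha).continuousAt
    exact ContinuousAt.comp (f := fun y : ℝ => (c + y * I : ℂ)) this (by fun_prop)
  have hFn : ∀ y : ℝ, ‖F y‖ / ‖(c + y * I + 1 : ℂ)‖ ≤ K * Q ^ (k + 3) * (Real.log (|y| + 4) ^ (k + 2) / (1 + y ^ 2)) := by
    intro y
    have hy := abs_nonneg y
    have hd := h.iteratedDeriv_logDeriv k (s := c + y * I) (by rw [hre]; exact hc1)
    have hb := h.iteratedDeriv_logDeriv_le hex k (c := c + y * I) (by rw [hre]; exact hc1) (by rw [hre]; exact hc2)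
    rw [hd, norm_mul, norm_pow, norm_neg, norm_one, one_pow, one_mul, hre, him, norm_sub_rev] at hb
    set l4 := Real.log (|y| + 4) with hl4
    have hl41 : 1 ≤ l4 := by
      rw [hl4, Real.le_log_iff_exp_le (by linarith)]
      linarith [Real.exp_one_lt_d9]
    have hlog : Real.log ((|y| + 3) / (c - 1)) ≤ 2 * Q * l4 := by
      have : c - 1 = 1 / ℓ := by rw [hc]; ring
      rw [this, div_div_eq_mul_div, div_one, Real.log_mul (by linarith) (by linarith)]
      have : Real.log (|y| + 3) ≤ l4 := Real.log_le_log (by linarith) (by linarith)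
      nlinarith
    have hM := h.M_le_Q
    have hl0 : 0 ≤ Real.log ((|y| + 3) / (c - 1)) := by
      refine Real.log_nonneg ?_
      rw [le_div_iff₀ (by linarith)]; linarith
    have hM1 := h.M_ge
    rw [hF]
    simp only [norm_div]
    rw [div_div, div_le_iff₀ (mul_pos (norm_pos_iff.mpr (hne y)) ((norm_pos_iff.mpr (hne y)).trans_le (hn2 y)))]
    have hden : 1 + y ^ 2 ≤ ‖(c + y * I : ℂ)‖ * ‖(c + y * I + 1 : ℂ)‖ := by
      have := hn1 y
      nlinarith [hn2 y, norm_nonneg (c + y * I : ℂ)]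
    calc _ ≤ _ := hb
      _ ≤ (k + 1).factorial * (2 * (Q * (2 * Q * l4))) * (4 * 10 ^ 6 * Q * l4) ^ (k + 1) := by
          gcongr
      _ = K * Q ^ (k + 3) * (l4 ^ (k + 2) / (1 + y ^ 2)) * (1 + y ^ 2) := by
          rw [hK]; field_simp; ring
      _ ≤ _ := by gcongr
  have hmain := abs_cumulative_le (h.measurable_logError k) (c := c) (by linarith) (fun b => h.intervalIntegrable_logError k 1 b)
    (h.integrableOn_logError k hc1) hFc (fun y => h.integral_logError k hc1 y)
    ((integrable_log_pow_div (k + 2)).const_mul (K * Q ^ (k + 3))) hFn hu1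
  rw [integral_const_mul] at hmain
  refine hmain.trans ?_
  have hu0 : 0 < u := by linarith
  have hpow : u ^ (c + 1) ≤ Real.exp 2 * u ^ 2 := by
    have : c + 1 = 2 + 1 / ℓ := by rw [hc]; ring
    rw [this, Real.rpow_add hu0, Real.rpow_two, mul_comm]
    gcongr
    rw [Real.rpow_def_of_pos hu0]
    apply Real.exp_le_exp.mpr
    have : Real.log u ≤ 2 * ℓ := by
      have := Real.log_le_log hu0 hux
      rwa [Real.log_pow] at this
    rw [mul_one_div, div_le_iff₀ (by linarith)]; linarith
  calc u ^ (c + 1) * (K * Q ^ (k + 3) * J) ≤ (Real.exp 2 * u ^ 2) * (K * Q ^ (k + 3) * J) := by gcongr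
    _ ≤ (Real.exp 2 * u ^ 2) * ((K * J + 1) * Q ^ (k + 3)) := by
        have : K * Q ^ (k + 3) * J ≤ (K * J + 1) * Q ^ (k + 3) := by
          have : 0 < Q ^ (k + 3) := by positivity
          nlinarith
        gcongr
    _ = _ := by ring

/-- The prime number theorem for a `ZetaLike` function, with logarithmic weights. -/
theorem abs_logError_le (k : ℕ) : ∃ C > 0, ∀ {f : ℂ → ℂ} {Λ : ℕ → ℝ} {R M Q : ℝ},
    ZetaLike f Λ R M Q → (∀ ρ : ℂ, ‖ρ - 1‖ < 1 / (10 ^ 4 * Q) → f ρ ≠ 0) →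
    ∀ x : ℝ, Real.exp 1 ≤ x → Real.log (Real.log x) ≤ Q → ∀ u : ℝ, 1 ≤ u → u ≤ x → ∀ h : ℝ, 0 < h → h ≤ 1 / 2 →
    |logError Λ k u| ≤ C * u * (Q ^ (k + 3) / h + h * Real.log x ^ k) := by
  obtain ⟨C, hC, hb⟩ := abs_integral_logError_le k
  refine ⟨8 * C + 2 ^ k + 4, by positivity, ?_⟩
  intro f Λ R M Q hz hex x hx hlogx u hu1 hux h hh0 hh2
  have hQ := hz.Q_ge
  have hQk : 1 ≤ Q ^ (k + 3) := one_le_pow₀ hQ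
  have hx2 : 2 ≤ x := by linarith [Real.exp_one_gt_d9]
  have hℓ1 : 1 ≤ Real.log x := by rw [Real.le_log_iff_exp_le (by linarith)]; exact hx
  set q := Q ^ (k + 3) with hq
  set ℓk := Real.log x ^ k with hℓk
  have hℓk1 : 1 ≤ ℓk := one_le_pow₀ hℓ1
  set I : ℝ → ℝ := fun u => ∫ t in (1:ℝ)..u, Real.log (max t 1) ^ k with hI
  have hIi : ∀ a b, IntervalIntegrable (fun t : ℝ => Real.log (max t 1) ^ k) volume a b :=
    fun a b => (continuous_log_max_pow k).intervalIntegrable a b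
  have hIc : Continuous I := intervalIntegral.continuous_primitive hIi 1
  have hIstep : ∀ a b, 1 ≤ a → a ≤ b → b ≤ x ^ 2 → I b - I a ≤ (b - a) * (2 ^ k * ℓk) ∧ 0 ≤ I b - I a := by
    intro a b ha hab hbx
    have : I b - I a = ∫ t in a..b, Real.log (max t 1) ^ k := by
      rw [hI]; exact intervalIntegral.integral_interval_sub_left (hIi _ _) (hIi _ _)
    rw [this]
    constructor
    · have := intervalIntegral.integral_mono_on (g := fun _ => 2 ^ k * ℓk) hab (hIi a b) (by simp) (fun t ht => by
        have ht1 : 1 ≤ t := ha.trans ht.1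
        rw [max_eq_left ht1, hℓk, ← mul_pow]
        refine pow_le_pow_left₀ (Real.log_nonneg ht1) ?_ k
        have := Real.log_le_log (by linarith) (ht.2.trans hbx)
        rwa [Real.log_pow] at this)
      rwa [intervalIntegral.integral_const, smul_eq_mul] at this
    · exact intervalIntegral.integral_nonneg hab fun t _ => pow_nonneg (Real.log_nonneg (le_max_right _ _)) k
  have hAB : ∀ t, logSum Λ k t = logError Λ k t + I t := by intro t; rw [logError]; ring
  have hBi : ∀ a b, IntervalIntegrable (logSum Λ k) volume a b := fun a b => (logSum_mono hz.nonneg k).intervalIntegrable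
  have hAi := hz.intervalIntegrable_logError k
  have hintg : ∀ a b, ∫ t in a..b, logSum Λ k t = ((∫ t in (1:ℝ)..b, logError Λ k t) - ∫ t in (1:ℝ)..a, logError Λ k t) + ∫ t in a..b, I t := by
    intro a b
    rw [intervalIntegral.integral_interval_sub_left (hAi _ _) (hAi _ _), ← intervalIntegral.integral_add (hAi a b) (hIc.intervalIntegrable a b)]
    simp_rw [hAB]
  have hxx : 2 * x ≤ x ^ 2 := by nlinarith
  have hhu : 0 < h * u := by positivity
  have hhu' : h * u ≤ u / 2 := by nlinarith
  have hmain : ∀ X : ℝ, h * u * X ≤ 5 * C * u ^ 2 * q + C * u ^ 2 * q + (h * u) ^ 2 * (2 ^ k * ℓk) →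
      X ≤ (8 * C + 2 ^ k + 4) * u * (q / h + h * ℓk) := by
    intro X hX
    have : X ≤ (6 * C * u ^ 2 * q + (h * u) ^ 2 * (2 ^ k * ℓk)) / (h * u) := by
      rw [le_div_iff₀ hhu]; linarith
    have e : (6 * C * u ^ 2 * q + (h * u) ^ 2 * (2 ^ k * ℓk)) / (h * u) = u * (6 * C * (q / h) + 2 ^ k * (h * ℓk)) := by
      field_simp
    rw [e] at this
    refine this.trans ?_
    rw [mul_comm (8 * C + 2 ^ k + 4) u, mul_assoc u]
    refine mul_le_mul_of_nonneg_left ?_ (by linarith)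
    have h1 : 0 < q / h := by positivity
    have h2 : 0 < h * ℓk := by positivity
    have h3 : (0:ℝ) < 2 ^ k := by positivity
    nlinarith [mul_pos hC h1, mul_pos hC h2, mul_pos h3 h1]
  rw [abs_le']
  constructor
  · apply hmain
    have hu' : u + h * u ≤ x ^ 2 := by linarith
    have hb1 := abs_le.mp (hb hz hex x hx hlogx (u + h * u) (by linarith) hu')
    have hb2 := abs_le.mp (hb hz hex x hx hlogx u hu1 (by linarith))
    have hB : h * u * logSum Λ k u ≤ ∫ t in u..(u + h * u), logSum Λ k t := by
      have := intervalIntegral.integral_mono_on (f := fun _ => logSum Λ k u) (b := u + h * u) (by linarith) (by simp) (hBi u _)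
        (fun t ht => logSum_mono hz.nonneg k ht.1)
      simpa only [intervalIntegral.integral_const, smul_eq_mul, add_sub_cancel_left, sub_sub_cancel] using this
    have hI2 : ∫ t in u..(u + h * u), I t ≤ h * u * (I u + h * u * (2 ^ k * ℓk)) := by
      have := intervalIntegral.integral_mono_on (μ := volume) (f := I) (g := fun _ => I u + h * u * (2 ^ k * ℓk)) (a := u) (b := u + h * u) (by linarith) (hIc.intervalIntegrable _ _) (continuous_const.intervalIntegrable _ _)
        (fun t ht => by
          have := (hIstep u t hu1 ht.1 (ht.2.trans hu')).1
          have h2 : (t - u) * (2 ^ k * ℓk) ≤ h * u * (2 ^ k * ℓk) := by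
            gcongr; linarith [ht.2]
          linarith)
      simpa only [intervalIntegral.integral_const, smul_eq_mul, add_sub_cancel_left, sub_sub_cancel] using this
    rw [hintg, hAB] at hB
    have h5 : (u + h * u) ^ 2 ≤ 4 * u ^ 2 := by nlinarith
    have h6 : C * (u + h * u) ^ 2 * q ≤ C * (4 * u ^ 2) * q := by gcongr
    nlinarith
  · by_cases hu2 : 2 ≤ u
    · apply hmain
      have hlo : 1 ≤ u - h * u := by linarith
      have hb1 := abs_le.mp (hb hz hex x hx hlogx (u - h * u) hlo (by linarith))
      have hb2 := abs_le.mp (hb hz hex x hx hlogx u hu1 (by linarith))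
      have hB : ∫ t in (u - h * u)..u, logSum Λ k t ≤ h * u * logSum Λ k u := by
        have := intervalIntegral.integral_mono_on (g := fun _ => logSum Λ k u) (a := u - h * u) (b := u) (by linarith) (hBi _ _) (by simp)
          (fun t ht => logSum_mono hz.nonneg k ht.2)
        simpa only [intervalIntegral.integral_const, smul_eq_mul, add_sub_cancel_left, sub_sub_cancel] using this
      have hI2 : h * u * (I u - h * u * (2 ^ k * ℓk)) ≤ ∫ t in (u - h * u)..u, I t := by
        have := intervalIntegral.integral_mono_on (μ := volume) (f := fun _ => I u - h * u * (2 ^ k * ℓk)) (g := I) (a := u - h * u) (b := u) (by linarith) (continuous_const.intervalIntegrable _ _) (hIc.intervalIntegrable _ _)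
          (fun t ht => by
            have := (hIstep t u (hlo.trans ht.1) ht.2 (by linarith)).1
            have h2 : (u - t) * (2 ^ k * ℓk) ≤ h * u * (2 ^ k * ℓk) := by
              gcongr; linarith [ht.1]
            linarith)
        simpa only [intervalIntegral.integral_const, smul_eq_mul, add_sub_cancel_left, sub_sub_cancel] using this
      rw [hintg, hAB] at hB
      have h5 : (u - h * u) ^ 2 ≤ 4 * u ^ 2 := by nlinarith
      have h6 : C * (u - h * u) ^ 2 * q ≤ C * (4 * u ^ 2) * q := by gcongr
      nlinarith
    · push Not at hu2
      have h1 := logSum_nonneg hz.nonneg k u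
      have h2 := integral_log_max_le k hu1
      have h3 : Real.log u ^ k ≤ 1 := by
        apply pow_le_one₀ (Real.log_nonneg hu1)
        rw [Real.log_le_iff_le_exp (by linarith)]; linarith [Real.exp_one_gt_d9]
      have h4 : -logError Λ k u ≤ u := by rw [logError]; nlinarith
      have h5 : 1 ≤ q / h := by rw [le_div_iff₀ hh0]; linarith
      have h6 : 0 < h * ℓk := by positivity
      have h7 : (0:ℝ) < 2 ^ k := by positivity
      have h8 : 1 ≤ (8 * C + 2 ^ k + 4) * (q / h + h * ℓk) := by nlinarith
      nlinarith

end ZetaLike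
end

section
open MeasureTheory Set Complex Filter Topology ArithmeticFunction

/-- `a` is the coefficient sequence of a Dirichlet series with logarithmic derivative `-∑ b m m^{-s}`
dominated by `N` times that of the zeta function. -/
structure EulerLike (a b : ℕ → ℂ) (N : ℝ) : Prop where
  N_nonneg : 0 ≤ N
  one : a 1 = 1
  summable : ∀ s : ℂ, 1 < s.re → LSeriesSummable a s
  conv : ∀ m : ℕ, m ≠ 0 → LSeries.convolution b a m = Complex.log m * a m
  bound : ∀ m, ‖b m‖ ≤ N * vonMangoldt m

namespace EulerLike
variable {a b : ℕ → ℂ} {N : ℝ}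

lemma abscissa_lt (h : EulerLike a b N) {s : ℂ} (hs : 1 < s.re) : LSeries.abscissaOfAbsConv a < s.re := by
  have := LSeries.abscissaOfAbsConv_le_of_forall_lt_LSeriesSummable (f := a) (x := 1)
    (fun y hy => h.summable _ (by simpa using hy))
  exact this.trans_lt (by exact_mod_cast hs)

lemma summable_log (h : EulerLike a b N) {s : ℂ} (hs : 1 < s.re) : LSeriesSummable b s := by
  have h1 : LSeriesSummable (fun m => ((N : ℝ) : ℂ) * vonMangoldt m) s :=
    (LSeriesSummable_vonMangoldt hs).smul (N : ℂ)
  refine Summable.of_norm_bounded h1.norm fun m => ?_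
  apply LSeries.norm_term_le
  rw [norm_mul, Complex.norm_real, Complex.norm_real, Real.norm_of_nonneg h.N_nonneg, Real.norm_of_nonneg vonMangoldt_nonneg]
  exact h.bound m

/-- The coefficients of the logarithm of the Dirichlet series. -/
noncomputable def logCoeff (b : ℕ → ℂ) (m : ℕ) : ℂ := b m / Complex.log m

lemma summable_logCoeff (h : EulerLike a b N) {s : ℂ} (hs : 1 < s.re) : LSeriesSummable (logCoeff b) s := by
  have h1 : LSeriesSummable (fun m => 2 * b m) s := (h.summable_log hs).smul 2
  refine Summable.of_norm_bounded h1.norm fun m => ?_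
  apply LSeries.norm_term_le
  rw [norm_mul, logCoeff, norm_div, ← Complex.natCast_log, Complex.norm_real]
  rcases Nat.lt_or_ge m 2 with h2 | h2
  · interval_cases m <;> simp
  · have : Real.log 2 ≤ Real.log m := Real.log_le_log (by norm_num) (by exact_mod_cast h2)
    have h3 := Real.log_two_gt_d9
    have h4 : (1:ℝ)/2 ≤ ‖Real.log m‖ := by rw [Real.norm_of_nonneg (by linarith)]; linarith
    rw [div_le_iff₀ (by linarith)]
    have := norm_nonneg (b m)
    simp only [Complex.norm_ofNat]
    nlinarith

lemma abscissa_logCoeff_lt (h : EulerLike a b N) {s : ℂ} (hs : 1 < s.re) :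
    LSeries.abscissaOfAbsConv (logCoeff b) < s.re := by
  have := LSeries.abscissaOfAbsConv_le_of_forall_lt_LSeriesSummable (f := logCoeff b) (x := 1)
    (fun y hy => h.summable_logCoeff (by simpa using hy))
  exact this.trans_lt (by exact_mod_cast hs)

lemma deriv_LSeries (h : EulerLike a b N) {s : ℂ} (hs : 1 < s.re) :
    HasDerivAt (LSeries a) (-(LSeries b s * LSeries a s)) s := by
  have h1 := LSeries_hasDerivAt (h.abscissa_lt hs)
  refine h1.congr_deriv ?_
  rw [← LSeries_convolution' (h.summable_log hs) (h.summable s hs)]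
  congr 1
  exact (LSeries_congr (fun {m} hm => h.conv m hm) s).symm

lemma deriv_logCoeff (h : EulerLike a b N) {s : ℂ} (hs : 1 < s.re) :
    HasDerivAt (LSeries (logCoeff b)) (-(LSeries b s)) s := by
  have h1 := LSeries_hasDerivAt (h.abscissa_logCoeff_lt hs)
  refine h1.congr_deriv ?_
  congr 1
  refine LSeries_congr (fun {m} hm => ?_) s
  rw [LSeries.logMul, logCoeff]
  rcases Nat.lt_or_ge m 2 with h2 | h2
  · have : m = 1 := by omega
    subst this
    have := h.bound 1
    simp at this
    simp [this]
  · have : Complex.log m ≠ 0 := by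
      rw [← Complex.natCast_log]
      have := Real.log_pos (x := m) (by exact_mod_cast h2)
      exact_mod_cast this.ne'
    field_simp

lemma LSeries_eq_exp (h : EulerLike a b N) {s : ℂ} (hs : 1 < s.re) :
    LSeries a s = Complex.exp (LSeries (logCoeff b) s) := by
  let G : ℂ → ℂ := fun s => LSeries a s * Complex.exp (-LSeries (logCoeff b) s)
  have hU : IsOpen {z : ℂ | 1 < z.re} := isOpen_lt continuous_const continuous_re
  have hconv : Convex ℝ {z : ℂ | 1 < z.re} := convex_halfSpace_re_gt 1
  have hG : ∀ z ∈ {z : ℂ | 1 < z.re}, HasDerivAt G 0 z := by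
    intro z hz
    have := (h.deriv_LSeries hz).mul ((h.deriv_logCoeff hz).neg.cexp)
    refine this.congr_deriv ?_
    ring
  have hlim : Tendsto (fun x : ℝ => G x) atTop (𝓝 1) := by
    have h1 := LSeries.tendsto_atTop (f := a) ((h.abscissa_lt (s := 2) (by norm_num)).trans_le le_top)
    have h2 := LSeries.tendsto_atTop (f := logCoeff b) ((h.abscissa_logCoeff_lt (s := 2) (by norm_num)).trans_le le_top)
    have h3 := h1.mul ((Complex.continuous_exp.tendsto _).comp h2.neg)
    have e : logCoeff b 1 = 0 := by simp [logCoeff]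
    simpa [h.one, e] using h3
  have hconst : ∀ z, 1 < z.re → G z = 1 := by
    intro z hz
    have hc : ∀ x : ℝ, 1 < x → G z = G x := by
      intro x hx
      refine hU.is_const_of_deriv_eq_zero hconv.isPreconnected
        (fun w hw => (hG w hw).differentiableAt.differentiableWithinAt) (fun w hw => (hG w hw).deriv) hz ?_
      simpa using hx
    refine tendsto_nhds_unique ?_ hlim
    refine tendsto_const_nhds.congr' ?_
    filter_upwards [eventually_gt_atTop 1] with x hx using hc x hx
  have := hconst s hs
  simp only [G, Complex.exp_neg] at this
  exact (mul_inv_eq_one₀ (Complex.exp_ne_zero _)).mp this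

lemma ne_zero (h : EulerLike a b N) {s : ℂ} (hs : 1 < s.re) : LSeries a s ≠ 0 := by
  rw [h.LSeries_eq_exp hs]; exact Complex.exp_ne_zero _

lemma logDeriv (h : EulerLike a b N) {s : ℂ} (hs : 1 < s.re) :
    deriv (LSeries a) s / LSeries a s = -LSeries b s := by
  rw [(h.deriv_LSeries hs).deriv]
  have := h.ne_zero hs
  field_simp

lemma zeta : EulerLike 1 (fun m => vonMangoldt m) 1 where
  N_nonneg := by norm_num
  one := rfl
  summable s hs := LSeriesSummable_one_iff.2 hs
  conv m hm := by rw [convolution_vonMangoldt_const_one]; simp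
  bound m := by rw [Complex.norm_real, Real.norm_of_nonneg vonMangoldt_nonneg, one_mul]

lemma riemannZeta_le {σ : ℝ} (hσ : 1 < σ) : ‖LSeries 1 σ‖ ≤ σ / (σ - 1) := by
  rw [LSeries_one_eq_riemannZeta (by simpa using hσ), zeta_eq_tsum_one_div_nat_add_one_cpow (by simpa using hσ)]
  have e : ∀ n : ℕ, 1 / ((n : ℂ) + 1) ^ (σ : ℂ) = ((1 / ((n : ℝ) + 1) ^ σ : ℝ) : ℂ) := by
    intro n
    push_cast
    rw [Complex.ofReal_cpow (by positivity)]
    push_cast; rfl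
  simp_rw [e]
  rw [← Complex.ofReal_tsum, Complex.norm_real, Real.norm_of_nonneg (tsum_nonneg fun n => by positivity)]
  have h1 := ZetaAsymptotics.zeta_limit_aux1 hσ
  have h2 : 0 ≤ ZetaAsymptotics.termTSum σ := tsum_nonneg fun n => ZetaAsymptotics.term_nonneg _ _
  have h3 : σ / (σ - 1) = 1 + 1 / (σ - 1) := by
    have : σ - 1 ≠ 0 := by linarith
    field_simp
    ring
  rw [h3]
  have := mul_nonneg (by linarith : 0 ≤ σ) h2
  linarith

lemma norm_logSeries_le (h : EulerLike a b N) {s : ℂ} (hs : 1 < s.re) :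
    ‖LSeries (logCoeff b) s‖ ≤ N * Real.log (s.re / (s.re - 1)) := by
  have hσ : 1 < ((s.re : ℝ) : ℂ).re := by simpa using hs
  let c : ℕ → ℂ := logCoeff (fun m => (vonMangoldt m : ℂ))
  have hc : ∀ m, c m = ((vonMangoldt m / Real.log m : ℝ) : ℂ) := fun m => by
    simp only [c, logCoeff]; push_cast; rfl
  have hc0 : ∀ m : ℕ, 0 ≤ vonMangoldt m / Real.log m := fun m => div_nonneg vonMangoldt_nonneg (Real.log_natCast_nonneg m)
  have hterm : ∀ m, LSeries.term c (s.re : ℂ) m = ((if m = 0 then 0 else vonMangoldt m / Real.log m / (m : ℝ) ^ s.re : ℝ) : ℂ) := by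
    intro m
    rw [LSeries.term]
    split_ifs
    · simp
    · rw [hc]; push_cast; rw [Complex.ofReal_cpow (by positivity)]; simp
  have hsum := zeta.summable_logCoeff hσ
  have hre : LSeries c (s.re : ℂ) = ((∑' m, (if m = 0 then 0 else vonMangoldt m / Real.log m / (m : ℝ) ^ s.re : ℝ) : ℝ) : ℂ) := by
    rw [LSeries, Complex.ofReal_tsum]
    exact tsum_congr hterm
  have hsum' : Summable (fun m : ℕ => (if m = 0 then 0 else vonMangoldt m / Real.log m / (m : ℝ) ^ s.re : ℝ)) := by
    have : Summable (LSeries.term c (s.re : ℂ)) := hsum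
    rw [funext hterm] at this
    exact Complex.summable_ofReal.1 this
  have hz := zeta.LSeries_eq_exp hσ
  have hexp : Real.exp (∑' m, (if m = 0 then 0 else vonMangoldt m / Real.log m / (m : ℝ) ^ s.re : ℝ)) ≤ s.re / (s.re - 1) := by
    have := riemannZeta_le hs
    rw [hz, Complex.norm_exp] at this
    change Real.exp (LSeries c (s.re : ℂ)).re ≤ _ at this
    rwa [hre, Complex.ofReal_re] at this
  have hlog : (∑' m, (if m = 0 then 0 else vonMangoldt m / Real.log m / (m : ℝ) ^ s.re : ℝ)) ≤ Real.log (s.re / (s.re - 1)) := by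
    rw [Real.le_log_iff_exp_le (by apply div_pos <;> linarith)]; exact hexp
  refine le_trans ?_ (mul_le_mul_of_nonneg_left hlog h.N_nonneg)
  rw [← tsum_mul_left]
  refine tsum_of_norm_bounded (hsum'.mul_left N).hasSum fun m => ?_
  rw [LSeries.norm_term_eq]
  split_ifs with hm
  · simp
  · rw [logCoeff, norm_div, ← Complex.natCast_log, Complex.norm_real, Real.norm_of_nonneg (Real.log_natCast_nonneg m), ← mul_div_assoc, ← mul_div_assoc]
    have := h.bound m
    have := Real.log_natCast_nonneg m
    gcongr

lemma norm_LSeries_le (h : EulerLike a b N) {s : ℂ} (hs : 1 < s.re) :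
    ‖LSeries a s‖ ≤ (s.re / (s.re - 1)) ^ N := by
  have hp : 0 < s.re / (s.re - 1) := by apply div_pos <;> linarith
  rw [h.LSeries_eq_exp hs, Complex.norm_exp, Real.rpow_def_of_pos hp, mul_comm]
  exact Real.exp_le_exp.2 ((Complex.re_le_norm _).trans (h.norm_logSeries_le hs))

lemma le_norm_LSeries (h : EulerLike a b N) {s : ℂ} (hs : 1 < s.re) :
    ((s.re - 1) / s.re) ^ N ≤ ‖LSeries a s‖ := by
  have hp : 0 < (s.re - 1) / s.re := by apply div_pos <;> linarith
  rw [h.LSeries_eq_exp hs, Complex.norm_exp, Real.rpow_def_of_pos hp]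
  apply Real.exp_le_exp.2
  have h1 := (abs_le.1 ((Complex.abs_re_le_norm _).trans (h.norm_logSeries_le hs))).1
  rw [← inv_div, Real.log_inv]
  linarith

end EulerLike
end

section
open Filter NumberField Ideal UniqueFactorizationMonoid ArithmeticFunction

namespace NumberField
variable (K : Type*) [Field K] [NumberField K]

/-- The number of integral ideals of norm `m`. -/
noncomputable def idealCount (m : ℕ) : ℕ := Nat.card {I : Ideal (𝓞 K) // absNorm I = m}

/-- The ideals of norm `m`. -/
noncomputable def idealsOfNorm (m : ℕ) : Finset (Ideal (𝓞 K)) :=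
  (finite_setOfPred_absNorm_eq (S := 𝓞 K) m).toFinset

/-- The nonzero prime ideals of norm at most `m`. -/
noncomputable def primesUpTo (m : ℕ) : Finset (Ideal (𝓞 K)) :=
  (finite_setOfPred_absNorm_le (S := 𝓞 K) m).toFinset.filter Prime

variable {K}

lemma mem_idealsOfNorm {m : ℕ} {I : Ideal (𝓞 K)} : I ∈ idealsOfNorm K m ↔ absNorm I = m := by
  simp [idealsOfNorm]

lemma mem_primesUpTo {m : ℕ} {P : Ideal (𝓞 K)} : P ∈ primesUpTo K m ↔ absNorm P ≤ m ∧ Prime P := by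
  simp [primesUpTo]

lemma idealCount_eq_card (m : ℕ) : idealCount K m = (idealsOfNorm K m).card := by
  rw [idealCount, idealsOfNorm, ← Set.ncard_eq_toFinset_card _ (finite_setOfPred_absNorm_eq m)]
  rfl

lemma two_le_absNorm {P : Ideal (𝓞 K)} (hP : Prime P) : 2 ≤ absNorm P := by
  have h0 : absNorm P ≠ 0 := absNorm_eq_zero_iff.not.2 hP.ne_zero
  have h1 : absNorm P ≠ 1 := fun h => hP.not_isUnit (isUnit_iff.2 (absNorm_eq_one_iff.1 h))
  omega

lemma lt_of_pow_le {P : Ideal (𝓞 K)} (hP : Prime P) {k m : ℕ} (h : absNorm P ^ k ≤ m) : k < m :=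
  (Nat.lt_pow_self (two_le_absNorm hP)).trans_le h

variable (K) in
/-- The von Mangoldt function of a number field, summed over ideals of given norm. -/
noncomputable def fieldMangoldt (m : ℕ) : ℝ :=
  ∑ P ∈ primesUpTo K m, ∑ k ∈ Finset.Icc 1 m, if absNorm P ^ k = m then Real.log (absNorm P) else 0

lemma fieldMangoldt_eq {d m : ℕ} (hd : d ≤ m) : fieldMangoldt K d =
    ∑ P ∈ primesUpTo K m, ∑ k ∈ Finset.Icc 1 m, if absNorm P ^ k = d then Real.log (absNorm P) else 0 := by
  have h1 : primesUpTo K d ⊆ primesUpTo K m := fun P hP => by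
    rw [mem_primesUpTo] at hP ⊢; exact ⟨hP.1.trans hd, hP.2⟩
  have h2 : Finset.Icc 1 d ⊆ Finset.Icc 1 m := Finset.Icc_subset_Icc_right hd
  rw [fieldMangoldt]
  refine Finset.sum_subset_zero_on_sdiff h1 (fun P hP => ?_) (fun P hP => ?_)
  · rw [Finset.mem_sdiff, mem_primesUpTo, mem_primesUpTo] at hP
    refine Finset.sum_eq_zero fun k hk => if_neg fun h => hP.2 ⟨?_, hP.1.2⟩
    rw [← h]
    exact Nat.le_self_pow (by rw [Finset.mem_Icc] at hk; omega) _
  · refine Finset.sum_subset h2 fun k hk hk' => if_neg fun h => hk' ?_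
    rw [Finset.mem_Icc] at hk ⊢
    exact ⟨hk.1, (lt_of_pow_le (mem_primesUpTo.1 hP).2 h.le).le⟩

lemma fieldMangoldt_nonneg (m : ℕ) : 0 ≤ fieldMangoldt K m :=
  Finset.sum_nonneg fun P _ => Finset.sum_nonneg fun k _ => by
    split_ifs
    · exact Real.log_natCast_nonneg _
    · exact le_rfl

lemma pow_dvd_iff {P I : Ideal (𝓞 K)} (hP : Prime P) (hI : I ≠ 0) (k : ℕ) :
    P ^ k ∣ I ↔ k ≤ (normalizedFactors I).count P := by
  rw [dvd_iff_normalizedFactors_le_normalizedFactors (pow_ne_zero _ hP.ne_zero) hI, normalizedFactors_pow,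
    normalizedFactors_irreducible hP.irreducible, normalize_eq, Multiset.nsmul_singleton,
    ← Multiset.le_count_iff_replicate_le]

lemma log_absNorm {I : Ideal (𝓞 K)} {m : ℕ} (hI : absNorm I = m) (hm : m ≠ 0) :
    ∑ P ∈ primesUpTo K m, ∑ k ∈ Finset.Icc 1 m, (if P ^ k ∣ I then Real.log (absNorm P) else 0) = Real.log m := by
  have hI0 : I ≠ 0 := by rintro rfl; simp at hI; omega
  have h1 : ∀ P ∈ primesUpTo K m, ∑ k ∈ Finset.Icc 1 m, (if P ^ k ∣ I then Real.log (absNorm P) else 0) =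
      (normalizedFactors I).count P * Real.log (absNorm P) := by
    intro P hP
    have hP' := (mem_primesUpTo.1 hP).2
    rw [← Finset.sum_filter, Finset.sum_const, nsmul_eq_mul]
    congr 2
    have : (Finset.Icc 1 m).filter (fun k => P ^ k ∣ I) = Finset.Icc 1 ((normalizedFactors I).count P) := by
      ext k
      rw [Finset.mem_filter, Finset.mem_Icc, Finset.mem_Icc, pow_dvd_iff hP' hI0]
      refine ⟨fun h => ⟨h.1.1, h.2⟩, fun h => ⟨⟨h.1, ?_⟩, h.2⟩⟩
      have h3 := (pow_dvd_iff hP' hI0 k).2 h.2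
      have h4 := map_dvd absNorm h3
      rw [map_pow, hI] at h4
      exact (lt_of_pow_le hP' (Nat.le_of_dvd (Nat.pos_of_ne_zero hm) h4)).le
    rw [this, Nat.card_Icc, Nat.add_sub_cancel]
  rw [Finset.sum_congr rfl h1]
  have h2 : (normalizedFactors I).toFinset ⊆ primesUpTo K m := by
    intro P hP
    rw [Multiset.mem_toFinset] at hP
    refine mem_primesUpTo.2 ⟨?_, prime_of_normalized_factor P hP⟩
    rw [← hI]
    exact Nat.le_of_dvd (by omega) (map_dvd absNorm (dvd_of_mem_normalizedFactors hP))
  rw [← Finset.sum_subset h2]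
  · have h3 := prod_normalizedFactors_eq hI0
    rw [normalize_eq] at h3
    have h4 := congrArg absNorm h3
    rw [Finset.prod_multiset_count, map_prod, hI] at h4
    rw [← h4]
    push_cast
    rw [Real.log_prod]
    · refine Finset.sum_congr rfl fun P _ => ?_
      rw [map_pow]; push_cast
      rw [Real.log_pow]
    · intro P hP
      rw [Multiset.mem_toFinset] at hP
      have := two_le_absNorm (prime_of_normalized_factor P hP)
      rw [map_pow]; push_cast
      positivity
  · intro P _ hP
    rw [Multiset.mem_toFinset] at hP
    rw [Multiset.count_eq_zero_of_notMem hP]; simp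

lemma card_filter_dvd {Q : Ideal (𝓞 K)} {m : ℕ} (hm : m ≠ 0) :
    (((idealsOfNorm K m).filter (fun I => Q ∣ I)).card : ℕ) =
      ∑ x ∈ m.divisorsAntidiagonal, if absNorm Q = x.1 then idealCount K x.2 else 0 := by
  by_cases hQ : absNorm Q ∣ m
  · obtain ⟨e, he⟩ := hQ
    have hQ0 : absNorm Q ≠ 0 := by rintro h; rw [h] at he; omega
    rw [Finset.sum_eq_single (absNorm Q, e), if_pos rfl, idealCount_eq_card]
    · symm
      refine Finset.card_bij (fun J _ => Q * J) ?_ ?_ ?_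
      · intro J hJ
        rw [mem_idealsOfNorm] at hJ
        rw [Finset.mem_filter, mem_idealsOfNorm, map_mul, hJ]
        exact ⟨he.symm, dvd_mul_right _ _⟩
      · intro J _ J' _ h
        exact mul_left_cancel₀ (fun h => hQ0 (by simp [h])) h
      · intro I hI
        rw [Finset.mem_filter, mem_idealsOfNorm] at hI
        obtain ⟨J, rfl⟩ := hI.2
        refine ⟨J, ?_, rfl⟩
        rw [mem_idealsOfNorm]
        have := hI.1
        rw [map_mul, he] at this
        exact Nat.eq_of_mul_eq_mul_left (Nat.pos_of_ne_zero hQ0) this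
    · rintro ⟨a, b⟩ hab hne
      rw [Nat.mem_divisorsAntidiagonal] at hab
      refine if_neg fun h => hne ?_
      simp only at h hab
      rw [← h, he] at hab
      rw [← h, Nat.eq_of_mul_eq_mul_left (Nat.pos_of_ne_zero hQ0) hab.1]
    · intro h
      exact absurd (Nat.mem_divisorsAntidiagonal.2 ⟨he.symm, hm⟩) h
  · rw [Finset.sum_eq_zero, Finset.card_eq_zero, Finset.filter_eq_empty_iff]
    · intro I hI h
      rw [mem_idealsOfNorm] at hI
      exact hQ (hI ▸ map_dvd absNorm h)
    · rintro ⟨a, b⟩ hab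
      rw [Nat.mem_divisorsAntidiagonal] at hab
      exact if_neg fun h => hQ ⟨b, by rw [h]; exact hab.1.symm⟩

lemma fieldMangoldt_convolution {m : ℕ} (hm : m ≠ 0) :
    ∑ x ∈ m.divisorsAntidiagonal, fieldMangoldt K x.1 * idealCount K x.2 = Real.log m * idealCount K m := by
  calc _ = ∑ x ∈ m.divisorsAntidiagonal, ∑ P ∈ primesUpTo K m, ∑ k ∈ Finset.Icc 1 m,
        (if absNorm P ^ k = x.1 then Real.log (absNorm P) else 0) * idealCount K x.2 := by
        refine Finset.sum_congr rfl fun x hx => ?_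
        have hx' := Nat.mem_divisorsAntidiagonal.1 hx
        have h0 : x.1 ≠ 0 := by rintro h; rw [h] at hx'; simp at hx'; omega
        rw [fieldMangoldt_eq (Nat.le_of_dvd (Nat.pos_of_ne_zero hm) ⟨x.2, hx'.1.symm⟩), Finset.sum_mul]
        exact Finset.sum_congr rfl fun P _ => by rw [Finset.sum_mul]
    _ = ∑ P ∈ primesUpTo K m, ∑ k ∈ Finset.Icc 1 m, ∑ x ∈ m.divisorsAntidiagonal,
        (if absNorm P ^ k = x.1 then Real.log (absNorm P) else 0) * idealCount K x.2 := by
        rw [Finset.sum_comm]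
        exact Finset.sum_congr rfl fun P _ => by rw [Finset.sum_comm]
    _ = ∑ P ∈ primesUpTo K m, ∑ k ∈ Finset.Icc 1 m, ∑ I ∈ idealsOfNorm K m,
        (if P ^ k ∣ I then Real.log (absNorm P) else 0) := by
        refine Finset.sum_congr rfl fun P _ => Finset.sum_congr rfl fun k _ => ?_
        have h1 := card_filter_dvd (K := K) (Q := P ^ k) hm
        rw [← Finset.sum_filter, Finset.sum_const, nsmul_eq_mul, h1, Nat.cast_sum, Finset.sum_mul]
        refine Finset.sum_congr rfl fun x _ => ?_
        rw [map_pow]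
        split_ifs
        · ring
        · simp
    _ = ∑ I ∈ idealsOfNorm K m, ∑ P ∈ primesUpTo K m, ∑ k ∈ Finset.Icc 1 m,
        (if P ^ k ∣ I then Real.log (absNorm P) else 0) := by
        rw [Finset.sum_comm]
        rw [Finset.sum_congr rfl fun P _ => Finset.sum_comm, Finset.sum_comm]
        refine Finset.sum_comm.trans ?_
        rw [Finset.sum_comm]
        refine Finset.sum_congr rfl fun I _ => ?_
        rw [Finset.sum_comm]
    _ = _ := by
        rw [Finset.sum_congr rfl fun I hI => log_absNorm (mem_idealsOfNorm.1 hI) hm, Finset.sum_const,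
          nsmul_eq_mul, idealCount_eq_card, mul_comm]

lemma sum_log_absNorm_le {l : ℕ} (hl : l.Prime) (T : Finset (Ideal (𝓞 K))) (hT : ∀ P ∈ T, Prime P ∧ (l : 𝓞 K) ∈ P) :
    ∑ P ∈ T, Real.log (absNorm P) ≤ Module.finrank ℚ K * Real.log l := by
  have hl0 : (span {(l : 𝓞 K)} : Ideal (𝓞 K)) ≠ 0 := by simpa using hl.ne_zero
  have h1 : T.val ≤ normalizedFactors (span {(l : 𝓞 K)}) := by
    refine (Multiset.le_iff_subset T.nodup).2 fun P hP => ?_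
    have := hT P hP
    exact (mem_normalizedFactors_iff' hl0).2 ⟨this.1.irreducible, normalize_eq _, by
      rw [dvd_span_singleton]; exact this.2⟩
  have h2 : T.val.prod ∣ span {(l : 𝓞 K)} := by
    have := Multiset.prod_dvd_prod_of_le h1
    rwa [prod_normalizedFactors_eq hl0, normalize_eq] at this
  have h3 := map_dvd absNorm h2
  have h4 : absNorm (span {(l : 𝓞 K)}) = l ^ Module.finrank ℚ K := by
    rw [absNorm_span_singleton, show (l : 𝓞 K) = algebraMap ℤ (𝓞 K) l by simp, Algebra.norm_algebraMap, RingOfIntegers.rank]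
    simp [Int.natAbs_pow]
  have h5 : T.val.prod = ∏ P ∈ T, P := by simp
  rw [h4, h5, map_prod] at h3
  have h6 := Nat.le_of_dvd (pow_pos hl.pos _) h3
  rw [← Real.log_prod fun P hP => ?_, ← Real.log_pow]
  · apply Real.log_le_log
    · refine Finset.prod_pos fun P hP => ?_
      have := two_le_absNorm (hT P hP).1
      positivity
    · exact_mod_cast h6
  · have := two_le_absNorm (hT P hP).1
    positivity

lemma exists_prime_of_prime {P : Ideal (𝓞 K)} (hP : Prime P) : ∃ l f : ℕ, l.Prime ∧ (l : 𝓞 K) ∈ P ∧ absNorm P = l ^ f := by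
  have : P.IsPrime := isPrime_of_prime hP
  have : NeZero P := ⟨hP.ne_zero⟩
  have hl := Nat.absNorm_under_prime P
  have hmem : ((absNorm (under ℤ P) : ℕ) : 𝓞 K) ∈ P := by
    have := Int.absNorm_under_mem P
    exact_mod_cast this
  have h3 := map_dvd absNorm ((dvd_span_singleton (I := P)).2 hmem)
  rw [absNorm_span_singleton, show ((absNorm (under ℤ P) : ℕ) : 𝓞 K) = algebraMap ℤ (𝓞 K) (absNorm (under ℤ P) : ℕ) by simp, Algebra.norm_algebraMap, RingOfIntegers.rank, Int.natAbs_pow, Int.natAbs_natCast, Nat.dvd_prime_pow hl] at h3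
  obtain ⟨f, -, hf⟩ := h3
  exact ⟨_, f, hl, hmem, hf⟩

lemma fieldMangoldt_le (m : ℕ) : fieldMangoldt K m ≤ Module.finrank ℚ K * vonMangoldt m := by
  by_cases hex : ∃ P : Ideal (𝓞 K), Prime P ∧ ∃ k, k ≠ 0 ∧ absNorm P ^ k = m
  · obtain ⟨P, hP, k, hk, rfl⟩ := hex
    obtain ⟨l, f, hl, hmem, hf⟩ := exists_prime_of_prime hP
    have hf0 : f ≠ 0 := by
      rintro rfl
      have := two_le_absNorm hP
      rw [hf] at this; simp at this
    rw [hf, ← pow_mul, vonMangoldt_apply_pow (mul_ne_zero hf0 hk), vonMangoldt_apply_prime hl]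
    set m := l ^ (f * k) with hm
    have hm0 : m ≠ 0 := pow_ne_zero _ hl.ne_zero
    let T := (primesUpTo K m).filter fun P' => ∃ k', k' ≠ 0 ∧ absNorm P' ^ k' = m
    refine le_trans ?_ (sum_log_absNorm_le hl T ?_)
    · rw [fieldMangoldt, Finset.sum_filter]
      refine Finset.sum_le_sum fun P' hP' => ?_
      have h2 := two_le_absNorm (mem_primesUpTo.1 hP').2
      split_ifs with h
      · obtain ⟨k', hk', h'⟩ := h
        rw [← Finset.sum_filter, Finset.sum_const, nsmul_eq_mul]
        have : ((Finset.Icc 1 m).filter fun i => absNorm P' ^ i = m).card ≤ 1 := by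
          rw [Finset.card_le_one]
          intro a ha b hb
          rw [Finset.mem_filter] at ha hb
          exact Nat.pow_right_injective h2 (ha.2.trans hb.2.symm)
        have h5 : (((Finset.Icc 1 m).filter fun i => absNorm P' ^ i = m).card : ℝ) ≤ 1 := by exact_mod_cast this
        have := Real.log_natCast_nonneg (absNorm P')
        nlinarith
      · push Not at h
        refine le_of_eq (Finset.sum_eq_zero fun i hi => if_neg (h i ?_))
        rw [Finset.mem_Icc] at hi; omega
    · intro P' hP'
      rw [Finset.mem_filter, mem_primesUpTo] at hP'
      refine ⟨hP'.1.2, ?_⟩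
      obtain ⟨k', hk', h'⟩ := hP'.2
      have : P'.IsPrime := isPrime_of_prime hP'.1.2
      have h1 : ((m : ℕ) : 𝓞 K) ∈ P' := by
        rw [← h']; push_cast
        exact pow_mem_of_mem _ (absNorm_mem P') _ (Nat.pos_of_ne_zero hk')
      rw [hm] at h1; push_cast at h1
      exact this.mem_of_pow_mem _ h1
  · push Not at hex
    rw [fieldMangoldt, Finset.sum_eq_zero]
    · exact mul_nonneg (Nat.cast_nonneg _) vonMangoldt_nonneg
    · intro P hP
      refine Finset.sum_eq_zero fun k hk => if_neg (hex P (mem_primesUpTo.1 hP).2 k ?_)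
      rw [Finset.mem_Icc] at hk; omega

lemma idealCount_one : idealCount K 1 = 1 := by
  rw [idealCount_eq_card, Finset.card_eq_one]
  refine ⟨⊤, ?_⟩
  ext I
  rw [mem_idealsOfNorm, absNorm_eq_one_iff, Finset.mem_singleton]

lemma summable_idealCount {s : ℂ} (hs : 1 < s.re) : LSeriesSummable (fun m => (idealCount K m : ℂ)) s := by
  refine LSeriesSummable_of_sum_norm_bigO_and_nonneg (f := fun m => (idealCount K m : ℝ)) (r := 1) ?_ (fun _ => Nat.cast_nonneg _) zero_le_one hs |>.congr ?_
  · have h := ((Ideal.tendsto_norm_le_div_atTop₀ K).comp tendsto_natCast_atTop_atTop)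
    have h2 := h.isBigO_one ℝ
    have h3 := h2.mul (Asymptotics.isBigO_refl (fun n : ℕ => (n : ℝ)) atTop)
    refine (h3.congr' ?_ ?_)
    · filter_upwards [eventually_gt_atTop 0] with n hn
      have hn0 : (n : ℝ) ≠ 0 := by exact_mod_cast hn.ne'
      simp only [Function.comp_apply, Nat.cast_le]
      rw [div_mul_cancel₀ _ hn0]
      simp only [← Nat.cast_sum]
      congr
      rw [← add_left_inj 1, ← card_norm_le_eq_card_norm_le_add_one,
        show Finset.Icc 1 n = Finset.Ioc 0 n from Finset.Icc_succ_left_eq_Ioc _ _,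
        show 1 = idealCount K 0 by simp [idealCount, Ideal.absNorm_eq_zero_iff],
        Finset.sum_Ioc_add_eq_sum_Icc (n.zero_le)]
      simp only [idealCount]
      rw [← Finset.card_preimage_eq_sum_card_image_eq (fun k _ ↦ finite_setOfPred_absNorm_eq k)]
      simp [Set.coe_eq_subtype]
    · filter_upwards with n; simp
  · intro m; simp

variable (K) in
theorem eulerLike : EulerLike (fun m => (idealCount K m : ℂ)) (fun m => (fieldMangoldt K m : ℂ)) (Module.finrank ℚ K) where
  N_nonneg := Nat.cast_nonneg _
  one := by simp [idealCount_one]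
  summable s hs := summable_idealCount hs
  conv m hm := by
    rw [LSeries.convolution_def]
    have := congrArg (fun x : ℝ => (x : ℂ)) (fieldMangoldt_convolution (K := K) hm)
    push_cast at this
    exact this
  bound m := by
    rw [Complex.norm_real, Real.norm_of_nonneg (fieldMangoldt_nonneg m)]
    exact fieldMangoldt_le m

end NumberField
end

section LatticeCount

open MeasureTheory ENNReal

/-- The number of points of the lattice `L` in `B`. -/
noncomputable def latticeCount {E : Type*} [AddCommGroup E] (L : Submodule ℤ E) (B : Set E) :
    ℝ≥0∞ := ∑' l : L, B.indicator 1 (l : E)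

theorem tsum_indicator_add {E : Type*} [AddCommGroup E] {L : Submodule ℤ E} (B : Set E) (l₀ : L) :
    ∑' l : L, B.indicator 1 ((l : E) + l₀) = latticeCount L B :=
  (Equiv.addRight l₀).tsum_eq (fun l : L => B.indicator (1 : E → ℝ≥0∞) (l : E))

variable {E : Type*} [AddCommGroup E] [MeasurableSpace E] [MeasurableAdd E] {μ : Measure E}
  [μ.IsAddLeftInvariant] {L : Submodule ℤ E} [Countable L] {D : Set E}

theorem measure_eq_setLIntegral_latticeCount (hD : IsAddFundamentalDomain L D μ) {B : Set E}
    (hB : MeasurableSet B) :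
    μ B = ∫⁻ x in D, ∑' l : L, B.indicator 1 ((l : E) + x) ∂μ := by
  have : VAddInvariantMeasure L E μ := ⟨fun c s _ => measure_preimage_add μ (c : E) s⟩
  have : MeasurableConstVAdd L E := ⟨fun c => measurable_const_add (c : E)⟩
  rw [lintegral_tsum]
  · rw [← lintegral_indicator_one hB, hD.lintegral_eq_tsum'']
    rfl
  · intro l
    exact ((measurable_one.indicator hB).comp (measurable_const_add (l : E))).aemeasurable

theorem measure_le_latticeCount_mul (hD : IsAddFundamentalDomain L D μ) {B B₁ : Set E}
    (hB : MeasurableSet B₁) (h : ∀ x : E, ∃ l₀ : L, ∀ z : E, z + x ∈ B₁ → z + l₀ ∈ B) :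
    μ B₁ ≤ latticeCount L B * μ D := by
  rw [measure_eq_setLIntegral_latticeCount hD hB, ← setLIntegral_const]
  refine lintegral_mono fun x => ?_
  obtain ⟨l₀, h₀⟩ := h x
  rw [← tsum_indicator_add B l₀]
  refine ENNReal.tsum_le_tsum fun l => ?_
  by_cases hl : (l : E) + x ∈ B₁
  · rw [Set.indicator_of_mem hl, Set.indicator_of_mem (h₀ _ hl)]; rfl
  · rw [Set.indicator_of_notMem hl]; exact zero_le

theorem latticeCount_mul_le_measure (hD : IsAddFundamentalDomain L D μ) {B B₂ : Set E}
    (hB : MeasurableSet B₂) (h : ∀ x : E, ∃ l₀ : L, ∀ z : E, z + l₀ ∈ B → z + x ∈ B₂) :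
    latticeCount L B * μ D ≤ μ B₂ := by
  rw [measure_eq_setLIntegral_latticeCount hD hB, ← setLIntegral_const]
  refine lintegral_mono fun x => ?_
  obtain ⟨l₀, h₀⟩ := h x
  rw [← tsum_indicator_add B l₀]
  refine ENNReal.tsum_le_tsum fun l => ?_
  by_cases hl : (l : E) + l₀ ∈ B
  · rw [Set.indicator_of_mem hl, Set.indicator_of_mem (h₀ _ hl)]; rfl
  · rw [Set.indicator_of_notMem hl]; exact zero_le

end LatticeCount

section Boxes

open NumberField NumberField.InfinitePlace NumberField.mixedEmbedding MeasureTheory ENNReal NNReal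
open Module ZSpan nonZeroDivisors

variable {K : Type*} [Field K]

theorem NumberField.mixedEmbedding.mem_convexBodyLT_iff {f : InfinitePlace K → ℝ≥0}
    {x : mixedSpace K} : x ∈ convexBodyLT K f ↔ ∀ w, normAtPlace w x < f w := by
  constructor
  · rintro ⟨h1, h2⟩ w
    by_cases hw : IsReal w
    · rw [normAtPlace_apply_of_isReal hw]
      simpa using h1 ⟨w, hw⟩ trivial
    · rw [not_isReal_iff_isComplex] at hw
      rw [normAtPlace_apply_of_isComplex hw]
      simpa using h2 ⟨w, hw⟩ trivial
  · intro h
    refine ⟨fun w _ => ?_, fun w _ => ?_⟩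
    · have := h w.1
      rw [normAtPlace_apply_of_isReal w.2] at this
      simpa using this
    · have := h w.1
      rw [normAtPlace_apply_of_isComplex w.2] at this
      simpa using this

variable [NumberField K]

theorem NumberField.mixedEmbedding.measurableSet_convexBodyLT (f : InfinitePlace K → ℝ≥0) :
    MeasurableSet (convexBodyLT K f) :=
  (MeasurableSet.univ_pi fun _ => measurableSet_ball).prod
    (MeasurableSet.univ_pi fun _ => measurableSet_ball)

theorem NumberField.mixedEmbedding.convexBodyLT_volume_mul (f : InfinitePlace K → ℝ≥0) (c : ℝ≥0) :
    volume (convexBodyLT K fun w => c * f w) =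
      (convexBodyLTFactor K * c ^ finrank ℚ K * ∏ w, f w ^ mult w : ℝ≥0) := by
  rw [convexBodyLT_volume, ← sum_mult_eq]
  simp only [mul_pow, Finset.prod_mul_distrib, Finset.prod_pow_eq_pow_sum]
  push_cast
  ring

/-- Every point of the mixed space is at distance less than `T` of a point of the lattice of
integers, at every infinite place. -/
def NumberField.CoverRadius (K : Type*) [Field K] (T : ℝ≥0) : Prop :=
  ∀ v : mixedSpace K, ∃ a : 𝓞 K, ∀ w, normAtPlace w (v - mixedEmbedding K (a : K)) < T

/-- The covolume of the lattice of integers. -/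
noncomputable def NumberField.covol (K : Type*) [Field K] [NumberField K] : ℝ≥0 :=
  (volume (fundamentalDomain (latticeBasis K))).toNNReal

variable (K) in
theorem NumberField.covol_eq :
    (covol K : ℝ≥0∞) = volume (fundamentalDomain (latticeBasis K)) :=
  ENNReal.coe_toNNReal ((fundamentalDomain_isBounded _).measure_lt_top).ne

variable (K) in
theorem NumberField.covol_pos : 0 < covol K := by
  rw [← ENNReal.coe_pos, covol_eq, pos_iff_ne_zero]
  exact ZSpan.measure_fundamentalDomain_ne_zero _

variable (I : (FractionalIdeal (𝓞 K)⁰ K)ˣ)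

/-- The absolute norm of a fractional ideal, as a nonnegative real. -/
noncomputable def NumberField.idealNorm : ℝ≥0 := Real.toNNReal (FractionalIdeal.absNorm I.1 : ℝ)

theorem NumberField.coe_idealNorm : (idealNorm I : ℝ) = FractionalIdeal.absNorm I.1 :=
  Real.coe_toNNReal _ (by exact_mod_cast FractionalIdeal.absNorm_nonneg _)

theorem NumberField.idealNorm_pos : 0 < idealNorm I := by
  have : (0 : ℚ) < FractionalIdeal.absNorm I.1 :=
    lt_of_le_of_ne (FractionalIdeal.absNorm_nonneg _)
      (fun h => Units.ne_zero I (FractionalIdeal.absNorm_eq_zero_iff.1 h.symm))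
  rw [idealNorm, Real.toNNReal_pos]
  exact_mod_cast this

theorem NumberField.volume_fundamentalDomain_ideal :
    volume (fundamentalDomain (fractionalIdealLatticeBasis K I)) =
      (idealNorm I * covol K : ℝ≥0) := by
  rw [volume_fundamentalDomain_fractionalIdealLatticeBasis, ENNReal.coe_mul, covol_eq]
  rfl

theorem NumberField.volume_le_latticeCount {f : InfinitePlace K → ℝ≥0} {δ : ℝ≥0} (hδ : δ ≤ 1)
    (hcov : ∀ x : mixedSpace K, ∃ l ∈ (I : Set K), ∀ w,
      normAtPlace w (x - mixedEmbedding K l) ≤ δ * f w) :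
    (convexBodyLTFactor K * (1 - δ) ^ finrank ℚ K * ∏ w, f w ^ mult w : ℝ≥0) ≤
      latticeCount (idealLattice K I) (convexBodyLT K f) * (idealNorm I * covol K : ℝ≥0) := by
  rw [← convexBodyLT_volume_mul, ← volume_fundamentalDomain_ideal]
  refine measure_le_latticeCount_mul (fundamentalDomain_idealLattice K I)
    (measurableSet_convexBodyLT _) fun x => ?_
  obtain ⟨l, hl, h⟩ := hcov x
  refine ⟨⟨mixedEmbedding K l, (mem_idealLattice K I).2 ⟨l, hl, rfl⟩⟩, fun z hz => ?_⟩
  rw [mem_convexBodyLT_iff] at hz ⊢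
  intro w
  have h1 := normAtPlace_add_le w (z + x) (-(x - mixedEmbedding K l))
  rw [normAtPlace_neg] at h1
  have h2 := hz w
  have h3 := h w
  rw [NNReal.coe_mul, NNReal.coe_sub hδ, NNReal.coe_one] at h2
  rw [show z + x + -(x - mixedEmbedding K l) = z + mixedEmbedding K l by abel] at h1
  change normAtPlace w (z + mixedEmbedding K l) < f w
  linarith

theorem NumberField.latticeCount_le_volume {f : InfinitePlace K → ℝ≥0} {δ : ℝ≥0}
    (hcov : ∀ x : mixedSpace K, ∃ l ∈ (I : Set K), ∀ w,
      normAtPlace w (x - mixedEmbedding K l) ≤ δ * f w) :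
    latticeCount (idealLattice K I) (convexBodyLT K f) * (idealNorm I * covol K : ℝ≥0) ≤
      (convexBodyLTFactor K * (1 + δ) ^ finrank ℚ K * ∏ w, f w ^ mult w : ℝ≥0) := by
  rw [← convexBodyLT_volume_mul, ← volume_fundamentalDomain_ideal]
  refine latticeCount_mul_le_measure (fundamentalDomain_idealLattice K I)
    (measurableSet_convexBodyLT _) fun x => ?_
  obtain ⟨l, hl, h⟩ := hcov x
  refine ⟨⟨mixedEmbedding K l, (mem_idealLattice K I).2 ⟨l, hl, rfl⟩⟩, fun z hz => ?_⟩
  rw [mem_convexBodyLT_iff] at hz ⊢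
  intro w
  have h1 := normAtPlace_add_le w (z + mixedEmbedding K l) (x - mixedEmbedding K l)
  have h2 := hz w
  have h3 := h w
  change normAtPlace w (z + mixedEmbedding K l) < f w at h2
  rw [show z + mixedEmbedding K l + (x - mixedEmbedding K l) = z + x by abel] at h1
  rw [NNReal.coe_mul, NNReal.coe_add, NNReal.coe_one]
  linarith

theorem NumberField.covol_le {T : ℝ≥0} (hT : CoverRadius K T) :
    covol K ≤ convexBodyLTFactor K * T ^ finrank ℚ K := by
  have h1 : idealNorm (1 : (FractionalIdeal (𝓞 K)⁰ K)ˣ) = 1 := by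
    rw [idealNorm, Units.val_one, map_one]; simp
  have h := convexBodyLT_volume_mul (K := K) (fun _ => 1) T
  have h2 := measure_eq_setLIntegral_latticeCount
    (fundamentalDomain_idealLattice K (1 : (FractionalIdeal (𝓞 K)⁰ K)ˣ))
    (measurableSet_convexBodyLT (K := K) (fun w => T * 1))
  rw [h] at h2
  simp only [one_pow, Finset.prod_const_one, mul_one] at h2
  rw [← ENNReal.coe_le_coe, h2]
  calc (covol K : ℝ≥0∞)
      = 1 * volume (fundamentalDomain
          (fractionalIdealLatticeBasis K (1 : (FractionalIdeal (𝓞 K)⁰ K)ˣ))) := by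
        rw [volume_fundamentalDomain_ideal, h1, one_mul, one_mul]
    _ ≤ _ := by
      rw [← setLIntegral_const]
      refine lintegral_mono fun x => ?_
      obtain ⟨a, ha⟩ := hT (x)
      have hmem : mixedEmbedding K (-(a : K)) ∈
          idealLattice K (1 : (FractionalIdeal (𝓞 K)⁰ K)ˣ) := by
        refine (mem_idealLattice K _).2 ⟨-(a : K), ?_, rfl⟩
        refine (FractionalIdeal.mem_one_iff _).2 ⟨-a, by simp⟩
      refine le_trans ?_ (ENNReal.le_tsum ⟨_, hmem⟩)
      rw [Set.indicator_of_mem]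
      · rfl
      · rw [mem_convexBodyLT_iff]
        intro w
        have := ha w
        change normAtPlace w (mixedEmbedding K (-(a : K)) + x) < T
        rwa [map_neg, neg_add_eq_sub]

end Boxes

section CountUnits

open NumberField NumberField.InfinitePlace NumberField.mixedEmbedding MeasureTheory ENNReal NNReal
open Module ZSpan nonZeroDivisors

variable {K : Type*} [Field K] [NumberField K] (I : (FractionalIdeal (𝓞 K)⁰ K)ˣ)

theorem NumberField.exists_cover {T : ℝ≥0} (hT : CoverRadius K T) {f : InfinitePlace K → ℝ≥0}
    {t : ℝ≥0} (ht : t ^ finrank ℚ K * ∏ w, f w ^ mult w = (3 * T) ^ finrank ℚ K * idealNorm I)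
    (x : mixedSpace K) :
    ∃ l ∈ (I : Set K), ∀ w, normAtPlace w (x - mixedEmbedding K l) ≤ (t * T : ℝ≥0) * f w := by
  have hN : finrank ℚ K ≠ 0 := finrank_pos.ne'
  have hM : minkowskiBound K I < volume (convexBodyLT K fun w => t * f w) := by
    rw [convexBodyLT_volume_mul, minkowskiBound, volume_fundamentalDomain_ideal,
      mixedEmbedding.finrank, mul_assoc, ht,
      show ((2 : ℝ≥0∞)) = ((2 : ℝ≥0) : ℝ≥0∞) from rfl, ← ENNReal.coe_pow, ← ENNReal.coe_mul,
      ENNReal.coe_lt_coe, mul_pow]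
    calc idealNorm I * covol K * 2 ^ finrank ℚ K
        < idealNorm I * covol K * 3 ^ finrank ℚ K := by
          refine mul_lt_mul_of_pos_left ?_ (mul_pos (idealNorm_pos I) (covol_pos K))
          exact pow_lt_pow_left₀ (by norm_num) (by norm_num) hN
      _ ≤ idealNorm I * (convexBodyLTFactor K * T ^ finrank ℚ K) * 3 ^ finrank ℚ K := by
          gcongr
          exact covol_le hT
      _ = _ := by ring
  obtain ⟨b, hb, hb0, hbw⟩ := exists_ne_zero_mem_ideal_lt K I hM
  obtain ⟨a, ha⟩ := hT (mixedEmbedding K b⁻¹ * x)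
  refine ⟨b * a, ?_, fun w => ?_⟩
  · have h1 : (a : K) • b ∈ (I : Submodule (𝓞 K) K) := by
      have := (I : Submodule (𝓞 K) K).smul_mem a hb
      rwa [Algebra.smul_def] at this
    rwa [smul_eq_mul, mul_comm] at h1
  · have h1 : x - mixedEmbedding K (b * a) =
        mixedEmbedding K b * (mixedEmbedding K b⁻¹ * x - mixedEmbedding K a) := by
      rw [mul_sub, ← mul_assoc, ← map_mul, mul_inv_cancel₀ hb0, map_one, one_mul, map_mul]
    rw [h1, map_mul, normAtPlace_apply]
    have h2 := (hbw w).le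
    have h3 := (ha w).le
    push_cast at h2 ⊢
    calc w b * _ ≤ (t * f w) * T :=
          mul_le_mul h2 h3 (normAtPlace_nonneg _ _) (by positivity)
      _ = _ := by ring

/-- The number of nonzero elements of `I` lying in the box `f`. -/
noncomputable def NumberField.boxCount (f : InfinitePlace K → ℝ≥0) : ℝ≥0∞ :=
  ∑' α : Kˣ, if (α : K) ∈ I.1 ∧ ∀ w : InfinitePlace K, w (α : K) < f w then 1 else 0

theorem NumberField.latticeCount_eq {f : InfinitePlace K → ℝ≥0} (hf : ∀ w, f w ≠ 0) :
    latticeCount (idealLattice K I) (convexBodyLT K f) = 1 + boxCount I f := by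
  refine (tsum_subtype (idealLattice K I : Set (mixedSpace K))
    ((convexBodyLT K f).indicator (1 : mixedSpace K → ℝ≥0∞))).trans ?_
  rw [← (mixedEmbedding_injective K).tsum_eq]
  · rw [tsum_eq_add_tsum_ite (0 : K), map_zero, boxCount]
    congr 1
    · rw [Set.indicator_of_mem (zero_mem _), Set.indicator_of_mem]
      · rfl
      · rw [mem_convexBodyLT_iff]
        intro w
        rw [map_zero]
        exact_mod_cast (hf w).bot_lt
    · rw [← (Units.val_injective (α := K)).tsum_eq]
      · refine tsum_congr fun α => ?_
        rw [if_neg α.ne_zero]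
        by_cases h : (α : K) ∈ I.1
        · rw [Set.indicator_of_mem]
          · simp only [h, true_and]
            simp only [Set.indicator_apply, Pi.one_apply, convexBodyLT_mem]
          · exact (mem_idealLattice K I).2 ⟨α, h, rfl⟩
        · rw [Set.indicator_of_notMem, if_neg fun h' => h h'.1]
          intro h'
          obtain ⟨y, hy, hyα⟩ := (mem_idealLattice K I).1 h'
          exact h (mixedEmbedding_injective K hyα ▸ hy)
      · intro α hα
        rw [Function.mem_support] at hα
        have : α ≠ 0 := fun h => hα (if_pos h)
        exact ⟨Units.mk0 α this, rfl⟩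
  · intro x hx
    have := Set.mem_of_indicator_ne_zero (Function.mem_support.1 hx)
    obtain ⟨y, _, rfl⟩ := (mem_idealLattice K I).1 this
    exact ⟨y, rfl⟩

/-- The density of the lattice of integers in boxes. -/
noncomputable def NumberField.boxDensity (K : Type*) [Field K] [NumberField K] : ℝ :=
  convexBodyLTFactor K / covol K

variable (K) in
theorem NumberField.boxDensity_pos : 0 < boxDensity K :=
  div_pos (by exact_mod_cast (convexBodyLTFactor_ne_zero K).bot_lt) (by exact_mod_cast covol_pos K)

theorem box_count_arith {N : ℕ} {T y V c n J δ : ℝ} (hN1 : 1 ≤ N) (hT1 : 1 ≤ T)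
    (hy : (3 * N * T ^ 2) ^ N ≤ y) (hcV : c ≤ V * T ^ N) (hc : 0 < c) (hJ : 0 < J) (hV : 0 < V)
    (hδ0 : 0 ≤ δ) (hδ : N * δ ≤ 1) (hδs : δ = 3 * T ^ 2 * y ^ (-(1 / (N : ℝ))))
    (hlow : V * (1 - δ) ^ N * (y * J) ≤ (1 + n) * (J * c))
    (hupp : (1 + n) * (J * c) ≤ V * (1 + δ) ^ N * (y * J)) :
    V / c * (y - 9 * N * T ^ 2 * y ^ (1 - 1 / (N : ℝ))) ≤ n ∧
      n ≤ V / c * (y + 9 * N * T ^ 2 * y ^ (1 - 1 / (N : ℝ))) := by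
  have hNr : (1 : ℝ) ≤ N := by exact_mod_cast hN1
  have hb1 : 1 ≤ 3 * (N : ℝ) * T ^ 2 := by nlinarith [one_le_pow₀ hT1 (n := 2)]
  have hy1 : 1 ≤ y := (one_le_pow₀ hb1).trans hy
  have hy0 : 0 < y := by linarith
  have hys : y ^ (1 - 1 / (N : ℝ)) = y * y ^ (-(1 / (N : ℝ))) := by
    rw [sub_eq_add_neg, Real.rpow_add hy0, Real.rpow_one]
  have hδ1 : δ ≤ 1 := by nlinarith
  have hp1 : 1 - N * δ ≤ (1 - δ) ^ N := by
    have := one_add_mul_le_pow (a := -δ) (by linarith) N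
    rw [← sub_eq_add_neg] at this
    linarith
  have hp2 : (1 + δ) ^ N ≤ 1 + 2 * (N * δ) := by
    have h1 : (1 + δ) ^ N ≤ Real.exp (N * δ) := by
      rw [Real.exp_nat_mul]
      exact pow_le_pow_left₀ (by linarith) (by linarith [Real.add_one_le_exp δ]) N
    have h0 : 0 ≤ N * δ := by positivity
    have h2 := Real.abs_exp_sub_one_le (x := N * δ) (by rw [abs_of_nonneg h0]; exact hδ)
    rw [abs_of_nonneg h0] at h2
    linarith [le_abs_self (Real.exp (N * δ) - 1)]
  have hκ : 0 < V / c := div_pos hV hc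
  have hlow' : V / c * (y * (1 - N * δ)) ≤ 1 + n := by
    rw [div_mul_eq_mul_div, div_le_iff₀ hc]
    have h1 : V * (1 - N * δ) * (y * J) ≤ (1 + n) * (J * c) := by
      refine le_trans ?_ hlow
      exact mul_le_mul_of_nonneg_right (mul_le_mul_of_nonneg_left hp1 hV.le) (by positivity)
    refine le_of_mul_le_mul_right ?_ hJ
    linarith only [h1]
  have hupp' : 1 + n ≤ V / c * (y * (1 + 2 * (N * δ))) := by
    rw [div_mul_eq_mul_div, le_div_iff₀ hc]
    have h1 : (1 + n) * (J * c) ≤ V * (1 + 2 * (N * δ)) * (y * J) := by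
      refine hupp.trans ?_
      exact mul_le_mul_of_nonneg_right (mul_le_mul_of_nonneg_left hp2 hV.le) (by positivity)
    refine le_of_mul_le_mul_right ?_ hJ
    linarith only [h1]
  have hκT : 1 ≤ V / c * T ^ N := by
    rw [div_mul_eq_mul_div, le_div_iff₀ hc, one_mul]
    exact hcV
  have hyδ : T ^ N ≤ y * (N * δ) := by
    have h0 : y * (N * δ) = 3 * N * T ^ 2 * y ^ (1 - 1 / (N : ℝ)) := by rw [hys, hδs]; ring
    have h1 : (3 * N * T ^ 2) ^ (N - 1) ≤ y ^ (1 - 1 / (N : ℝ)) := by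
      have hle : (3 * N * T ^ 2) ≤ y ^ (1 / (N : ℝ)) := by
        rw [one_div, Real.le_rpow_inv_iff_of_pos (by positivity) hy0.le (by linarith),
          Real.rpow_natCast]
        exact hy
      calc _ ≤ (y ^ (1 / (N : ℝ))) ^ (N - 1) := pow_le_pow_left₀ (by positivity) hle _
        _ = _ := by
          rw [← Real.rpow_natCast, ← Real.rpow_mul hy0.le]
          congr 1
          rw [Nat.cast_sub hN1]
          field_simp
          simp
    rw [h0]
    calc T ^ N ≤ (3 * N * T ^ 2) ^ N := by
          refine pow_le_pow_left₀ (by positivity) ?_ N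
          nlinarith [mul_le_mul hNr hT1 zero_le_one (by linarith)]
      _ = (3 * N * T ^ 2) * (3 * N * T ^ 2) ^ (N - 1) := by
          rw [← pow_succ', Nat.sub_add_cancel hN1]
      _ ≤ _ := mul_le_mul_of_nonneg_left h1 (by positivity)
  have h1le : 1 ≤ V / c * (y * (N * δ)) :=
    hκT.trans (mul_le_mul_of_nonneg_left hyδ hκ.le)
  have hE : 9 * N * T ^ 2 * y ^ (1 - 1 / (N : ℝ)) = 3 * (y * (N * δ)) := by
    rw [hys, hδs]; ring
  rw [hE]
  constructor
  · linarith only [h1le, hlow', hupp']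
  · linarith only [h1le, hlow', hupp']

theorem NumberField.boxCount_bounds {T : ℝ≥0} (hT : CoverRadius K T) (hT1 : 1 ≤ T)
    {f : InfinitePlace K → ℝ≥0} {y : ℝ} (hy : (3 * finrank ℚ K * (T : ℝ) ^ 2) ^ finrank ℚ K ≤ y)
    (hf : ((∏ w, f w ^ mult w : ℝ≥0) : ℝ) = y * idealNorm I) :
    ENNReal.ofReal (boxDensity K *
      (y - 9 * finrank ℚ K * (T : ℝ) ^ 2 * y ^ (1 - 1 / (finrank ℚ K : ℝ)))) ≤ boxCount I f ∧
    boxCount I f ≤ ENNReal.ofReal (boxDensity K *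
      (y + 9 * finrank ℚ K * (T : ℝ) ^ 2 * y ^ (1 - 1 / (finrank ℚ K : ℝ)))) := by
  set N := finrank ℚ K with hN
  have hN1 : 1 ≤ N := finrank_pos
  have hNr : (1 : ℝ) ≤ N := by exact_mod_cast hN1
  have hT1r : (1 : ℝ) ≤ T := by exact_mod_cast hT1
  have hb1 : 1 ≤ 3 * (N : ℝ) * (T : ℝ) ^ 2 := by nlinarith [one_le_pow₀ hT1r (n := 2)]
  have hy1 : 1 ≤ y := (one_le_pow₀ hb1).trans hy
  have hy0 : 0 < y := by linarith
  -- the scaling parameter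
  set s : ℝ := y ^ (-(1 / (N : ℝ))) with hs
  have hs0 : 0 < s := Real.rpow_pos_of_pos hy0 _
  have hsN : s ^ N * y = 1 := by
    rw [hs, ← Real.rpow_natCast, ← Real.rpow_mul hy0.le,
      show -(1 / (N : ℝ)) * (N : ℕ) = -1 by field_simp, Real.rpow_neg_one, inv_mul_cancel₀ hy0.ne']
  have hys : y ^ (1 - 1 / (N : ℝ)) = y * s := by
    rw [hs, sub_eq_add_neg, Real.rpow_add hy0, Real.rpow_one]
  set t : ℝ≥0 := 3 * T * ⟨s, hs0.le⟩ with ht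
  have htr : (t : ℝ) = 3 * T * s := rfl
  have ht' : t ^ N * ∏ w, f w ^ mult w = (3 * T) ^ N * idealNorm I := by
    apply NNReal.coe_injective
    rw [NNReal.coe_mul, hf, NNReal.coe_pow, htr]
    push_cast
    calc _ = (3 * (T : ℝ)) ^ N * idealNorm I * (s ^ N * y) := by ring
      _ = _ := by rw [hsN, mul_one]
  have hcov := exists_cover I hT ht'
  have hδ : (N : ℝ) * (t * T : ℝ≥0) ≤ 1 := by
    push_cast
    rw [htr]
    have h1 : (3 * N * (T : ℝ) ^ 2 * s) ^ N ≤ 1 := by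
      rw [mul_pow, ← hsN, mul_comm (s ^ N)]
      exact mul_le_mul_of_nonneg_right hy (by positivity)
    have h2 : 3 * N * (T : ℝ) ^ 2 * s ≤ 1 :=
      (pow_le_one_iff_of_nonneg (by positivity) (by omega)).1 h1
    linarith
  set δ : ℝ≥0 := t * T with hδdef
  have hδr : (δ : ℝ) = 3 * T ^ 2 * s := by rw [hδdef, NNReal.coe_mul, htr]; ring
  have hδ0 : (0 : ℝ) ≤ δ := δ.2
  have hδ1r : (δ : ℝ) ≤ 1 := by nlinarith
  have hδ1 : δ ≤ 1 := by exact_mod_cast hδ1r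
  have hfne : ∀ w, f w ≠ 0 := by
    intro w hw
    have : (∏ w, f w ^ mult w : ℝ≥0) = 0 :=
      Finset.prod_eq_zero (Finset.mem_univ w) (by rw [hw, zero_pow mult_ne_zero])
    rw [this, NNReal.coe_zero] at hf
    have : 0 < y * idealNorm I := mul_pos hy0 (by exact_mod_cast idealNorm_pos I)
    linarith
  have hlow := volume_le_latticeCount I hδ1 hcov
  have hupp := latticeCount_le_volume I hcov
  rw [latticeCount_eq I hfne] at hlow hupp
  have hI : (0 : ℝ) < idealNorm I := by exact_mod_cast idealNorm_pos I
  have hc : (0 : ℝ) < covol K := by exact_mod_cast covol_pos K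
  have hV : (0 : ℝ) < convexBodyLTFactor K := by
    exact_mod_cast (convexBodyLTFactor_ne_zero K).bot_lt
  have hκ := boxDensity_pos K
  have hfin : boxCount I f ≠ ⊤ := by
    intro h
    rw [h, add_top, ENNReal.top_mul] at hupp
    · exact ENNReal.coe_ne_top (top_le_iff.1 hupp)
    · exact_mod_cast (mul_pos (idealNorm_pos I) (covol_pos K)).ne'
  obtain ⟨n, hn⟩ : ∃ n : ℝ≥0, (n : ℝ≥0∞) = boxCount I f := ⟨_, ENNReal.coe_toNNReal hfin⟩
  rw [← hn] at hlow hupp ⊢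
  rw [show (1 : ℝ≥0∞) = ((1 : ℝ≥0) : ℝ≥0∞) from rfl, ← ENNReal.coe_add, ← ENNReal.coe_mul,
    ENNReal.coe_le_coe, ← NNReal.coe_le_coe] at hlow hupp
  simp only [NNReal.coe_mul, NNReal.coe_add, NNReal.coe_one, NNReal.coe_pow, hf, ← hN,
    NNReal.coe_sub hδ1] at hlow hupp
  rw [boxDensity, show (n : ℝ≥0∞) = ENNReal.ofReal (n : ℝ) by rw [ENNReal.ofReal_coe_nnreal]]
  obtain ⟨h1, h2⟩ := box_count_arith hN1 hT1r hy (by exact_mod_cast covol_le hT) hc hI hV hδ0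
    hδ (hδr.trans (by rw [hs])) hlow hupp
  exact ⟨ENNReal.ofReal_le_ofReal h1, ENNReal.ofReal_le_ofReal h2⟩

end CountUnits

section UnitAverage

open NumberField NumberField.InfinitePlace NumberField.Units NumberField.Units.dirichletUnitTheorem
open MeasureTheory ENNReal NNReal Module nonZeroDivisors
open scoped Pointwise

/-- The open simplex of size `t`. -/
def openSimplex (ι : Type*) [Fintype ι] (t : ℝ) : Set (ι → ℝ) :=
  {v | (∀ i, 0 < v i) ∧ ∑ i, v i < t}

theorem isOpen_openSimplex (ι : Type*) [Fintype ι] (t : ℝ) : IsOpen (openSimplex ι t) := by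
  have h1 : IsOpen {v : ι → ℝ | ∀ i, 0 < v i} := by
    simp only [Set.ofPred_forall]
    exact isOpen_iInter_of_finite fun i => isOpen_lt continuous_const (continuous_apply i)
  exact h1.inter (isOpen_lt (continuous_finsetSum _ fun i _ => continuous_apply i) continuous_const)

theorem openSimplex_eq_smul (ι : Type*) [Fintype ι] {t : ℝ} (ht : 0 < t) :
    openSimplex ι t = t • openSimplex ι 1 := by
  ext v
  rw [Set.mem_smul_set_iff_inv_smul_mem₀ ht.ne']
  simp only [openSimplex, Set.mem_ofPred_eq, Pi.smul_apply, smul_eq_mul, ← Finset.mul_sum]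
  rw [inv_mul_lt_iff₀ ht, mul_one]
  simp [ht]

theorem openSimplex_eq_empty (ι : Type*) [Fintype ι] {t : ℝ} (ht : t ≤ 0) :
    openSimplex ι t = ∅ := by
  ext v
  simp only [openSimplex, Set.mem_ofPred_eq, Set.mem_empty_iff_false, iff_false, not_and, not_lt]
  intro h
  exact ht.trans (Finset.sum_nonneg fun i _ => (h i).le)

theorem volume_openSimplex_pos (ι : Type*) [Fintype ι] : 0 < volume (openSimplex ι 1) := by
  refine (isOpen_openSimplex ι 1).measure_pos _ ⟨fun _ => 1 / (Fintype.card ι + 1), ?_⟩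
  refine ⟨fun i => by positivity, ?_⟩
  rw [Finset.sum_const, nsmul_eq_mul, Finset.card_univ, mul_one_div, div_lt_one (by positivity)]
  linarith

theorem volume_openSimplex_lt_top (ι : Type*) [Fintype ι] : volume (openSimplex ι 1) < ⊤ := by
  refine (Metric.isBounded_Icc (0 : ι → ℝ) 1).subset ?_ |>.measure_lt_top
  intro v hv
  refine ⟨fun i => (hv.1 i).le, fun i => ?_⟩
  exact (Finset.single_le_sum (f := v) (fun j _ => (hv.1 j).le) (Finset.mem_univ i)).trans hv.2.le

theorem volume_openSimplex (ι : Type*) [Fintype ι] (t : ℝ) :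
    volume (openSimplex ι t) =
      (if 0 < t then ENNReal.ofReal (t ^ Fintype.card ι) else 0) * volume (openSimplex ι 1) := by
  split_ifs with ht
  · rw [openSimplex_eq_smul ι ht, Measure.addHaar_smul, finrank_fintype_fun_eq_card,
      abs_of_nonneg (by positivity)]
  · rw [openSimplex_eq_empty ι (not_lt.1 ht), measure_empty, zero_mul]

variable {K : Type*} [Field K] [NumberField K]

/-- The logarithmic coordinates of a nonzero element, away from the distinguished place. -/
noncomputable def NumberField.logCoord (α : Kˣ) : logSpace K :=
  fun w => mult w.1 * Real.log (w.1 (α : K))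

/-- The box with logarithmic coordinates `v` and volume proportional to `X`. -/
noncomputable def NumberField.logBox (X : ℝ) (v : logSpace K) (w : InfinitePlace K) : ℝ≥0 :=
  if h : w = w₀ then Real.toNNReal (Real.exp ((Real.log X - ∑ i, v i) / mult w))
  else Real.toNNReal (Real.exp (v ⟨w, h⟩ / mult w))

theorem NumberField.sum_places (g : InfinitePlace K → ℝ) :
    ∑ w, g w = g w₀ + ∑ i : {w : InfinitePlace K // w ≠ w₀}, g i := by
  rw [Fintype.sum_eq_add_sum_subtype_ne g w₀]

theorem NumberField.logBox_pos (X : ℝ) (v : logSpace K) (w : InfinitePlace K) :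
    0 < logBox X v w := by
  unfold logBox
  split_ifs <;> exact Real.toNNReal_pos.2 (Real.exp_pos _)

theorem NumberField.mult_mul_log_logBox (X : ℝ) (v : logSpace K) (w : InfinitePlace K) :
    mult w * Real.log (logBox X v w) =
      if h : w = w₀ then Real.log X - ∑ i, v i else v ⟨w, h⟩ := by
  have hm : (mult w : ℝ) ≠ 0 := by exact_mod_cast mult_ne_zero
  unfold logBox
  split_ifs with h <;>
  rw [Real.coe_toNNReal _ (Real.exp_pos _).le, Real.log_exp] <;> field_simp

theorem NumberField.prod_logBox {X : ℝ} (hX : 0 < X) (v : logSpace K) :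
    ((∏ w, logBox X v w ^ mult w : ℝ≥0) : ℝ) = X := by
  have h0 : ∀ w, (0 : ℝ) < logBox X v w := fun w => by exact_mod_cast logBox_pos X v w
  have hpos : (0 : ℝ) < ((∏ w, logBox X v w ^ mult w : ℝ≥0) : ℝ) := by
    push_cast
    exact Finset.prod_pos fun w _ => pow_pos (h0 w) _
  refine Real.log_injOn_pos hpos hX ?_
  push_cast
  rw [Real.log_prod (fun w _ => (pow_pos (h0 w) _).ne')]
  simp only [Real.log_pow, mult_mul_log_logBox]
  rw [sum_places]
  simp only [dite_true]
  have : ∀ i : {w : InfinitePlace K // w ≠ w₀}, (if h : (i : InfinitePlace K) = w₀ then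
      Real.log X - ∑ i, v i else v ⟨i, h⟩) = v i := fun i => by rw [dif_neg i.2]
  simp only [this]
  ring

theorem NumberField.log_norm_eq (α : Kˣ) :
    Real.log |((Algebra.norm ℚ (α : K) : ℚ) : ℝ)| =
      mult (w₀ : InfinitePlace K) * Real.log ((w₀ : InfinitePlace K) (α : K)) +
        ∑ i, logCoord α i := by
  have h := prod_eq_abs_norm (α : K)
  rw [Rat.cast_abs] at h
  have h0 : ∀ w : InfinitePlace K, 0 < w (α : K) := fun w => pos_iff.2 α.ne_zero
  rw [← h, Real.log_prod (fun w _ => (pow_pos (h0 w) _).ne')]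
  simp only [Real.log_pow]
  rw [sum_places]
  rfl

theorem NumberField.forall_lt_logBox_iff {X : ℝ} (hX : 0 < X) (v : logSpace K) (α : Kˣ) :
    (∀ w : InfinitePlace K, w (α : K) < logBox X v w) ↔
      v - logCoord α ∈ openSimplex _
        (Real.log (X / |((Algebra.norm ℚ (α : K) : ℚ) : ℝ)|)) := by
  have h0 : ∀ w : InfinitePlace K, 0 < w (α : K) := fun w => pos_iff.2 α.ne_zero
  have hN : |((Algebra.norm ℚ (α : K) : ℚ) : ℝ)| ≠ 0 := by
    rw [abs_ne_zero]
    exact_mod_cast Algebra.norm_ne_zero_iff.2 α.ne_zero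
  have key : ∀ w : InfinitePlace K, w (α : K) < logBox X v w ↔
      mult w * Real.log (w (α : K)) < if h : w = w₀ then Real.log X - ∑ i, v i else v ⟨w, h⟩ := by
    intro w
    have hm : (0 : ℝ) < mult w := by exact_mod_cast mult_pos
    rw [← mult_mul_log_logBox, mul_lt_mul_iff_right₀ hm,
      Real.log_lt_log_iff (h0 w) (by exact_mod_cast logBox_pos X v w)]
  simp only [key]
  rw [Real.log_div hX.ne' hN, log_norm_eq]
  simp only [openSimplex, Set.mem_ofPred_eq, Pi.sub_apply, Finset.sum_sub_distrib]
  constructor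
  · intro h
    refine ⟨fun i => ?_, ?_⟩
    · have := h i.1
      rw [dif_neg i.2] at this
      change 0 < v i - mult i.1 * Real.log (i.1 (α : K))
      linarith
    · have := h w₀
      rw [dif_pos rfl] at this
      linarith
  · rintro ⟨h1, h2⟩ w
    split_ifs with hw
    · subst hw
      linarith
    · have := h1 ⟨w, hw⟩
      change 0 < v ⟨w, hw⟩ - mult w * Real.log (w (α : K)) at this
      linarith

variable (K) in
theorem NumberField.exists_logFundamentalDomain :
    ∃ D : Set (logSpace K), IsAddFundamentalDomain (unitLattice K) D volume ∧ volume D ≠ 0 ∧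
      volume D ≠ ⊤ := by
  refine ⟨_, ZLattice.isAddFundamentalDomain (Module.Free.chooseBasis ℤ (unitLattice K)) volume,
    ZSpan.measure_fundamentalDomain_ne_zero _, (ZSpan.fundamentalDomain_isBounded _).measure_lt_top.ne⟩

theorem QuotientGroup.tsum_mk {G : Type*} [Group G] (s : Subgroup G) [Finite s]
    (F : G ⧸ s → ℝ≥0∞) : ∑' g : G, F (QuotientGroup.mk g) = Nat.card s * ∑' q, F q := by
  have hbij : Function.Bijective (fun z : (G ⧸ s) × s => (Quotient.out z.1 : G) * z.2) := by
    constructor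
    · rintro ⟨q, k⟩ ⟨q', k'⟩ h
      have h' : (Quotient.out q : G) * k = Quotient.out q' * k' := h
      have h1 := congrArg (QuotientGroup.mk (s := s)) h'
      rw [QuotientGroup.mk_mul_of_mem _ k.2, QuotientGroup.mk_mul_of_mem _ k'.2,
        QuotientGroup.out_eq', QuotientGroup.out_eq'] at h1
      subst h1
      rw [mul_right_inj] at h'
      exact Prod.ext rfl (Subtype.ext h')
    · intro g
      have hg : (Quotient.out (QuotientGroup.mk g : G ⧸ s) : G)⁻¹ * g ∈ s := by
        rw [← QuotientGroup.eq, QuotientGroup.out_eq']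
      exact ⟨(QuotientGroup.mk g, ⟨_, hg⟩), mul_inv_cancel_left _ _⟩
  rw [← (Equiv.ofBijective _ hbij).tsum_eq,
    ENNReal.tsum_prod (f := fun q k => F (QuotientGroup.mk ((Equiv.ofBijective _ hbij) (q, k)))), ← ENNReal.tsum_mul_left]
  refine tsum_congr fun q => ?_
  have : ∀ k : s, F (QuotientGroup.mk ((Equiv.ofBijective _ hbij) (q, k))) = F q := by
    intro k
    change F (QuotientGroup.mk ((Quotient.out q : G) * k)) = F q
    rw [QuotientGroup.mk_mul_of_mem _ k.2, QuotientGroup.out_eq']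
  simp only [this, ENNReal.tsum_const, ENat.card_eq_coe_natCard]
  rfl

theorem NumberField.tsum_units (F : logSpace K → ℝ≥0∞) :
    ∑' u : (𝓞 K)ˣ, F (logEmbedding K (Additive.ofMul u)) =
      Nat.card (torsion K) * ∑' l : unitLattice K, F l := by
  rw [← (logEmbeddingEquiv K).toEquiv.tsum_eq (fun l : unitLattice K => F l)]
  exact QuotientGroup.tsum_mk (torsion K) fun q => F (logEmbeddingEquiv K (Additive.ofMul q))

theorem NumberField.logCoord_mul (α β : Kˣ) : logCoord (α * β) = logCoord α + logCoord β := by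
  ext w
  have h0 : ∀ α : Kˣ, w.1 (α : K) ≠ 0 := fun α => (pos_iff.2 α.ne_zero).ne'
  change mult w.1 * Real.log (w.1 ((α * β : Kˣ) : K)) =
    mult w.1 * Real.log (w.1 (α : K)) + mult w.1 * Real.log (w.1 (β : K))
  rw [Units.val_mul, map_mul, Real.log_mul (h0 α) (h0 β), mul_add]

/-- A unit of the ring of integers, as a unit of the field. -/
noncomputable def NumberField.unitToField (u : (𝓞 K)ˣ) : Kˣ :=
  Units.map (algebraMap (𝓞 K) K).toMonoidHom u

theorem NumberField.logCoord_unit (u : (𝓞 K)ˣ) :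
    logCoord (unitToField u) = logEmbedding K (Additive.ofMul u) := by
  ext w
  rw [logEmbedding_component]
  rfl

theorem NumberField.abs_norm_unit_mul (u : (𝓞 K)ˣ) (α : Kˣ) :
    |((Algebra.norm ℚ ((α * unitToField u : Kˣ) : K) : ℚ) : ℝ)| =
      |((Algebra.norm ℚ (α : K) : ℚ) : ℝ)| := by
  rw [Units.val_mul, map_mul, Rat.cast_mul, abs_mul]
  have h1 : |Algebra.norm ℚ (unitToField u : K)| = 1 := NumberField.isUnit_iff_norm.1 u.isUnit
  rw [← Rat.cast_abs (Algebra.norm ℚ (unitToField u : K)), h1, Rat.cast_one, mul_one]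

/-- The average over a fundamental domain of the units of the indicator that `α * u` is in a
logarithmic box, summed over the units `u`. -/
theorem NumberField.tsum_volume_inter {D : Set (logSpace K)}
    (hD : IsAddFundamentalDomain (unitLattice K) D volume) (X : ℝ) (α : Kˣ) :
    ∑' u : (𝓞 K)ˣ, volume ({v | v - logCoord (α * unitToField u) ∈ openSimplex _
        (Real.log (X / |((Algebra.norm ℚ ((α * unitToField u : Kˣ) : K) : ℚ) : ℝ)|))} ∩ D) =
      Nat.card (torsion K) * volume (openSimplex {w : InfinitePlace K // w ≠ w₀}
        (Real.log (X / |((Algebra.norm ℚ (α : K) : ℚ) : ℝ)|))) := by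
  simp only [abs_norm_unit_mul, logCoord_mul, logCoord_unit]
  rw [tsum_units (fun l => volume ({v | v - (logCoord α + l) ∈ openSimplex _
        (Real.log (X / |((Algebra.norm ℚ (α : K) : ℚ) : ℝ)|))} ∩ D))]
  congr 1
  have hinv : VAddInvariantMeasure (unitLattice K) (logSpace K) volume :=
    ⟨fun c s _ => measure_preimage_add volume (c : logSpace K) s⟩
  set S := openSimplex {w : InfinitePlace K // w ≠ w₀}
    (Real.log (X / |((Algebra.norm ℚ (α : K) : ℚ) : ℝ)|))
  have h1 : volume {v | v - logCoord α ∈ S} = volume S := by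
    rw [← measure_preimage_add_right volume (-logCoord α) S]
    simp only [← sub_eq_add_neg]
    rfl
  rw [← h1, hD.measure_eq_tsum {v | v - logCoord α ∈ S}]
  refine tsum_congr fun l => ?_
  congr 2
  ext v
  rw [Set.mem_vadd_set_iff_neg_vadd_mem]
  change v - (logCoord α + l) ∈ S ↔ (-(l : logSpace K) + v) - logCoord α ∈ S
  rw [show v - (logCoord α + l) = (-(l : logSpace K) + v) - logCoord α by abel]

end UnitAverage

section ClassSum

open NumberField NumberField.InfinitePlace NumberField.Units NumberField.Units.dirichletUnitTheorem
open MeasureTheory ENNReal NNReal Module nonZeroDivisors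

variable {K : Type*} [Field K] [NumberField K] (J : (FractionalIdeal (𝓞 K)⁰ K)ˣ)

theorem NumberField.span_eq_unique {α : Kˣ} {a b : (Ideal (𝓞 K))⁰}
    (ha : FractionalIdeal.spanSingleton (𝓞 K)⁰ (α : K) = J.1 * ((a : Ideal (𝓞 K)) :
      FractionalIdeal (𝓞 K)⁰ K))
    (hb : FractionalIdeal.spanSingleton (𝓞 K)⁰ (α : K) = J.1 * ((b : Ideal (𝓞 K)) :
      FractionalIdeal (𝓞 K)⁰ K)) : a = b := by
  have := ha.symm.trans hb
  exact Subtype.ext (FractionalIdeal.coeIdeal_injective (J.isUnit.mul_left_cancel this))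

theorem NumberField.mem_iff_exists_ideal {α : Kˣ} :
    (α : K) ∈ J.1 ↔ ∃ a : (Ideal (𝓞 K))⁰,
      FractionalIdeal.spanSingleton (𝓞 K)⁰ (α : K) = J.1 * ((a : Ideal (𝓞 K)) :
        FractionalIdeal (𝓞 K)⁰ K) := by
  constructor
  · intro h
    have h1 : J⁻¹.1 * FractionalIdeal.spanSingleton (𝓞 K)⁰ (α : K) ≤ 1 := by
      have h2 := FractionalIdeal.spanSingleton_le_iff_mem.2 h
      calc _ ≤ J⁻¹.1 * J.1 := mul_le_mul_right h2 _
        _ = 1 := J.inv_mul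
    obtain ⟨a, ha⟩ := FractionalIdeal.le_one_iff_exists_coeIdeal.1 h1
    have h3 : FractionalIdeal.spanSingleton (𝓞 K)⁰ (α : K) = J.1 * (a :
        FractionalIdeal (𝓞 K)⁰ K) := by rw [ha, J.mul_inv_cancel_left]
    refine ⟨⟨a, mem_nonZeroDivisors_iff_ne_zero.2 ?_⟩, h3⟩
    rintro rfl
    rw [Ideal.zero_eq_bot, FractionalIdeal.coeIdeal_bot, mul_zero,
      FractionalIdeal.spanSingleton_eq_zero_iff] at h3
    exact α.ne_zero h3
  · rintro ⟨a, ha⟩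
    rw [← FractionalIdeal.spanSingleton_le_iff_mem, ha]
    calc J.1 * ((a : Ideal (𝓞 K)) : FractionalIdeal (𝓞 K)⁰ K) ≤ J.1 * 1 :=
          mul_le_mul_right FractionalIdeal.coeIdeal_le_one _
      _ = J.1 := mul_one _

theorem NumberField.abs_norm_eq {α : Kˣ} {a : Ideal (𝓞 K)}
    (ha : FractionalIdeal.spanSingleton (𝓞 K)⁰ (α : K) = J.1 * (a : FractionalIdeal (𝓞 K)⁰ K)) :
    |((Algebra.norm ℚ (α : K) : ℚ) : ℝ)| = idealNorm J * Ideal.absNorm a := by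
  have h := congrArg FractionalIdeal.absNorm ha
  rw [FractionalIdeal.absNorm_span_singleton, map_mul, FractionalIdeal.coeIdeal_absNorm] at h
  rw [coe_idealNorm, ← Rat.cast_abs, h]
  push_cast
  rfl

theorem NumberField.spanSingleton_eq_iff {α β : Kˣ} :
    FractionalIdeal.spanSingleton (𝓞 K)⁰ (β : K) = FractionalIdeal.spanSingleton (𝓞 K)⁰ (α : K) ↔
      ∃ u : (𝓞 K)ˣ, α * unitToField u = β := by
  constructor
  · intro h
    have h1 : (β : K) ∈ FractionalIdeal.spanSingleton (𝓞 K)⁰ (α : K) :=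
      h ▸ FractionalIdeal.mem_spanSingleton_self _ _
    have h2 : (α : K) ∈ FractionalIdeal.spanSingleton (𝓞 K)⁰ (β : K) :=
      h ▸ FractionalIdeal.mem_spanSingleton_self _ _
    obtain ⟨x, hx⟩ := (FractionalIdeal.mem_spanSingleton _).1 h1
    obtain ⟨y, hy⟩ := (FractionalIdeal.mem_spanSingleton _).1 h2
    have hxy : x * y = 1 := by
      have h3 : ((x * y : 𝓞 K) : K) * α = 1 * α := by
        rw [one_mul]
        conv_rhs => rw [← hy, ← hx]
        simp only [Algebra.smul_def, map_mul]
        ring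
      exact_mod_cast mul_right_cancel₀ α.ne_zero h3
    refine ⟨⟨x, y, hxy, by rw [mul_comm, hxy]⟩, Units.ext ?_⟩
    rw [← hx, Algebra.smul_def, mul_comm]
    rfl
  · rintro ⟨u, rfl⟩
    rw [Units.val_mul, ← FractionalIdeal.spanSingleton_mul_spanSingleton]
    have : FractionalIdeal.spanSingleton (𝓞 K)⁰ (unitToField u : K) = 1 := by
      have h := FractionalIdeal.coeIdeal_span_singleton (S := (𝓞 K)⁰) (P := K) (u : 𝓞 K)
      rw [Ideal.span_singleton_eq_top.2 u.isUnit, FractionalIdeal.coeIdeal_top] at h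
      exact h.symm
    rw [this, mul_one]

/-- The summand `log z ^ r`, truncated to `1 < z`. -/
noncomputable def logWeight (r : ℕ) (z : ℝ) : ℝ≥0∞ :=
  if 0 < Real.log z then ENNReal.ofReal (Real.log z ^ r) else 0

theorem NumberField.unitToField_injective {K : Type*} [Field K] :
    Function.Injective (unitToField (K := K)) :=
  Units.map_injective (FaithfulSMul.algebraMap_injective (𝓞 K) K)

theorem NumberField.setLIntegral_boxCount {D : Set (logSpace K)}
    (hD : IsAddFundamentalDomain (unitLattice K) D volume) {y : ℝ} (hy : 0 < y) :
    ∫⁻ v in D, boxCount J (logBox (y * idealNorm J) v) =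
      Nat.card (torsion K) * volume (openSimplex {w : InfinitePlace K // w ≠ w₀} 1) *
        ∑' a : (Ideal (𝓞 K))⁰, if ∃ α : Kˣ, FractionalIdeal.spanSingleton (𝓞 K)⁰ (α : K) =
          J.1 * ((a : Ideal (𝓞 K)) : FractionalIdeal (𝓞 K)⁰ K) then
            logWeight (Fintype.card {w : InfinitePlace K // w ≠ w₀})
              (y / Ideal.absNorm (a : Ideal (𝓞 K))) else 0 := by
  have hK : Countable K := (Module.finBasis ℚ K).equivFun.injective.countable
  have hK' : Countable Kˣ := Units.val_injective.countable
  have hJ : (0 : ℝ) < idealNorm J := by exact_mod_cast idealNorm_pos J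
  have hX : 0 < y * idealNorm J := mul_pos hy hJ
  set X := y * idealNorm J with hXdef
  set S : Kˣ → Set (logSpace K) := fun α => {v | v - logCoord α ∈ openSimplex _
    (Real.log (X / |((Algebra.norm ℚ (α : K) : ℚ) : ℝ)|))} with hS
  have hSm : ∀ α, MeasurableSet (S α) := fun α =>
    ((isOpen_openSimplex _ _).preimage (continuous_id.sub continuous_const)).measurableSet
  have hbox : ∀ v, boxCount J (logBox X v) =
      ∑' α : Kˣ, (if (α : K) ∈ J.1 then 1 else 0) * (S α).indicator 1 v := by
    intro v
    refine tsum_congr fun α => ?_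
    have hiff := forall_lt_logBox_iff hX v α
    by_cases h1 : (α : K) ∈ J.1 <;> by_cases h2 : v ∈ S α
    · rw [if_pos ⟨h1, hiff.2 h2⟩, if_pos h1, Set.indicator_of_mem h2, one_mul, Pi.one_apply]
    · rw [if_neg fun h => h2 (hiff.1 h.2), Set.indicator_of_notMem h2, mul_zero]
    · rw [if_neg fun h => h1 h.1, if_neg h1, zero_mul]
    · rw [if_neg fun h => h1 h.1, if_neg h1, zero_mul]
  simp only [hbox]
  rw [lintegral_tsum fun α => ((measurable_one.indicator (hSm α)).const_mul _).aemeasurable]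
  have h1 : ∀ α : Kˣ, ∫⁻ v in D, (if (α : K) ∈ J.1 then 1 else 0) * (S α).indicator 1 v =
      ∑' a : (Ideal (𝓞 K))⁰, if FractionalIdeal.spanSingleton (𝓞 K)⁰ (α : K) =
          J.1 * ((a : Ideal (𝓞 K)) : FractionalIdeal (𝓞 K)⁰ K) then volume (S α ∩ D) else 0 := by
    intro α
    rw [lintegral_const_mul _ (measurable_one.indicator (hSm α)), lintegral_indicator_one (hSm α),
      Measure.restrict_apply (hSm α)]
    by_cases h : (α : K) ∈ J.1
    · obtain ⟨a, ha⟩ := (mem_iff_exists_ideal J).1 h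
      rw [if_pos h, one_mul, tsum_eq_single a, if_pos ha]
      intro b hb
      rw [if_neg fun hb' => hb (span_eq_unique J hb' ha)]
    · rw [if_neg h, zero_mul, eq_comm, ENNReal.tsum_eq_zero]
      intro a
      rw [if_neg fun ha => h ((mem_iff_exists_ideal J).2 ⟨a, ha⟩)]
  rw [tsum_congr h1, ENNReal.tsum_comm, ← ENNReal.tsum_mul_left]
  refine tsum_congr fun a => ?_
  split_ifs with hex
  · obtain ⟨α, hα⟩ := hex
    have ha0 : (0 : ℝ) < Ideal.absNorm (a : Ideal (𝓞 K)) := by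
      exact_mod_cast Ideal.absNorm_pos_of_nonZeroDivisors a
    rw [← hα]
    have hinj : Function.Injective fun u : (𝓞 K)ˣ => α * unitToField u :=
      fun u v h => unitToField_injective (mul_left_cancel h)
    rw [← hinj.tsum_eq]
    · have h2 : ∀ u : (𝓞 K)ˣ, FractionalIdeal.spanSingleton (𝓞 K)⁰ ((α * unitToField u : Kˣ) : K) =
          FractionalIdeal.spanSingleton (𝓞 K)⁰ (α : K) := fun u => spanSingleton_eq_iff.2 ⟨u, rfl⟩
      simp only [h2, if_true]
      rw [tsum_volume_inter hD X α, volume_openSimplex, abs_norm_eq J hα, hXdef,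
        mul_comm y, mul_div_mul_left _ _ hJ.ne', logWeight]
      ring
    · intro β hβ
      rw [Function.mem_support] at hβ
      have : FractionalIdeal.spanSingleton (𝓞 K)⁰ (β : K) =
          FractionalIdeal.spanSingleton (𝓞 K)⁰ (α : K) := by
        by_contra hne
        exact hβ (if_neg hne)
      exact spanSingleton_eq_iff.1 this
  · rw [mul_zero, ENNReal.tsum_eq_zero]
    intro α
    rw [if_neg fun h => hex ⟨α, h⟩]

theorem NumberField.exists_span_eq_iff (a : (Ideal (𝓞 K))⁰) (J : ClassGroup (𝓞 K) →
    (FractionalIdeal (𝓞 K)⁰ K)ˣ) (hJ : ∀ c, ClassGroup.mk K (J c) = c) (c : ClassGroup (𝓞 K)) :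
    (∃ α : Kˣ, FractionalIdeal.spanSingleton (𝓞 K)⁰ (α : K) =
      (J c).1 * ((a : Ideal (𝓞 K)) : FractionalIdeal (𝓞 K)⁰ K)) ↔ c = (ClassGroup.mk0 a)⁻¹ := by
  have h : c = (ClassGroup.mk0 a)⁻¹ ↔ ClassGroup.mk K (J c * FractionalIdeal.mk0 K a) = 1 := by
    rw [map_mul, hJ, ClassGroup.mk_mk0, eq_inv_iff_mul_eq_one]
  rw [h, ClassGroup.mk_eq_one_iff, ← FractionalIdeal.coe_mk0 (K := K), ← Units.val_mul]
  constructor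
  · rintro ⟨α, hα⟩
    rw [← hα, FractionalIdeal.coe_spanSingleton]
    exact ⟨⟨(α : K), rfl⟩⟩
  · rintro ⟨⟨x, hx⟩⟩
    have hx' : FractionalIdeal.spanSingleton (𝓞 K)⁰ x = (J c * FractionalIdeal.mk0 K a).1 :=
      FractionalIdeal.coeToSubmodule_injective (by
        change ((_ : FractionalIdeal (𝓞 K)⁰ K) : Submodule (𝓞 K) K) = _
        rw [FractionalIdeal.coe_spanSingleton]
        exact hx.symm)
    have hx0 : x ≠ 0 := by
      rintro rfl
      rw [FractionalIdeal.spanSingleton_zero] at hx'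
      exact (J c * FractionalIdeal.mk0 K a).ne_zero hx'.symm
    exact ⟨Units.mk0 x hx0, hx'⟩

/-- The sum `∑ log (y / N𝔞) ^ r` over the nonzero ideals of norm less than `y`. -/
noncomputable def NumberField.idealLogSum (K : Type*) [Field K] [NumberField K] (r : ℕ) (y : ℝ) :
    ℝ≥0∞ :=
  ∑' a : (Ideal (𝓞 K))⁰, logWeight r (y / Ideal.absNorm (a : Ideal (𝓞 K)))

theorem NumberField.sum_setLIntegral_boxCount {D : Set (logSpace K)}
    (hD : IsAddFundamentalDomain (unitLattice K) D volume) {y : ℝ} (hy : 0 < y)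
    (J : ClassGroup (𝓞 K) → (FractionalIdeal (𝓞 K)⁰ K)ˣ) (hJ : ∀ c, ClassGroup.mk K (J c) = c) :
    ∑ c, ∫⁻ v in D, boxCount (J c) (logBox (y * idealNorm (J c)) v) =
      Nat.card (torsion K) * volume (openSimplex {w : InfinitePlace K // w ≠ w₀} 1) *
        idealLogSum K (Fintype.card {w : InfinitePlace K // w ≠ w₀}) y := by
  simp_rw [setLIntegral_boxCount _ hD hy, exists_span_eq_iff _ J hJ]
  rw [← Finset.mul_sum, ← tsum_fintype (L := SummationFilter.unconditional _), ENNReal.tsum_comm, idealLogSum]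
  congr 1
  refine tsum_congr fun a => ?_
  rw [tsum_eq_single (ClassGroup.mk0 a)⁻¹ fun c hc => if_neg hc, if_pos rfl]

theorem NumberField.exists_idealLogSum_bounds (K : Type*) [Field K] [NumberField K] :
    ∃ κ : ℝ, 0 < κ ∧ ∀ T : ℝ≥0, CoverRadius K T → 1 ≤ T → ∀ y : ℝ,
      (3 * finrank ℚ K * (T : ℝ) ^ 2) ^ finrank ℚ K ≤ y →
      ENNReal.ofReal (κ * (y - 9 * finrank ℚ K * T ^ 2 * y ^ (1 - 1 / (finrank ℚ K : ℝ)))) ≤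
        idealLogSum K (Fintype.card {w : InfinitePlace K // w ≠ w₀}) y ∧
      idealLogSum K (Fintype.card {w : InfinitePlace K // w ≠ w₀}) y ≤
        ENNReal.ofReal (κ * (y + 9 * finrank ℚ K * T ^ 2 * y ^ (1 - 1 / (finrank ℚ K : ℝ)))) := by
  obtain ⟨D, hD, hD0, hDtop⟩ := exists_logFundamentalDomain K
  obtain ⟨J, hJ⟩ : ∃ J : ClassGroup (𝓞 K) → (FractionalIdeal (𝓞 K)⁰ K)ˣ,
      ∀ c, ClassGroup.mk K (J c) = c := by
    choose I hI using ClassGroup.mk0_surjective (R := 𝓞 K)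
    exact ⟨fun c => FractionalIdeal.mk0 K (I c), fun c => by rw [ClassGroup.mk_mk0, hI]⟩
  set V := volume (openSimplex {w : InfinitePlace K // w ≠ w₀} 1) with hV
  have hV0 : V ≠ 0 := (volume_openSimplex_pos _).ne'
  have hVtop : V ≠ ⊤ := (volume_openSimplex_lt_top _).ne
  have hw : (Nat.card (torsion K) : ℝ≥0∞) ≠ 0 := by
    exact_mod_cast (Nat.card_pos (α := torsion K)).ne'
  set A : ℝ≥0∞ := Nat.card (torsion K) * V with hA
  have hA0 : A ≠ 0 := mul_ne_zero hw hV0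
  have hAtop : A ≠ ⊤ := ENNReal.mul_ne_top (ENNReal.natCast_ne_top _) hVtop
  set B : ℝ≥0∞ := Fintype.card (ClassGroup (𝓞 K)) * volume D with hB
  have hB0 : B ≠ 0 := mul_ne_zero (by exact_mod_cast Fintype.card_ne_zero) hD0
  have hBtop : B ≠ ⊤ := ENNReal.mul_ne_top (ENNReal.natCast_ne_top _) hDtop
  have hAr : 0 < A.toReal := ENNReal.toReal_pos hA0 hAtop
  have hBr : 0 < B.toReal := ENNReal.toReal_pos hB0 hBtop
  have hkey : ∀ z : ℝ, ENNReal.ofReal (boxDensity K * z) * B =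
      A * ENNReal.ofReal (B.toReal / A.toReal * boxDensity K * z) := by
    intro z
    conv_lhs => rw [← ENNReal.ofReal_toReal hBtop]
    conv_rhs => rw [← ENNReal.ofReal_toReal hAtop]
    rw [mul_comm, ← ENNReal.ofReal_mul hBr.le, ENNReal.toReal_ofReal hAr.le,
      ← ENNReal.ofReal_mul hAr.le]
    congr 1
    field_simp
  refine ⟨B.toReal / A.toReal * boxDensity K,
    mul_pos (div_pos hBr hAr) (boxDensity_pos K), fun T hT hT1 y hy => ?_⟩
  have hy0 : 0 < y := by
    have h1 : (0 : ℝ) < finrank ℚ K := by exact_mod_cast finrank_pos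
    have h2 : (0 : ℝ) < T := by exact_mod_cast zero_lt_one.trans_le hT1
    exact lt_of_lt_of_le (by positivity) hy
  have hsum := sum_setLIntegral_boxCount hD hy0 J hJ
  have hb : ∀ c v, _ := fun c v => boxCount_bounds (J c) hT hT1 hy
    (prod_logBox (mul_pos hy0 (by exact_mod_cast idealNorm_pos (J c))) v)
  constructor
  · refine (ENNReal.mul_le_mul_iff_right hA0 hAtop).1 ?_
    rw [← hkey, ← hsum, hB, mul_left_comm, ← nsmul_eq_mul, ← Finset.card_univ, ← Finset.sum_const]
    refine Finset.sum_le_sum fun c _ => ?_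
    rw [← setLIntegral_const]
    exact lintegral_mono fun v => (hb c v).1
  · refine (ENNReal.mul_le_mul_iff_right hA0 hAtop).1 ?_
    rw [← hkey, ← hsum, hB, mul_left_comm, ← nsmul_eq_mul, ← Finset.card_univ, ← Finset.sum_const]
    refine Finset.sum_le_sum fun c _ => ?_
    rw [← setLIntegral_const]
    exact lintegral_mono fun v => (hb c v).2

end ClassSum

section Mellin

open MeasureTheory Set Filter Topology Complex

/-- The function `log z ^ r`, truncated to `1 < z`. -/
noncomputable def logTrunc (r : ℕ) (z : ℝ) : ℝ := (Ioi 1).indicator (fun z => Real.log z ^ r) z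

theorem logTrunc_nonneg (r : ℕ) (z : ℝ) : 0 ≤ logTrunc r z :=
  indicator_nonneg (fun _ hz => pow_nonneg (Real.log_nonneg (le_of_lt hz)) r) z

theorem logTrunc_of_le {r : ℕ} {z : ℝ} (hz : z ≤ 1) : logTrunc r z = 0 :=
  indicator_of_notMem (not_lt.2 hz) _

theorem logTrunc_mono (r : ℕ) : Monotone (logTrunc r) := by
  intro a b hab
  rcases le_or_gt a 1 with ha | ha
  · rw [logTrunc_of_le ha]
    exact logTrunc_nonneg r b
  · rw [logTrunc, logTrunc, indicator_of_mem (mem_Ioi.2 ha),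
      indicator_of_mem (mem_Ioi.2 (ha.trans_le hab))]
    exact pow_le_pow_left₀ (Real.log_nonneg ha.le)
      (Real.log_le_log (one_pos.trans ha) hab) r

theorem logTrunc_div_eq_zero {r m : ℕ} {y : ℝ} (hy : 0 ≤ y) (hm : ⌊y⌋₊ < m) :
    logTrunc r (y / m) = 0 := by
  have hm' := Nat.lt_of_floor_lt hm
  exact logTrunc_of_le ((div_le_one (hy.trans_lt hm')).2 hm'.le)

theorem logTrunc_div_zero {r : ℕ} {y : ℝ} : logTrunc r (y / (0 : ℕ)) = 0 :=
  logTrunc_of_le (by simp)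

/-- The sum `∑ c m log (y / m) ^ r` over `m < y`. -/
noncomputable def rieszSum (c : ℕ → ℝ) (r : ℕ) (y : ℝ) : ℝ := ∑' m : ℕ, c m * logTrunc r (y / m)

theorem hasFiniteSupport_rieszSum (c : ℕ → ℝ) (r : ℕ) {y : ℝ} (hy : 0 ≤ y) :
    (Function.support fun m : ℕ => c m * logTrunc r (y / m)).Finite := by
  refine (Set.finite_Iic ⌊y⌋₊).subset fun m hm => ?_
  by_contra h
  exact hm (by simp only [logTrunc_div_eq_zero hy (not_le.1 h), mul_zero])

theorem rieszSum_nonneg {c : ℕ → ℝ} (hc : ∀ m, 0 ≤ c m) (r : ℕ) (y : ℝ) : 0 ≤ rieszSum c r y :=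
  tsum_nonneg fun m => mul_nonneg (hc m) (logTrunc_nonneg r _)

theorem rieszSum_of_le {c : ℕ → ℝ} {r : ℕ} {y : ℝ} (hy : y ≤ 1) : rieszSum c r y = 0 := by
  rw [rieszSum]
  convert tsum_zero with m
  rcases Nat.eq_zero_or_pos m with rfl | hm
  · rw [logTrunc_div_zero, mul_zero]
  · rw [logTrunc_of_le, mul_zero]
    have : (1 : ℝ) ≤ m := by exact_mod_cast hm
    exact (div_le_one (by linarith)).2 (by linarith)

theorem rieszSum_monotone {c : ℕ → ℝ} (hc : ∀ m, 0 ≤ c m) (r : ℕ) : Monotone (rieszSum c r) := by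
  intro a b hab
  rcases le_or_gt a 1 with ha | ha
  · rw [rieszSum_of_le ha]
    exact rieszSum_nonneg hc r b
  · have ha0 : 0 ≤ a := by linarith
    refine Summable.tsum_le_tsum (fun m => ?_)
      (summable_of_hasFiniteSupport (hasFiniteSupport_rieszSum c r ha0))
      (summable_of_hasFiniteSupport (hasFiniteSupport_rieszSum c r (ha0.trans hab)))
    exact mul_le_mul_of_nonneg_left (logTrunc_mono r (by gcongr)) (hc m)

/-- The kernel of the Mellin transform of `logTrunc`. -/
noncomputable def logKernel (r : ℕ) (s : ℂ) (x : ℝ) : ℂ := (x : ℂ) ^ (-s - 1) * logTrunc r x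

theorem logKernel_eq (r : ℕ) (s : ℂ) : logKernel r s = (Ioi (1 : ℝ)).indicator
    fun u : ℝ => ((Real.log u : ℝ) : ℂ) ^ r * (u : ℂ) ^ (-(s + 1)) := by
  ext x
  rw [logKernel, logTrunc]
  by_cases hx : x ∈ Ioi (1 : ℝ)
  · rw [indicator_of_mem hx, indicator_of_mem hx, mul_comm, neg_add']
    push_cast
    rfl
  · rw [indicator_of_notMem hx, indicator_of_notMem hx, ofReal_zero, mul_zero]

theorem integrableOn_logKernel (r : ℕ) {s : ℂ} (hs : 1 < s.re) :
    IntegrableOn (logKernel r s) (Ioi 0) := by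
  rw [logKernel_eq]
  refine Integrable.integrableOn ?_
  rw [integrable_indicator_iff measurableSet_Ioi]
  exact integrableOn_log_pow_mul_cpow r (by rw [add_re, one_re]; linarith)

theorem integral_logKernel (r : ℕ) {s : ℂ} (hs : 1 < s.re) :
    ∫ x in Ioi 0, logKernel r s x = r.factorial / s ^ (r + 1) := by
  rw [logKernel_eq, setIntegral_indicator measurableSet_Ioi, Ioi_inter_Ioi,
    sup_eq_right.2 zero_le_one,
    integral_log_pow_mul_cpow r (by rw [add_re, one_re]; linarith), add_sub_cancel_right]

theorem cpow_mul_logTrunc_div (r : ℕ) (s : ℂ) {m : ℕ} (hm : 0 < m) {y : ℝ} (hy : 0 < y) :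
    (y : ℂ) ^ (-s - 1) * logTrunc r (y / m) =
      (m : ℂ) ^ (-s - 1) * logKernel r s ((m : ℝ)⁻¹ * y) := by
  have hm0 : (0 : ℝ) < m := by exact_mod_cast hm
  rw [logKernel, ← mul_assoc, ← ofReal_natCast, ← mul_cpow_ofReal_nonneg hm0.le (by positivity),
    ← ofReal_mul, mul_inv_cancel_left₀ hm0.ne', inv_mul_eq_div]

theorem mellin_rieszSum {c : ℕ → ℝ} (hs : ∀ s : ℂ, 1 < s.re → LSeriesSummable (fun m => (c m : ℂ)) s)
    (r : ℕ) {s : ℂ} (hs1 : 1 < s.re) :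
    mellin (fun y => (rieszSum c r y : ℂ)) (-s) =
      r.factorial / s ^ (r + 1) * LSeries (fun m => (c m : ℂ)) s := by
  set F : ℕ → ℝ → ℂ := fun m y => (y : ℂ) ^ (-s - 1) * ((c m * logTrunc r (y / m) : ℝ) : ℂ) with hF
  have hF0 : ∀ y, F 0 y = 0 := fun y => by
    simp only [hF, logTrunc_div_zero, mul_zero, ofReal_zero]
  have hFm : ∀ m : ℕ, 0 < m → ∀ y ∈ Ioi (0 : ℝ), F m y =
      c m * (m : ℂ) ^ (-s - 1) * logKernel r s ((m : ℝ)⁻¹ * y) := by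
    intro m hm y hy
    simp only [hF]
    rw [ofReal_mul, mul_left_comm, cpow_mul_logTrunc_div r s hm hy, mul_assoc]
  have hm0 : ∀ m : ℕ, 0 < m → (0 : ℝ) < (m : ℝ)⁻¹ := fun m hm => by positivity
  have hker : ∀ m : ℕ, 0 < m →
      IntegrableOn (fun y => logKernel r s ((m : ℝ)⁻¹ * y)) (Ioi 0) := by
    intro m hm
    rw [integrableOn_Ioi_comp_mul_left_iff _ _ (hm0 m hm), mul_zero]
    exact integrableOn_logKernel r hs1
  have hintg : ∀ m, IntegrableOn (F m) (Ioi 0) := by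
    intro m
    rcases Nat.eq_zero_or_pos m with rfl | hm
    · rw [show F 0 = 0 from funext hF0]
      exact integrableOn_zero
    · rw [integrableOn_congr_fun (hFm m hm) measurableSet_Ioi]
      exact (hker m hm).const_mul _
  have hterm : ∀ m : ℕ, 0 < m → (m : ℂ) * (c m * (m : ℂ) ^ (-s - 1)) =
      LSeries.term (fun m => (c m : ℂ)) s m := by
    intro m hm
    have hmc : (m : ℂ) ≠ 0 := by exact_mod_cast hm.ne'
    rw [LSeries.term_of_ne_zero hm.ne', cpow_sub _ _ hmc, cpow_one, cpow_neg]
    field_simp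
  have hI : ∀ m, ∫ y in Ioi 0, F m y =
      LSeries.term (fun m => (c m : ℂ)) s m * (r.factorial / s ^ (r + 1)) := by
    intro m
    rcases Nat.eq_zero_or_pos m with rfl | hm
    · simp only [hF0, integral_zero, LSeries.term_zero, zero_mul]
    · rw [setIntegral_congr_fun measurableSet_Ioi (hFm m hm), integral_const_mul,
        integral_comp_mul_left_Ioi _ _ (hm0 m hm), mul_zero, integral_logKernel r hs1, inv_inv,
        ← hterm m hm, real_smul, ofReal_natCast]
      ring
  have hN : ∀ m, ∫ y in Ioi 0, ‖F m y‖ =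
      ‖LSeries.term (fun m => (c m : ℂ)) s m‖ * ∫ x in Ioi 0, ‖logKernel r s x‖ := by
    intro m
    rcases Nat.eq_zero_or_pos m with rfl | hm
    · simp only [hF0, norm_zero, integral_zero, LSeries.term_zero, zero_mul]
    · have h1 : ∀ y ∈ Ioi (0 : ℝ), ‖F m y‖ =
          ‖(c m : ℂ) * (m : ℂ) ^ (-s - 1)‖ * ‖logKernel r s ((m : ℝ)⁻¹ * y)‖ := by
        intro y hy
        rw [hFm m hm y hy, norm_mul]
      rw [setIntegral_congr_fun measurableSet_Ioi h1, integral_const_mul,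
        integral_comp_mul_left_Ioi (fun x => ‖logKernel r s x‖) _ (hm0 m hm), mul_zero, inv_inv,
        ← hterm m hm, norm_mul (m : ℂ), norm_natCast, smul_eq_mul]
      ring
  have hsum : Summable fun m => ∫ y in Ioi 0, ‖F m y‖ := by
    simp_rw [hN]
    exact (hs s hs1).norm.mul_right _
  have h := hasSum_integral_of_summable_integral_norm hintg hsum
  simp_rw [hI] at h
  have h2 := (hs s hs1).hasSum.mul_right ((r.factorial : ℂ) / s ^ (r + 1))
  rw [mellin, mul_comm, LSeries, h2.unique h]
  refine setIntegral_congr_fun measurableSet_Ioi fun y hy => ?_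
  simp only [hF]
  rw [tsum_mul_left, ← ofReal_tsum, smul_eq_mul, rieszSum]

end Mellin

section Continuation

open MeasureTheory Set Filter Topology Complex

theorem norm_mellin_le_of_tail {H : ℝ → ℂ} {B r : ℝ} (h1 : ∀ y, y ≤ 1 → H y = 0)
    (hH : ∀ y, 1 < y → ‖H y‖ ≤ B * y ^ r) {s : ℂ} (hs : r < s.re) :
    ‖mellin H (-s)‖ ≤ B / (s.re - r) := by
  have hset : mellin H (-s) = ∫ y in Ioi (1 : ℝ), (y : ℂ) ^ (-s - 1) * H y := by
    simp_rw [mellin, smul_eq_mul]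
    refine setIntegral_eq_of_subset_of_forall_sdiff_eq_zero measurableSet_Ioi
      (Ioi_subset_Ioi zero_le_one) fun y hy => ?_
    rw [h1 y (not_lt.1 hy.2), mul_zero]
  rw [hset]
  have hintg : IntegrableOn (fun y : ℝ => B * y ^ (-s.re - 1 + r)) (Ioi 1) :=
    (integrableOn_Ioi_rpow_of_lt (by linarith) one_pos).const_mul B
  have hval : ∫ y in Ioi (1 : ℝ), B * y ^ (-s.re - 1 + r) = B / (s.re - r) := by
    rw [integral_const_mul, integral_Ioi_rpow_of_lt (by linarith) one_pos, Real.one_rpow,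
      show -s.re - 1 + r + 1 = -(s.re - r) by ring, neg_div_neg_eq, mul_one_div]
  rw [← hval]
  refine norm_integral_le_of_norm_le hintg
    ((ae_restrict_iff' measurableSet_Ioi).2 (Eventually.of_forall fun y hy => ?_))
  have hy0 : (0 : ℝ) < y := one_pos.trans hy
  rw [norm_mul, norm_cpow_eq_rpow_re_of_pos hy0]
  calc y ^ (-s - 1).re * ‖H y‖ ≤ y ^ (-s - 1).re * (B * y ^ r) := by
        gcongr
        exact hH y hy
    _ = B * y ^ (-s.re - 1 + r) := by
        rw [mul_left_comm, ← Real.rpow_add hy0]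
        congr 2

theorem differentiableAt_mellin_of_tail {H : ℝ → ℂ} {B r : ℝ} (hm : Measurable H)
    (h1 : ∀ y, y ≤ 1 → H y = 0) (hH : ∀ y, 1 < y → ‖H y‖ ≤ B * y ^ r) {s : ℂ} (hs : r < s.re) :
    DifferentiableAt ℂ (fun s => mellin H (-s)) s := by
  have hloc : LocallyIntegrableOn H (Ioi 0) := by
    have h2 : LocallyIntegrableOn (fun y : ℝ => B * y ^ r) (Ioi 0) := by
      refine ContinuousOn.locallyIntegrableOn ?_ measurableSet_Ioi
      exact continuousOn_const.mul fun y hy =>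
        (Real.continuousAt_rpow_const y _ (Or.inl (ne_of_gt hy))).continuousWithinAt
    refine h2.mono hm.aestronglyMeasurable (Eventually.of_forall fun y => ?_)
    rcases le_or_gt y 1 with hy | hy
    · rw [h1 y hy, norm_zero]
      exact norm_nonneg _
    · exact (hH y hy).trans (le_abs_self _)
  refine (mellin_differentiableAt_of_isBigO_rpow (a := -r) (b := (-s).re - 1) hloc ?_ ?_ ?_
    ?_).comp s differentiableAt_id.neg
  · rw [neg_neg]
    refine Asymptotics.IsBigO.of_bound B ?_
    filter_upwards [eventually_gt_atTop (1 : ℝ)] with y hy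
    rw [Real.norm_of_nonneg (by positivity)]
    exact hH y hy
  · rw [neg_re]
    linarith
  · refine Asymptotics.IsBigO.of_bound 0 ?_
    filter_upwards [mem_nhdsWithin_of_mem_nhds (Iio_mem_nhds zero_lt_one)] with y hy
    rw [h1 y (le_of_lt (mem_Iio.1 hy)), norm_zero, zero_mul]
  · linarith

/-- The error term `R y / κ - y` on `y > 1`. -/
noncomputable def relError (R : ℝ → ℝ) (κ y : ℝ) : ℂ :=
  (Ioi (1 : ℝ)).indicator (fun y => ((R y / κ - y : ℝ) : ℂ)) y

variable {R : ℝ → ℝ} {κ B δ : ℝ}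

theorem relError_of_le {y : ℝ} (hy : y ≤ 1) : relError R κ y = 0 :=
  indicator_of_notMem (fun h : y ∈ Ioi (1 : ℝ) => absurd (mem_Ioi.1 h) (not_lt.2 hy)) _

theorem norm_relError_le (hκ : 0 < κ) (hB : 0 ≤ B)
    (hR : ∀ y, 1 ≤ y → |R y - κ * y| ≤ κ * (B * y ^ (1 - δ))) {y : ℝ} (hy : 0 < y) :
    ‖relError R κ y‖ ≤ B * y ^ (1 - δ) := by
  rw [relError]
  by_cases h : y ∈ Ioi (1 : ℝ)
  · rw [indicator_of_mem h, norm_real, Real.norm_eq_abs,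
      show R y / κ - y = (R y - κ * y) / κ by field_simp, abs_div, abs_of_pos hκ,
      div_le_iff₀' hκ]
    exact hR y (le_of_lt h)
  · rw [indicator_of_notMem h, norm_zero]
    positivity

theorem measurable_relError (hm : Monotone R) : Measurable (relError R κ) :=
  (measurable_ofReal.comp ((hm.measurable.div_const κ).sub measurable_id)).indicator
    measurableSet_Ioi

theorem mellin_relError_eq_setIntegral (s : ℂ) : mellin (relError R κ) (-s) =
    ∫ y in Ioi (1 : ℝ), (y : ℂ) ^ (-s - 1) * ((R y / κ - y : ℝ) : ℂ) := by
  have h : ∀ y : ℝ, (y : ℂ) ^ (-s - 1) • relError R κ y =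
      (Ioi (1 : ℝ)).indicator (fun y : ℝ => (y : ℂ) ^ (-s - 1) * ((R y / κ - y : ℝ) : ℂ)) y := by
    intro y
    rw [relError, smul_eq_mul]
    by_cases h : y ∈ Ioi (1 : ℝ)
    · rw [indicator_of_mem h, indicator_of_mem h]
    · rw [indicator_of_notMem h, indicator_of_notMem h, mul_zero]
  simp_rw [mellin, h]
  rw [setIntegral_indicator measurableSet_Ioi, Ioi_inter_Ioi, sup_eq_right.2 zero_le_one]

theorem norm_mellin_relError_le (hκ : 0 < κ) (hB : 0 ≤ B)
    (hR : ∀ y, 1 ≤ y → |R y - κ * y| ≤ κ * (B * y ^ (1 - δ))) {s : ℂ} (hs : 1 - δ < s.re) :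
    ‖mellin (relError R κ) (-s)‖ ≤ B / (s.re - (1 - δ)) := by
  exact norm_mellin_le_of_tail (fun y hy => relError_of_le hy)
    (fun y hy => norm_relError_le hκ hB hR (one_pos.trans hy)) hs

theorem differentiableAt_mellin_relError (hm : Monotone R) (hκ : 0 < κ) (hB : 0 ≤ B)
    (hR : ∀ y, 1 ≤ y → |R y - κ * y| ≤ κ * (B * y ^ (1 - δ))) {s : ℂ} (hs : 1 - δ < s.re) :
    DifferentiableAt ℂ (fun s => mellin (relError R κ) (-s)) s := by
  exact differentiableAt_mellin_of_tail (measurable_relError hm) (fun y hy => relError_of_le hy)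
    (fun y hy => norm_relError_le hκ hB hR (one_pos.trans hy)) hs

theorem integral_cpow_mul_self {s : ℂ} (hs : 1 < s.re) :
    ∫ y in Ioi (1 : ℝ), (y : ℂ) ^ (-s - 1) * ((y : ℝ) : ℂ) = 1 / (s - 1) := by
  have h : ∀ y ∈ Ioi (1 : ℝ), (y : ℂ) ^ (-s - 1) * ((y : ℝ) : ℂ) = (y : ℂ) ^ (-s) := by
    intro y hy
    have hy0 : (y : ℂ) ≠ 0 := by exact_mod_cast (one_pos.trans hy).ne'
    rw [cpow_sub _ _ hy0, cpow_one, div_mul_cancel₀ _ hy0]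
  rw [setIntegral_congr_fun measurableSet_Ioi h,
    integral_Ioi_cpow_of_lt (by rw [neg_re]; linarith) one_pos, ofReal_one, one_cpow, ← neg_div_neg_eq,
    neg_neg]
  congr 1
  ring

theorem mellin_relError_eq (hm : Monotone R) (hR1 : ∀ y, y ≤ 1 → R y = 0) (hκ : 0 < κ)
    (hδ : 0 ≤ δ) (hB : 0 ≤ B)
    (hR : ∀ y, 1 ≤ y → |R y - κ * y| ≤ κ * (B * y ^ (1 - δ))) {s : ℂ} (hs : 1 < s.re) :
    mellin (relError R κ) (-s) = mellin (fun y => (R y : ℂ)) (-s) / κ - 1 / (s - 1) := by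
  have hint1 : IntegrableOn (fun y : ℝ => (y : ℂ) ^ (-s - 1) * ((y : ℝ) : ℂ)) (Ioi 1) := by
    refine IntegrableOn.congr_fun (f := fun y : ℝ => (y : ℂ) ^ (-s)) ?_ (fun y hy => ?_)
      measurableSet_Ioi
    · exact integrableOn_Ioi_cpow_of_lt (by rw [neg_re]; linarith) one_pos
    · have hy0 : (y : ℂ) ≠ 0 := by exact_mod_cast (one_pos.trans hy).ne'
      simp only
      rw [cpow_sub _ _ hy0, cpow_one, div_mul_cancel₀ _ hy0]
  have hint2 : IntegrableOn (fun y : ℝ => (y : ℂ) ^ (-s - 1) * ((R y / κ : ℝ) : ℂ)) (Ioi 1) := by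
    have hg : IntegrableOn (fun y : ℝ => (1 + B) * y ^ (-s.re)) (Ioi 1) :=
      (integrableOn_Ioi_rpow_of_lt (by linarith) one_pos).const_mul _
    refine Integrable.mono' hg ?_ ((ae_restrict_iff' measurableSet_Ioi).2
      (Eventually.of_forall fun y hy => ?_))
    · exact ((measurable_ofReal.pow_const _).mul
        (measurable_ofReal.comp (hm.measurable.div_const κ))).aestronglyMeasurable
    · have hy1 : (1 : ℝ) < y := hy
      have hy0 : (0 : ℝ) < y := one_pos.trans hy1
      have h1 := hR y hy1.le
      have h2 : y ^ (1 - δ) ≤ y := by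
        conv_rhs => rw [← Real.rpow_one y]
        exact Real.rpow_le_rpow_of_exponent_le hy1.le (by linarith)
      have h3 : |R y / κ| ≤ (1 + B) * y := by
        rw [abs_div, abs_of_pos hκ, div_le_iff₀ hκ]
        have h4 : |R y| ≤ |R y - κ * y| + |κ * y| := by
          simpa using abs_add_le (R y - κ * y) (κ * y)
        rw [abs_of_pos (mul_pos hκ hy0)] at h4
        have h5 : κ * (B * y ^ (1 - δ)) ≤ κ * (B * y) := by gcongr
        linarith
      rw [norm_mul, norm_cpow_eq_rpow_re_of_pos hy0, norm_real, Real.norm_eq_abs]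
      calc y ^ (-s - 1).re * |R y / κ| ≤ y ^ (-s - 1).re * ((1 + B) * y) := by gcongr
        _ = (1 + B) * y ^ (-s.re) := by
          rw [sub_re, neg_re, one_re, Real.rpow_sub hy0, Real.rpow_one]
          field_simp
  have hR2 : mellin (fun y => (R y : ℂ)) (-s) =
      ∫ y in Ioi (1 : ℝ), (y : ℂ) ^ (-s - 1) * (R y : ℂ) := by
    rw [mellin]
    refine (setIntegral_eq_of_subset_of_forall_sdiff_eq_zero measurableSet_Ioi
      (Ioi_subset_Ioi zero_le_one) fun y hy => ?_)
    rw [hR1 y (not_lt.1 hy.2), ofReal_zero, smul_zero]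
  rw [mellin_relError_eq_setIntegral, hR2, ← integral_cpow_mul_self hs, ← integral_div,
    ← integral_sub _ hint1]
  · refine setIntegral_congr_fun measurableSet_Ioi fun y _ => ?_
    push_cast
    ring
  · refine hint2.congr_fun (fun y _ => ?_) measurableSet_Ioi
    simp only
    push_cast
    ring

end Continuation

section RieszZetaLike

open Set Filter Topology Complex

theorem growth_arith {N : ℕ} (hN : 1 ≤ N) {B τ e Z F G : ℝ} (hB : 1 ≤ B) (hτ : 3 ≤ τ) (he : 0 < e)
    (he1 : e ≤ 1) (hZ : Z ≤ τ)
    (hF : F ≤ B * τ ^ N * (1 + Z * (2 * B * N))) (hG : e * (e / 2) ^ N ≤ G) :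
    F ≤ Real.exp ((3 * N + 2 + 2 * Real.log B) * Real.log (τ / e)) * G := by
  have hN' : (1 : ℝ) ≤ N := by exact_mod_cast hN
  have hω : 3 ≤ τ / e := by
    rw [le_div_iff₀ he]
    nlinarith
  have hω0 : 0 < τ / e := by linarith
  have hlog : 1 ≤ Real.log (τ / e) := by
    rw [Real.le_log_iff_exp_le hω0]
    exact Real.exp_one_lt_three.le.trans hω
  have hlogB : 0 ≤ Real.log B := Real.log_nonneg hB
  have hexp : (τ / e) ^ (3 * N + 2) * B ^ 2 ≤
      Real.exp ((3 * N + 2 + 2 * Real.log B) * Real.log (τ / e)) := by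
    have h1 : (τ / e) ^ (3 * N + 2) = Real.exp ((3 * N + 2) * Real.log (τ / e)) := by
      rw [mul_comm _ (Real.log _), Real.exp_mul, Real.exp_log hω0]
      exact_mod_cast rfl
    have h2 : B ^ 2 = Real.exp (2 * Real.log B) := by
      rw [mul_comm, Real.exp_mul, Real.exp_log (by linarith)]
      exact_mod_cast rfl
    rw [h1, h2, ← Real.exp_add]
    refine Real.exp_le_exp.2 ?_
    nlinarith
  have hF2 : F ≤ 3 * N * B ^ 2 * τ ^ (N + 1) := by
    refine hF.trans ?_
    have h3 : 1 ≤ B * N * τ := by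
      have h31 : 1 ≤ B * N := one_le_mul_of_one_le_of_one_le hB hN'
      exact one_le_mul_of_one_le_of_one_le h31 (by linarith)
    have h4 : 1 + Z * (2 * B * N) ≤ 3 * (B * N * τ) := by
      have : Z * (2 * B * N) ≤ τ * (2 * B * N) := by gcongr
      linarith
    calc B * τ ^ N * (1 + Z * (2 * B * N)) ≤ B * τ ^ N * (3 * (B * N * τ)) := by gcongr
      _ = 3 * N * B ^ 2 * τ ^ (N + 1) := by ring
  refine hF2.trans ?_
  have h5 : (N : ℝ) * 2 ^ N ≤ 9 ^ N := by
    have h6 : (N : ℝ) ≤ 2 ^ N := by exact_mod_cast N.lt_two_pow_self.le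
    calc (N : ℝ) * 2 ^ N ≤ 2 ^ N * 2 ^ N := by gcongr
      _ = 4 ^ N := by rw [← mul_pow]; norm_num
      _ ≤ 9 ^ N := by gcongr; norm_num
  have h7 : 3 * (N : ℝ) * τ ^ (N + 1) ≤ (τ / e) ^ (3 * N + 2) * (e * (e / 2) ^ N) := by
    have h8 : (τ / e) ^ (3 * N + 2) * (e * (e / 2) ^ N) =
        τ ^ (N + 1) * ((τ / e) ^ (2 * N + 1) / 2 ^ N) := by
      rw [show 3 * N + 2 = (N + 1) + (2 * N + 1) by ring, pow_add (τ / e) (N + 1),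
        div_pow τ e (N + 1), div_pow e 2 N]
      field_simp
      ring
    have h9 : 3 * (N : ℝ) ≤ (τ / e) ^ (2 * N + 1) / 2 ^ N := by
      rw [le_div_iff₀ (by positivity)]
      calc 3 * (N : ℝ) * 2 ^ N ≤ 3 * 9 ^ N := by linarith
        _ = 3 ^ (2 * N + 1) := by rw [pow_succ, pow_mul]; norm_num; ring
        _ ≤ _ := by gcongr
    rw [h8, mul_comm]
    gcongr
  calc 3 * N * B ^ 2 * τ ^ (N + 1) = 3 * N * τ ^ (N + 1) * B ^ 2 := by ring
    _ ≤ (τ / e) ^ (3 * N + 2) * (e * (e / 2) ^ N) * B ^ 2 := by gcongr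
    _ = (τ / e) ^ (3 * N + 2) * B ^ 2 * (e * (e / 2) ^ N) := by ring
    _ ≤ _ := by gcongr

theorem exists_zetaLike_of_rieszSum {c Λ : ℕ → ℝ} {N r : ℕ} {κ B Q : ℝ} (hr : r + 1 ≤ N)
    (hκ : 0 < κ) (hB : 1 ≤ B) (hκB : κ / r.factorial ≤ B)
    (hE : EulerLike (fun m => (c m : ℂ)) (fun m => (Λ m : ℂ)) N) (hc : ∀ m, 0 ≤ c m)
    (hΛ : ∀ m, 0 ≤ Λ m)
    (hR : ∀ y, 1 ≤ y → |rieszSum c r y - κ * y| ≤ κ * (B * y ^ (1 - 1 / (N : ℝ)))) (hQ : 1 ≤ Q)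
    (hMQ : (3 * N + 2 + 2 * Real.log B) / (1 / (4 * N)) * (1 + Real.log Q) ≤ Q) :
    ∃ f, f 1 ≠ 0 ∧ ZetaLike f Λ (1 / (4 * N)) (3 * N + 2 + 2 * Real.log B) Q := by
  have hN : 1 ≤ N := by omega
  have hN' : (1 : ℝ) ≤ N := by exact_mod_cast hN
  have hN0 : (0 : ℝ) < N := by linarith
  have hB0 : 0 ≤ B := by linarith
  have hmono := rieszSum_monotone hc r
  set Θ : ℂ → ℂ := fun s => mellin (relError (rieszSum c r) κ) (-s) with hΘ
  set f : ℂ → ℂ := fun s => (κ / r.factorial : ℝ) * s ^ (r + 1) * (1 + (s - 1) * Θ s) with hf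
  have hΘd : ∀ s : ℂ, 1 - 1 / (N : ℝ) < s.re → DifferentiableAt ℂ Θ s := fun s hs =>
    differentiableAt_mellin_relError hmono hκ hB0 hR hs
  have hfd : ∀ s : ℂ, 1 - 1 / (N : ℝ) < s.re → DifferentiableAt ℂ f s := fun s hs =>
    ((differentiableAt_const _).mul (differentiableAt_id.pow _)).mul
      ((differentiableAt_const _).add ((differentiableAt_id.sub_const 1).mul (hΘd s hs)))
  have hfe : ∀ s : ℂ, 1 < s.re → f s = (s - 1) * LSeries (fun m => (c m : ℂ)) s := by
    intro s hs
    have hs0 : s ≠ 0 := by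
      rintro rfl
      norm_num at hs
    have hs1 : s - 1 ≠ 0 := by
      intro h
      rw [sub_eq_zero.1 h, one_re] at hs
      exact lt_irrefl _ hs
    have hκ0 : (κ : ℂ) ≠ 0 := by exact_mod_cast hκ.ne'
    have hr0 : (r.factorial : ℂ) ≠ 0 := by exact_mod_cast r.factorial_ne_zero
    simp only [hf, hΘ]
    rw [mellin_relError_eq hmono (fun y hy => rieszSum_of_le hy) hκ (by positivity) hB0 hR hs,
      mellin_rieszSum hE.summable r hs]
    push_cast
    field_simp
    ring
  refine ⟨f, ?_, ⟨by positivity, ?_, ?_, hQ, hMQ, ?_, ?_, hΛ, fun s hs => hE.summable_log hs, ?_, ?_⟩⟩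
  · simp only [hf]
    rw [one_pow, mul_one, sub_self, zero_mul, add_zero, mul_one]
    exact_mod_cast (div_pos hκ (by positivity : (0 : ℝ) < r.factorial)).ne'
  · exact one_div_le_one_div_of_le (by norm_num) (by linarith)
  · have := Real.log_nonneg hB
    linarith
  · intro s hs
    refine (hfd s (lt_of_le_of_lt ?_ hs)).differentiableWithinAt
    have : 2 * (1 / (4 * (N : ℝ))) ≤ 1 / N := by
      rw [mul_one_div, div_le_div_iff₀ (by positivity) hN0]
      linarith
    linarith
  · intro s hs
    rw [hfe s hs]
    refine mul_ne_zero (fun h => ?_) (hE.ne_zero hs)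
    rw [sub_eq_zero.1 h, one_re] at hs
    exact lt_irrefl _ hs
  · intro s hs
    have hs1 : s - 1 ≠ 0 := by
      intro h
      rw [sub_eq_zero.1 h, one_re] at hs
      exact lt_irrefl _ hs
    have hev : f =ᶠ[𝓝 s] fun s => (s - 1) * LSeries (fun m => (c m : ℂ)) s :=
      Filter.mem_of_superset ((isOpen_lt continuous_const continuous_re).mem_nhds hs)
        fun z hz => hfe z hz
    have hd := ((hasDerivAt_id s).sub_const 1).mul (hE.deriv_LSeries hs)
    have hd2 : HasDerivAt (fun s => (s - 1) * LSeries (fun m => (c m : ℂ)) s) _ s := hd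
    rw [hev.deriv_eq, hfe s hs, hd2.deriv]
    have := hE.ne_zero hs
    simp only [id]
    field_simp
    ring
  · intro z₀ z h1 h2 hz
    have hre := (abs_le.1 ((abs_re_le_norm (z - z₀)).trans hz)).1
    rw [sub_re] at hre
    have hR4 : 1 / (4 * (N : ℝ)) ≤ 1 / 4 :=
      one_div_le_one_div_of_le (by norm_num) (by linarith)
    have hzn : ∀ w : ℂ, ‖w‖ ≤ |w.re| + |w.im| := norm_le_abs_re_add_abs_im
    have hz0 : ‖z‖ ≤ |z₀.im| + 3 := by
      have h3 := hzn z₀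
      have h4 : ‖z‖ ≤ ‖z - z₀‖ + ‖z₀‖ := by simpa using norm_add_le (z - z₀) z₀
      rw [abs_of_pos (by linarith : (0 : ℝ) < z₀.re)] at h3
      linarith
    have hz1 : ‖z - 1‖ ≤ |z₀.im| + 3 := by
      have h3 := hzn (z₀ - 1)
      have h4 : ‖z - 1‖ ≤ ‖z - z₀‖ + ‖z₀ - 1‖ := by simpa using norm_add_le (z - z₀) (z₀ - 1)
      rw [sub_re, sub_im, one_re, one_im, sub_zero,
        abs_of_pos (by linarith : (0 : ℝ) < z₀.re - 1)] at h3
      linarith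
    have hτ : 3 ≤ |z₀.im| + 3 := by linarith [abs_nonneg z₀.im]
    have hgap : 1 / (2 * (N : ℝ)) ≤ z.re - (1 - 1 / N) := by
      have h5 : 1 / (N : ℝ) = 4 * (1 / (4 * N)) := by field_simp
      have h6 : 1 / (2 * (N : ℝ)) = 2 * (1 / (4 * N)) := by field_simp; norm_num
      have h7 : 0 < 1 / (4 * (N : ℝ)) := by positivity
      linarith
    have hgap0 : 0 < 1 / (2 * (N : ℝ)) := by positivity
    have hΘb : ‖Θ z‖ ≤ 2 * B * N := by
      refine (norm_mellin_relError_le hκ hB0 hR (by linarith)).trans ?_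
      rw [div_le_iff₀ (by linarith)]
      calc B = 2 * B * N * (1 / (2 * N)) := by field_simp
        _ ≤ _ := by gcongr
    refine growth_arith hN hB hτ (by linarith) (by linarith) hz1 ?_ ?_
    · simp only [hf]
      rw [norm_mul, norm_mul, norm_pow, norm_real, Real.norm_of_nonneg (by positivity)]
      have h8 : ‖z‖ ^ (r + 1) ≤ (|z₀.im| + 3) ^ N :=
        (pow_le_pow_left₀ (norm_nonneg _) hz0 _).trans (pow_le_pow_right₀ (by linarith) hr)
      have h9 : ‖1 + (z - 1) * Θ z‖ ≤ 1 + ‖z - 1‖ * (2 * B * N) := by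
        refine (norm_add_le _ _).trans ?_
        rw [norm_one, norm_mul]
        gcongr
      gcongr
    · rw [hfe z₀ h1, norm_mul]
      have h10 := hE.le_norm_LSeries h1
      rw [Real.rpow_natCast] at h10
      have h11 : z₀.re - 1 ≤ ‖z₀ - 1‖ := by
        have := re_le_norm (z₀ - 1)
        rwa [sub_re, one_re] at this
      have h12 : ((z₀.re - 1) / 2) ^ N ≤ ((z₀.re - 1) / z₀.re) ^ N := by
        have : 0 ≤ z₀.re - 1 := by linarith
        gcongr
      have h13 : (0 : ℝ) ≤ z₀.re - 1 := by linarith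
      exact mul_le_mul h11 (h12.trans h10) (by positivity) (norm_nonneg _)

end RieszZetaLike

section FieldZetaLike

open NumberField NumberField.InfinitePlace NumberField.Units.dirichletUnitTheorem
open MeasureTheory ENNReal NNReal Module nonZeroDivisors

theorem logWeight_eq_ofReal {r : ℕ} {z : ℝ} (hz : 0 ≤ z) :
    logWeight r z = ENNReal.ofReal (logTrunc r z) := by
  rw [logWeight, logTrunc]
  by_cases h : 1 < z
  · rw [if_pos (Real.log_pos h), Set.indicator_of_mem (Set.mem_Ioi.2 h)]
  · rw [if_neg (not_lt.2 (Real.log_nonpos hz (not_lt.1 h))),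
      Set.indicator_of_notMem (fun h' => h (Set.mem_Ioi.1 h')), ENNReal.ofReal_zero]

theorem logTrunc_le (r : ℕ) (z : ℝ) :
    logTrunc r z ≤ r.factorial / 2 ^ r * z ^ 2 := by
  rcases le_or_gt z 1 with h | h
  · rw [logTrunc_of_le h]
    positivity
  · have hz0 : 0 < z := by linarith
    rw [logTrunc, Set.indicator_of_mem (Set.mem_Ioi.2 h)]
    have h1 := Real.pow_div_factorial_le_exp (x := 2 * Real.log z)
      (mul_nonneg zero_le_two (Real.log_nonneg h.le)) r
    have h2 : Real.exp (2 * Real.log z) = z ^ 2 := by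
      rw [mul_comm, Real.exp_mul, Real.exp_log hz0]
      exact_mod_cast rfl
    rw [h2, mul_pow, div_le_iff₀ (by positivity)] at h1
    rw [div_mul_eq_mul_div, le_div_iff₀ (by positivity)]
    linarith

namespace NumberField
variable (K : Type*) [Field K] [NumberField K]

theorem idealLogSum_eq {r : ℕ} {y : ℝ} (hy : 0 ≤ y) :
    idealLogSum K r y = ENNReal.ofReal (rieszSum (fun m => (idealCount K m : ℝ)) r y) := by
  rw [rieszSum, ENNReal.ofReal_tsum_of_nonneg
    (fun m => mul_nonneg (Nat.cast_nonneg _) (logTrunc_nonneg r _))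
    (summable_of_hasFiniteSupport (hasFiniteSupport_rieszSum _ r hy)), idealLogSum,
    ← (Equiv.sigmaFiberEquiv fun a : (Ideal (𝓞 K))⁰ => Ideal.absNorm (a : Ideal (𝓞 K))).tsum_eq,
    ENNReal.tsum_sigma']
  refine tsum_congr fun m => ?_
  have h1 : ∀ a : {a : (Ideal (𝓞 K))⁰ // Ideal.absNorm (a : Ideal (𝓞 K)) = m},
      logWeight r (y / Ideal.absNorm ((Equiv.sigmaFiberEquiv fun a : (Ideal (𝓞 K))⁰ =>
        Ideal.absNorm (a : Ideal (𝓞 K))) ⟨m, a⟩ : Ideal (𝓞 K))) = logWeight r (y / m) := by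
    intro a
    change logWeight r (y / (Ideal.absNorm (a.1 : Ideal (𝓞 K)) : ℝ)) = _
    rw [a.2]
  rw [tsum_congr h1, ENNReal.tsum_const, logWeight_eq_ofReal (by positivity),
    ENNReal.ofReal_mul (Nat.cast_nonneg _)]
  rcases Nat.eq_zero_or_pos m with rfl | hm
  · rw [logTrunc_div_zero, ENNReal.ofReal_zero, mul_zero, mul_zero]
  · congr 1
    have e : {a : (Ideal (𝓞 K))⁰ // Ideal.absNorm (a : Ideal (𝓞 K)) = m} ≃
        {I : Ideal (𝓞 K) // Ideal.absNorm I = m} :=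
      { toFun := fun a => ⟨a.1, a.2⟩
        invFun := fun I => ⟨⟨I.1, mem_nonZeroDivisors_iff_ne_zero.2 fun h => by
          have := I.2
          rw [h, Ideal.zero_eq_bot, Ideal.absNorm_bot] at this
          exact hm.ne this⟩, I.2⟩
        left_inv := fun a => rfl
        right_inv := fun I => rfl }
    have : Finite {I : Ideal (𝓞 K) // Ideal.absNorm I = m} :=
      Ideal.finite_setOfPred_absNorm_eq m
    rw [ENat.card_congr e, ENat.card_eq_coe_natCard, ENNReal.ofReal_natCast, idealCount]
    rfl

theorem card_ne_succ_le : Fintype.card {w : InfinitePlace K // w ≠ w₀} + 1 ≤ finrank ℚ K := by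
  have h1 := card_eq_nrRealPlaces_add_nrComplexPlaces K
  have h2 := card_add_two_mul_card_eq_rank K
  have h3 : Fintype.card {w : InfinitePlace K // w ≠ w₀} = Fintype.card (InfinitePlace K) - 1 := by
    simp
  have h4 : 0 < Fintype.card (InfinitePlace K) := Fintype.card_pos
  omega

theorem rieszSum_idealCount_le (r : ℕ) {y : ℝ} (hy : 0 ≤ y) :
    rieszSum (fun m => (idealCount K m : ℝ)) r y ≤ r.factorial * y ^ 2 * 2 ^ finrank ℚ K := by
  have h2 : (1 : ℝ) < (2 : ℂ).re := by norm_num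
  have hs := (summable_idealCount (K := K) h2).norm
  have hterm : ∀ m, (idealCount K m : ℝ) * logTrunc r (y / m) ≤
      r.factorial / 2 ^ r * y ^ 2 * ‖LSeries.term (fun m => (idealCount K m : ℂ)) 2 m‖ := by
    intro m
    rcases Nat.eq_zero_or_pos m with rfl | hm
    · rw [logTrunc_div_zero, mul_zero]
      positivity
    · rw [LSeries.norm_term_eq, if_neg hm.ne', Complex.norm_natCast]
      calc (idealCount K m : ℝ) * logTrunc r (y / m) ≤
          idealCount K m * (r.factorial / 2 ^ r * (y / m) ^ 2) :=
            mul_le_mul_of_nonneg_left (logTrunc_le r _) (Nat.cast_nonneg _)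
        _ = r.factorial / 2 ^ r * y ^ 2 * (idealCount K m / (m : ℝ) ^ (2 : ℂ).re) := by
            rw [Complex.re_ofNat, Real.rpow_ofNat]
            ring
  have hle : ∑' m, ‖LSeries.term (fun m => (idealCount K m : ℂ)) 2 m‖ ≤ 2 ^ finrank ℚ K := by
    have h3 := (eulerLike K).norm_LSeries_le h2
    have h4 : LSeries (fun m => (idealCount K m : ℂ)) 2 =
        ((∑' m, ‖LSeries.term (fun m => (idealCount K m : ℂ)) 2 m‖ : ℝ) : ℂ) := by
      rw [LSeries, Complex.ofReal_tsum]
      refine tsum_congr fun m => ?_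
      rcases Nat.eq_zero_or_pos m with rfl | hm
      · simp
      · rw [LSeries.norm_term_eq, if_neg hm.ne', LSeries.term_of_ne_zero hm.ne',
          Complex.norm_natCast, Complex.re_ofNat, Real.rpow_ofNat, Complex.cpow_ofNat]
        push_cast
        rfl
    rw [h4, Complex.norm_real, Complex.re_ofNat, Real.rpow_natCast] at h3
    norm_num at h3
    exact (le_abs_self _).trans h3
  calc rieszSum (fun m => (idealCount K m : ℝ)) r y
      ≤ ∑' m, r.factorial / 2 ^ r * y ^ 2 *
        ‖LSeries.term (fun m => (idealCount K m : ℂ)) 2 m‖ :=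
        Summable.tsum_le_tsum hterm
          (summable_of_hasFiniteSupport (hasFiniteSupport_rieszSum _ r hy)) (hs.mul_left _)
    _ ≤ r.factorial / 2 ^ r * y ^ 2 * 2 ^ finrank ℚ K := by
        rw [hs.tsum_mul_left]
        gcongr
    _ ≤ r.factorial * y ^ 2 * 2 ^ finrank ℚ K := by
        gcongr
        exact div_le_self (by positivity) (one_le_pow₀ (by norm_num))

end NumberField

theorem riesz_arith {R : ℝ → ℝ} (hm : Monotone R) (h0 : ∀ y, 0 ≤ R y) {κ a F : ℝ} {N : ℕ}
    (hN : 1 ≤ N) (hκ : 0 < κ) (ha : 1 ≤ a) (hF : 0 < F)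
    (hR : ∀ y, (2 * a) ^ N ≤ y → |R y - κ * y| ≤ κ * (a * y ^ (1 - 1 / (N : ℝ))))
    (hup : ∀ y, 0 ≤ y → R y ≤ F * y ^ 2 * 2 ^ N) :
    κ / F ≤ 2 * (4 * a) ^ N ∧
      ∀ y, 1 ≤ y → |R y - κ * y| ≤ κ * (2 * (4 * a) ^ N * y ^ (1 - 1 / (N : ℝ))) := by
  have hN' : (1 : ℝ) ≤ N := by exact_mod_cast hN
  set Y := (2 * a) ^ N with hY
  have hY1 : 1 ≤ Y := one_le_pow₀ (by linarith)
  have hY0 : 0 < Y := by linarith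
  have h4 : (4 * a) ^ N = 2 ^ N * Y := by rw [hY, ← mul_pow]; ring
  have h2N : (1 : ℝ) ≤ 2 ^ N := one_le_pow₀ (by norm_num)
  have haY : a * Y ^ (1 - 1 / (N : ℝ)) = Y / 2 := by
    rw [Real.rpow_sub hY0, Real.rpow_one]
    have : Y ^ (1 / (N : ℝ)) = 2 * a := by
      rw [hY, one_div, Real.pow_rpow_inv_natCast (by linarith) (by omega)]
    rw [this]
    field_simp
  have hRY := abs_le.1 (hR Y le_rfl)
  rw [haY] at hRY
  constructor
  · have h1 := hup Y hY0.le
    have h2 : κ * Y ≤ 2 * (F * Y ^ 2 * 2 ^ N) := by linarith [hRY.1]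
    rw [div_le_iff₀ hF, h4]
    refine le_of_mul_le_mul_right ?_ hY0
    linarith
  · intro y hy
    have hexp : 0 ≤ 1 - 1 / (N : ℝ) := by
      rw [sub_nonneg, div_le_one (by linarith)]
      exact hN'
    have hy1 : 1 ≤ y ^ (1 - 1 / (N : ℝ)) := Real.one_le_rpow hy hexp
    have ha4 : a ≤ (4 * a) ^ N := by
      calc a ≤ 4 * a := by linarith
        _ = (4 * a) ^ 1 := (pow_one _).symm
        _ ≤ (4 * a) ^ N := pow_le_pow_right₀ (by linarith) hN
    rcases le_or_gt Y y with h | h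
    · refine (hR y h).trans ?_
      gcongr
      linarith
    · have h5 : R y ≤ R Y := hm h.le
      have h6 := h0 y
      have h7 : |R y - κ * y| ≤ κ * (2 * Y) := by
        have h8 : κ * y ≤ κ * Y := by gcongr
        have h9 : 0 < κ * y := by positivity
        rw [abs_le]
        constructor <;> linarith [hRY.2]
      refine h7.trans (mul_le_mul_of_nonneg_left ?_ hκ.le)
      calc 2 * Y = 2 * (1 * Y) * 1 := by ring
        _ ≤ 2 * (2 ^ N * Y) * y ^ (1 - 1 / (N : ℝ)) := by gcongr
        _ = _ := by rw [h4]

theorem NumberField.exists_zetaLike (K : Type*) [Field K] [NumberField K] {T : ℝ≥0}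
    (hT : CoverRadius K T) (hT1 : 1 ≤ T) {Q : ℝ} (hQ : 1 ≤ Q)
    (hMQ : (3 * finrank ℚ K + 2 +
      2 * Real.log (2 * (36 * finrank ℚ K * (T : ℝ) ^ 2) ^ finrank ℚ K)) /
        (1 / (4 * finrank ℚ K)) * (1 + Real.log Q) ≤ Q) :
    ∃ f, f 1 ≠ 0 ∧ ZetaLike f (fieldMangoldt K) (1 / (4 * finrank ℚ K)) (3 * finrank ℚ K + 2 +
      2 * Real.log (2 * (36 * finrank ℚ K * (T : ℝ) ^ 2) ^ finrank ℚ K)) Q := by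
  obtain ⟨κ, hκ, hb⟩ := exists_idealLogSum_bounds K
  specialize hb T hT hT1
  set N := finrank ℚ K with hN
  set r := Fintype.card {w : InfinitePlace K // w ≠ w₀} with hr
  have hN1 : 1 ≤ N := finrank_pos
  have hN' : (1 : ℝ) ≤ N := by exact_mod_cast hN1
  have hT' : (1 : ℝ) ≤ T := by exact_mod_cast hT1
  have hNT : 1 ≤ (N : ℝ) * T ^ 2 := one_le_mul_of_one_le_of_one_le hN' (one_le_pow₀ hT')
  set R := rieszSum (fun m => (idealCount K m : ℝ)) r with hRdef
  have hR0 : ∀ y, 0 ≤ R y := rieszSum_nonneg (fun m => Nat.cast_nonneg _) r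
  have hR : ∀ y, (2 * (9 * N * (T : ℝ) ^ 2)) ^ N ≤ y →
      |R y - κ * y| ≤ κ * (9 * N * (T : ℝ) ^ 2 * y ^ (1 - 1 / (N : ℝ))) := by
    intro y hy
    have hy3 : (3 * N * (T : ℝ) ^ 2) ^ N ≤ y := by
      refine le_trans (pow_le_pow_left₀ (by positivity) ?_ _) hy
      linarith
    have hy0 : 0 < y := lt_of_lt_of_le (by positivity) hy
    have h := hb y hy3
    rw [idealLogSum_eq K hy0.le] at h
    have h1 := (ENNReal.ofReal_le_ofReal_iff (hR0 y)).1 h.1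
    have h2 := (ENNReal.ofReal_le_ofReal_iff (by positivity)).1 h.2
    rw [abs_le]
    constructor <;> linarith
  have key := riesz_arith (rieszSum_monotone (fun m => Nat.cast_nonneg _) r) hR0 hN1 hκ
    (by linarith) (by positivity : (0 : ℝ) < r.factorial) hR
    (fun y hy => rieszSum_idealCount_le K r hy)
  rw [show 4 * (9 * (N : ℝ) * (T : ℝ) ^ 2) = 36 * N * (T : ℝ) ^ 2 by ring] at key
  have hB : 1 ≤ 2 * (36 * (N : ℝ) * (T : ℝ) ^ 2) ^ N := by
    have : 1 ≤ (36 * (N : ℝ) * (T : ℝ) ^ 2) ^ N := one_le_pow₀ (by linarith)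
    linarith
  exact exists_zetaLike_of_rieszSum (card_ne_succ_le K) hκ hB key.1
    (by simpa using eulerLike K) (fun m => Nat.cast_nonneg _) fieldMangoldt_nonneg
    key.2 hQ hMQ

end FieldZetaLike

section

open Complex Filter Topology DirichletCharacter
open scoped ComplexOrder

lemma norm_sum_mul_le_of_antitone {f : ℕ → ℂ} {w : ℕ → ℝ} {B : ℝ} (hw : Antitone w)
    (hw0 : ∀ i, 0 ≤ w i) (hB : ∀ k, ‖∑ i ∈ Finset.range k, f i‖ ≤ B) (n : ℕ) :
    ‖∑ i ∈ Finset.range n, (w i : ℂ) * f i‖ ≤ B * w 0 := by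
  have hB0 : 0 ≤ B := (norm_nonneg _).trans (hB 0)
  have h := Finset.sum_range_by_parts (fun i => (w i : ℂ)) f n
  simp only [smul_eq_mul] at h
  rw [h]
  have h1 : ‖(w (n - 1) : ℂ) * ∑ i ∈ Finset.range n, f i‖ ≤ w (n - 1) * B := by
    rw [norm_mul, Complex.norm_real, Real.norm_of_nonneg (hw0 _)]
    exact mul_le_mul_of_nonneg_left (hB n) (hw0 _)
  have h2 : ‖∑ i ∈ Finset.range (n - 1), ((w (i + 1) : ℂ) - w i) * ∑ j ∈ Finset.range (i + 1), f j‖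
      ≤ ∑ i ∈ Finset.range (n - 1), (w i - w (i + 1)) * B := by
    refine norm_sum_le_of_le _ fun i _ => ?_
    rw [norm_mul, ← Complex.ofReal_sub, Complex.norm_real, norm_sub_rev,
      Real.norm_of_nonneg (sub_nonneg.2 (hw (Nat.le_succ i)))]
    exact mul_le_mul_of_nonneg_left (hB _) (sub_nonneg.2 (hw (Nat.le_succ i)))
  rw [← Finset.sum_mul, Finset.sum_range_sub' w] at h2
  have := norm_sub_le ((w (n - 1) : ℂ) * ∑ i ∈ Finset.range n, f i)
    (∑ i ∈ Finset.range (n - 1), ((w (i + 1) : ℂ) - w i) * ∑ j ∈ Finset.range (i + 1), f j)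
  linarith

/-- The function `1 / v - 1 / (exp v - 1)` is decreasing. -/
lemma one_div_sub_one_div_exp_antitoneOn :
    AntitoneOn (fun v : ℝ => 1 / v - 1 / (Real.exp v - 1)) (Set.Ioi 0) := by
  have hd : ∀ v ∈ Set.Ioi (0:ℝ), HasDerivAt (fun v : ℝ => 1 / v - 1 / (Real.exp v - 1))
      (-(1 / v ^ 2) - -(Real.exp v) / (Real.exp v - 1) ^ 2) v := by
    intro v hv
    have hv : 0 < v := hv
    have he : Real.exp v - 1 ≠ 0 := by
      have := Real.add_one_lt_exp hv.ne'
      linarith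
    have h1 := (hasDerivAt_inv hv.ne')
    have h2 := ((Real.hasDerivAt_exp v).sub_const 1).inv he
    simp only [one_div]
    exact h1.sub h2
  refine antitoneOn_of_deriv_nonpos (convex_Ioi 0)
    (fun v hv => (hd v hv).continuousAt.continuousWithinAt)
    (fun v hv => (hd v (interior_subset hv)).differentiableAt.differentiableWithinAt) fun v hv => ?_
  rw [(hd v (interior_subset hv)).deriv]
  rw [interior_Ioi] at hv
  have hv : 0 < v := hv
  have he : 0 < Real.exp v - 1 := by
    have := Real.add_one_lt_exp hv.ne'
    linarith
  have h1 : v / 2 ≤ Real.sinh (v / 2) := Real.self_le_sinh_iff.2 (by positivity)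
  have h2 : Real.exp v - 1 = Real.exp (v / 2) * (2 * Real.sinh (v / 2)) := by
    rw [Real.sinh_eq, mul_div_cancel₀ _ two_ne_zero, mul_sub, ← Real.exp_add, ← Real.exp_add]
    simp
  have h3 : Real.exp v = Real.exp (v / 2) ^ 2 := by rw [← Real.exp_nat_mul]; congr 1; push_cast; ring
  have h4 : v ^ 2 * Real.exp v ≤ (Real.exp v - 1) ^ 2 := by
    rw [h2, h3, mul_pow, mul_comm]
    exact mul_le_mul_of_nonneg_left (pow_le_pow_left₀ hv.le (by linarith) 2) (by positivity)
  rw [neg_div, sub_neg_eq_add, neg_add_eq_sub, sub_nonpos, div_le_div_iff₀ (by positivity) (by positivity)]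
  linarith

lemma one_div_sub_one_div_exp_mem {v : ℝ} (hv : 0 < v) :
    0 ≤ 1 / v - 1 / (Real.exp v - 1) ∧ 1 / v - 1 / (Real.exp v - 1) ≤ 1 := by
  have h1 := Real.add_one_lt_exp hv.ne'
  constructor
  · rw [sub_nonneg]; exact one_div_le_one_div_of_le hv (by linarith)
  · have h2 := Real.add_one_le_exp (-v)
    rw [Real.exp_neg] at h2
    have h3 : 0 < Real.exp v := Real.exp_pos v
    have h4 : (1 - v) * Real.exp v ≤ 1 := by
      have := mul_le_mul_of_nonneg_right h2 h3.le
      rw [inv_mul_cancel₀ h3.ne'] at this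
      linarith
    rw [sub_le_iff_le_add, add_div' _ _ _ (by linarith), div_le_div_iff₀ hv (by linarith)]
    nlinarith

namespace DirichletCharacter

variable {q : ℕ} {χ : DirichletCharacter ℂ q}

lemma norm_sum_range_le [NeZero q] (hχ : χ ≠ 1) (a k : ℕ) :
    ‖∑ i ∈ Finset.range k, χ ((i + a : ℕ) : ZMod q)‖ ≤ q := by
  have hper : ∀ b : ℕ, ∑ i ∈ Finset.range q, χ ((i + b : ℕ) : ZMod q) = 0 := by
    intro b
    have h0 : ∑ x : ZMod q, χ x = 0 := MulChar.sum_eq_zero_of_ne_one hχ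
    have h1 : ∑ x : ZMod q, χ (x + b) = 0 := by
      rw [← h0]; exact Equiv.sum_comp (Equiv.addRight (b : ZMod q)) (fun x => χ x)
    rw [← h1]
    refine Finset.sum_bij' (fun i _ => (i : ZMod q)) (fun x _ => x.val) ?_ ?_ ?_ ?_ ?_
    · simp
    · intro x _; simpa using ZMod.val_lt x
    · intro i hi; exact ZMod.val_cast_of_lt (Finset.mem_range.1 hi)
    · intro x _; exact ZMod.natCast_zmod_val x
    · intro i _; push_cast; rfl
  induction k using Nat.strong_induction_on with
  | _ k ih =>
    rcases lt_or_ge k q with hk | hk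
    · refine (norm_sum_le_of_le (f := fun i => χ ((i + a : ℕ) : ZMod q)) (n := fun _ => (1:ℝ)) _
        fun i _ => norm_le_one χ _).trans ?_
      simpa using hk.le
    · obtain ⟨j, rfl⟩ := Nat.exists_eq_add_of_le' hk
      rw [Finset.sum_range_add, ]
      have h2 : ∑ x ∈ Finset.range q, χ ((j + x + a : ℕ) : ZMod q) = 0 := by
        rw [← hper (j + a)]
        refine Finset.sum_congr rfl fun i _ => ?_
        congr 2; ring
      rw [h2, add_zero]
      exact ih j (by have := NeZero.pos q; omega)

lemma zetaMul_apply (χ : DirichletCharacter ℂ q) (m : ℕ) :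
    zetaMul χ m = ∑ i ∈ m.divisors, χ (i : ZMod q) := by
  unfold zetaMul
  rw [ArithmeticFunction.coe_zeta_mul_apply]
  refine Finset.sum_congr rfl fun i hi => ?_
  exact if_neg (Nat.pos_of_mem_divisors hi).ne'

lemma one_le_zetaMul_sq (hχ : χ ^ 2 = 1) {n : ℕ} (hn : n ≠ 0) : 1 ≤ zetaMul χ (n ^ 2) := by
  rw [χ.isMultiplicative_zetaMul.multiplicative_factorization _ (pow_ne_zero 2 hn),
    Nat.factorization_pow, Finsupp.prod]
  refine Finset.prod_induction _ (fun z : ℂ => 1 ≤ z) (fun a b ha hb => one_le_mul_of_one_le_of_one_le ha hb) le_rfl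
    fun p hp => ?_
  have hp' : p.Prime := by
    refine Nat.prime_of_mem_primeFactors (n := n) ?_
    rw [← Nat.support_factorization]
    simp only [Finsupp.mem_support_iff, Finsupp.smul_apply, smul_eq_mul] at hp ⊢
    exact right_ne_zero_of_mul hp
  have h : (2 • n.factorization) p = 2 * n.factorization p := by simp
  rw [h]
  generalize n.factorization p = k
  simp only [zetaMul_apply, Nat.sum_divisors_prime_pow hp', Nat.cast_pow, map_pow]
  rcases MulChar.isQuadratic_iff_sq_eq_one.mpr hχ p with h | h | h
  · rw [h, Finset.sum_range_succ']; simp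
  · rw [h]; simp; positivity
  · rw [h, neg_one_geom_sum, if_neg]
    rw [Nat.not_even_iff_odd]; exact odd_two_mul_add_one k

lemma hasSum_lambert (χ : DirichletCharacter ℂ q) {x : ℝ} (hx0 : 0 < x) (hx1 : x < 1) :
    Summable (fun n : ℕ+ => χ (n : ℕ) * ((x:ℂ) ^ (n:ℕ) / (1 - (x:ℂ) ^ (n:ℕ)))) ∧
    HasSum (fun m : ℕ+ => zetaMul χ m * (x:ℂ) ^ (m:ℕ))
      (∑' n : ℕ+, χ (n : ℕ) * ((x:ℂ) ^ (n:ℕ) / (1 - (x:ℂ) ^ (n:ℕ)))) := by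
  have hxn : ‖(x:ℂ)‖ < 1 := by rwa [Complex.norm_real, Real.norm_of_nonneg hx0.le]
  have hs : Summable fun c : ℕ+ × ℕ+ => χ (c.1 : ℕ) * (x:ℂ) ^ (c.1 * c.2 : ℕ) := by
    refine Summable.of_norm_bounded (summable_prod_mul_pow 0 hxn).norm fun c => ?_
    rw [norm_mul, pow_zero, one_mul]
    exact mul_le_of_le_one_left (norm_nonneg _) (norm_le_one χ _)
  have hin : ∀ n : ℕ+, ∑' k : ℕ+, χ (n : ℕ) * (x:ℂ) ^ (n * k : ℕ)
      = χ (n : ℕ) * ((x:ℂ) ^ (n:ℕ) / (1 - (x:ℂ) ^ (n:ℕ))) := by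
    intro n
    have h1 : ‖(x:ℂ) ^ (n:ℕ)‖ < 1 := by
      rw [norm_pow]; exact pow_lt_one₀ (norm_nonneg _) hxn n.ne_zero
    rw [tsum_mul_left, tsum_pnat_eq_tsum_succ (f := fun k => (x:ℂ) ^ (n * k : ℕ))]
    congr 1
    simp only [pow_mul, pow_succ]
    rw [tsum_mul_right, tsum_geometric_of_norm_lt_one h1, div_eq_inv_mul]
  refine ⟨by simpa only [hin] using hs.prod, ?_⟩
  have h2 : HasSum (fun c : ℕ+ × ℕ+ => χ (c.1 : ℕ) * (x:ℂ) ^ (c.1 * c.2 : ℕ))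
      (∑' n : ℕ+, χ (n : ℕ) * ((x:ℂ) ^ (n:ℕ) / (1 - (x:ℂ) ^ (n:ℕ)))) := by
    rw [← tsum_congr hin, ← hs.tsum_prod]; exact hs.hasSum
  rw [← sigmaAntidiagonalEquivProd.hasSum_iff] at h2
  have h3 := h2.sigma fun m => hasSum_fintype _
  convert h3 using 2 with m
  have h4 := (m : ℕ).divisorsAntidiagonal.sum_attach
      (fun y => χ (y.1 : ℕ) * (x:ℂ) ^ (y.1 * y.2 : ℕ))
  rw [Nat.sum_divisorsAntidiagonal (fun a b => χ (a : ℕ) * (x:ℂ) ^ (a * b : ℕ))] at h4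
  rw [zetaMul_apply, Finset.sum_mul, ← Finset.univ_eq_attach] at *
  refine Eq.trans (Finset.sum_congr rfl fun i hi => ?_) h4.symm
  rw [Nat.mul_div_cancel' (Nat.dvd_of_mem_divisors hi)]

lemma norm_LFunction_one_sub_sum_le [NeZero q] (hχ : χ ≠ 1) (N : ℕ) :
    ‖LFunction χ 1 - ∑ i ∈ Finset.range N, χ ((i + 1 : ℕ) : ZMod q) * (1 / ((i + 1 : ℕ) : ℂ))‖
      ≤ q / (N + 1) := by
  have key : ∀ s : ℝ, 1 < s → ‖LFunction χ s - ∑ i ∈ Finset.range N, χ ((i + 1 : ℕ) : ZMod q) *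
      (1 / ((i + 1 : ℕ) : ℂ) ^ (s:ℂ))‖ ≤ q / (N + 1) := by
    intro s hs
    rw [LFunction_eq_LSeries χ (by simpa using hs)]
    have hsum := (LSeriesSummable_of_one_lt_re χ (s := (s:ℂ)) (by simpa using hs)).LSeriesHasSum
    have h1 : HasSum (fun i : ℕ => χ ((i + 1 : ℕ) : ZMod q) * (1 / ((i + 1 : ℕ) : ℂ) ^ (s:ℂ)))
        (LSeries (fun n => χ n) s) := by
      have := (hasSum_nat_add_iff' 1).2 hsum
      simp only [Finset.range_one, Finset.sum_singleton, LSeries.term_zero, sub_zero] at this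
      have e : (fun i : ℕ => LSeries.term (fun n => χ n) s (i + 1)) =
          fun i : ℕ => χ ((i + 1 : ℕ) : ZMod q) * (1 / ((i + 1 : ℕ) : ℂ) ^ (s:ℂ)) := by
        funext i
        rw [LSeries.term_of_ne_zero (Nat.succ_ne_zero i)]
        ring
      rwa [e] at this
    have h2 := (h1.tendsto_sum_nat.sub_const (∑ i ∈ Finset.range N, χ ((i + 1 : ℕ) : ZMod q) *
      (1 / ((i + 1 : ℕ) : ℂ) ^ (s:ℂ)))).norm
    have h3 := h2.comp (tendsto_add_atTop_nat N)
    refine le_of_tendsto h3 (Eventually.of_forall fun k => ?_)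
    simp only [Function.comp]
    rw [add_comm k N, Finset.sum_range_add, add_sub_cancel_left]
    have hw : Antitone fun i : ℕ => ((N + i + 1 : ℕ) : ℝ) ^ (-s) := by
      intro a b hab
      refine Real.rpow_le_rpow_of_nonpos (by positivity) ?_ (by linarith)
      exact_mod_cast (by omega)
    have h4 := norm_sum_mul_le_of_antitone (f := fun i => χ ((i + (N + 1) : ℕ) : ZMod q)) hw
      (fun i => by positivity) (fun k => norm_sum_range_le hχ (N + 1) k) k
    have h5 : ((N + 0 + 1 : ℕ) : ℝ) ^ (-s) ≤ 1 / (N + 1) := by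
      rw [one_div, ← Real.rpow_neg_one]
      push_cast
      rw [add_zero]
      exact Real.rpow_le_rpow_of_exponent_le (by linarith [Nat.cast_nonneg (α := ℝ) N]) (by linarith)
    refine le_trans (le_of_eq ?_) (h4.trans ((mul_le_mul_of_nonneg_left h5 (by positivity)).trans
      (by rw [mul_one_div])))
    congr 1
    refine Finset.sum_congr rfl fun i _ => ?_
    rw [mul_comm, Complex.ofReal_cpow (by positivity), show i + (N + 1) = N + i + 1 by ring]
    congr 1
    rw [Complex.ofReal_neg, Complex.cpow_neg, one_div, Complex.ofReal_natCast]
  have hcont : Tendsto (fun s : ℝ => ‖LFunction χ s - ∑ i ∈ Finset.range N, χ ((i + 1 : ℕ) : ZMod q) *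
      (1 / ((i + 1 : ℕ) : ℂ) ^ (s:ℂ))‖) (𝓝[>] 1) (𝓝 ‖LFunction χ ((1:ℝ):ℂ) - ∑ i ∈ Finset.range N,
        χ ((i + 1 : ℕ) : ZMod q) * (1 / ((i + 1 : ℕ) : ℂ) ^ ((1:ℝ):ℂ))‖) := by
    refine (Continuous.tendsto ?_ _).mono_left nhdsWithin_le_nhds
    have hL : Continuous fun s : ℝ => LFunction χ s :=
      (differentiable_LFunction hχ).continuous.comp continuous_ofReal
    refine (hL.sub (continuous_finsetSum _ fun i _ => continuous_const.mul ?_)).norm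
    refine continuous_const.div ?_ fun s => ?_
    · exact continuous_ofReal.const_cpow (Or.inl (by exact_mod_cast Nat.succ_ne_zero i))
    · rw [Ne, Complex.cpow_eq_zero_iff]
      exact fun h => absurd h.1 (by exact_mod_cast Nat.succ_ne_zero i)
  have := le_of_tendsto hcont (eventually_nhdsWithin_of_forall fun s hs => key s hs)
  simpa using this

/-- A quadratic Dirichlet character of modulus `q` has `L(1, χ) ≥ 1 / (36 q)`. -/
lemma le_re_LFunction_one [NeZero q] (hχ : χ ≠ 1) (hχ2 : χ ^ 2 = 1) :
    1 / (36 * q) ≤ (LFunction χ 1).re := by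
  have hq : (0:ℝ) < q := by exact_mod_cast NeZero.pos q
  obtain ⟨t, ht⟩ : ∃ t : ℝ, t = 1 / (36 * q ^ 2) := ⟨_, rfl⟩
  have ht0 : 0 < t := by rw [ht]; positivity
  have hx0 : 0 < Real.exp (-t) := Real.exp_pos _
  have hx1 : Real.exp (-t) < 1 := by rw [Real.exp_lt_one_iff]; linarith
  have hpow : ∀ m : ℕ, ((Real.exp (-t) : ℝ) : ℂ) ^ m = ((Real.exp (-(m * t)) : ℝ) : ℂ) := by
    intro m
    rw [← Complex.ofReal_pow, ← Real.exp_nat_mul, mul_neg]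
  obtain ⟨hS, hΛ⟩ := hasSum_lambert χ hx0 hx1
  set Λ := ∑' n : ℕ+, χ (n : ℕ) * (((Real.exp (-t) : ℝ) : ℂ) ^ (n:ℕ) / (1 - ((Real.exp (-t) : ℝ) : ℂ) ^ (n:ℕ)))
    with hΛdef
  have hterm : ∀ m : ℕ, 0 < m → ((Real.exp (-t) : ℝ) : ℂ) ^ m / (1 - ((Real.exp (-t) : ℝ) : ℂ) ^ m)
      = ((1 / (Real.exp (m * t) - 1) : ℝ) : ℂ) := by
    intro m hm
    have h1 : 1 < Real.exp (m * t) := by rw [Real.one_lt_exp_iff]; positivity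
    rw [hpow, ← Complex.ofReal_one, ← Complex.ofReal_sub, ← Complex.ofReal_div, Real.exp_neg]
    congr 1
    have h2 : Real.exp (m * t) ≠ 0 := (Real.exp_pos _).ne'
    have h3 : Real.exp (m * t) - 1 ≠ 0 := by linarith
    have h4 : 1 - (Real.exp (m * t))⁻¹ ≠ 0 := by
      rw [sub_ne_zero]; intro h; rw [eq_comm, inv_eq_one] at h; linarith
    rw [div_eq_div_iff h4 h3]
    field_simp
  have hlow : 2 * q ≤ Λ.re := by
    have h1 := (Complex.hasSum_re hΛ)
    have hnn : ∀ m : ℕ+, 0 ≤ (zetaMul χ m * ((Real.exp (-t) : ℝ) : ℂ) ^ (m:ℕ)).re := by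
      intro m
      rw [hpow, Complex.re_mul_ofReal]
      exact mul_nonneg (Complex.nonneg_iff.1 (zetaMul_nonneg hχ2 m)).1 (Real.exp_pos _).le
    have h2 := h1.summable.sum_le_tsum (Finset.image (β := ℕ+) (fun k => Nat.toPNat ((k + 1) ^ 2) (by positivity)) (Finset.range (6 * q)))
      (fun m _ => hnn m)
    rw [h1.tsum_eq, Finset.sum_image] at h2
    · refine le_trans ?_ h2
      have h3 : ∀ k ∈ Finset.range (6 * q), (1:ℝ) / 3 ≤ (zetaMul χ ((k + 1) ^ 2) *
          ((Real.exp (-t) : ℝ) : ℂ) ^ ((k + 1) ^ 2)).re := by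
        intro k hk
        rw [hpow, Complex.re_mul_ofReal]
        have h4 : 1 ≤ (zetaMul χ ((k + 1) ^ 2)).re :=
          (Complex.le_def.1 (one_le_zetaMul_sq hχ2 (Nat.succ_ne_zero k))).1
        have h5 : (((k + 1) ^ 2 : ℕ) : ℝ) * t ≤ 1 := by
          have : ((k + 1 : ℕ) : ℝ) ≤ 6 * q := by exact_mod_cast Finset.mem_range.1 hk
          rw [ht, mul_one_div, div_le_one (by positivity)]
          push_cast at this ⊢
          nlinarith [Nat.cast_nonneg (α := ℝ) k]
        have h6 : (1:ℝ) / 3 ≤ Real.exp (-((((k + 1) ^ 2 : ℕ) : ℝ) * t)) := by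
          refine le_trans ?_ (Real.exp_le_exp.2 (neg_le_neg h5))
          rw [Real.exp_neg, one_div]
          exact inv_anti₀ (Real.exp_pos _) Real.exp_one_lt_three.le
        calc (1:ℝ) / 3 ≤ 1 * Real.exp (-((((k + 1) ^ 2 : ℕ) : ℝ) * t)) := by linarith
          _ ≤ _ := mul_le_mul_of_nonneg_right h4 (Real.exp_pos _).le
      have h7 := Finset.card_nsmul_le_sum _ _ _ h3
      rw [Finset.card_range, nsmul_eq_mul] at h7
      rw [Nat.cast_mul, Nat.cast_ofNat] at h7
      exact le_trans (by linarith) h7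
    · intro a _ b _ hab
      have : (a + 1) ^ 2 = (b + 1) ^ 2 := congrArg PNat.val hab
      have := Nat.pow_left_injective (n := 2) (by norm_num) this
      omega
  have hlim1 : Tendsto (fun N => ∑ i ∈ Finset.range N, χ ((i + 1 : ℕ) : ZMod q) * (1 / ((i + 1 : ℕ) : ℂ)))
      atTop (𝓝 (LFunction χ 1)) := by
    rw [tendsto_iff_norm_sub_tendsto_zero]
    refine squeeze_zero (fun _ => norm_nonneg _) (fun N => ?_)
      (tendsto_const_div_atTop_nhds_zero_nat (q:ℝ) |>.comp (tendsto_add_atTop_nat 1))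
    rw [norm_sub_rev]
    simpa using norm_LFunction_one_sub_sum_le hχ N
  have hlim2 : Tendsto (fun N => ∑ i ∈ Finset.range N, χ ((i + 1 : ℕ) : ZMod q) *
      ((1 / (Real.exp ((i + 1 : ℕ) * t) - 1) : ℝ) : ℂ)) atTop (𝓝 Λ) := by
    have h1 : HasSum (fun i : ℕ => χ ((i + 1 : ℕ) : ZMod q) *
      ((1 / (Real.exp ((i + 1 : ℕ) * t) - 1) : ℝ) : ℂ)) Λ := by
      have h2 := Equiv.pnatEquivNat.symm.hasSum_iff.2 hS.hasSum
      have e : (fun i : ℕ => χ ((i + 1 : ℕ) : ZMod q) *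
          ((1 / (Real.exp ((i + 1 : ℕ) * t) - 1) : ℝ) : ℂ)) = (fun n : ℕ+ => χ (n : ℕ) *
          (((Real.exp (-t) : ℝ) : ℂ) ^ (n:ℕ) / (1 - ((Real.exp (-t) : ℝ) : ℂ) ^ (n:ℕ)))) ∘
            Equiv.pnatEquivNat.symm := by
        funext i
        rw [← hterm _ (Nat.succ_pos i)]
        rfl
      rwa [e]
    exact h1.tendsto_sum_nat
  have hbd : ∀ N, ‖(∑ i ∈ Finset.range N, χ ((i + 1 : ℕ) : ZMod q) * (1 / ((i + 1 : ℕ) : ℂ))) / t -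
      ∑ i ∈ Finset.range N, χ ((i + 1 : ℕ) : ZMod q) *
        ((1 / (Real.exp ((i + 1 : ℕ) * t) - 1) : ℝ) : ℂ)‖ ≤ q := by
    intro N
    have hpos : ∀ i : ℕ, 0 < ((i + 1 : ℕ) : ℝ) * t := fun i => by positivity
    have h1 := norm_sum_mul_le_of_antitone (f := fun i => χ ((i + 1 : ℕ) : ZMod q))
      (w := fun i => 1 / (((i + 1 : ℕ) : ℝ) * t) - 1 / (Real.exp (((i + 1 : ℕ) : ℝ) * t) - 1))
      (fun a b hab => one_div_sub_one_div_exp_antitoneOn (hpos a) (hpos b)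
        (mul_le_mul_of_nonneg_right (by exact_mod_cast Nat.succ_le_succ hab) ht0.le))
      (fun i => (one_div_sub_one_div_exp_mem (hpos i)).1)
      (fun k => norm_sum_range_le hχ 1 k) N
    refine le_trans (le_of_eq ?_) (h1.trans (mul_le_of_le_one_right hq.le
      (one_div_sub_one_div_exp_mem (hpos 0)).2))
    rw [Finset.sum_div, ← Finset.sum_sub_distrib]
    congr 1
    refine Finset.sum_congr rfl fun i _ => ?_
    push_cast
    have : ((i:ℂ) + 1) ≠ 0 := by exact_mod_cast Nat.succ_ne_zero i
    have htc : (t:ℂ) ≠ 0 := by exact_mod_cast ht0.ne'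
    field_simp
  have hfin := le_of_tendsto ((hlim1.div_const (t:ℂ)).sub hlim2).norm (Eventually.of_forall hbd)
  have h8 := (Complex.abs_re_le_norm _).trans hfin
  rw [Complex.sub_re, Complex.div_ofReal_re, abs_le] at h8
  have h9 : (q:ℝ) ≤ (LFunction χ 1).re / t := by linarith
  rw [le_div_iff₀ ht0, ht] at h9
  refine le_trans (le_of_eq ?_) h9
  field_simp

end DirichletCharacter

end

section

open Complex Filter Topology Set MeasureTheory

/-- Two functions that are differentiable on a right half-plane containing `re s > 1`, and agree on
the latter, are equal. -/
lemma eq_of_eqOn_one_lt_re {f g : ℂ → ℂ} {a : ℝ} (hf : ∀ s : ℂ, a < s.re → DifferentiableAt ℂ f s)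
    (hg : ∀ s : ℂ, a < s.re → DifferentiableAt ℂ g s) (h : ∀ s : ℂ, 1 < s.re → f s = g s) {s : ℂ}
    (hs : a < s.re) : f s = g s := by
  have hU : IsOpen {s : ℂ | a < s.re} := isOpen_lt continuous_const continuous_re
  have hf' : AnalyticOnNhd ℂ f {s : ℂ | a < s.re} :=
    DifferentiableOn.analyticOnNhd (fun s hs => (hf s hs).differentiableWithinAt) hU
  have hg' : AnalyticOnNhd ℂ g {s : ℂ | a < s.re} :=
    DifferentiableOn.analyticOnNhd (fun s hs => (hg s hs).differentiableWithinAt) hU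
  have h0 : a < (((max a 1 + 1 : ℝ)) : ℂ).re := by
    rw [ofReal_re]; linarith [le_max_left a 1]
  refine hf'.eqOn_of_preconnected_of_eventuallyEq hg' (convex_halfSpace_re_gt a).isPreconnected
    (z₀ := ((max a 1 + 1 : ℝ) : ℂ)) h0 ?_ hs
  have hV : IsOpen {s : ℂ | 1 < s.re} := isOpen_lt continuous_const continuous_re
  refine Filter.mem_of_superset (hV.mem_nhds ?_) fun z hz => h z hz
  change 1 < (((max a 1 + 1 : ℝ)) : ℂ).re
  rw [ofReal_re]; linarith [le_max_right a 1]

lemma exists_riemannZeta_eq : ∃ Θ : ℂ → ℂ, (∀ s, 0 < s.re → ‖Θ s‖ ≤ 1 / s.re) ∧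
    ∀ s, 0 < s.re → s ≠ 1 → (s - 1) * riemannZeta s = s * (1 + (s - 1) * Θ s) := by
  have hfl : ∀ y : ℝ, 1 ≤ y → rieszSum (fun _ => 1) 0 y = ⌈y⌉₊ - 1 := by
    intro y hy
    have h1 : 1 ≤ ⌈y⌉₊ := Nat.one_le_ceil_iff.2 (by linarith)
    rw [rieszSum, tsum_eq_sum (s := Finset.Ico 1 ⌈y⌉₊)]
    · rw [Finset.sum_congr rfl (g := fun _ => (1:ℝ)), Finset.sum_const, Nat.card_Ico, nsmul_eq_mul,
        mul_one, Nat.cast_sub h1, Nat.cast_one]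
      intro m hm
      rw [Finset.mem_Ico] at hm
      have hm0 : (0:ℝ) < m := by exact_mod_cast hm.1
      rw [one_mul, logTrunc, indicator_of_mem, pow_zero]
      rw [mem_Ioi, one_lt_div hm0]
      exact Nat.lt_ceil.1 hm.2
    · intro m hm
      rw [Finset.mem_Ico, not_and_or, not_le, not_lt, Nat.lt_one_iff] at hm
      rcases hm with rfl | hm
      · rw [logTrunc_div_zero, mul_zero]
      · have hm' : y ≤ m := Nat.ceil_le.1 hm
        rw [logTrunc_of_le ((div_le_one (by linarith)).2 hm'), mul_zero]
  have hR : ∀ y, 1 ≤ y → |rieszSum (fun _ => 1) 0 y - 1 * y| ≤ 1 * (1 * y ^ (1 - (1:ℝ))) := by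
    intro y hy
    rw [hfl y hy, sub_self, Real.rpow_zero, abs_le]
    have := Nat.le_ceil y
    have := Nat.ceil_lt_add_one (show 0 ≤ y by linarith)
    constructor <;> linarith
  have hm : Monotone (rieszSum (fun _ => 1) 0) := rieszSum_monotone (fun _ => zero_le_one) 0
  refine ⟨fun s => mellin (relError (rieszSum (fun _ => 1) 0) 1) (-s), fun s hs => ?_, fun s hs hs1 => ?_⟩
  · have := norm_mellin_relError_le (δ := 1) one_pos zero_le_one hR (s := s) (by simpa using hs)
    simpa using this
  · have hΘ : ∀ s : ℂ, 0 < s.re →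
        DifferentiableAt ℂ (fun s => mellin (relError (rieszSum (fun _ => 1) 0) 1) (-s)) s := fun s hs =>
      differentiableAt_mellin_relError hm one_pos zero_le_one hR (by simpa using hs)
    have key := eq_of_eqOn_one_lt_re (a := 0) (s := s)
      (f := Function.update (fun s => (s - 1) * riemannZeta s) 1 1)
      (g := fun s => s * (1 + (s - 1) * mellin (relError (rieszSum (fun _ => 1) 0) 1) (-s))) ?_ ?_ ?_ hs
    · rwa [Function.update_of_ne hs1] at key
    · have := DirichletCharacter.differentiable_LFunctionTrivChar₁ 1
      simp only [DirichletCharacter.LFunctionTrivChar₁, DirichletCharacter.LFunctionTrivChar,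
        DirichletCharacter.LFunction_modOne_eq, Nat.primeFactors_one, Finset.prod_empty] at this
      exact fun s _ => this s
    · exact fun s hs => differentiableAt_id.mul ((differentiableAt_const _).add
        ((differentiableAt_id.sub_const 1).mul (hΘ s hs)))
    · intro s hs
      have hs0 : s ≠ 0 := by rintro rfl; norm_num at hs
      have hs1 : s ≠ 1 := by rintro rfl; simp at hs
      have hs1' : s - 1 ≠ 0 := sub_ne_zero.2 hs1
      change _ = s * (1 + (s - 1) * mellin (relError (rieszSum (fun _ => 1) 0) 1) (-s))
      rw [Function.update_of_ne hs1, mellin_relError_eq hm (fun y hy => rieszSum_of_le hy) one_pos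
        zero_le_one zero_le_one hR hs, mellin_rieszSum (fun s hs => ?_) 0 hs]
      · have : LSeries (fun _ => ((1:ℝ):ℂ)) s = riemannZeta s := by
          rw [← LSeries_one_eq_riemannZeta hs, ofReal_one]; rfl
        rw [this]
        simp only [Nat.factorial_zero, Nat.cast_one, zero_add, pow_one, ofReal_one, div_one]
        field_simp
        ring
      · have := LSeriesSummable_one_iff.2 hs
        rw [ofReal_one]; exact this

namespace DirichletCharacter

variable {q : ℕ} [NeZero q] {χ : DirichletCharacter ℂ q}

lemma norm_sum_Icc_le (hχ : χ ≠ 1) (n : ℕ) :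
    ‖∑ k ∈ Finset.Icc 1 n, χ (k : ZMod q)‖ ≤ q ∧ ‖∑ k ∈ Finset.Icc 1 n, χ (k : ZMod q)‖ ≤ n := by
  constructor
  · have := norm_sum_range_le hχ 1 n
    rwa [Finset.range_eq_Ico, Finset.sum_Ico_add' (fun i : ℕ => χ (i : ZMod q)) 0 n 1] at this
  · refine (norm_sum_le_of_le (n := fun _ => (1:ℝ)) _ fun i _ => norm_le_one χ _).trans ?_
    simp

lemma norm_LFunction_le (hχ : χ ≠ 1) {s : ℂ} (hs : 39 / 40 ≤ s.re) :
    ‖LFunction χ s‖ ≤ 40 * (q:ℝ) ^ (1 / 20 : ℝ) * ‖s‖ := by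
  have hq : (0:ℝ) < q := by exact_mod_cast NeZero.pos q
  set H : ℝ → ℂ := (Ioi (1:ℝ)).indicator fun y => ∑ k ∈ Finset.Icc 1 ⌊y⌋₊, χ (k : ZMod q) with hH
  have hm : Measurable H := by
    refine Measurable.indicator ?_ measurableSet_Ioi
    exact (measurable_from_nat (f := fun n => ∑ k ∈ Finset.Icc 1 n, χ (k : ZMod q))).comp Nat.measurable_floor
  have h1 : ∀ y, y ≤ 1 → H y = 0 := fun y hy => indicator_of_notMem (not_lt.2 hy) _
  have hHb : ∀ y, 1 < y → ‖H y‖ ≤ (q:ℝ) ^ (1 / 20 : ℝ) * y ^ (19 / 20 : ℝ) := by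
    intro y hy
    rw [hH, indicator_of_mem (mem_Ioi.2 hy)]
    obtain ⟨ha, hb⟩ := norm_sum_Icc_le hχ ⌊y⌋₊
    have hb' := hb.trans (Nat.floor_le (by linarith))
    set m := ‖∑ k ∈ Finset.Icc 1 ⌊y⌋₊, χ (k : ZMod q)‖ with hmdef
    have hm0 : 0 ≤ m := norm_nonneg _
    calc m = m ^ (1 / 20 : ℝ) * m ^ (19 / 20 : ℝ) := by
          rw [← Real.rpow_add_of_nonneg hm0 (by norm_num) (by norm_num)]; norm_num
      _ ≤ _ := by gcongr
  have key := eq_of_eqOn_one_lt_re (a := 19 / 20) (s := s) (f := LFunction χ)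
      (g := fun s => s * mellin H (-s)) (fun s _ => differentiable_LFunction hχ s)
      (fun s hs => differentiableAt_id.mul (differentiableAt_mellin_of_tail hm h1 hHb hs)) ?_ (by linarith)
  · rw [key, norm_mul, mul_comm]
    refine mul_le_mul_of_nonneg_right ((norm_mellin_le_of_tail h1 hHb (s := s) (by linarith)).trans ?_)
      (norm_nonneg _)
    rw [div_le_iff₀ (by linarith)]
    have : (0:ℝ) ≤ (q:ℝ) ^ (1 / 20 : ℝ) := by positivity
    nlinarith
  · intro s hs
    rw [LFunction_eq_LSeries χ hs, LSeries_eq_mul_integral _ zero_le_one hs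
      (LSeriesSummable_of_one_lt_re χ hs)]
    · congr 1
      simp_rw [mellin, smul_eq_mul]
      symm
      rw [setIntegral_eq_of_subset_of_forall_sdiff_eq_zero measurableSet_Ioi
        (Ioi_subset_Ioi zero_le_one) fun y hy => ?_]
      · refine setIntegral_congr_fun measurableSet_Ioi fun y hy => ?_
        simp only [hH]
        rw [indicator_of_mem hy, mul_comm, neg_add']
      · rw [h1 y (not_lt.1 hy.2), mul_zero]
    · refine Asymptotics.IsBigO.of_bound 1 (Eventually.of_forall fun n => ?_)
      rw [Real.rpow_one, one_mul, Real.norm_of_nonneg (Nat.cast_nonneg n)]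
      exact (norm_sum_Icc_le hχ n).2

lemma LFunction_inv_conj (hχ : χ ≠ 1) (s : ℂ) :
    LFunction χ⁻¹ (starRingEnd ℂ s) = starRingEnd ℂ (LFunction χ s) := by
  have key := eq_of_eqOn_one_lt_re (a := s.re - 1) (s := s) (f := LFunction χ)
      (g := starRingEnd ℂ ∘ LFunction χ⁻¹ ∘ starRingEnd ℂ) (fun s _ => differentiable_LFunction hχ s)
      (fun s _ => ?_) ?_ (by linarith)
  · rw [key]; simp
  · exact differentiableAt_conj_conj_iff.2 (differentiable_LFunction (inv_ne_one.2 hχ) _)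
  · intro s hs
    simp only [Function.comp]
    rw [LFunction_eq_LSeries χ hs, LFunction_eq_LSeries χ⁻¹ (by simpa using hs), LSeries, LSeries,
      Complex.conj_tsum]
    refine tsum_congr fun n => ?_
    rcases eq_or_ne n 0 with rfl | hn
    · simp
    · rw [LSeries.term_of_ne_zero hn, LSeries.term_of_ne_zero hn, map_div₀, ← MulChar.star_apply']
      have h1 : starRingEnd ℂ ((n:ℂ) ^ starRingEnd ℂ s) = (n:ℂ) ^ s := by
        rw [← conj_cpow _ _ (by rw [natCast_arg]; exact Real.pi_ne_zero.symm), conj_natCast]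
      rw [h1, ← starRingEnd_apply, conj_conj]

end DirichletCharacter

end

section

open Complex Filter Topology Set
open ArithmeticFunction (vonMangoldt)

namespace DirichletCharacter

lemma norm_natCast_cpow_neg_le_one {p : ℕ} (hp : p.Prime) {s : ℂ} (hs : 0 ≤ s.re) : ‖(p:ℂ) ^ (-s)‖ ≤ 1 := by
  rw [norm_natCast_cpow_of_pos hp.pos, neg_re]
  exact Real.rpow_le_one_of_one_le_of_nonpos (by exact_mod_cast hp.one_le) (by linarith)

lemma one_sub_natCast_cpow_neg_ne_zero {p : ℕ} (hp : p.Prime) {s : ℂ} (hs : 0 < s.re) :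
    1 - (p:ℂ) ^ (-s) ≠ 0 := by
  intro h
  have h1 : ‖(p:ℂ) ^ (-s)‖ < 1 := by
    rw [norm_natCast_cpow_of_pos hp.pos, neg_re]
    exact Real.rpow_lt_one_of_one_lt_of_neg (by exact_mod_cast hp.one_lt) (by linarith)
  rw [← sub_eq_zero.1 h, norm_one] at h1
  exact lt_irrefl _ h1

variable {q : ℕ}

lemma eulerLike (χ : DirichletCharacter ℂ q) :
    EulerLike (fun m => χ m) (fun m => χ m * (vonMangoldt m : ℂ)) 1 where
  N_nonneg := zero_le_one
  one := by simp
  summable s hs := LSeriesSummable_of_one_lt_re χ hs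
  conv m hm := by
    have := congrFun (convolution_twist_vonMangoldt χ) m
    simp only [Pi.mul_apply] at this
    rw [mul_comm (Complex.log m), ← this]
    rfl
  bound m := by
    rw [norm_mul, norm_real, Real.norm_of_nonneg ArithmeticFunction.vonMangoldt_nonneg]
    exact mul_le_mul_of_nonneg_right (norm_le_one χ _) ArithmeticFunction.vonMangoldt_nonneg

/-- The von Mangoldt function on the residue class `1` modulo `q`, scaled by `φ(q)`. -/
noncomputable def classMangoldt (q m : ℕ) : ℝ := q.totient * vonMangoldt.residueClass (1 : ZMod q) m

lemma summable_classMangoldt {s : ℂ} (hs : 1 < s.re) :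
    LSeriesSummable (fun m => (classMangoldt q m : ℂ)) s := by
  have : LSeriesSummable (fun m => ((vonMangoldt.residueClass (1 : ZMod q) m : ℝ) : ℂ)) s :=
    LSeriesSummable_of_abscissaOfAbsConv_lt_re
      ((vonMangoldt.abscissaOfAbsConv_residueClass_le_one _).trans_lt (by exact_mod_cast hs))
  convert this.smul (q.totient : ℂ) using 1
  ext m; simp [classMangoldt]

variable [NeZero q]

lemma norm_prod_one_sub_cpow_le {s : ℂ} (hs : 0 ≤ s.re) :
    ‖∏ p ∈ q.primeFactors, (1 - (p:ℂ) ^ (-s))‖ ≤ q := by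
  have h1 : ‖∏ p ∈ q.primeFactors, (1 - (p:ℂ) ^ (-s))‖ ≤ ∏ p ∈ q.primeFactors, (p:ℝ) := by
    rw [norm_prod]
    refine Finset.prod_le_prod (fun _ _ => norm_nonneg _) fun p hp => ?_
    have hp' := Nat.prime_of_mem_primeFactors hp
    have h2 : (2:ℝ) ≤ p := by exact_mod_cast hp'.two_le
    have := norm_sub_le 1 ((p:ℂ) ^ (-s))
    rw [norm_one] at this
    linarith [norm_natCast_cpow_neg_le_one hp' hs]
  refine h1.trans ?_
  rw [← Nat.cast_prod]
  exact_mod_cast Nat.le_of_dvd (NeZero.pos q) (Nat.prod_primeFactors_dvd q)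

/-- The `L`-function of a Dirichlet character, multiplied by `s - 1` for the trivial character. -/
noncomputable def entireL (χ : DirichletCharacter ℂ q) : ℂ → ℂ :=
  if χ = 1 then LFunctionTrivChar₁ q else LFunction χ

lemma entireL_one : entireL (1 : DirichletCharacter ℂ q) = LFunctionTrivChar₁ q := if_pos rfl

lemma entireL_of_ne {χ : DirichletCharacter ℂ q} (hχ : χ ≠ 1) : entireL χ = LFunction χ := if_neg hχ

lemma differentiable_entireL (χ : DirichletCharacter ℂ q) : Differentiable ℂ (entireL χ) := by
  by_cases hχ : χ = 1
  · rw [hχ, entireL_one]; exact differentiable_LFunctionTrivChar₁ q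
  · rw [entireL_of_ne hχ]; exact differentiable_LFunction hχ

lemma entireL_one_of_ne {s : ℂ} (hs : s ≠ 1) :
    entireL (1 : DirichletCharacter ℂ q) s = (s - 1) * LFunction (1 : DirichletCharacter ℂ q) s := by
  rw [entireL_one, LFunctionTrivChar₁, Function.update_of_ne hs]

lemma entireL_ne_zero (χ : DirichletCharacter ℂ q) {s : ℂ} (hs : 1 < s.re) : entireL χ s ≠ 0 := by
  have hs1 : s ≠ 1 := by rintro rfl; simp at hs
  by_cases hχ : χ = 1
  · rw [hχ, entireL_one_of_ne hs1]
    exact mul_ne_zero (sub_ne_zero.2 hs1) (LFunction_ne_zero_of_one_le_re 1 (.inr hs1) hs.le)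
  · rw [entireL_of_ne hχ]; exact LFunction_ne_zero_of_one_le_re χ (.inl hχ) hs.le

lemma norm_entireL_le (χ : DirichletCharacter ℂ q) {s : ℂ} {t : ℝ} (hs : 39 / 40 ≤ s.re)
    (ht : ‖s‖ ≤ t) (ht' : ‖s - 1‖ ≤ t) (h3 : 3 ≤ t) : ‖entireL χ s‖ ≤ 40 * q * t ^ 2 := by
  have hq : (1:ℝ) ≤ q := by exact_mod_cast NeZero.pos q
  by_cases hχ : χ = 1
  · rw [hχ]
    rcases eq_or_ne s 1 with rfl | hs1
    · have h1 := norm_prod_one_sub_cpow_le (q := q) (s := 1) (by simp)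
      rw [entireL_one, LFunctionTrivChar₁, Function.update_self]
      simp only [cpow_neg, cpow_one] at h1
      calc _ ≤ (q:ℝ) * 1 := by rwa [mul_one]
        _ ≤ q * (40 * t ^ 2) := by gcongr; nlinarith
        _ = _ := by ring
    · obtain ⟨Θ, hΘ, hz⟩ := exists_riemannZeta_eq
      have hs0 : 0 < s.re := by linarith
      have e : entireL (1 : DirichletCharacter ℂ q) s
          = (∏ p ∈ q.primeFactors, (1 - (p : ℂ) ^ (-s))) * (s * (1 + (s - 1) * Θ s)) := by
        rw [entireL_one_of_ne hs1, ← hz s hs0 hs1, show LFunction (1 : DirichletCharacter ℂ q) s = _ from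
          LFunctionTrivChar_eq_mul_riemannZeta hs1]
        ring
      rw [e, norm_mul, norm_mul]
      have h1 := norm_prod_one_sub_cpow_le (q := q) hs0.le
      have h2 : ‖1 + (s - 1) * Θ s‖ ≤ 1 + t * 2 := by
        refine (norm_add_le _ _).trans ?_
        rw [norm_one, norm_mul]
        have : ‖Θ s‖ ≤ 2 := (hΘ s hs0).trans (by rw [div_le_iff₀ hs0]; linarith)
        gcongr
      calc _ ≤ (q:ℝ) * (t * (1 + t * 2)) := by gcongr
        _ ≤ q * (40 * t ^ 2) := mul_le_mul_of_nonneg_left (by nlinarith) (by linarith)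
        _ = _ := by ring
  · rw [entireL_of_ne hχ]
    refine (norm_LFunction_le hχ hs).trans ?_
    have h1 : (q:ℝ) ^ (1 / 20 : ℝ) ≤ q := by
      conv_rhs => rw [← Real.rpow_one (q:ℝ)]
      exact Real.rpow_le_rpow_of_exponent_le hq (by norm_num)
    have h2 : ‖s‖ ≤ t ^ 2 := by nlinarith
    gcongr

lemma le_norm_entireL (χ : DirichletCharacter ℂ q) {s : ℂ} (hs : 1 < s.re) (hs2 : s.re ≤ 2) :
    (s.re - 1) ^ 2 / 2 ≤ ‖entireL χ s‖ := by
  have hs1 : s ≠ 1 := by rintro rfl; simp at hs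
  have h1 := (eulerLike χ).le_norm_LSeries hs
  rw [Real.rpow_one, ← LFunction_eq_LSeries χ hs] at h1
  have h2 : (s.re - 1) / 2 ≤ (s.re - 1) / s.re :=
    div_le_div_of_nonneg_left (by linarith) (by linarith) hs2
  by_cases hχ : χ = 1
  · subst hχ
    rw [entireL_one_of_ne hs1, norm_mul]
    have h3 : s.re - 1 ≤ ‖s - 1‖ := by simpa using re_le_norm (s - 1)
    calc _ = (s.re - 1) * ((s.re - 1) / 2) := by ring
      _ ≤ _ := mul_le_mul h3 (h2.trans h1) (by linarith) (norm_nonneg _)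
  · rw [entireL_of_ne hχ]
    nlinarith

lemma norm_entireL_le_mul (χ : DirichletCharacter ℂ q) {z₀ z : ℂ} (h1 : 1 < z₀.re) (h2 : z₀.re ≤ 2)
    (hz : ‖z - z₀‖ ≤ 1 / 80) :
    ‖entireL χ z‖ ≤ (q * ((|z₀.im| + 3) / (z₀.re - 1)) ^ 6) * ‖entireL χ z₀‖ := by
  have hq : (1:ℝ) ≤ q := by exact_mod_cast NeZero.pos q
  set t := |z₀.im| + 3 with ht
  set e := z₀.re - 1 with he
  have he0 : 0 < e := by linarith
  have ht3 : 3 ≤ t := by linarith [abs_nonneg z₀.im]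
  have hn0 : ‖z₀‖ ≤ 2 + |z₀.im| :=
    (norm_le_abs_re_add_abs_im z₀).trans (by rw [abs_of_pos (by linarith)]; linarith)
  have hn1 : ‖z₀ - 1‖ ≤ 1 + |z₀.im| :=
    (norm_le_abs_re_add_abs_im _).trans
      (by rw [sub_re, one_re, abs_of_pos (by linarith), sub_im, one_im, sub_zero]; linarith)
  have hre : 39 / 40 ≤ z.re := by
    have := (abs_le.1 ((abs_re_le_norm (z - z₀)).trans hz)).1
    rw [sub_re] at this; linarith
  have hz1 : ‖z‖ ≤ t := by
    have := norm_add_le (z - z₀) z₀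
    rw [sub_add_cancel] at this; linarith
  have hz2 : ‖z - 1‖ ≤ t := by
    have := norm_add_le (z - z₀) (z₀ - 1)
    rw [sub_add_sub_cancel] at this; linarith
  have hu := norm_entireL_le χ hre hz1 hz2 ht3
  have hl := le_norm_entireL χ h1 h2
  have hw : 3 ≤ t / e := by rw [le_div_iff₀ he0]; linarith
  have hw4 : (80:ℝ) ≤ (t / e) ^ 4 := by
    calc (80:ℝ) ≤ 3 ^ 4 := by norm_num
      _ ≤ _ := by gcongr
  calc ‖entireL χ z‖ ≤ 40 * q * t ^ 2 := hu
    _ = q * (80 * (t / e) ^ 2) * (e ^ 2 / 2) := by field_simp; norm_num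
    _ ≤ q * ((t / e) ^ 4 * (t / e) ^ 2) * ‖entireL χ z₀‖ := by gcongr
    _ = _ := by ring

variable (q)

/-- The product of `entireL χ` over all characters modulo `q`. -/
noncomputable def prodL (s : ℂ) : ℂ := ∏ χ : DirichletCharacter ℂ q, entireL χ s

variable {q}

lemma sum_logDeriv_entireL {s : ℂ} (hs : 1 < s.re) :
    ∑ χ : DirichletCharacter ℂ q, logDeriv (entireL χ) s
      = 1 / (s - 1) - LSeries (fun m => (classMangoldt q m : ℂ)) s := by
  have hφ : (q.totient : ℂ) ≠ 0 := by exact_mod_cast (Nat.totient_pos.2 (NeZero.pos q)).ne'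
  have key := ArithmeticFunction.vonMangoldt.eqOn_LFunctionResidueClassAux (q := q) isUnit_one hs
  rw [ArithmeticFunction.vonMangoldt.LFunctionResidueClassAux, ZMod.inv_one] at key
  simp only [MulChar.map_one, one_mul] at key
  have e : LSeries (fun m => (classMangoldt q m : ℂ)) s
      = q.totient * LSeries (fun m => ((vonMangoldt.residueClass (1 : ZMod q) m : ℝ) : ℂ)) s := by
    rw [← LSeries_smul (fun m : ℕ => ((vonMangoldt.residueClass (1 : ZMod q) m : ℝ) : ℂ))]
    refine congrArg (fun f => LSeries f s) (funext fun m => ?_)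
    simp [classMangoldt]
  rw [Fintype.sum_eq_add_sum_compl 1, e]
  have e2 : ∑ χ ∈ ({1}ᶜ : Finset (DirichletCharacter ℂ q)), logDeriv (entireL χ) s
      = ∑ χ ∈ ({1}ᶜ : Finset (DirichletCharacter ℂ q)), deriv (LFunction χ) s / LFunction χ s := by
    refine Finset.sum_congr rfl fun χ hχ => ?_
    rw [entireL_of_ne (by simpa using hχ), logDeriv_apply]
  rw [e2, entireL_one, logDeriv_apply]
  have h2 := congrArg (fun w => (q.totient : ℂ) * w) key
  simp only [mul_sub, ← mul_assoc,
    mul_inv_cancel₀ hφ, one_mul, ← mul_div_assoc] at h2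
  linear_combination (norm := (ring_nf; rw [sub_eq_zero]; congr!)) -h2

lemma zetaLike_prodL {Q : ℝ} (hQ : 1 ≤ Q)
    (hMQ : 80 * (q.totient * (6 + Real.log q)) * (1 + Real.log Q) ≤ Q) :
    ZetaLike (prodL q) (classMangoldt q) (1 / 80) (q.totient * (6 + Real.log q)) Q where
  R_pos := by norm_num
  R_le := by norm_num
  M_ge := by
    have h1 : (1:ℝ) ≤ q.totient := by exact_mod_cast Nat.totient_pos.2 (NeZero.pos q)
    have : 0 ≤ Real.log q := Real.log_natCast_nonneg q
    nlinarith
  Q_ge := hQ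
  le_Q := by convert hMQ using 1; ring
  diff := fun s _ => DifferentiableAt.differentiableWithinAt
    (DifferentiableAt.fun_finsetProd fun χ _ => differentiable_entireL χ s)
  ne_zero s hs := Finset.prod_ne_zero_iff.2 fun χ _ => entireL_ne_zero χ hs
  nonneg m := mul_nonneg (Nat.cast_nonneg _) (vonMangoldt.residueClass_nonneg _ _)
  summable s hs := summable_classMangoldt hs
  logDeriv s hs := by
    rw [← logDeriv_apply, ← sum_logDeriv_entireL hs]
    exact logDeriv_prod (fun χ _ => entireL_ne_zero χ hs) fun χ _ => differentiable_entireL χ s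
  growth z₀ z h1 h2 hz := by
    have hq : (1:ℝ) ≤ q := by exact_mod_cast NeZero.pos q
    set w := (|z₀.im| + 3) / (z₀.re - 1) with hw
    have hw3 : 3 ≤ w := by rw [hw, le_div_iff₀ (by linarith)]; linarith [abs_nonneg z₀.im]
    have hlw : 1 ≤ Real.log w := by
      rw [Real.le_log_iff_exp_le (by linarith)]
      linarith [Real.exp_one_lt_d9]
    have hb : (q:ℝ) * w ^ 6 ≤ Real.exp ((6 + Real.log q) * Real.log w) := by
      rw [add_mul, Real.exp_add, mul_comm]
      refine mul_le_mul ?_ ?_ (by linarith) (Real.exp_pos _).le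
      · rw [mul_comm, Real.exp_mul, Real.exp_log (by linarith)]; norm_cast
      · conv_lhs => rw [← Real.exp_log (show (0:ℝ) < q by linarith)]
        exact Real.exp_le_exp.2 (le_mul_of_one_le_right (Real.log_nonneg hq) hlw)
    have hcard : Fintype.card (DirichletCharacter ℂ q) = q.totient := by
      rw [← Nat.card_eq_fintype_card, DirichletCharacter.card_eq_totient_of_hasEnoughRootsOfUnity]
    calc ‖prodL q z‖ = ∏ χ : DirichletCharacter ℂ q, ‖entireL χ z‖ := norm_prod _ _
      _ ≤ ∏ χ : DirichletCharacter ℂ q,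
          (Real.exp ((6 + Real.log q) * Real.log w) * ‖entireL χ z₀‖) := by
        refine Finset.prod_le_prod (fun _ _ => norm_nonneg _) fun χ _ => ?_
        exact (norm_entireL_le_mul χ h1 h2 hz).trans (by gcongr)
      _ = _ := by
        rw [Finset.prod_mul_distrib, Finset.prod_const, Finset.card_univ, hcard, ← Real.exp_nat_mul,
          prodL, norm_prod, mul_assoc]

end DirichletCharacter

end

section

open Complex Filter Topology Set
open ArithmeticFunction (vonMangoldt)

namespace DirichletCharacter

variable {q : ℕ} [NeZero q]

lemma prodL_eq_zero {χ : DirichletCharacter ℂ q} {s : ℂ} (h : entireL χ s = 0) : prodL q s = 0 :=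
  Finset.prod_eq_zero (Finset.mem_univ χ) h

lemma deriv_prodL_eq_zero {χ ψ : DirichletCharacter ℂ q} (hne : ψ ≠ χ) {s : ℂ} (h : entireL χ s = 0)
    (h' : entireL ψ s = 0) : deriv (prodL q) s = 0 := by
  have e : prodL q = fun s => entireL χ s * ∏ ψ ∈ Finset.univ.erase χ, entireL ψ s := by
    ext s; exact (Finset.mul_prod_erase _ _ (Finset.mem_univ χ)).symm
  have hd : DifferentiableAt ℂ (fun s => ∏ ψ ∈ Finset.univ.erase χ, entireL ψ s) s :=
    DifferentiableAt.fun_finsetProd fun χ _ => differentiable_entireL χ s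
  rw [e, deriv_fun_mul (differentiable_entireL χ s) hd, h,
    Finset.prod_eq_zero (Finset.mem_erase.2 ⟨hne, Finset.mem_univ ψ⟩) h', mul_zero, zero_mul, add_zero]

lemma entireL_one_ne_zero {s : ℂ} (hs : ‖s - 1‖ < 1 / 4) :
    entireL (1 : DirichletCharacter ℂ q) s ≠ 0 := by
  have hs0 : 3 / 4 < s.re := by
    have := (abs_lt.1 ((abs_re_le_norm (s - 1)).trans_lt hs)).1
    rw [sub_re, one_re] at this; linarith
  rcases eq_or_ne s 1 with rfl | hs1
  · rw [entireL_one]; exact LFunctionTrivChar₁_apply_one_ne_zero q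
  · obtain ⟨Θ, hΘ, hz⟩ := exists_riemannZeta_eq
    have h1 : riemannZeta s ≠ 0 := by
      intro h
      have := hz s (by linarith) hs1
      rw [h, mul_zero, zero_eq_mul] at this
      rcases this with rfl | h0
      · norm_num at hs0
      · have h2 : ‖(s - 1) * Θ s‖ < 1 := by
          rw [norm_mul]
          have h3 : ‖Θ s‖ ≤ 2 :=
            (hΘ s (by linarith)).trans (by rw [div_le_iff₀ (by linarith)]; linarith)
          nlinarith [norm_nonneg (s - 1), norm_nonneg (Θ s)]
        rw [eq_neg_of_add_eq_zero_right h0, norm_neg, norm_one] at h2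
        exact lt_irrefl _ h2
    rw [entireL_one_of_ne hs1, show LFunction (1 : DirichletCharacter ℂ q) s = _ from
      LFunctionTrivChar_eq_mul_riemannZeta hs1]
    refine mul_ne_zero (sub_ne_zero.2 hs1) (mul_ne_zero (Finset.prod_ne_zero_iff.2 fun p hp => ?_) h1)
    exact one_sub_natCast_cpow_neg_ne_zero (Nat.prime_of_mem_primeFactors hp) (by linarith)

lemma norm_deriv_LFunction_le {χ : DirichletCharacter ℂ q} (hχ : χ ≠ 1) {s : ℂ}
    (hs : ‖s - 1‖ ≤ 1 / 10 ^ 4) : ‖deriv (LFunction χ) s‖ ≤ 3600 * (q:ℝ) ^ (1 / 20 : ℝ) := by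
  have h := norm_deriv_le_of_forall_mem_sphere_norm_le (c := s) (R := 1 / 80) (f := LFunction χ)
    (C := 45 * (q:ℝ) ^ (1 / 20 : ℝ)) (by norm_num) (differentiable_LFunction hχ).diffContOnCl ?_
  · exact h.trans_eq (by ring)
  · intro z hz
    rw [mem_sphere_iff_norm] at hz
    have hz1 : ‖z - 1‖ ≤ 1 / 50 := by
      have := norm_add_le (z - s) (s - 1)
      rw [sub_add_sub_cancel] at this; linarith
    have hre := (abs_le.1 ((abs_re_le_norm (z - 1)).trans hz1)).1
    rw [sub_re, one_re] at hre
    have hn : ‖z‖ ≤ 45 / 40 := by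
      have := norm_add_le (z - 1) 1
      rw [sub_add_cancel, norm_one] at this; linarith
    calc _ ≤ 40 * (q:ℝ) ^ (1 / 20 : ℝ) * ‖z‖ := norm_LFunction_le hχ (by linarith)
      _ ≤ 40 * (q:ℝ) ^ (1 / 20 : ℝ) * (45 / 40) := by gcongr
      _ = _ := by ring

/-- A real character has no zero very close to `1`. -/
lemma LFunction_ne_zero_of_sq_eq_one {χ : DirichletCharacter ℂ q} (hχ : χ ≠ 1) (hχ2 : χ ^ 2 = 1)
    {Q : ℝ} (hqQ : 24 * (q:ℝ) ^ (21 / 20 : ℝ) ≤ Q) {s : ℂ} (hs : ‖s - 1‖ ≤ 1 / (10 ^ 4 * Q)) :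
    LFunction χ s ≠ 0 := by
  intro h0
  have hq : (1:ℝ) ≤ q := by exact_mod_cast NeZero.pos q
  have hq1 : (1:ℝ) ≤ (q:ℝ) ^ (21 / 20 : ℝ) := Real.one_le_rpow hq (by norm_num)
  have hQ : 1 ≤ Q := by linarith
  have hs' : ‖s - 1‖ ≤ 1 / 10 ^ 4 := hs.trans (one_div_le_one_div_of_le (by norm_num) (by linarith))
  have key := (convex_closedBall (1:ℂ) (1 / 10 ^ 4)).norm_image_sub_le_of_norm_deriv_le
    (f := LFunction χ) (C := 3600 * (q:ℝ) ^ (1 / 20 : ℝ)) (x := s) (y := 1)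
    (fun z _ => differentiable_LFunction hχ z)
    (fun z hz => norm_deriv_LFunction_le hχ (mem_closedBall_iff_norm.1 hz))
    (mem_closedBall_iff_norm.2 hs') (Metric.mem_closedBall_self (by positivity))
  rw [h0, sub_zero, norm_sub_rev] at key
  have h1 := (le_re_LFunction_one hχ hχ2).trans ((re_le_norm _).trans key)
  have h2 : 1 / (36 * (q:ℝ)) ≤ 3600 * (q:ℝ) ^ (1 / 20 : ℝ) * (1 / (10 ^ 4 * Q)) :=
    h1.trans (by gcongr)
  rw [mul_one_div, div_le_div_iff₀ (by positivity) (by positivity)] at h2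
  have h3 : (q:ℝ) ^ (1 / 20 : ℝ) * q = (q:ℝ) ^ (21 / 20 : ℝ) := by
    rw [← Real.rpow_add_one (by positivity)]; norm_num
  nlinarith

/-- No Dirichlet `L`-function has a zero very close to `1`. -/
theorem entireL_ne_zero_of_near {Q : ℝ}
    (hMQ : 80 * (q.totient * (6 + Real.log q)) * (1 + Real.log Q) ≤ Q)
    (hqQ : 24 * (q:ℝ) ^ (21 / 20 : ℝ) ≤ Q) (χ : DirichletCharacter ℂ q) {s : ℂ}
    (hs : ‖s - 1‖ ≤ 1 / (10 ^ 4 * Q)) : entireL χ s ≠ 0 := by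
  have hq : (1:ℝ) ≤ q := by exact_mod_cast NeZero.pos q
  have hq1 : (1:ℝ) ≤ (q:ℝ) ^ (21 / 20 : ℝ) := Real.one_le_rpow hq (by norm_num)
  have hQ : 1 ≤ Q := by linarith
  have hs' : ‖s - 1‖ ≤ 1 / 10 ^ 4 := hs.trans (one_div_le_one_div_of_le (by norm_num) (by linarith))
  intro h0
  by_cases hχ : χ = 1
  · subst hχ
    exact entireL_one_ne_zero (by linarith) h0
  have h0' : entireL χ⁻¹ (starRingEnd ℂ s) = 0 := by
    rw [entireL_of_ne (inv_ne_one.2 hχ), LFunction_inv_conj hχ, ← entireL_of_ne hχ, h0, map_zero]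
  have hs2 : ‖starRingEnd ℂ s - 1‖ ≤ 1 / (10 ^ 4 * Q) := by
    rw [← map_one (starRingEnd ℂ), ← map_sub, norm_conj]; exact hs
  refine (zetaLike_prodL hQ hMQ).zeros_near_one hs hs2 (prodL_eq_zero h0) (prodL_eq_zero h0') ?_
  by_cases hss : starRingEnd ℂ s = s
  · right
    refine ⟨deriv_prodL_eq_zero (ψ := χ⁻¹) (fun h => ?_) h0 (by rwa [hss] at h0'), hss⟩
    refine LFunction_ne_zero_of_sq_eq_one hχ ?_ hqQ hs (by rwa [← entireL_of_ne hχ])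
    rw [sq]; nth_rw 1 [← h]; exact inv_mul_cancel χ
  · exact Or.inl hss

lemma exists_differentiableOn_residueClass {a : ZMod q} (ha : IsUnit a) {Q : ℝ}
    (hMQ : 80 * (q.totient * (6 + Real.log q)) * (1 + Real.log Q) ≤ Q)
    (hqQ : 24 * (q:ℝ) ^ (21 / 20 : ℝ) ≤ Q) :
    ∃ g : ℂ → ℂ, DifferentiableOn ℂ g (Metric.ball 1 (1 / (10 ^ 4 * Q))) ∧
      ∀ s : ℂ, 1 < s.re → LSeries (fun m => (vonMangoldt.residueClass a m : ℂ)) s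
        = (q.totient : ℂ)⁻¹ / (s - 1) + g s := by
  refine ⟨vonMangoldt.LFunctionResidueClassAux a, fun s hs => ?_, fun s hs => ?_⟩
  · have hs' : ‖s - 1‖ ≤ 1 / (10 ^ 4 * Q) := (mem_ball_iff_norm.1 hs).le
    have hne := fun χ : DirichletCharacter ℂ q => entireL_ne_zero_of_near hMQ hqQ χ hs'
    have hd : ∀ {f : ℂ → ℂ}, Differentiable ℂ f → DifferentiableAt ℂ (deriv f) s := fun hf =>
      (hf.analyticAt s).deriv.differentiableAt
    refine DifferentiableAt.differentiableWithinAt ?_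
    refine (differentiableAt_const _).mul (DifferentiableAt.sub ?_ (DifferentiableAt.fun_sum fun χ hχ => ?_))
    · have h1 := hne 1
      rw [entireL_one] at h1
      exact ((hd (differentiable_LFunctionTrivChar₁ q)).neg).div (differentiable_LFunctionTrivChar₁ q s) h1
    · have hχ1 : χ ≠ 1 := by simpa using hχ
      have h1 := hne χ
      rw [entireL_of_ne hχ1] at h1
      exact ((hd (differentiable_LFunction hχ1)).const_mul _).div (differentiable_LFunction hχ1 s) h1
  · rw [vonMangoldt.eqOn_LFunctionResidueClassAux ha hs, add_sub_cancel]

theorem exists_differentiableOn_classes {S : Finset (ZMod q)} (hS : ∀ a ∈ S, IsUnit a) {Q : ℝ}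
    (hMQ : 80 * (q.totient * (6 + Real.log q)) * (1 + Real.log Q) ≤ Q)
    (hqQ : 24 * (q:ℝ) ^ (21 / 20 : ℝ) ≤ Q) :
    ∃ (c : ℂ) (g : ℂ → ℂ), DifferentiableOn ℂ g (Metric.ball 1 (1 / (10 ^ 4 * Q))) ∧
      ∀ s : ℂ, 1 < s.re →
        LSeries (fun m => ((if (m : ZMod q) ∈ S then vonMangoldt m else 0 : ℝ) : ℂ)) s
          = c / (s - 1) + g s := by
  choose! g hg hg' using fun a (ha : a ∈ S) => exists_differentiableOn_residueClass (hS a ha) hMQ hqQ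
  refine ⟨∑ a ∈ S, (q.totient : ℂ)⁻¹, fun s => ∑ a ∈ S, g a s,
    DifferentiableOn.fun_sum fun a ha => hg a ha, fun s hs => ?_⟩
  rw [Finset.sum_div, ← Finset.sum_add_distrib, ← Finset.sum_congr rfl fun a ha => hg' a ha s hs,
    ← LSeries_sum]
  · refine LSeries_congr (fun {m} _ => ?_) s
    rw [Finset.sum_apply, ← ofReal_sum]
    congr 1
    simp only [vonMangoldt.residueClass, indicator_apply, mem_ofPred_eq]
    rw [Finset.sum_ite_eq]
  · exact fun a _ => LSeriesSummable_of_abscissaOfAbsConv_lt_re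
      ((vonMangoldt.abscissaOfAbsConv_residueClass_le_one _).trans_lt (by exact_mod_cast hs))

end DirichletCharacter

end

section

open Complex Filter Topology Set
open ArithmeticFunction (vonMangoldt)

lemma sum_abs_le_of_prime_eq_zero {e : ℕ → ℝ} {K : ℝ} {B : Finset ℕ} (hK : 0 ≤ K)
    (he : ∀ m, |e m| ≤ K * vonMangoldt m) (h0 : ∀ r, r.Prime → r ∉ B → e r = 0) {x : ℝ}
    (hx : 1 ≤ x) :
    ∑ m ∈ Finset.Icc 1 ⌊x⌋₊, |e m| ≤ K * (2 * √x * Real.log x + ∑ r ∈ B, Real.log r) := by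
  have h1 : ∀ m, |e m| ≤ K * (if ¬ m.Prime then vonMangoldt m else 0)
      + K * (if m ∈ B then Real.log m else 0) := by
    intro m
    have hl : 0 ≤ K * (if m ∈ B then Real.log m else 0) :=
      mul_nonneg hK (by split_ifs; exacts [Real.log_natCast_nonneg m, le_rfl])
    by_cases hm : m.Prime
    · rw [if_neg (not_not.2 hm), mul_zero, zero_add]
      by_cases hB : m ∈ B
      · rw [if_pos hB]
        exact (he m).trans (mul_le_mul_of_nonneg_left ArithmeticFunction.vonMangoldt_le_log hK)
      · rw [h0 m hm hB, abs_zero]; exact hl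
    · rw [if_pos hm]
      linarith [he m]
  refine (Finset.sum_le_sum fun m _ => h1 m).trans ?_
  rw [Finset.sum_add_distrib, ← Finset.mul_sum, ← Finset.mul_sum, ← mul_add]
  refine mul_le_mul_of_nonneg_left (add_le_add ?_ ?_) hK
  · have h2 := Chebyshev.psi_sub_theta_eq_sum_not_prime x
    have h3 := (le_abs_self _).trans (Chebyshev.abs_psi_sub_theta_le_sqrt_mul_log hx)
    rw [h2, Finset.sum_filter] at h3
    exact h3
  · rw [← Finset.sum_filter]
    exact Finset.sum_le_sum_of_subset_of_nonneg (fun m hm => (Finset.mem_filter.1 hm).2)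
      fun m _ _ => Real.log_natCast_nonneg m

lemma LSeriesSummable_of_prime_eq_zero {e : ℕ → ℝ} {K : ℝ} {B : Finset ℕ} (hK : 0 ≤ K)
    (he : ∀ m, |e m| ≤ K * vonMangoldt m) (h0 : ∀ r, r.Prime → r ∉ B → e r = 0) {s : ℂ}
    (hs : 3 / 4 < s.re) : LSeriesSummable (fun m => (e m : ℂ)) s := by
  refine LSeriesSummable_of_sum_norm_bigO (r := 3 / 4) ?_ (by norm_num) hs
  refine Asymptotics.IsBigO.of_bound (K * (8 + ∑ r ∈ B, Real.log r)) ?_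
  filter_upwards [eventually_ge_atTop 1] with n hn
  have hn1 : (1:ℝ) ≤ n := by exact_mod_cast hn
  have h1 := sum_abs_le_of_prime_eq_zero hK he h0 hn1
  rw [Nat.floor_natCast] at h1
  simp only [norm_real, Real.norm_eq_abs]
  rw [abs_of_nonneg (Finset.sum_nonneg fun _ _ => abs_nonneg _), abs_of_nonneg (by positivity)]
  refine h1.trans ?_
  rw [mul_assoc K]
  refine mul_le_mul_of_nonneg_left ?_ hK
  have h2 : Real.log n ≤ (n:ℝ) ^ (1 / 4 : ℝ) / (1 / 4) := Real.log_le_rpow_div (by positivity) (by norm_num)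
  have h3 : √(n:ℝ) * (n:ℝ) ^ (1 / 4 : ℝ) = (n:ℝ) ^ (3 / 4 : ℝ) := by
    rw [Real.sqrt_eq_rpow, ← Real.rpow_add (by positivity)]; norm_num
  have h4 : (1:ℝ) ≤ (n:ℝ) ^ (3 / 4 : ℝ) := Real.one_le_rpow hn1 (by norm_num)
  have h5 : 0 ≤ ∑ r ∈ B, Real.log r := Finset.sum_nonneg fun r _ => Real.log_natCast_nonneg r
  have h6 : 2 * √(n:ℝ) * Real.log n ≤ 8 * (n:ℝ) ^ (3 / 4 : ℝ) := by
    calc 2 * √(n:ℝ) * Real.log n ≤ 2 * √(n:ℝ) * ((n:ℝ) ^ (1 / 4 : ℝ) / (1 / 4)) := by gcongr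
      _ = 8 * (√(n:ℝ) * (n:ℝ) ^ (1 / 4 : ℝ)) := by ring
      _ = _ := by rw [h3]
  nlinarith

lemma differentiableAt_LSeries_of_prime_eq_zero {e : ℕ → ℝ} {K : ℝ} {B : Finset ℕ} (hK : 0 ≤ K)
    (he : ∀ m, |e m| ≤ K * vonMangoldt m) (h0 : ∀ r, r.Prime → r ∉ B → e r = 0) {s : ℂ}
    (hs : 3 / 4 < s.re) : DifferentiableAt ℂ (LSeries (fun m => (e m : ℂ))) s := by
  refine (LSeries_hasDerivAt ?_).differentiableAt
  refine lt_of_le_of_lt (LSeries.abscissaOfAbsConv_le_of_forall_lt_LSeriesSummable (x := 3 / 4) fun y hy => ?_)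
    (by exact_mod_cast hs)
  exact LSeriesSummable_of_prime_eq_zero hK he h0 (by simpa using hy)

lemma sub_mul_deriv_of_eventuallyEq {f u : ℂ → ℂ} {ρ : ℂ} {l : ℕ} (hu : AnalyticAt ℂ u ρ)
    (h : ∀ᶠ z in 𝓝 ρ, f z = (z - ρ) ^ l • u z) :
    ∀ᶠ z in 𝓝 ρ, (z - ρ) * deriv f z = (z - ρ) ^ l * (l * u z + (z - ρ) * deriv u z) := by
  filter_upwards [h.eventually_nhds, hu.eventually_analyticAt] with z hz hz2
  have hd : HasDerivAt (fun z => (z - ρ) ^ l * u z)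
      (l * (z - ρ) ^ (l - 1) * u z + (z - ρ) ^ l * deriv u z) z := by
    have h1 : HasDerivAt (fun z => (z - ρ) ^ l) (l * (z - ρ) ^ (l - 1)) z := by
      simpa using ((hasDerivAt_id z).sub_const ρ).fun_pow l
    exact h1.mul hz2.differentiableAt.hasDerivAt
  rw [Filter.EventuallyEq.deriv_eq (show f =ᶠ[𝓝 z] fun z => (z - ρ) ^ l * u z from hz), hd.deriv]
  rcases l with _ | l
  · simp
  · rw [Nat.add_sub_cancel, pow_succ]
    ring

/-- If `2 i f₂'/f₂ - f'/f` has no pole at a zero `ρ` of `f`, then `ρ` is not a simple zero of `f`. -/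
lemma deriv_eq_zero_of_even_logDeriv {f f₂ a : ℂ → ℂ} {ρ : ℂ} (i : ℕ) (hf : AnalyticAt ℂ f ρ)
    (hf₂ : AnalyticAt ℂ f₂ ρ) (ha : ContinuousAt a ρ) (h0 : ¬ ∀ᶠ z in 𝓝 ρ, f₂ z = 0)
    (h : ∀ᶠ z in 𝓝 ρ, 2 * i * deriv f₂ z * f z - deriv f z * f₂ z = a z * (f z * f₂ z))
    (hρ : f ρ = 0) : deriv f ρ = 0 := by
  by_cases hf0 : ∀ᶠ z in 𝓝 ρ, f z = 0
  · rw [Filter.EventuallyEq.deriv_eq (show f =ᶠ[𝓝 ρ] fun _ => (0:ℂ) from hf0), deriv_const]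
  obtain ⟨j, v, hv, hvρ, hve⟩ := (hf₂.exists_eventuallyEq_pow_smul_nonzero_iff).2 h0
  obtain ⟨l, u, hu, huρ, hue⟩ := (hf.exists_eventuallyEq_pow_smul_nonzero_iff).2 hf0
  have hev : ∀ᶠ z in 𝓝[≠] ρ, 2 * i * (j * v z + (z - ρ) * deriv v z) * u z
      - (l * u z + (z - ρ) * deriv u z) * v z - a z * (z - ρ) * u z * v z = 0 := by
    filter_upwards [(sub_mul_deriv_of_eventuallyEq hv hve).filter_mono nhdsWithin_le_nhds,
      (sub_mul_deriv_of_eventuallyEq hu hue).filter_mono nhdsWithin_le_nhds,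
      h.filter_mono nhdsWithin_le_nhds, hve.filter_mono nhdsWithin_le_nhds,
      hue.filter_mono nhdsWithin_le_nhds, self_mem_nhdsWithin] with z h1 h2 h3 h4 h5 h6
    have hw : (z - ρ) ^ (l + j) ≠ 0 := pow_ne_zero _ (sub_ne_zero.2 h6)
    refine mul_left_cancel₀ hw ?_
    rw [smul_eq_mul] at h4 h5
    have h3' := congrArg (fun t => (z - ρ) * t) h3
    rw [mul_zero, pow_add]
    have e1 : (z - ρ) * (2 * i * deriv f₂ z * f z - deriv f z * f₂ z)
        = 2 * i * ((z - ρ) * deriv f₂ z) * f z - ((z - ρ) * deriv f z) * f₂ z := by ring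
    rw [e1, h1, h2, h4, h5] at h3'
    linear_combination h3'
  have hc : ContinuousAt (fun z => 2 * i * (j * v z + (z - ρ) * deriv v z) * u z
      - (l * u z + (z - ρ) * deriv u z) * v z - a z * (z - ρ) * u z * v z) ρ := by
    have := hv.continuousAt; have := hu.continuousAt
    have := hv.deriv.continuousAt; have := hu.deriv.continuousAt
    fun_prop
  have hz : (fun z => 2 * i * (j * v z + (z - ρ) * deriv v z) * u z
      - (l * u z + (z - ρ) * deriv u z) * v z - a z * (z - ρ) * u z * v z) ρ = 0 := by
    refine tendsto_nhds_unique (hc.tendsto.mono_left (nhdsWithin_le_nhds (s := {ρ}ᶜ))) ?_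
    exact (tendsto_const_nhds (x := (0:ℂ))).congr' (hev.mono fun z hz => hz.symm)
  simp only [sub_self, zero_mul, add_zero, mul_zero, sub_zero] at hz
  have hl : (2 * i * j : ℂ) = l := by
    have : (2 * i * j - l : ℂ) * (u ρ * v ρ) = 0 := by linear_combination hz
    exact sub_eq_zero.1 ((mul_eq_zero.1 this).resolve_right (mul_ne_zero huρ hvρ))
  have hl' : 2 * i * j = l := by exact_mod_cast hl
  have hl0 : l ≠ 0 := by
    rintro rfl
    have := hue.self_of_nhds
    rw [hρ, pow_zero, one_smul] at this
    exact huρ this.symm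
  have hd : HasDerivAt (fun z => (z - ρ) ^ l * u z) _ ρ :=
    (((hasDerivAt_id ρ).sub_const ρ).pow l).mul hu.differentiableAt.hasDerivAt
  rw [Filter.EventuallyEq.deriv_eq (show f =ᶠ[𝓝 ρ] fun z => (z - ρ) ^ l * u z from hue), hd.deriv]
  have h1 : l ≠ 1 := by rintro rfl; rw [mul_assoc] at hl'; omega
  simp [sub_self, zero_pow hl0, zero_pow (show l - 1 ≠ 0 by omega)]

/-- If, up to primes in residue classes and negligible terms, the coefficients of `f` agree with an
even multiple of those of another zeta-like function, then `f` has no zero very close to `1`. -/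
theorem ZetaLike.ne_zero_of_residual {q : ℕ} [NeZero q] {S : Finset (ZMod q)}
    (hS : ∀ a ∈ S, IsUnit a) {f f₂ : ℂ → ℂ} {Λ Λ₂ : ℕ → ℝ} {R M Q R₂ M₂ Q₂ : ℝ}
    (h : ZetaLike f Λ R M Q) (h₂ : ZetaLike f₂ Λ₂ R₂ M₂ Q₂) (hR : R ≤ R₂) (hf1 : f 1 ≠ 0)
    (hMQ : 80 * (q.totient * (6 + Real.log q)) * (1 + Real.log Q) ≤ Q)
    (hqQ : 24 * (q:ℝ) ^ (21 / 20 : ℝ) ≤ Q) (i : ℕ) (k : ℝ) {K : ℝ} {B : Finset ℕ} (hK : 0 ≤ K)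
    (he : ∀ m, |2 * i * Λ₂ m - Λ m - k * (if (m : ZMod q) ∈ S then vonMangoldt m else 0)|
      ≤ K * vonMangoldt m)
    (h0 : ∀ r, r.Prime → r ∉ B →
      2 * i * Λ₂ r - Λ r - k * (if (r : ZMod q) ∈ S then vonMangoldt r else 0) = 0) {ρ : ℂ}
    (hρ : ‖ρ - 1‖ < 1 / (10 ^ 4 * Q)) : f ρ ≠ 0 := by
  intro hfρ
  have hQ := h.Q_ge
  have hR0 := h.R_pos
  obtain ⟨c, g, hg, hcg⟩ := DirichletCharacter.exists_differentiableOn_classes hS hMQ hqQ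
  set δ : ℝ := 1 / (10 ^ 4 * Q) with hδ
  have hδ0 : 0 < δ := by positivity
  have hδR : δ ≤ R := by
    have := h.inv_R_le
    rw [div_le_iff₀ hR0] at this
    rw [hδ, div_le_iff₀ (by positivity)]
    nlinarith
  have hδ4 : δ < 1 / 4 := by
    rw [hδ, div_lt_div_iff₀ (by positivity) (by norm_num)]; linarith
  set e : ℕ → ℝ := fun m => 2 * i * Λ₂ m - Λ m - k * (if (m : ZMod q) ∈ S then vonMangoldt m else 0)
    with hedef
  set b : ℕ → ℝ := fun m => if (m : ZMod q) ∈ S then vonMangoldt m else 0 with hb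
  have hre : ∀ z ∈ Metric.ball (1:ℂ) δ, 1 - δ < z.re := by
    intro z hz
    have := (abs_lt.1 ((abs_re_le_norm (z - 1)).trans_lt (mem_ball_iff_norm.1 hz))).1
    rw [sub_re, one_re] at this; linarith
  have hfd : ∀ z ∈ Metric.ball (1:ℂ) δ, AnalyticAt ℂ f z := fun z hz =>
    h.diff.analyticAt (ZetaLike.isOpen_dom.mem_nhds (by
      change 1 - 2 * R < z.re; linarith [hre z hz]))
  have hf₂d : ∀ z ∈ Metric.ball (1:ℂ) δ, AnalyticAt ℂ f₂ z := fun z hz =>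
    h₂.diff.analyticAt (ZetaLike.isOpen_dom.mem_nhds (by
      change 1 - 2 * R₂ < z.re; linarith [hre z hz]))
  have hEd : ∀ z ∈ Metric.ball (1:ℂ) δ, DifferentiableAt ℂ (LSeries (fun m => (e m : ℂ))) z :=
    fun z hz => differentiableAt_LSeries_of_prime_eq_zero hK he h0 (by linarith [hre z hz])
  have hgd : ∀ z ∈ Metric.ball (1:ℂ) δ, DifferentiableAt ℂ g z := fun z hz =>
    (hg z hz).differentiableAt (Metric.isOpen_ball.mem_nhds hz)
  set G : ℂ → ℂ := fun s => -(k * g s) - LSeries (fun m => (e m : ℂ)) s with hG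
  have hGd : ∀ z ∈ Metric.ball (1:ℂ) δ, DifferentiableAt ℂ G z := fun z hz =>
    (((hgd z hz).const_mul _).neg).sub (hEd z hz)
  have hLS : ∀ s : ℂ, 1 < s.re → LSeries (fun m => (e m : ℂ)) s
      = 2 * i * LSeries (fun m => (Λ₂ m : ℂ)) s - LSeries (fun m => (Λ m : ℂ)) s
        - k * LSeries (fun m => (b m : ℂ)) s := by
    intro s hs
    have h1 := h₂.summable s hs
    have h2 := h.summable s hs
    have h3 : LSeriesSummable (fun m => (b m : ℂ)) s := by
      refine Summable.of_norm_bounded (ArithmeticFunction.LSeriesSummable_vonMangoldt hs).norm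
        fun m => LSeries.norm_term_le s ?_
      rw [hb, norm_real, norm_real]
      by_cases hm : (m : ZMod q) ∈ S <;> simp [hm]
    rw [← LSeries_smul, ← LSeries_smul, ← LSeries_sub ((h1.smul _)) h2, ← LSeries_sub ((h1.smul _).sub h2) (h3.smul _)]
    refine LSeries_congr (fun {m} _ => ?_) s
    simp only [hedef, hb, ofReal_sub, ofReal_mul, ofReal_ofNat, ofReal_natCast, Pi.sub_apply,
      Pi.smul_apply, smul_eq_mul]
  set c₁ : ℂ := 2 * i - 1 - k * c with hc₁
  have key : ∀ z ∈ Metric.ball (1:ℂ) δ, (z - 1) * (2 * i * deriv f₂ z * f z - deriv f z * f₂ z)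
      = (c₁ + (z - 1) * G z) * (f z * f₂ z) := by
    have ha1 : AnalyticOnNhd ℂ (fun z => (z - 1) * (2 * i * deriv f₂ z * f z - deriv f z * f₂ z))
        (Metric.ball (1:ℂ) δ) := fun z hz => by
      have := hfd z hz; have := hf₂d z hz
      have := (hfd z hz).deriv; have := (hf₂d z hz).deriv
      fun_prop
    have ha2 : AnalyticOnNhd ℂ (fun z => (c₁ + (z - 1) * G z) * (f z * f₂ z))
        (Metric.ball (1:ℂ) δ) := fun z hz => by
      have := hfd z hz; have := hf₂d z hz
      have : AnalyticAt ℂ G z := DifferentiableOn.analyticAt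
        (fun w hw => (hGd w hw).differentiableWithinAt) (Metric.isOpen_ball.mem_nhds hz)
      fun_prop
    have hpt : ((1 + δ / 2 : ℝ) : ℂ) ∈ Metric.ball (1:ℂ) δ := by
      rw [mem_ball_iff_norm, ← ofReal_one, ← ofReal_sub, norm_real, add_sub_cancel_left,
        Real.norm_of_nonneg (by positivity)]
      linarith
    refine fun z hz => ha1.eqOn_of_preconnected_of_eventuallyEq ha2
      (convex_ball (1:ℂ) δ).isPreconnected hpt ?_ hz
    have hV : IsOpen {s : ℂ | 1 < s.re} := isOpen_lt continuous_const continuous_re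
    refine Filter.mem_of_superset (hV.mem_nhds (x := ((1 + δ / 2 : ℝ) : ℂ)) ?_) fun s hs => ?_
    · change 1 < ((1 + δ / 2 : ℝ) : ℂ).re
      rw [ofReal_re]; linarith
    · have hs' : 1 < s.re := hs
      have hs1 : s - 1 ≠ 0 := by
        intro h'
        rw [sub_eq_zero.1 h', one_re] at hs'
        exact lt_irrefl _ hs'
      have e1 := h.logDeriv s hs'
      have e2 := h₂.logDeriv s hs'
      rw [div_eq_iff (h.ne_zero s hs')] at e1
      rw [div_eq_iff (h₂.ne_zero s hs')] at e2
      change (s - 1) * (2 * i * deriv f₂ s * f s - deriv f s * f₂ s)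
        = (c₁ + (s - 1) * G s) * (f s * f₂ s)
      rw [e1, e2, hG]
      simp only
      rw [hLS s hs', hcg s hs', hc₁]
      field_simp
      ring
  have hρ' : ρ ∈ Metric.ball (1:ℂ) δ := mem_ball_iff_norm.2 hρ
  have hρ1 : ρ ≠ 1 := by rintro rfl; exact hf1 hfρ
  have hd := deriv_eq_zero_of_even_logDeriv (a := fun z => c₁ / (z - 1) + G z) i (hfd ρ hρ') (hf₂d ρ hρ')
    ?_ ?_ ?_ hfρ
  · exact h.zeros_near_one hρ.le hρ.le hfρ hfρ (Or.inr ⟨hd, rfl⟩)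
  · exact (continuousAt_const.div (continuousAt_id.sub continuousAt_const) (sub_ne_zero.2 hρ1)).add
      (hGd ρ hρ').continuousAt
  · intro hz
    have hfa : AnalyticOnNhd ℂ f₂ (Metric.ball (1:ℂ) δ) := hf₂d
    have hz0 := hfa.eqOn_zero_of_preconnected_of_eventuallyEq_zero
      (convex_ball (1:ℂ) δ).isPreconnected hρ' hz
    have hpt : ((1 + δ / 2 : ℝ) : ℂ) ∈ Metric.ball (1:ℂ) δ := by
      rw [mem_ball_iff_norm, ← ofReal_one, ← ofReal_sub, norm_real, add_sub_cancel_left,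
        Real.norm_of_nonneg (by positivity)]
      linarith
    exact h₂.ne_zero _ (by rw [ofReal_re]; linarith) (hz0 hpt)
  · filter_upwards [Metric.isOpen_ball.mem_nhds hρ', isOpen_ne.mem_nhds hρ1] with z hz hz1
    have hz1' : z - 1 ≠ 0 := sub_ne_zero.2 hz1
    refine mul_left_cancel₀ hz1' ?_
    rw [key z hz]
    field_simp

end

section
open NumberField NumberField.mixedEmbedding Module
open scoped NNReal

namespace NumberField
variable {K : Type*} [Field K] [NumberField K]

/-- The covering radius of the lattice of integers is controlled by any family of integers
spanning the field. -/
theorem coverRadius_of_span {ι : Type*} [Fintype ι] {ω : ι → 𝓞 K} {T : ℝ≥0}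
    (hω : Submodule.span ℚ (Set.range fun i => (ω i : K)) = ⊤)
    (hT : ∀ w : InfinitePlace K, ∑ i, w (ω i : K) < T) : CoverRadius K T := by
  intro v
  have hK : ∀ a : K, mixedEmbedding K a ∈
      Submodule.span ℝ (Set.range fun i => mixedEmbedding K (ω i : K)) := fun a => by
    have ha : a ∈ Submodule.span ℚ (Set.range fun i => (ω i : K)) := hω ▸ Submodule.mem_top
    obtain ⟨c, rfl⟩ := (Submodule.mem_span_range_iff_exists_fun ℚ).1 ha
    rw [map_sum]
    refine Submodule.sum_mem _ fun i _ => ?_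
    rw [map_rat_smul, ← Rat.cast_smul_eq_qsmul ℝ]
    exact Submodule.smul_mem _ _ (Submodule.subset_span ⟨i, rfl⟩)
  have hv : v ∈ Submodule.span ℝ (Set.range fun i => mixedEmbedding K (ω i : K)) := by
    rw [← (latticeBasis K).sum_repr v]
    refine Submodule.sum_mem _ fun i _ => Submodule.smul_mem _ _ ?_
    rw [latticeBasis_apply]
    exact hK _
  obtain ⟨c, rfl⟩ := (Submodule.mem_span_range_iff_exists_fun ℝ).1 hv
  refine ⟨∑ i, ⌊c i⌋ • ω i, fun w => lt_of_le_of_lt ?_ (hT w)⟩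
  have h1 : ∑ i, c i • mixedEmbedding K (ω i : K) - mixedEmbedding K ((∑ i, ⌊c i⌋ • ω i : 𝓞 K) : K)
      = ∑ i, Int.fract (c i) • mixedEmbedding K (ω i : K) := by
    have hc : ((∑ i, ⌊c i⌋ • ω i : 𝓞 K) : K) = ∑ i, ⌊c i⌋ • (ω i : K) := by
      refine (map_sum (algebraMap (𝓞 K) K) _ _).trans ?_
      exact Finset.sum_congr rfl fun i _ => map_zsmul (algebraMap (𝓞 K) K) _ _
    rw [hc, map_sum, ← Finset.sum_sub_distrib]
    refine Finset.sum_congr rfl fun i _ => ?_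
    rw [map_zsmul, ← Int.cast_smul_eq_zsmul ℝ, ← sub_smul]
    rfl
  rw [h1]
  have h2 : ∀ s : Finset ι, normAtPlace w (∑ i ∈ s, Int.fract (c i) • mixedEmbedding K (ω i : K))
      ≤ ∑ i ∈ s, w (ω i : K) := fun s => by
    induction s using Finset.induction_on with
    | empty => simp
    | insert i s hi ih =>
      rw [Finset.sum_insert hi, Finset.sum_insert hi]
      refine (normAtPlace_add_le w _ _).trans (add_le_add ?_ ih)
      rw [normAtPlace_smul, normAtPlace_apply, abs_of_nonneg (Int.fract_nonneg _)]
      exact mul_le_of_le_one_left (apply_nonneg w _) (Int.fract_lt_one _).le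
  exact h2 _

variable (K) in
lemma exists_coverRadius : ∃ T : ℝ≥0, 1 ≤ T ∧ CoverRadius K T := by
  set S : ℝ := ∑ w : InfinitePlace K, ∑ i, w (RingOfIntegers.basis K i : K) with hS
  have h0 : ∀ w : InfinitePlace K, 0 ≤ ∑ i, w (RingOfIntegers.basis K i : K) := fun w =>
    Finset.sum_nonneg fun i _ => apply_nonneg w _
  have hS0 : 0 ≤ S := Finset.sum_nonneg fun w _ => h0 w
  refine ⟨(S + 1).toNNReal, ?_, coverRadius_of_span (ω := RingOfIntegers.basis K) ?_ fun w => ?_⟩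
  · rw [Real.one_le_toNNReal]
    linarith
  · have h : (fun i => (RingOfIntegers.basis K i : K)) = integralBasis K := by
      ext i; rw [integralBasis_apply]
    rw [h, Basis.span_eq]
  · have := Finset.single_le_sum (f := fun w : InfinitePlace K => ∑ i, w (RingOfIntegers.basis K i : K))
      (fun w _ => h0 w) (Finset.mem_univ w)
    rw [Real.coe_toNNReal _ (by positivity)]
    linarith

end NumberField
end

section
open NumberField Module

/-- A ring homomorphism to an algebraically closed field extends along integral extensions. -/
lemma exists_ringHom_extension {A B Ω : Type*} [CommRing A] [CommRing B] [Field Ω] [IsAlgClosed Ω]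
    [Algebra A B] [Algebra.IsIntegral A B] (hinj : Function.Injective (algebraMap A B))
    (ψ : A →+* Ω) : ∃ φ : B →+* Ω, φ.comp (algebraMap A B) = ψ := by
  have : (RingHom.ker ψ).IsPrime := RingHom.ker_isPrime ψ
  obtain ⟨Q, -, hQ, hQ'⟩ := Ideal.exists_ideal_over_prime_of_isIntegral (S := B) (RingHom.ker ψ) ⊥
    (by rw [← RingHom.ker_eq_comap_bot, (RingHom.injective_iff_ker_eq_bot _).1 hinj]; exact bot_le)
  let f : A ⧸ RingHom.ker ψ →+* Ω := RingHom.kerLift ψ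
  let : Algebra (A ⧸ RingHom.ker ψ) Ω := f.toAlgebra
  let g : A ⧸ RingHom.ker ψ →+* B ⧸ Q := Ideal.quotientMap Q (algebraMap A B) hQ'.ge
  let : Algebra (A ⧸ RingHom.ker ψ) (B ⧸ Q) := g.toAlgebra
  have hg : Function.Injective g := Ideal.quotientMap_injective' hQ'.le
  have hf : Function.Injective f := RingHom.kerLift_injective ψ
  have : Module.IsTorsionFree (A ⧸ RingHom.ker ψ) Ω :=
    Module.isTorsionFree_iff_algebraMap_injective.2 hf
  have : Module.IsTorsionFree (A ⧸ RingHom.ker ψ) (B ⧸ Q) :=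
    Module.isTorsionFree_iff_algebraMap_injective.2 hg
  have : Algebra.IsIntegral (A ⧸ RingHom.ker ψ) (B ⧸ Q) := ⟨fun x => by
    obtain ⟨b, rfl⟩ := Ideal.Quotient.mk_surjective x
    obtain ⟨p, hp, hp'⟩ := Algebra.IsIntegral.isIntegral (R := A) b
    refine ⟨p.map (Ideal.Quotient.mk _), hp.map _, ?_⟩
    rw [Polynomial.eval₂_map]
    have h : (algebraMap (A ⧸ RingHom.ker ψ) (B ⧸ Q)).comp (Ideal.Quotient.mk _)
        = (Ideal.Quotient.mk Q).comp (algebraMap A B) := RingHom.ext fun a => rfl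
    rw [h, ← Polynomial.hom_eval₂, hp', map_zero]⟩
  let F : B ⧸ Q →ₐ[A ⧸ RingHom.ker ψ] Ω := IsAlgClosed.lift
  refine ⟨(F : B ⧸ Q →+* Ω).comp (Ideal.Quotient.mk Q), RingHom.ext fun a => ?_⟩
  exact F.commutes (Ideal.Quotient.mk _ a)

/-- If two homomorphisms to a domain agree on the invariants of a finite group, acting freely on
the orbit of the first, then they are conjugate. -/
lemma exists_smul_of_eq_on_invariants {G B Ω : Type*} [Group G] [Finite G] [CommRing B]
    [MulSemiringAction G B] [Field Ω] {x y : B →+* Ω}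
    (h : ∀ b : B, (∀ g : G, g • b = b) → x b = y b)
    (hfree : ∀ g : G, (∀ b, x (g • b) = x b) → g = 1) : ∃ g : G, ∀ b, y b = x (g • b) := by
  by_contra hne
  rw [not_exists] at hne
  have := Fintype.ofFinite G
  let F : G ⊕ G → (B →* Ω) := Sum.elim
    (fun g => (x : B →* Ω).comp (MulSemiringAction.toRingHom G B g : B →* B))
    (fun g => (y : B →* Ω).comp (MulSemiringAction.toRingHom G B g : B →* B))
  have hx : ∀ (g g' : G), (∀ b, x (g • b) = x (g' • b)) → g = g' := fun g g' hgg => by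
    have := hfree (g * g'⁻¹) fun b => by rw [mul_smul, hgg, smul_inv_smul]
    exact mul_inv_eq_one.1 this
  set c : (B →* Ω) →₀ Ω := ∑ g : G, (Finsupp.single (F (Sum.inl g)) 1 - Finsupp.single (F (Sum.inr g)) 1)
    with hc
  have hc0 : c = 0 := by
    refine (linearIndependent_iff.1 (linearIndependent_monoidHom B Ω)) c (funext fun b => ?_)
    rw [hc, map_sum, Finset.sum_apply]
    simp only [map_sub, Finsupp.linearCombination_single, one_smul, Pi.sub_apply,
      Finset.sum_sub_distrib, Pi.zero_apply]
    have := h (∑ g : G, g • b) fun g => by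
      rw [Finset.smul_sum]
      exact Fintype.sum_equiv (Equiv.mulLeft g) _ _ fun g' => (mul_smul g g' b).symm
    rw [map_sum, map_sum] at this
    exact sub_eq_zero.2 this
  have h1 : c (F (Sum.inl 1)) = 1 := by
    rw [hc, Finsupp.finsetSum_apply]
    rw [Finset.sum_eq_single 1]
    · rw [Finsupp.sub_apply, Finsupp.single_eq_same, Finsupp.single_eq_of_ne, sub_zero]
      intro h'
      refine hne 1 fun b => ?_
      have := DFunLike.congr_fun h' b
      simpa [F] using this.symm
    · intro g _ hg
      rw [Finsupp.sub_apply, Finsupp.single_eq_of_ne, Finsupp.single_eq_of_ne, sub_zero]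
      · intro h'
        refine hne g⁻¹ fun b => ?_
        have := DFunLike.congr_fun h' (g⁻¹ • b)
        simpa [F] using this.symm
      · intro h'
        refine hg (hx _ _ fun b => ?_)
        have := DFunLike.congr_fun h' b
        simpa [F] using this.symm
    · exact fun h' => absurd (Finset.mem_univ _) h'
  rw [hc0] at h1
  exact zero_ne_one h1

namespace NumberField
variable {F : Type*} [Field F]

/-- The homomorphisms from the ring of integers of `F` to `Ω` with values in the fixed points of
`z ↦ z ^ r`. -/
def FrobFixed (F : Type*) [Field F] (Ω : Type*) [Field Ω] (r : ℕ) : Type _ :=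
  {ψ : 𝓞 F →+* Ω // ∀ a, ψ a ^ r = ψ a}

lemma FrobFixed.exists_natCast {Ω : Type*} [Field Ω] {r : ℕ} [Fact r.Prime] [CharP Ω r]
    (ψ : FrobFixed F Ω r) (a : 𝓞 F) : ∃ m : ℕ, ψ.1 a = m := by
  have h := (Subfield.mem_bot_iff_pow_eq_self Ω r).2 (ψ.2 a)
  have h2 : (⊥ : Subfield Ω) ≤ (ZMod.castHom (dvd_refl r) Ω).fieldRange := bot_le
  obtain ⟨z, hz⟩ := h2 h
  exact ⟨z.val, by rw [← hz, ← ZMod.natCast_zmod_val z, map_natCast, ZMod.natCast_zmod_val]⟩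

variable [NumberField F]

/-- Primes of degree one over `r` correspond to homomorphisms to the prime field. -/
theorem card_filter_absNorm_eq {Ω : Type*} [Field Ω] {r : ℕ} [Fact r.Prime] [CharP Ω r] :
    ((primesUpTo F r).filter fun P => Ideal.absNorm P = r).card = Nat.card (FrobFixed F Ω r) := by
  have hr : r.Prime := Fact.out
  rw [← Nat.card_eq_finsetCard]
  symm
  refine Nat.card_eq_of_bijective (fun ψ : FrobFixed F Ω r => ⟨RingHom.ker ψ.1, ?_⟩) ⟨?_, ?_⟩
  · have hc : Ideal.absNorm (RingHom.ker ψ.1) = r := by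
      rw [Ideal.absNorm_apply, Submodule.cardQuot_apply]
      have hb : Function.Bijective (fun z : ZMod r =>
          (Ideal.Quotient.mk (RingHom.ker ψ.1) (z.val : 𝓞 F))) := by
        refine ⟨fun z z' h => ?_, fun y => ?_⟩
        · have h' := Ideal.Quotient.eq.1 h
          rw [RingHom.mem_ker, map_sub, map_natCast, map_natCast, sub_eq_zero,
            CharP.natCast_eq_natCast (R := Ω) r, ← ZMod.natCast_eq_natCast_iff] at h'
          simpa using h'
        · obtain ⟨a, rfl⟩ := Ideal.Quotient.mk_surjective y
          obtain ⟨m, hm⟩ := ψ.exists_natCast a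
          refine ⟨m, Ideal.Quotient.eq.2 ?_⟩
          rw [RingHom.mem_ker, map_sub, map_natCast, hm, sub_eq_zero, CharP.natCast_eq_natCast (R := Ω) r,
            ← ZMod.natCast_eq_natCast_iff]
          simp
      rw [← Nat.card_eq_of_bijective _ hb, Nat.card_zmod]
    rw [Finset.mem_filter, mem_primesUpTo]
    refine ⟨⟨hc.le, Ideal.prime_of_isPrime ?_ (RingHom.ker_isPrime _)⟩, hc⟩
    intro h
    rw [h, Ideal.absNorm_bot] at hc
    exact hr.ne_zero hc.symm
  · intro ψ ψ' h
    have h' : RingHom.ker ψ.1 = RingHom.ker ψ'.1 := congrArg Subtype.val h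
    refine Subtype.ext (RingHom.ext fun a => ?_)
    obtain ⟨m, hm⟩ := ψ.exists_natCast a
    have : a - m ∈ RingHom.ker ψ'.1 := by
      rw [← h', RingHom.mem_ker, map_sub, hm, map_natCast, sub_self]
    rw [RingHom.mem_ker, map_sub, map_natCast, sub_eq_zero] at this
    rw [hm, this]
  · rintro ⟨P, hP⟩
    obtain ⟨hP1, hP2⟩ := Finset.mem_filter.1 hP
    have hc : Nat.card (𝓞 F ⧸ P) = r := by
      rw [← hP2, Ideal.absNorm_apply, Submodule.cardQuot_apply]
    have : Finite (𝓞 F ⧸ P) := Nat.finite_of_card_ne_zero (by rw [hc]; exact hr.ne_zero)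
    have := Fintype.ofFinite (𝓞 F ⧸ P)
    let e := ZMod.ringEquivOfPrime (𝓞 F ⧸ P) hr (by rw [← Nat.card_eq_fintype_card, hc])
    let φ : 𝓞 F →+* ZMod r := (e.symm : 𝓞 F ⧸ P →+* ZMod r).comp (Ideal.Quotient.mk P)
    refine ⟨⟨(ZMod.castHom (dvd_refl r) Ω).comp φ, fun a => ?_⟩, Subtype.ext (Ideal.ext fun a => ?_)⟩
    · rw [RingHom.comp_apply, ← map_pow, ZMod.pow_card]
    · rw [RingHom.mem_ker, RingHom.comp_apply, map_eq_zero, RingHom.comp_apply, RingHom.coe_coe,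
        map_eq_zero_iff _ e.symm.injective, Ideal.Quotient.eq_zero_iff_mem]

theorem fieldMangoldt_prime {Ω : Type*} [Field Ω] {r : ℕ} [Fact r.Prime] [CharP Ω r] :
    fieldMangoldt F r = Nat.card (FrobFixed F Ω r) * Real.log r := by
  have hr : r.Prime := Fact.out
  rw [← card_filter_absNorm_eq, fieldMangoldt, ← nsmul_eq_mul, ← Finset.sum_const, Finset.sum_filter]
  refine Finset.sum_congr rfl fun P hP => ?_
  rw [Finset.sum_eq_single 1]
  · rw [pow_one]
    split_ifs with h
    · rw [h]
    · rfl
  · intro k hk hk1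
    refine if_neg fun h => ?_
    rw [← h] at hr
    exact hr.not_prime_pow' hk1
  · exact fun h => absurd (Finset.mem_Icc.2 ⟨le_rfl, hr.one_le⟩) h

end NumberField

end

section
open NumberField Module

namespace NumberField
variable {L : Type*} [Field L]

lemma coe_gal_smul [NumberField L] (g : L ≃ₐ[ℚ] L) (b : 𝓞 L) : ((g • b : 𝓞 L) : L) = g (b : L) := rfl

lemma exists_ringOfIntegers_of_mem_range {F : Type*} [Field F] [NumberField F] [Algebra F L] {b : 𝓞 L}
    (hb : (b : L) ∈ (algebraMap F L).range) : ∃ a : 𝓞 F, algebraMap (𝓞 F) (𝓞 L) a = b := by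
  obtain ⟨f, hf⟩ := hb
  have hi : IsIntegral ℤ f := by
    rw [← isIntegral_algebraMap_iff (algebraMap F L).injective, hf]
    exact b.isIntegral_coe
  exact ⟨⟨f, hi⟩, RingOfIntegers.ext hf⟩

variable [NumberField L] [IsGalois ℚ L]

/-- Any two homomorphisms to an algebraically closed field are conjugate, when the Galois group
acts freely. -/
lemma exists_gal_smul {Ω : Type*} [Field Ω] {x : 𝓞 L →+* Ω}
    (hfree : ∀ g : L ≃ₐ[ℚ] L, (∀ b, x (g • b) = x b) → g = 1) (y : 𝓞 L →+* Ω) :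
    ∃ g : L ≃ₐ[ℚ] L, ∀ b, y b = x (g • b) := by
  refine exists_smul_of_eq_on_invariants (fun b hb => ?_) hfree
  have h : (b : L) ∈ (algebraMap ℚ L).range := by
    have := (IsGalois.mem_bot_iff_fixed (F := ℚ) (b : L)).2 fun g => by
      rw [← coe_gal_smul, hb]
    exact this
  obtain ⟨q, hq⟩ := h
  have hi : IsIntegral ℤ q := by
    rw [← isIntegral_algebraMap_iff (algebraMap ℚ L).injective, hq]
    exact b.isIntegral_coe
  obtain ⟨m, hm⟩ := IsIntegrallyClosed.isIntegral_iff.1 hi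
  have hb : b = (m : 𝓞 L) := by
    refine RingOfIntegers.ext ?_
    rw [← hq, ← hm]
    simp
  rw [hb, map_intCast, map_intCast]

/-- The number of primes of degree one in a subfield, in terms of a Frobenius element `s`. -/
theorem card_frobFixed_mul {F : Type*} [Field F] [NumberField F] [Algebra F L]
    {H : Subgroup (L ≃ₐ[ℚ] L)}
    (hH : ∀ a : L, (∀ h ∈ H, h a = a) ↔ a ∈ (algebraMap F L).range)
    {Ω : Type*} [Field Ω] [IsAlgClosed Ω] {x : 𝓞 L →+* Ω}
    (hfree : ∀ g : L ≃ₐ[ℚ] L, (∀ b, x (g • b) = x b) → g = 1)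
    {r : ℕ} {s : L ≃ₐ[ℚ] L} (hs : ∀ b, x (s • b) = x b ^ r) :
    Nat.card (FrobFixed F Ω r) * Nat.card H = Nat.card {g : L ≃ₐ[ℚ] L // g⁻¹ * s * g ∈ H} := by
  have hfree' : ∀ g g' : L ≃ₐ[ℚ] L, (∀ b, x (g • b) = x (g' • b)) → g = g' := fun g g' hgg => by
    have := hfree (g * g'⁻¹) fun b => by rw [mul_smul, hgg, smul_inv_smul]
    exact mul_inv_eq_one.1 this
  have hfix : ∀ h ∈ H, ∀ a : 𝓞 F, h • algebraMap (𝓞 F) (𝓞 L) a = algebraMap (𝓞 F) (𝓞 L) a :=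
    fun h hh a => RingOfIntegers.ext ((hH _).2 ⟨(a : F), rfl⟩ h hh)
  have hK : ∀ g g' : L ≃ₐ[ℚ] L,
      (∀ a : 𝓞 F, x (g • algebraMap (𝓞 F) (𝓞 L) a) = x (g' • algebraMap (𝓞 F) (𝓞 L) a)) →
      ∃ h ∈ H, g' = g * h := fun g g' hgg => by
    have key : ∃ h : H, ∀ b : 𝓞 L, x (g' • b) = x (g • h • b) := by
      refine exists_smul_of_eq_on_invariants (G := H)
        (x := x.comp (MulSemiringAction.toRingHom _ (𝓞 L) g))
        (y := x.comp (MulSemiringAction.toRingHom _ (𝓞 L) g')) (fun b hb => ?_) (fun h hh => ?_)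
      · obtain ⟨a, rfl⟩ := exists_ringOfIntegers_of_mem_range (F := F)
          ((hH (b : L)).1 fun h hh => by rw [← coe_gal_smul]; exact congrArg _ (hb ⟨h, hh⟩))
        exact hgg a
      · have := hfree' (g * h) g fun b => by rw [mul_smul]; exact hh b
        exact Subtype.ext (mul_eq_left.1 this)
    obtain ⟨h, hh⟩ := key
    exact ⟨h, h.2, hfree' _ _ fun b => by rw [mul_smul]; exact hh b⟩
  have hψ : ∀ ψ : FrobFixed F Ω r, ∃ g : L ≃ₐ[ℚ] L, ∀ a, ψ.1 a = x (g • algebraMap (𝓞 F) (𝓞 L) a) :=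
    fun ψ => by
      obtain ⟨y, hy⟩ := exists_ringHom_extension (B := 𝓞 L)
        (FaithfulSMul.algebraMap_injective (𝓞 F) (𝓞 L)) ψ.1
      obtain ⟨g, hg⟩ := exists_gal_smul hfree y
      exact ⟨g, fun a => by rw [← hg, ← hy, RingHom.comp_apply]⟩
  choose γ hγ using hψ
  have hs' : ∀ g a, x ((s * g) • algebraMap (𝓞 F) (𝓞 L) a) = x (g • algebraMap (𝓞 F) (𝓞 L) a) ^ r :=
    fun g a => by rw [mul_smul, hs]
  rw [← Nat.card_prod]
  refine Nat.card_eq_of_bijective (fun t => ⟨γ t.1 * t.2, ?_⟩) ⟨?_, ?_⟩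
  · obtain ⟨h, hh, he⟩ := hK (γ t.1) (s * γ t.1) fun a => by rw [hs', ← hγ, t.1.2]
    have : (γ t.1 * t.2)⁻¹ * s * (γ t.1 * t.2) = (t.2 : L ≃ₐ[ℚ] L)⁻¹ * h * t.2 := by
      rw [mul_inv_rev, mul_assoc, mul_assoc, ← mul_assoc s, he]
      group
    rw [this]
    exact H.mul_mem (H.mul_mem (H.inv_mem t.2.2) hh) t.2.2
  · rintro ⟨ψ, h⟩ ⟨ψ', h'⟩ he
    have he' : γ ψ * h = γ ψ' * h' := congrArg Subtype.val he
    have h1 : ψ = ψ' := Subtype.ext (RingHom.ext fun a => by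
      have e1 : ψ.1 a = x ((γ ψ * h) • algebraMap (𝓞 F) (𝓞 L) a) := by
        rw [hγ, mul_smul, hfix h h.2]
      rw [e1, he', hγ, mul_smul, hfix h' h'.2])
    subst h1
    rw [Prod.mk.injEq]
    exact ⟨rfl, Subtype.ext (mul_left_cancel he')⟩
  · rintro ⟨g, hg⟩
    let ψ : FrobFixed F Ω r := ⟨(x.comp (MulSemiringAction.toRingHom _ (𝓞 L) g)).comp
      (algebraMap (𝓞 F) (𝓞 L)), fun a => by
        change x (g • algebraMap (𝓞 F) (𝓞 L) a) ^ r = x (g • algebraMap (𝓞 F) (𝓞 L) a)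
        have e : s * g = g * (g⁻¹ * s * g) := by group
        rw [← hs', e, mul_smul, hfix _ hg]⟩
    obtain ⟨h, hh, he⟩ := hK (γ ψ) g fun a => (hγ ψ a).symm
    exact ⟨(ψ, ⟨h, hh⟩), Subtype.ext he.symm⟩

end NumberField

end

section
open NumberField Module Polynomial

namespace NumberField

lemma ext_algebraMap {L : Type*} [Field L] {a b : 𝓞 L}
    (h : algebraMap (𝓞 L) L a = algebraMap (𝓞 L) L b) : a = b := RingOfIntegers.ext h

lemma exists_algebraMap_eq {L : Type*} [Field L] {a : L} {n : ℕ} (hn : 0 < n)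
    (ha : IsIntegral ℤ (a ^ n)) : ∃ b : 𝓞 L, algebraMap (𝓞 L) L b = a :=
  ⟨⟨a, ha.of_pow hn⟩, rfl⟩

/-- The field `L` is generated by a primitive `n`-th root of unity `ζ` and a `d`-th root `θ` of the
prime `p`, where `d ∣ n`. -/
structure IsKummer {L : Type*} [Field L] [NumberField L] (n d p : ℕ) (ζ θ : L) : Prop where
  n_pos : 0 < n
  d_dvd : d ∣ n
  prim : IsPrimitiveRoot ζ n
  prime : p.Prime
  pow_eq : θ ^ d = p
  adjoin_eq : IntermediateField.adjoin ℚ ({ζ, θ} : Set L) = ⊤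

namespace IsKummer
variable {L : Type*} [Field L] [NumberField L] {n d p : ℕ} {ζ θ : L}

lemma d_pos (h : IsKummer n d p ζ θ) : 0 < d := Nat.pos_of_dvd_of_pos h.d_dvd h.n_pos

lemma gen_ne_zero (h : IsKummer n d p ζ θ) : θ ≠ 0 := fun h0 => by
  have := h.pow_eq
  rw [h0, zero_pow h.d_pos.ne'] at this
  exact h.prime.ne_zero (by exact_mod_cast this.symm)

lemma root_ne_zero (h : IsKummer n d p ζ θ) : ζ ≠ 0 := h.prim.ne_zero h.n_pos.ne'

lemma gal_ext (h : IsKummer n d p ζ θ) {g g' : L ≃ₐ[ℚ] L} (h1 : g ζ = g' ζ) (h2 : g θ = g' θ) :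
    g = g' := by
  refine AlgEquiv.ext fun a => ?_
  have ha : a ∈ IntermediateField.adjoin ℚ ({ζ, θ} : Set L) := by rw [h.adjoin_eq]; trivial
  induction ha using IntermediateField.adjoin_induction with
  | mem y hy =>
    rcases hy with rfl | rfl
    · exact h1
    · exact h2
  | algebraMap y => simp
  | add y z _ _ h3 h4 => simp only [map_add, h3, h4]
  | inv y _ h3 => simp only [map_inv₀, h3]
  | mul y z _ _ h3 h4 => simp only [map_mul, h3, h4]

lemma minpoly_eq (h : IsKummer n d p ζ θ) : minpoly ℚ θ = X ^ d - C (p : ℚ) := by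
  have hd := h.d_pos.ne'
  have hm : (X ^ d - C (p : ℤ)).Monic := monic_X_pow_sub_C _ hd
  have hP : (Ideal.span {(p : ℤ)}).IsPrime :=
    (Ideal.span_singleton_prime (by exact_mod_cast h.prime.ne_zero)).2
      (Nat.prime_iff_prime_int.1 h.prime)
  have hE : (X ^ d - C (p : ℤ)).IsEisensteinAt (Ideal.span {(p : ℤ)}) := by
    refine hm.isEisensteinAt_of_mem_of_notMem hP.ne_top (fun {i} hi => ?_) ?_
    · rw [natDegree_X_pow_sub_C] at hi
      rw [coeff_sub, coeff_X_pow, if_neg hi.ne, zero_sub, coeff_C]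
      split_ifs
      · exact neg_mem (Ideal.mem_span_singleton_self _)
      · simp
    · rw [coeff_sub, coeff_X_pow, if_neg hd.symm, zero_sub, coeff_C_zero, neg_mem_iff,
        Ideal.span_singleton_pow, Ideal.mem_span_singleton]
      rw [pow_two, ← Nat.cast_mul, Int.natCast_dvd_natCast]
      intro hdvd
      have := Nat.le_of_dvd h.prime.pos hdvd
      have := h.prime.two_le
      nlinarith
  have hi : Irreducible (X ^ d - C (p : ℤ)) :=
    hE.irreducible hP hm.isPrimitive (by rw [natDegree_X_pow_sub_C]; exact h.d_pos)
  rw [hm.irreducible_iff_irreducible_map_fraction_map (K := ℚ)] at hi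
  have e : (X ^ d - C (p : ℤ)).map (algebraMap ℤ ℚ) = X ^ d - C (p : ℚ) := by simp
  rw [e] at hi
  refine (minpoly.eq_of_irreducible_of_monic hi ?_ (monic_X_pow_sub_C _ hd)).symm
  simp [h.pow_eq]

lemma exists_gal [IsGalois ℚ L] (h : IsKummer n d p ζ θ) {η : L} (hη : η ^ d = 1) :
    ∃ g : L ≃ₐ[ℚ] L, g θ = η * θ := by
  refine minpoly.exists_algEquiv_of_root' (Algebra.IsAlgebraic.isAlgebraic θ) ?_
  rw [h.minpoly_eq]
  simp [mul_pow, hη, h.pow_eq]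

lemma exists_coe (h : IsKummer n d p ζ θ) :
    ∃ z t : 𝓞 L, algebraMap (𝓞 L) L z = ζ ∧ algebraMap (𝓞 L) L t = θ := by
  obtain ⟨z, hz⟩ := exists_algebraMap_eq h.n_pos (by rw [h.prim.pow_eq_one]; exact isIntegral_one)
  obtain ⟨t, ht⟩ := exists_algebraMap_eq h.d_pos (by
    rw [h.pow_eq]
    exact_mod_cast isIntegral_algebraMap (R := ℤ) (A := L) (x := (p : ℤ)))
  exact ⟨z, t, hz, ht⟩

end IsKummer

/-- Elements with the same `n`-th power are separated by reduction modulo a prime not dividing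
`n`. -/
lemma eq_of_pow_eq_of_map_eq {L : Type*} [Field L] [NumberField L] {Ω : Type*} [Field Ω] {n : ℕ}
    (hn : (n : Ω) ≠ 0) (x : 𝓞 L →+* Ω) {a b : 𝓞 L} (hab : a ^ n = b ^ n) (hb : x b ≠ 0)
    (hx : x a = x b) : a = b := by
  have hn0 : 0 < n := Nat.pos_of_ne_zero fun h0 => hn (by simp [h0])
  have hb0 : (b : L) ≠ 0 := fun h0 => hb (by
    rw [show b = 0 from ext_algebraMap (h0.trans (map_zero _).symm), map_zero])
  have hu : ((a : L) / b) ^ n = 1 := by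
    rw [div_pow, ← map_pow, hab, map_pow, div_self (pow_ne_zero _ hb0)]
  obtain ⟨η, hη⟩ := exists_algebraMap_eq hn0 (by rw [hu]; exact isIntegral_one)
  have h1 : η ^ n = 1 := ext_algebraMap (by rw [map_pow, hη, hu, map_one])
  have h2 : a = η * b := ext_algebraMap (by rw [map_mul, hη, div_mul_cancel₀ _ hb0])
  have h3 : x η = 1 := by
    rw [h2, map_mul] at hx
    exact mul_right_cancel₀ hb (hx.trans (one_mul _).symm)
  have h4 : (η - 1) * ∑ i ∈ Finset.range n, η ^ i = 0 := by
    rw [mul_comm, geom_sum_mul, h1, sub_self]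
  rcases mul_eq_zero.1 h4 with h5 | h5
  · rw [h2, sub_eq_zero.1 h5, one_mul]
  · have := congrArg x h5
    rw [map_sum, map_zero] at this
    simp only [map_pow, h3, one_pow, Finset.sum_const, Finset.card_range, nsmul_eq_mul,
      mul_one] at this
    exact absurd this hn

namespace IsKummer
variable {L : Type*} [Field L] [NumberField L] {n d p : ℕ} {ζ θ : L}
variable {Ω : Type*} [Field Ω]

/-- The Galois group acts freely on the homomorphisms to a field of good characteristic. -/
lemma free (h : IsKummer n d p ζ θ) (hn : (n : Ω) ≠ 0) (hp : (p : Ω) ≠ 0) (x : 𝓞 L →+* Ω)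
    (g : L ≃ₐ[ℚ] L) (hg : ∀ b, x (g • b) = x b) : g = 1 := by
  obtain ⟨z, t, rfl, rfl⟩ := h.exists_coe
  have hz : z ^ n = 1 := ext_algebraMap (by rw [map_pow, h.prim.pow_eq_one, map_one])
  have ht : t ^ d = p := ext_algebraMap (by rw [map_pow, h.pow_eq, map_natCast])
  refine h.gal_ext ?_ ?_
  · refine congrArg (algebraMap (𝓞 L) L) (eq_of_pow_eq_of_map_eq hn x (a := g • z) (b := z) ?_ ?_ (hg z))
    · rw [← smul_pow', hz, smul_one]
    · intro h0
      have := congrArg x hz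
      rw [map_pow, h0, zero_pow h.n_pos.ne', map_one] at this
      exact zero_ne_one this
  · refine congrArg (algebraMap (𝓞 L) L) (eq_of_pow_eq_of_map_eq hn x (a := g • t) (b := t) ?_ ?_ (hg t))
    · obtain ⟨k, hk⟩ := h.d_dvd
      rw [← smul_pow', hk, pow_mul, ht, ← Nat.cast_pow]
      exact map_natCast (MulSemiringAction.toRingHom _ (𝓞 L) g) _
    · intro h0
      have := congrArg x ht
      rw [map_pow, h0, zero_pow h.d_pos.ne', map_natCast] at this
      exact hp this.symm

/-- A root of unity is raised to the power `r` by a Frobenius element. -/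
lemma frob_root (h : IsKummer n d p ζ θ) (hn : (n : Ω) ≠ 0) {x : 𝓞 L →+* Ω} {r : ℕ}
    {s : L ≃ₐ[ℚ] L} (hs : ∀ b, x (s • b) = x b ^ r) {η : L} (hη : η ^ n = 1) : s η = η ^ r := by
  obtain ⟨z, rfl⟩ := exists_algebraMap_eq h.n_pos (by rw [hη]; exact isIntegral_one)
  have hz : z ^ n = 1 := ext_algebraMap (by rw [map_pow, hη, map_one])
  refine congrArg (algebraMap (𝓞 L) L) (eq_of_pow_eq_of_map_eq hn x (a := s • z) (b := z ^ r) ?_ ?_ ?_)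
  · rw [← smul_pow', hz, smul_one, ← pow_mul, mul_comm, pow_mul, hz, one_pow]
  · intro h0
    rw [map_pow] at h0
    have := congrArg x hz
    rw [map_pow, eq_zero_of_pow_eq_zero h0, zero_pow h.n_pos.ne', map_one] at this
    exact zero_ne_one this
  · rw [hs, map_pow]

end IsKummer
end NumberField
end

section
open NumberField Module

lemma CharP.pow_eq_one_iff_zmod {Ω : Type*} [Field Ω] {r : ℕ} [CharP Ω r] (p m : ℕ) :
    (p : Ω) ^ m = 1 ↔ (p : ZMod r) ^ m = 1 := by
  have h1 := CharP.natCast_eq_natCast (R := Ω) (p := r) (a := p ^ m) (b := 1)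
  have h2 := CharP.natCast_eq_natCast (R := ZMod r) (p := r) (a := p ^ m) (b := 1)
  push_cast at h1 h2
  rw [h1, h2]

lemma ZMod.dvd_sub_one_div_orderOf_iff {r : ℕ} [Fact r.Prime] {a : ZMod r} (ha : a ≠ 0) {d m : ℕ}
    (hd : 0 < d) (hm : r - 1 = d * m) : d ∣ (r - 1) / orderOf a ↔ a ^ m = 1 := by
  have h1 : orderOf a ∣ r - 1 := orderOf_dvd_of_pow_eq_one (ZMod.pow_card_sub_one_eq_one ha)
  rw [Nat.dvd_div_iff_mul_dvd h1, hm, mul_comm, Nat.mul_dvd_mul_iff_left hd,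
    orderOf_dvd_iff_pow_eq_one]

namespace NumberField
variable {L : Type*} [Field L] [NumberField L] {n p : ℕ} {Ω : Type*} [Field Ω]

/-- A Frobenius element fixes the `k`-th root `b` of `p` iff `p` is a `k`-th power residue. -/
lemma frob_fix_iff (hn : (n : Ω) ≠ 0) (hp : (p : Ω) ≠ 0)
    {x : 𝓞 L →+* Ω} {r : ℕ} {s : L ≃ₐ[ℚ] L} (hs : ∀ b, x (s • b) = x b ^ r) (hr : 0 < r)
    {b : L} {k m : ℕ} (hk : 0 < k) (hkn : k ∣ n) (hb : b ^ k = p) (hm : r - 1 = k * m) :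
    s b = b ↔ (p : Ω) ^ m = 1 := by
  obtain ⟨t, rfl⟩ := exists_algebraMap_eq hk (a := b) (by
    rw [hb]
    exact_mod_cast isIntegral_algebraMap (R := ℤ) (A := L) (x := (p : ℤ)))
  have ht : t ^ k = p := ext_algebraMap (by rw [map_pow, hb, map_natCast])
  have hxt : x t ^ k = p := by rw [← map_pow, ht, map_natCast]
  have hx0 : x t ≠ 0 := fun h0 => by
    rw [h0, zero_pow hk.ne'] at hxt
    exact hp hxt.symm
  have e1 : s (algebraMap (𝓞 L) L t) = algebraMap (𝓞 L) L t ↔ x (s • t) = x t := by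
    constructor
    · intro h1
      rw [show s • t = t from ext_algebraMap h1]
    · intro h1
      refine congrArg (algebraMap (𝓞 L) L)
        (eq_of_pow_eq_of_map_eq hn x (a := s • t) (b := t) ?_ hx0 h1)
      obtain ⟨k', hk'⟩ := hkn
      rw [← smul_pow', hk', pow_mul, ht, ← Nat.cast_pow]
      exact map_natCast (MulSemiringAction.toRingHom _ (𝓞 L) s) _
  have e2 : x t ^ r = x t * (p : Ω) ^ m := by
    rw [← hxt, ← pow_mul, ← hm, ← pow_succ', Nat.sub_add_cancel hr]
  rw [e1, hs, e2, mul_eq_left₀ hx0]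

namespace IsKummer
variable {d : ℕ} {ζ θ : L}

lemma exists_frob [IsGalois ℚ L] (h : IsKummer n d p ζ θ) (hn : (n : Ω) ≠ 0) (hp : (p : Ω) ≠ 0)
    (x : 𝓞 L →+* Ω) (r : ℕ) [Fact r.Prime] [CharP Ω r] :
    ∃ s : L ≃ₐ[ℚ] L, ∀ b, x (s • b) = x b ^ r := by
  obtain ⟨s, hs⟩ := exists_gal_smul (h.free hn hp x) ((frobenius Ω r).comp x)
  exact ⟨s, fun b => (hs b).symm⟩

/-- The Frobenius elements at the totally split primes. -/
lemma frob_eq_one_iff (h : IsKummer n d p ζ θ) {r : ℕ} [Fact r.Prime] [CharP Ω r]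
    (hn : (n : Ω) ≠ 0) (hp : (p : Ω) ≠ 0) {x : 𝓞 L →+* Ω}
    {s : L ≃ₐ[ℚ] L} (hs : ∀ b, x (s • b) = x b ^ r) :
    s = 1 ↔ (r : ZMod n) = 1 ∧ d ∣ (r - 1) / orderOf (p : ZMod r) := by
  have hr := (Fact.out : r.Prime).pos
  have hp' : (p : ZMod r) ≠ 0 := by
    rw [Ne, CharP.cast_eq_zero_iff (ZMod r) r, ← CharP.cast_eq_zero_iff Ω r]
    exact hp
  have h1 : s ζ = ζ ↔ n ∣ r - 1 := by
    rw [h.frob_root hn hs h.prim.pow_eq_one, ← h.prim.pow_eq_one_iff_dvd]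
    nth_rewrite 1 [← Nat.sub_add_cancel hr]
    rw [pow_succ', mul_eq_left₀ h.root_ne_zero]
  have h2 : (r : ZMod n) = 1 ↔ n ∣ r - 1 := by
    rw [← Nat.cast_one, eq_comm, ZMod.natCast_eq_natCast_iff, Nat.modEq_iff_dvd' hr]
  have h3 : s = 1 ↔ s ζ = ζ ∧ s θ = θ := by
    refine ⟨fun h => by rw [h]; exact ⟨rfl, rfl⟩, fun h1 => h.gal_ext h1.1 h1.2⟩
  rw [h3, h1, h2]
  refine and_congr_right fun h4 => ?_
  obtain ⟨m, hm⟩ := h.d_dvd.trans h4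
  rw [frob_fix_iff hn hp hs hr h.d_pos h.d_dvd h.pow_eq hm,
    ZMod.dvd_sub_one_div_orderOf_iff hp' h.d_pos hm, CharP.pow_eq_one_iff_zmod]

/-- The Frobenius elements conjugate to complex conjugation. -/
lemma exists_conj_frob_iff [IsGalois ℚ L] (h : IsKummer n d p ζ θ) {r : ℕ} [Fact r.Prime]
    [CharP Ω r] (hn : (n : Ω) ≠ 0) (hp : (p : Ω) ≠ 0) (hr2 : r ≠ 2) {x : 𝓞 L →+* Ω}
    {s : L ≃ₐ[ℚ] L} (hs : ∀ b, x (s • b) = x b ^ r) {τ : L ≃ₐ[ℚ] L} (hτ : τ ζ = ζ⁻¹)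
    (hτ' : τ θ = θ) :
    (∃ g, s * g = g * τ) ↔ n ∣ r + 1 ∧ (Even d → (p : Ω) ^ (r / 2) = 1) := by
  have hr := (Fact.out : r.Prime).pos
  have hr1 : r - 1 = 2 * (r / 2) := by
    have := (Fact.out : r.Prime).eq_two_or_odd
    omega
  have : NeZero n := ⟨h.n_pos.ne'⟩
  have : NeZero d := ⟨h.d_pos.ne'⟩
  have hroot : ∀ g : L ≃ₐ[ℚ] L, ∃ k : ℕ, g ζ = ζ ^ k := fun g => by
    obtain ⟨k, -, hk⟩ := h.prim.eq_pow_of_pow_eq_one (ξ := g ζ)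
      (by rw [← map_pow, h.prim.pow_eq_one, map_one])
    exact ⟨k, hk.symm⟩
  have hsz : s ζ = ζ ^ r := h.frob_root hn hs h.prim.pow_eq_one
  have hhalf : ∀ {e : ℕ}, d = e + e → ∀ g : L ≃ₐ[ℚ] L, (s (g θ ^ e) = g θ ^ e ↔
      (p : Ω) ^ (r / 2) = 1) := fun {e} he g => by
    refine frob_fix_iff hn hp hs hr two_pos
      ((Dvd.intro_left e (by omega)).trans h.d_dvd) ?_ hr1
    rw [← pow_mul, ← map_pow, show e * 2 = d by omega, h.pow_eq, map_natCast]
  constructor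
  · rintro ⟨g, hg⟩
    have hg' : ∀ a, s (g a) = g (τ a) := fun a => DFunLike.congr_fun hg a
    refine ⟨?_, ?_⟩
    · have h1 : (g ζ) ^ (r + 1) = 1 := by
        have := hg' ζ
        rw [h.frob_root hn hs (by rw [← map_pow, h.prim.pow_eq_one, map_one]), hτ, map_inv₀] at this
        rw [pow_succ, this, inv_mul_cancel₀]
        exact (map_ne_zero g).2 h.root_ne_zero
      rw [← map_pow] at h1
      exact (h.prim.pow_eq_one_iff_dvd _).1 (g.injective (h1.trans (map_one g).symm))
    · rintro ⟨e, he⟩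
      rw [← hhalf he g, map_pow, hg', hτ']
  · rintro ⟨h1, h2⟩
    have hsinv : s ζ = ζ⁻¹ := by
      rw [hsz]
      refine eq_inv_of_mul_eq_one_left ?_
      rw [← pow_succ, h.prim.pow_eq_one_iff_dvd]
      exact h1
    have hθ := h.gen_ne_zero
    obtain ⟨κ, hκ⟩ : ∃ κ, s θ = κ * θ := ⟨s θ / θ, (div_mul_cancel₀ _ hθ).symm⟩
    have hκd : κ ^ d = 1 := by
      have := congrArg (fun a => a ^ d) hκ
      simp only [mul_pow, ← map_pow, h.pow_eq, map_natCast] at this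
      exact (mul_eq_right₀ (Nat.cast_ne_zero.2 h.prime.ne_zero)).1 this.symm
    obtain ⟨η, hη, hη2⟩ : ∃ η : L, η ^ d = 1 ∧ η ^ 2 = κ := by
      rcases Nat.even_or_odd d with hd | ⟨e, he⟩
      · obtain ⟨e, he⟩ := hd
        have h3 := (hhalf he 1).2 (h2 ⟨e, he⟩)
        have h4 : κ ^ e = 1 := by
          rw [AlgEquiv.one_apply, map_pow, hκ, mul_pow] at h3
          exact (mul_eq_right₀ (pow_ne_zero _ hθ)).1 h3
        obtain ⟨m, hm⟩ := h.d_dvd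
        have hξ : IsPrimitiveRoot (ζ ^ m) d := h.prim.pow h.n_pos (by rw [hm, mul_comm])
        obtain ⟨i, -, hi⟩ := hξ.eq_pow_of_pow_eq_one hκd
        have he0 : 0 < e := by have := h.d_pos; omega
        have h5 : d ∣ i * e := by
          rw [← hξ.pow_eq_one_iff_dvd, pow_mul, hi, h4]
        rw [he, ← two_mul] at h5
        obtain ⟨j, hj⟩ := Nat.dvd_of_mul_dvd_mul_right he0 h5
        refine ⟨(ζ ^ m) ^ j, ?_, ?_⟩
        · rw [← pow_mul, mul_comm, pow_mul, hξ.pow_eq_one, one_pow]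
        · rw [← hi, hj, ← pow_mul, mul_comm j]
      · refine ⟨κ ^ (e + 1), ?_, ?_⟩
        · rw [← pow_mul, mul_comm, pow_mul, hκd, one_pow]
        · rw [← pow_mul, show (e + 1) * 2 = d + 1 by omega, pow_succ, hκd, one_mul]
    obtain ⟨g, hg⟩ := h.exists_gal hη
    refine ⟨g, h.gal_ext ?_ ?_⟩
    · change s (g ζ) = g (τ ζ)
      obtain ⟨k, hk⟩ := hroot g
      rw [hτ, map_inv₀, hk, map_pow, hsinv, inv_pow]
    · change s (g θ) = g (τ θ)
      have hηn : η ^ n = 1 := by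
        obtain ⟨m, hm⟩ := h.d_dvd
        rw [hm, pow_mul, hη, one_pow]
      have hη0 : η ≠ 0 := fun h0 => by
        rw [h0, zero_pow h.d_pos.ne'] at hη
        exact zero_ne_one hη
      obtain ⟨i, -, hi⟩ := h.prim.eq_pow_of_pow_eq_one hηn
      have h6 : s η = η⁻¹ := by rw [← hi, map_pow, hsinv, inv_pow]
      rw [hτ', hg, map_mul, h6, hκ, ← hη2]
      field_simp

end IsKummer
end NumberField
end

section
open NumberField Module

lemma Nat.card_conj_eq {G : Type*} [Group G] [Finite G] (s τ : G) :
    Nat.card {g : G // s * g = g * τ} =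
      if ∃ g, s * g = g * τ then Nat.card {g : G // τ * g = g * τ} else 0 := by
  split_ifs with h
  · obtain ⟨g₀, h₀⟩ := h
    refine Nat.card_congr ((Equiv.mulLeft g₀⁻¹).subtypeEquiv fun g => ?_)
    have e : s = g₀ * τ * g₀⁻¹ := by rw [← h₀]; group
    change s * g = g * τ ↔ τ * (g₀⁻¹ * g) = g₀⁻¹ * g * τ
    rw [e, mul_assoc (g₀⁻¹), ← mul_right_inj (g₀⁻¹)]
    simp only [mul_assoc, inv_mul_cancel_left]
  · have : IsEmpty {g : G // s * g = g * τ} := ⟨fun g => h ⟨g.1, g.2⟩⟩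
    exact Nat.card_of_isEmpty

lemma jacobiSym_val_eq_one_iff {p n r : ℕ} [Fact r.Prime] (hp : (p : ZMod r) ≠ 0) (hr : r ≠ 2) :
    jacobiSym p (r : ZMod (4 * p * n)).val = 1 ↔ (p : ZMod r) ^ (r / 2) = 1 := by
  have hodd : Odd r := (Fact.out : r.Prime).odd_of_ne_two hr
  rw [← ZMod.euler_criterion r hp, ← legendreSym.eq_one_iff' r hp, jacobiSym.legendreSym.to_jacobiSym,
    ZMod.val_natCast]
  have h4 : 4 * p ∣ 4 * p * n := dvd_mul_right _ _
  rw [jacobiSym.mod_right' p hodd, jacobiSym.mod_right' p (hodd.mod_even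
    (((by decide : Even 4).mul_right p).mul_right n)), Nat.mod_mod_of_dvd _ h4]

lemma dvd_val_add_one_iff {m n r : ℕ} :
    n ∣ (r : ZMod (m * n)).val + 1 ↔ n ∣ r + 1 := by
  rw [ZMod.val_natCast, Nat.dvd_iff_mod_eq_zero, Nat.dvd_iff_mod_eq_zero, Nat.add_mod,
    Nat.mod_mod_of_dvd _ (dvd_mul_left n m), ← Nat.add_mod]

namespace NumberField
variable {L : Type*} [Field L] [NumberField L] [IsGalois ℚ L] {Ω : Type*} [Field Ω] [IsAlgClosed Ω]
  {x : 𝓞 L →+* Ω} {r : ℕ} {s : L ≃ₐ[ℚ] L}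

lemma card_frobFixed_bot (hfree : ∀ g : L ≃ₐ[ℚ] L, (∀ b, x (g • b) = x b) → g = 1)
    (hs : ∀ b, x (s • b) = x b ^ r) : Nat.card (FrobFixed L Ω r) =
      Nat.card {g : L ≃ₐ[ℚ] L // g⁻¹ * s * g ∈ (⊥ : Subgroup (L ≃ₐ[ℚ] L))} := by
  have h := card_frobFixed_mul (F := L) (H := ⊥) (fun a => ⟨fun _ => ⟨a, rfl⟩, fun _ h hh => by
    rw [Subgroup.mem_bot.1 hh]; rfl⟩) hfree hs
  rwa [Subgroup.card_bot, mul_one] at h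

/-- The number of degree one primes above `r` in a Galois field. -/
lemma card_frobFixed_self (hfree : ∀ g : L ≃ₐ[ℚ] L, (∀ b, x (g • b) = x b) → g = 1)
    (hs : ∀ b, x (s • b) = x b ^ r) :
    Nat.card (FrobFixed L Ω r) = if s = 1 then finrank ℚ L else 0 := by
  have h1 := card_frobFixed_bot hfree hs
  rw [h1]
  split_ifs with h
  · rw [h, ← IsGalois.card_aut_eq_finrank]
    exact Nat.card_congr (Equiv.subtypeUnivEquiv fun g => by simp)
  · have : IsEmpty {g : L ≃ₐ[ℚ] L // g⁻¹ * s * g ∈ (⊥ : Subgroup (L ≃ₐ[ℚ] L))} := ⟨fun g => h (by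
      have h2 := g.2
      rw [Subgroup.mem_bot, mul_assoc, inv_mul_eq_one] at h2
      exact mul_eq_right.1 h2.symm)⟩
    exact Nat.card_of_isEmpty

/-- The number of degree one primes in the fixed field of an involution. -/
lemma two_mul_card_frobFixed (hfree : ∀ g : L ≃ₐ[ℚ] L, (∀ b, x (g • b) = x b) → g = 1)
    (hs : ∀ b, x (s • b) = x b ^ r) {τ : L ≃ₐ[ℚ] L} (hτ : τ ≠ 1) (hτ2 : τ ^ 2 = 1) :
    2 * Nat.card (FrobFixed (IntermediateField.fixedField (Subgroup.zpowers τ)) Ω r) =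
      Nat.card (FrobFixed L Ω r) + Nat.card {g : L ≃ₐ[ℚ] L // s * g = g * τ} := by
  have h1 := card_frobFixed_mul (F := IntermediateField.fixedField (Subgroup.zpowers τ))
    (H := Subgroup.zpowers τ) (fun a => by
      rw [← IntermediateField.mem_fixedField_iff]
      exact ⟨fun h => ⟨⟨a, h⟩, rfl⟩, fun ⟨b, hb⟩ => hb ▸ b.2⟩) hfree hs
  have h2 := card_frobFixed_bot hfree hs
  have h3 : orderOf τ = 2 := orderOf_eq_prime hτ2 hτ
  rw [Nat.card_zpowers, h3, mul_comm] at h1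
  have hmem : ∀ g : L ≃ₐ[ℚ] L, g⁻¹ * s * g ∈ Subgroup.zpowers τ ↔
      g⁻¹ * s * g ∈ (⊥ : Subgroup (L ≃ₐ[ℚ] L)) ∨ s * g = g * τ := fun g => by
    have e : s * g = g * τ ↔ g⁻¹ * s * g = τ := by
      rw [mul_assoc, inv_mul_eq_iff_eq_mul]
    rw [e, Subgroup.mem_bot, mem_zpowers_iff_mem_range_orderOf, h3]
    simp only [Finset.mem_image, Finset.mem_range]
    constructor
    · rintro ⟨i, hi, h⟩
      interval_cases i
      · exact Or.inl (h.symm.trans (pow_zero _))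
      · exact Or.inr (h.symm.trans (pow_one _))
    · rintro (h | h)
      · exact ⟨0, by norm_num, (pow_zero _).trans h.symm⟩
      · exact ⟨1, by norm_num, (pow_one _).trans h.symm⟩
  rw [h1, h2, ← Nat.card_sum]
  simp only [Nat.card_eq_fintype_card, hmem, Fintype.card_sum]
  refine Fintype.card_subtype_or_disjoint _ _ (Pi.disjoint_iff.2 fun g => ?_)
  rw [Prop.disjoint_iff]
  rintro ⟨ha, hb⟩
  rw [Subgroup.mem_bot, mul_assoc, inv_mul_eq_one] at ha
  rw [← ha] at hb
  exact hτ (mul_eq_left.1 hb.symm)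

end NumberField
end

section
open NumberField Module ArithmeticFunction Filter
open scoped NNReal

namespace NumberField

lemma exists_zetaLike_of_large (K : Type*) [Field K] [NumberField K] : ∃ (f : ℂ → ℂ) (M Q : ℝ),
    ZetaLike f (fieldMangoldt K) (1 / (4 * finrank ℚ K)) M Q := by
  obtain ⟨T, hT1, hT⟩ := exists_coverRadius K
  set M := 3 * finrank ℚ K + 2 + 2 * Real.log (2 * (36 * finrank ℚ K * (T : ℝ) ^ 2) ^ finrank ℚ K)
  have h1 : Tendsto (fun Q : ℝ => M / (1 / (4 * finrank ℚ K)) * ((1 + Real.log Q) / Q))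
      atTop (nhds (M / (1 / (4 * finrank ℚ K)) * 0)) := by
    refine Tendsto.const_mul _ ?_
    have h2 : Tendsto (fun Q : ℝ => Q⁻¹ + Real.log Q / Q) atTop (nhds (0 + 0)) :=
      tendsto_inv_atTop_zero.add (by
        simpa using Real.tendsto_pow_log_div_mul_add_atTop 1 0 1 one_ne_zero)
    rw [add_zero] at h2
    refine h2.congr fun Q => ?_
    rw [add_div, one_div]
  rw [mul_zero] at h1
  obtain ⟨Q, hQ1, hQ⟩ := ((eventually_ge_atTop 1).and (h1.eventually_le_const one_pos)).exists
  obtain ⟨f, -, hf⟩ := exists_zetaLike K hT hT1 hQ1 (by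
    rw [← mul_div_assoc, div_le_one (by linarith)] at hQ
    exact hQ)
  exact ⟨f, _, _, hf⟩

namespace IsKummer
variable {L : Type*} [Field L] [NumberField L] [IsGalois ℚ L] {n d p : ℕ} {ζ θ : L}

/-- The relation between prime counts in `L` and in the fixed field of complex conjugation. -/
lemma exists_relation (h : IsKummer n d p ζ θ) {τ : L ≃ₐ[ℚ] L} (hτ : τ ζ = ζ⁻¹) (hτ' : τ θ = θ)
    {S : Finset (ZMod (4 * p * n))} (hS : ∀ a, a ∈ S ↔ IsUnit a ∧ n ∣ a.val + 1 ∧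
      (Even d → jacobiSym p a.val = 1)) :
    ∃ (E : IntermediateField ℚ L) (i : ℕ) (k : ℝ), ∀ r : ℕ, r.Prime →
      r ∉ (4 * p * n).primeFactors →
      2 * i * fieldMangoldt E r - fieldMangoldt L r -
        k * (if (r : ZMod (4 * p * n)) ∈ S then vonMangoldt r else 0) = 0 := by
  set c := Nat.card {g : L ≃ₐ[ℚ] L // τ * g = g * τ}
  have hloc : ∀ r : ℕ, r.Prime → r ∉ (4 * p * n).primeFactors → ∀ E : IntermediateField ℚ L,
      ∃ N M : ℕ, fieldMangoldt E r = M * Real.log r ∧ fieldMangoldt L r = N * Real.log r ∧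
        (E = IntermediateField.fixedField (Subgroup.zpowers τ) ∧ τ ≠ 1 →
          2 * M = N + if (r : ZMod (4 * p * n)) ∈ S then c else 0) ∧
        (τ = 1 → N = if (r : ZMod (4 * p * n)) ∈ S then c else 0) := by
    intro r hr hrB E
    have : Fact r.Prime := ⟨hr⟩
    let Ω := AlgebraicClosure (ZMod r)
    have : CharP Ω r := charP_of_injective_algebraMap (algebraMap (ZMod r) Ω).injective r
    have hq0 : 4 * p * n ≠ 0 :=
      mul_ne_zero (mul_ne_zero (by norm_num) h.prime.ne_zero) h.n_pos.ne'
    have hrq : ¬ r ∣ 4 * p * n := fun hd => hrB (Nat.mem_primeFactors.2 ⟨hr, hd, hq0⟩)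
    have hrn : ¬ r ∣ n := fun hd => hrq (hd.mul_left _)
    have hrp : ¬ r ∣ p := fun hd => hrq ((hd.mul_left 4).mul_right n)
    have hr2 : r ≠ 2 := fun h2 => hrq (by
      rw [h2]; exact (((by norm_num : 2 ∣ 4).mul_right p).mul_right n))
    have hn : (n : Ω) ≠ 0 := by rwa [Ne, CharP.cast_eq_zero_iff Ω r]
    have hp : (p : Ω) ≠ 0 := by rwa [Ne, CharP.cast_eq_zero_iff Ω r]
    have hp' : (p : ZMod r) ≠ 0 := by rwa [Ne, CharP.cast_eq_zero_iff (ZMod r) r]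
    obtain ⟨x, -⟩ := exists_ringHom_extension (A := ℤ) (B := 𝓞 L) (Ω := Ω)
      (FaithfulSMul.algebraMap_injective ℤ (𝓞 L)) (Int.castRingHom Ω)
    obtain ⟨s, hs⟩ := h.exists_frob hn hp x r
    have hfree := h.free hn hp x
    have hmem : (r : ZMod (4 * p * n)) ∈ S ↔ ∃ g, s * g = g * τ := by
      rw [h.exists_conj_frob_iff hn hp hr2 hs hτ hτ', hS, ZMod.isUnit_iff_coprime,
        dvd_val_add_one_iff, jacobiSym_val_eq_one_iff hp' hr2, CharP.pow_eq_one_iff_zmod (Ω := Ω)]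
      exact and_iff_right ((Nat.Prime.coprime_iff_not_dvd hr).2 hrq)
    have hcount : Nat.card {g : L ≃ₐ[ℚ] L // s * g = g * τ} =
        if (r : ZMod (4 * p * n)) ∈ S then c else 0 := by
      rw [Nat.card_conj_eq s τ]
      by_cases hg : ∃ g, s * g = g * τ
      · rw [if_pos hg, if_pos (hmem.2 hg)]
      · rw [if_neg hg, if_neg (mt hmem.1 hg)]
    refine ⟨Nat.card (FrobFixed L Ω r), Nat.card (FrobFixed E Ω r), fieldMangoldt_prime,
      fieldMangoldt_prime, ?_, ?_⟩
    · rintro ⟨rfl, hτ1⟩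
      have hτ2 : τ ^ 2 = 1 := h.gal_ext
        (by rw [pow_two]; change τ (τ ζ) = ζ; rw [hτ, map_inv₀, hτ, inv_inv])
        (by rw [pow_two]; change τ (τ θ) = θ; rw [hτ', hτ'])
      rw [two_mul_card_frobFixed hfree hs hτ1 hτ2, hcount]
    · intro hτ1
      have e : Nat.card (FrobFixed L Ω r) = Nat.card {g : L ≃ₐ[ℚ] L // s * g = g * τ} := by
        rw [card_frobFixed_bot hfree hs]
        refine Nat.card_congr (Equiv.subtypeEquivRight fun g => ?_)
        rw [Subgroup.mem_bot, mul_assoc, inv_mul_eq_one, hτ1, mul_one, eq_comm]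
      rw [e, hcount]
  by_cases hτ1 : τ = 1
  · refine ⟨⊥, 0, -c, fun r hr hrB => ?_⟩
    obtain ⟨N, M, h1, h2, -, h3⟩ := hloc r hr hrB ⊥
    rw [h1, h2, h3 hτ1, vonMangoldt_apply_prime hr]
    split_ifs <;> push_cast <;> ring
  · refine ⟨IntermediateField.fixedField (Subgroup.zpowers τ), 1, c, fun r hr hrB => ?_⟩
    obtain ⟨N, M, h1, h2, h3, -⟩ := hloc r hr hrB
      (IntermediateField.fixedField (Subgroup.zpowers τ))
    have h4 : (2 * M : ℝ) = N + if (r : ZMod (4 * p * n)) ∈ S then (c : ℝ) else 0 := by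
      exact_mod_cast h3 ⟨rfl, hτ1⟩
    rw [h1, h2, vonMangoldt_apply_prime hr, Nat.cast_one, mul_one, ← mul_assoc, h4]
    split_ifs <;> ring

/-- The Dedekind zeta function of a Kummer field has no exceptional zero. -/
theorem ne_zero (h : IsKummer n d p ζ θ) {τ : L ≃ₐ[ℚ] L} (hτ : τ ζ = ζ⁻¹) (hτ' : τ θ = θ)
    {f : ℂ → ℂ} {M Q : ℝ} (hf : ZetaLike f (fieldMangoldt L) (1 / (4 * finrank ℚ L)) M Q)
    (hf1 : f 1 ≠ 0)
    (hMQ : 80 * ((4 * p * n).totient * (6 + Real.log (4 * p * n : ℕ))) * (1 + Real.log Q) ≤ Q)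
    (hqQ : 24 * ((4 * p * n : ℕ) : ℝ) ^ (21 / 20 : ℝ) ≤ Q) {ρ : ℂ}
    (hρ : ‖ρ - 1‖ < 1 / (10 ^ 4 * Q)) : f ρ ≠ 0 := by
  have : NeZero (4 * p * n) :=
    ⟨mul_ne_zero (mul_ne_zero (by norm_num) h.prime.ne_zero) h.n_pos.ne'⟩
  let S : Finset (ZMod (4 * p * n)) := Finset.univ.filter fun a =>
    IsUnit a ∧ n ∣ a.val + 1 ∧ (Even d → jacobiSym p a.val = 1)
  have hS : ∀ a, a ∈ S ↔ IsUnit a ∧ n ∣ a.val + 1 ∧ (Even d → jacobiSym p a.val = 1) := fun a => by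
    simp [S]
  obtain ⟨E, i, k, hk⟩ := h.exists_relation hτ hτ' hS
  obtain ⟨f₂, M₂, Q₂, hf₂⟩ := exists_zetaLike_of_large E
  refine hf.ne_zero_of_residual (fun a ha => ((hS a).1 ha).1) hf₂ ?_ hf1 hMQ hqQ i k
    (K := 2 * i * finrank ℚ E + finrank ℚ L + |k|) (by positivity) (fun m => ?_) hk hρ
  · have h1 : finrank ℚ E ≤ finrank ℚ L :=
      LinearMap.finrank_le_finrank_of_injective (f := E.val.toLinearMap) E.val.injective
    have h2 : 0 < finrank ℚ E := finrank_pos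
    gcongr
  · have hE := fieldMangoldt_le (K := E) m
    have hL := fieldMangoldt_le (K := L) m
    have hE0 := fieldMangoldt_nonneg (K := E) m
    have hL0 := fieldMangoldt_nonneg (K := L) m
    have hΛ : 0 ≤ vonMangoldt m := vonMangoldt_nonneg
    calc _ ≤ |2 * i * fieldMangoldt E m - fieldMangoldt L m| +
          |k * (if (m : ZMod (4 * p * n)) ∈ S then vonMangoldt m else 0)| := abs_sub _ _
      _ ≤ (2 * i * (finrank ℚ E * vonMangoldt m) + finrank ℚ L * vonMangoldt m) +
          |k| * vonMangoldt m := by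
        refine add_le_add ((abs_sub _ _).trans (add_le_add ?_ ?_)) ?_
        · rw [abs_of_nonneg (by positivity)]
          gcongr
        · rwa [abs_of_nonneg hL0]
        · rw [abs_mul]
          refine mul_le_mul_of_nonneg_left ?_ (abs_nonneg _)
          split_ifs
          · rw [abs_of_nonneg hΛ]
          · rwa [abs_zero]
      _ = _ := by ring

end IsKummer
end NumberField
end

section
open NumberField Module ArithmeticFunction
open scoped NNReal

namespace NumberField.IsKummer
variable {L : Type*} [Field L] [NumberField L] {n d p : ℕ} {ζ θ : L}

/-- The primes counted by the von Mangoldt function of a Kummer field. -/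
lemma fieldMangoldt_eq [IsGalois ℚ L] (h : IsKummer n d p ζ θ) {r : ℕ} (hr : r.Prime)
    (hrp : r ∉ (p * n).primeFactors) : fieldMangoldt L r =
      if (r : ZMod n) = 1 ∧ d ∣ (r - 1) / orderOf (p : ZMod r) then finrank ℚ L * Real.log r
      else 0 := by
  have : Fact r.Prime := ⟨hr⟩
  let Ω := AlgebraicClosure (ZMod r)
  have : CharP Ω r := charP_of_injective_algebraMap (algebraMap (ZMod r) Ω).injective r
  have hrq : ¬ r ∣ p * n := fun hd => hrp (Nat.mem_primeFactors.2
    ⟨hr, hd, mul_ne_zero h.prime.ne_zero h.n_pos.ne'⟩)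
  have hn : (n : Ω) ≠ 0 := by
    rw [Ne, CharP.cast_eq_zero_iff Ω r]
    exact fun hd => hrq (hd.mul_left _)
  have hp : (p : Ω) ≠ 0 := by
    rw [Ne, CharP.cast_eq_zero_iff Ω r]
    exact fun hd => hrq (hd.mul_right n)
  obtain ⟨x, -⟩ := exists_ringHom_extension (A := ℤ) (B := 𝓞 L) (Ω := Ω)
    (FaithfulSMul.algebraMap_injective ℤ (𝓞 L)) (Int.castRingHom Ω)
  obtain ⟨s, hs⟩ := h.exists_frob hn hp x r
  rw [fieldMangoldt_prime (Ω := Ω), card_frobFixed_self (h.free hn hp x) hs]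
  simp only [← h.frob_eq_one_iff hn hp hs]
  split_ifs <;> simp

lemma exists_span (h : IsKummer n d p ζ θ) : ∃ ω : Fin n × Fin d → 𝓞 L,
    Submodule.span ℚ (Set.range fun i => (ω i : L)) = ⊤ ∧
      ∀ i (w : InfinitePlace L), w (ω i : L) ≤ p := by
  obtain ⟨z, t, hz, ht⟩ := h.exists_coe
  refine ⟨fun i => z ^ (i.1 : ℕ) * t ^ (i.2 : ℕ), ?_, fun i w => ?_⟩
  · have h1 : (IntermediateField.adjoin ℚ ({ζ, θ} : Set L)).toSubalgebra =
        Algebra.adjoin ℚ ({ζ, θ} : Set L) :=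
      IntermediateField.adjoin_toSubalgebra_of_isAlgebraic fun a _ =>
        Algebra.IsAlgebraic.isAlgebraic a
    rw [eq_top_iff]
    rintro a -
    have ha : a ∈ Algebra.adjoin ℚ ({ζ, θ} : Set L) := by
      rw [← h1, h.adjoin_eq]; trivial
    rw [← Subalgebra.mem_toSubmodule, Algebra.adjoin_eq_span] at ha
    refine Submodule.span_le.2 ?_ ha
    intro b hb
    obtain ⟨i, j, rfl⟩ := (Submonoid.mem_closure_pair _ _ _).1 hb
    have e : ζ ^ i * θ ^ j = (p : ℚ) ^ (j / d) • (ζ ^ (i % n) * θ ^ (j % d)) := by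
      conv_lhs => rw [← Nat.mod_add_div i n, ← Nat.mod_add_div j d]
      rw [pow_add, pow_mul, h.prim.pow_eq_one, one_pow, mul_one, pow_add, pow_mul, h.pow_eq,
        Algebra.smul_def, map_pow, map_natCast]
      ring
    rw [e]
    refine Submodule.smul_mem _ _ (Submodule.subset_span
      ⟨(⟨i % n, Nat.mod_lt _ h.n_pos⟩, ⟨j % d, Nat.mod_lt _ h.d_pos⟩), ?_⟩)
    change algebraMap (𝓞 L) L _ = _
    rw [map_mul, map_pow, map_pow, hz, ht]
  · change w (algebraMap (𝓞 L) L _) ≤ _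
    rw [map_mul, map_pow, map_pow, hz, ht, map_mul, map_pow, map_pow]
    have h1 : w ζ = 1 := by
      have := congrArg w h.prim.pow_eq_one
      rw [map_pow, map_one] at this
      exact (pow_eq_one_iff_of_nonneg (apply_nonneg w ζ) h.n_pos.ne').1 this
    have h2 : w θ ^ d = p := by
      have := congrArg w h.pow_eq
      rwa [map_pow, show w (p : L) = p by
        rw [← w.norm_embedding_eq, map_natCast, Complex.norm_natCast]] at this
    have hp : (1 : ℝ) ≤ p := by exact_mod_cast h.prime.one_le
    have h3 : 1 ≤ w θ := by
      rw [← h2] at hp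
      exact (one_le_pow_iff_of_nonneg (apply_nonneg w θ) h.d_pos.ne').1 hp
    rw [h1, one_pow, one_mul, ← h2]
    exact pow_le_pow_right₀ h3 i.2.2.le

lemma finrank_le (h : IsKummer n d p ζ θ) : finrank ℚ L ≤ n * d := by
  obtain ⟨ω, hω, -⟩ := h.exists_span
  rw [← finrank_top, ← hω]
  refine (finrank_range_le_card _).trans ?_
  simp

lemma coverRadius (h : IsKummer n d p ζ θ) : CoverRadius L (n * d * p + 1 : ℝ≥0) := by
  obtain ⟨ω, hω, hw⟩ := h.exists_span
  refine coverRadius_of_span hω fun w => ?_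
  calc _ ≤ ∑ _i : Fin n × Fin d, (p : ℝ) := Finset.sum_le_sum fun i _ => hw i w
    _ < _ := by simp

end NumberField.IsKummer

section concrete
open IntermediateField Polynomial

variable {n d p : ℕ}

section
variable {F K : Type*} [Field F] [CharZero F] [Field K] [Algebra F K] {ζ θ : K}

lemma adjoin_eq_adjoin_rootSet (hn : 0 < n) (hdn : d ∣ n) (hζ : IsPrimitiveRoot ζ n)
    (hp : p ≠ 0) (hθ : θ ^ d = p) :
    adjoin F ({ζ, θ} : Set K) =
      adjoin F (((X ^ n - C 1) * (X ^ d - C (p : F)) : F[X]).rootSet K) := by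
  have : CharZero K := charZero_of_injective_algebraMap (algebraMap F K).injective
  have hd := Nat.pos_of_dvd_of_pos hdn hn
  have h0 : ((X ^ n - C 1) * (X ^ d - C (p : F)) : F[X]) ≠ 0 :=
    mul_ne_zero (X_pow_sub_C_ne_zero hn _) (X_pow_sub_C_ne_zero hd _)
  have hmem : ∀ a : K, a ∈ ((X ^ n - C 1) * (X ^ d - C (p : F)) : F[X]).rootSet K ↔
      a ^ n = 1 ∨ a ^ d = p := fun a => by
    rw [mem_rootSet_of_ne h0]
    simp [sub_eq_zero]
  have : NeZero n := ⟨hn.ne'⟩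
  have hθ0 : θ ≠ 0 := fun h => by
    rw [h, zero_pow hd.ne'] at hθ
    exact hp (by exact_mod_cast hθ.symm)
  have hpow : ∀ a : K, a ^ n = 1 → a ∈ adjoin F ({ζ, θ} : Set K) := fun a ha => by
    obtain ⟨i, -, rfl⟩ := hζ.eq_pow_of_pow_eq_one ha
    exact pow_mem (subset_adjoin F _ (Set.mem_insert _ _)) i
  have hθm : θ ∈ adjoin F ({ζ, θ} : Set K) :=
    subset_adjoin F _ (Set.mem_insert_of_mem _ rfl)
  refine le_antisymm (adjoin_le_iff.2 ?_) (adjoin_le_iff.2 ?_)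
  · rintro a (rfl | rfl)
    · exact subset_adjoin F _ ((hmem _).2 (Or.inl hζ.pow_eq_one))
    · exact subset_adjoin F _ ((hmem _).2 (Or.inr hθ))
  · intro a ha
    rcases (hmem a).1 ha with h | h
    · exact hpow a h
    · have h1 : (a / θ) ^ n = 1 := by
        obtain ⟨k, rfl⟩ := hdn
        rw [pow_mul, div_pow, h, hθ, div_self (Nat.cast_ne_zero.2 hp), one_pow]
      have := mul_mem (hpow _ h1) hθm
      rwa [div_mul_cancel₀ _ hθ0] at this

lemma exists_generators_adjoin [IsAlgClosed K] (hn : 0 < n) (hdn : d ∣ n) (hζ : IsPrimitiveRoot ζ n)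
    (hp : p ≠ 0) (hθ : θ ^ d = p) {σ : K ≃ₐ[F] K} (hσ : σ ζ = ζ⁻¹) (hσ' : σ θ = θ) :
    FiniteDimensional F (adjoin F ({ζ, θ} : Set K)) ∧ IsGalois F (adjoin F ({ζ, θ} : Set K)) ∧
    ∃ (ζ' θ' : adjoin F ({ζ, θ} : Set K))
      (τ : adjoin F ({ζ, θ} : Set K) ≃ₐ[F] adjoin F ({ζ, θ} : Set K)),
      IsPrimitiveRoot ζ' n ∧ θ' ^ d = p ∧
      adjoin F ({ζ', θ'} : Set (adjoin F ({ζ, θ} : Set K))) = ⊤ ∧ τ ζ' = ζ'⁻¹ ∧ τ θ' = θ' := by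
  have hd := Nat.pos_of_dvd_of_pos hdn hn
  have hN : Normal F (adjoin F ({ζ, θ} : Set K)) := by
    rw [adjoin_eq_adjoin_rootSet hn hdn hζ hp hθ]
    have := adjoin_rootSet_isSplittingField
      (IsAlgClosed.splits (((X ^ n - C 1) * (X ^ d - C (p : F)) : F[X]).map (algebraMap F K)))
    exact Normal.of_isSplittingField ((X ^ n - C 1) * (X ^ d - C (p : F)) : F[X])
  have hF : FiniteDimensional F (adjoin F ({ζ, θ} : Set K)) := by
    have : Finite ({ζ, θ} : Set K) := Set.toFinite _
    refine finiteDimensional_adjoin fun a ha => ?_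
    rcases ha with rfl | rfl
    · refine IsIntegral.of_pow hn ?_
      rw [hζ.pow_eq_one]
      exact isIntegral_one
    · refine IsIntegral.of_pow hd ?_
      rw [hθ, ← map_natCast (algebraMap F K)]
      exact isIntegral_algebraMap
  have hζm : ζ ∈ adjoin F ({ζ, θ} : Set K) := subset_adjoin F _ (Set.mem_insert _ _)
  have hθm : θ ∈ adjoin F ({ζ, θ} : Set K) := subset_adjoin F _ (Set.mem_insert_of_mem _ rfl)
  refine ⟨hF, ⟨⟩, ⟨ζ, hζm⟩, ⟨θ, hθm⟩, σ.restrictNormal _, ?_, ?_, ?_, ?_, ?_⟩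
  · exact (IsPrimitiveRoot.map_iff_of_injective
      (adjoin F ({ζ, θ} : Set K)).val.injective).1 hζ
  · exact Subtype.ext (by simpa using hθ)
  · refine IntermediateField.map_injective (adjoin F ({ζ, θ} : Set K)).val ?_
    rw [adjoin_map, ← AlgHom.fieldRange_eq_map, fieldRange_val, Set.image_pair]
    rfl
  · refine Subtype.ext ((σ.restrictNormal_commutes (adjoin F ({ζ, θ} : Set K)) ⟨ζ, hζm⟩).trans ?_)
    exact hσ
  · refine Subtype.ext ((σ.restrictNormal_commutes (adjoin F ({ζ, θ} : Set K)) ⟨θ, hθm⟩).trans ?_)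
    exact hσ'

end

lemma NumberField.exists_isKummer_of_algebra {K : Type} [Field K] (inst : Algebra ℚ K)
    (hf : FiniteDimensional ℚ K) (hG : IsGalois ℚ K) {ζ θ : K} (hn : 0 < n) (hdn : d ∣ n)
    (hζ : IsPrimitiveRoot ζ n) (hp : p.Prime) (hθ : θ ^ d = p)
    (hadj : adjoin ℚ ({ζ, θ} : Set K) = ⊤) {τ : K ≃ₐ[ℚ] K} (hτ : τ ζ = ζ⁻¹) (hτ' : τ θ = θ) :
    ∃ (L : Type) (_ : Field L) (_ : NumberField L) (_ : IsGalois ℚ L) (ζ' θ' : L)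
      (τ' : L ≃ₐ[ℚ] L), IsKummer n d p ζ' θ' ∧ τ' ζ' = ζ'⁻¹ ∧ τ' θ' = θ' ∧
        finrank ℚ L = finrank ℚ K := by
  have hc : CharZero K := charZero_of_injective_algebraMap (algebraMap ℚ K).injective
  obtain rfl : inst = DivisionRing.toRatAlgebra := Subsingleton.elim _ _
  have hnf : NumberField K := ⟨⟩
  exact ⟨K, inferInstance, hnf, hG, ζ, θ, τ, ⟨hn, hdn, hζ, hp, hθ, hadj⟩, hτ, hτ', rfl⟩

/-- The field generated by `ζ` and the real root `t` is a Kummer field with a Galois automorphism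
coming from complex conjugation. -/
theorem NumberField.exists_isKummer_adjoin {ζ : ℂ} (hn : 0 < n) (hdn : d ∣ n)
    (hζ : IsPrimitiveRoot ζ n) (hp : p.Prime) {t : ℝ} (ht : t ^ d = p) :
    ∃ (L : Type) (_ : Field L) (_ : NumberField L) (_ : IsGalois ℚ L) (ζ' θ' : L)
      (τ' : L ≃ₐ[ℚ] L), IsKummer n d p ζ' θ' ∧ τ' ζ' = ζ'⁻¹ ∧ τ' θ' = θ' ∧
        finrank ℚ L = finrank ℚ (adjoin ℚ ({ζ, (t : ℂ)} : Set ℂ)) := by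
  have hθ : (t : ℂ) ^ d = p := by exact_mod_cast congrArg (fun a : ℝ => (a : ℂ)) ht
  obtain ⟨hf, hG, ζ', θ', τ, h1, h2, h3, h4, h5⟩ := exists_generators_adjoin (F := ℚ) hn hdn hζ
    hp.ne_zero hθ (σ := Complex.conjAe.restrictScalars ℚ)
    (by
      change (starRingEnd ℂ) ζ = ζ⁻¹
      exact (Complex.inv_eq_conj (hζ.norm'_eq_one hn.ne')).symm)
    (Complex.conj_ofReal t)
  exact exists_isKummer_of_algebra _ hf hG hn hdn h1 hp h2 h3 h4 h5

end concrete
end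

section
open MeasureTheory Set

lemma logSum_eq_sum_Icc_zero (a : ℕ → ℝ) {k : ℕ} (hk : k ≠ 0) (u : ℝ) :
    logSum a k u = ∑ m ∈ Finset.Icc 0 ⌊u⌋₊, a m * Real.log m ^ k := by
  rw [logSum, Finset.Icc_eq_cons_Ioc (Nat.zero_le _), Finset.sum_cons, ← Finset.Icc_add_one_left_eq_Ioc]
  simp [hk]

lemma hasDerivAt_inv_log_pow (k : ℕ) {t : ℝ} (ht : 1 < t) :
    HasDerivAt (fun t => (Real.log t ^ (k + 1))⁻¹)
      (-((k + 1) * Real.log t ^ k * t⁻¹) / (Real.log t ^ (k + 1)) ^ 2) t := by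
  have h := ((Real.hasDerivAt_log (by linarith : t ≠ 0)).fun_pow (k + 1)).inv
    (pow_ne_zero _ (Real.log_pos ht).ne')
  refine h.congr_deriv ?_
  push_cast
  simp

/-- Partial summation against `1 / (log t) ^ (k + 1)`. -/
lemma abs_sum_sub_integral_inv_log_le {a : ℕ → ℝ} {k : ℕ} (hk : k ≠ 0) {y x K : ℝ} (hy : 1 < y)
    (hyx : y ≤ x) (hE : ∀ u, y ≤ u → u ≤ x → |logError a k u| ≤ K) :
    |∑ m ∈ Finset.Ioc ⌊y⌋₊ ⌊x⌋₊, a m / Real.log m - ∫ t in y..x, 1 / Real.log t| ≤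
      2 * K / Real.log y ^ (k + 1) := by
  set g : ℝ → ℝ := fun t => (Real.log t ^ (k + 1))⁻¹ with hg
  set g' : ℝ → ℝ := fun t => -((k + 1) * Real.log t ^ k * t⁻¹) / (Real.log t ^ (k + 1)) ^ 2 with hg'
  set M : ℝ → ℝ := fun u => ∫ t in (1:ℝ)..u, Real.log (max t 1) ^ k with hM
  have hd : ∀ t ∈ uIcc y x, HasDerivAt g (g' t) t := fun t ht => by
    rw [uIcc_of_le hyx] at ht
    exact hasDerivAt_inv_log_pow k (hy.trans_le ht.1)
  have hlog : ∀ t ∈ Icc y x, t ≠ 0 ∧ Real.log t ≠ 0 := fun t ht =>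
    ⟨by linarith [ht.1], (Real.log_pos (hy.trans_le ht.1)).ne'⟩
  have hgc : ContinuousOn g' (Icc y x) := by
    have h1 : ContinuousOn Real.log (Icc y x) := Real.continuousOn_log.mono fun t ht => (hlog t ht).1
    refine ContinuousOn.div ?_ ((h1.pow _).pow _) fun t ht => pow_ne_zero _ (pow_ne_zero _ (hlog t ht).2)
    exact ((continuousOn_const.mul (h1.pow k)).mul (continuousOn_id.inv₀ fun t ht => (hlog t ht).1)).neg
  have hgi : IntervalIntegrable g' volume y x := by
    refine ContinuousOn.intervalIntegrable ?_
    rwa [uIcc_of_le hyx]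
  have hder : EqOn (deriv g) g' (Icc y x) := fun t ht => (hd t (by rwa [uIcc_of_le hyx])).deriv
  have hMd : ∀ t, HasDerivAt M (Real.log (max t 1) ^ k) t := fun t =>
    intervalIntegral.integral_hasDerivAt_right ((continuous_log_max_pow k).intervalIntegrable _ _)
      ((continuous_log_max_pow k).stronglyMeasurableAtFilter _ _) (continuous_log_max_pow k).continuousAt
  have hMc : Continuous M := continuous_iff_continuousAt.2 fun t => (hMd t).continuousAt
  have habel := sum_mul_eq_sub_sub_integral_mul (fun m => a m * Real.log m ^ k) (f := g)
    (by linarith : 0 ≤ y) hyx (fun t ht => (hd t (by rwa [uIcc_of_le hyx])).differentiableAt)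
    ((hgc.integrableOn_Icc).congr_fun hder.symm measurableSet_Icc)
  have hS : ∀ u, ∑ m ∈ Finset.Icc 0 ⌊u⌋₊, a m * Real.log m ^ k = logError a k u + M u := fun u => by
    rw [← logSum_eq_sum_Icc_zero a hk, logError]
    ring
  have hsum : ∑ m ∈ Finset.Ioc ⌊y⌋₊ ⌊x⌋₊, a m / Real.log m =
      ∑ m ∈ Finset.Ioc ⌊y⌋₊ ⌊x⌋₊, g m * (a m * Real.log m ^ k) := by
    refine Finset.sum_congr rfl fun m hm => ?_
    have hm1 : (1:ℝ) < m := hy.trans ((Nat.floor_lt (by linarith)).1 (Finset.mem_Ioc.1 hm).1)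
    have := (Real.log_pos hm1).ne'
    simp only [hg]
    field_simp
    ring
  have hparts := intervalIntegral.integral_deriv_mul_eq_sub (u := g) (v := M) hd (fun t _ => hMd t)
    hgi ((continuous_log_max_pow k).intervalIntegrable _ _)
  have hmain : ∫ t in y..x, 1 / Real.log t = ∫ t in y..x, g t * Real.log (max t 1) ^ k := by
    refine intervalIntegral.integral_congr fun t ht => ?_
    rw [uIcc_of_le hyx] at ht
    have := (hlog t ht).2
    simp only [hg, max_eq_left (hy.le.trans ht.1)]
    field_simp
    ring
  have hgM : IntervalIntegrable (fun t => g' t * M t) volume y x := hgi.mul_continuousOn hMc.continuousOn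
  have hgm : IntervalIntegrable (fun t => g t * Real.log (max t 1) ^ k) volume y x :=
    (ContinuousOn.intervalIntegrable fun t ht => (hd t ht).continuousAt.continuousWithinAt).mul_continuousOn
      (continuous_log_max_pow k).continuousOn
  rw [intervalIntegral.integral_add hgM hgm] at hparts
  have hiS : IntegrableOn (fun t => g' t * ∑ m ∈ Finset.Icc 0 ⌊t⌋₊, a m * Real.log m ^ k) (Icc y x) :=
    integrableOn_mul_sum_Icc _ (by linarith : 0 ≤ y) hgc.integrableOn_Icc
  have hintg : ∫ t in Ioc y x, deriv g t * ∑ m ∈ Finset.Icc 0 ⌊t⌋₊, a m * Real.log m ^ k =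
      (∫ t in y..x, g' t * logError a k t) + ∫ t in y..x, g' t * M t := by
    rw [← intervalIntegral.integral_of_le hyx, ← intervalIntegral.integral_add _ hgM]
    · refine intervalIntegral.integral_congr fun t ht => ?_
      rw [uIcc_of_le hyx] at ht
      simp only [hder ht, hS]
      ring
    · have h1 : IntervalIntegrable (fun t => g' t * ∑ m ∈ Finset.Icc 0 ⌊t⌋₊, a m * Real.log m ^ k)
          volume y x := by
        rw [intervalIntegrable_iff_integrableOn_Icc_of_le hyx]
        exact hiS
      refine (h1.sub hgM).congr_ae (Filter.Eventually.of_forall fun t => ?_)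
      simp only [hS]
      ring
  have hK : 0 ≤ K := (abs_nonneg _).trans (hE y le_rfl hyx)
  have hbound : |∫ t in y..x, g' t * logError a k t| ≤ K * (g y - g x) := by
    have h1 : ∫ t in y..x, -g' t * K = K * (g y - g x) := by
      rw [intervalIntegral.integral_mul_const, intervalIntegral.integral_neg,
        intervalIntegral.integral_eq_sub_of_hasDerivAt hd hgi]
      ring
    rw [← h1, ← Real.norm_eq_abs]
    refine intervalIntegral.norm_integral_le_of_norm_le hyx (Filter.Eventually.of_forall fun t ht => ?_)
      (hgi.neg.mul_const K)
    have ht1 : 1 < t := hy.trans ht.1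
    have hl := Real.log_pos ht1
    have hneg : g' t ≤ 0 := by
      refine div_nonpos_of_nonpos_of_nonneg (neg_nonpos.2 ?_) (by positivity)
      positivity
    rw [norm_mul, Real.norm_eq_abs, Real.norm_eq_abs, abs_of_nonpos hneg]
    exact mul_le_mul_of_nonneg_left (hE t ht.1.le ht.2) (neg_nonneg.2 hneg)
  have hgx : 0 ≤ g x := inv_nonneg.2 (pow_nonneg (Real.log_nonneg (by linarith)) _)
  have hgy : 0 ≤ g y := inv_nonneg.2 (pow_nonneg (Real.log_nonneg hy.le) _)
  have key : ∑ m ∈ Finset.Ioc ⌊y⌋₊ ⌊x⌋₊, a m / Real.log m - ∫ t in y..x, 1 / Real.log t =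
      g x * logError a k x - g y * logError a k y - ∫ t in y..x, g' t * logError a k t := by
    rw [hsum, habel, hintg, hmain, hS, hS]
    linarith
  have hx1 : |g x * logError a k x| ≤ g x * K := by
    rw [abs_mul, abs_of_nonneg hgx]
    exact mul_le_mul_of_nonneg_left (hE x hyx le_rfl) hgx
  have hy1 : |g y * logError a k y| ≤ g y * K := by
    rw [abs_mul, abs_of_nonneg hgy]
    exact mul_le_mul_of_nonneg_left (hE y le_rfl hyx) hgy
  have hfin : 2 * K / Real.log y ^ (k + 1) = 2 * K * g y := div_eq_mul_inv _ _
  rw [key, hfin]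
  rw [abs_le] at *
  constructor <;> linarith [hx1.1, hx1.2, hy1.1, hy1.2, hbound.1, hbound.2]

/-- Counting primes from the asymptotics of a von Mangoldt function. -/
lemma abs_card_sub_le {a : ℕ → ℝ} {k : ℕ} (hk : k ≠ 0) {D K W x : ℝ} (hD : 1 ≤ D) (hx : 16 ≤ x)
    {P : ℕ → Prop} {B : Finset ℕ} (ha : ∀ m, 0 ≤ a m)
    (haD : ∀ m, a m ≤ D * ArithmeticFunction.vonMangoldt m)
    (haP : ∀ r, r.Prime → r ∉ B → a r = if P r then D * Real.log r else 0)
    (hW : ∑ r ∈ B, Real.log r ≤ W) (hE : ∀ u, 1 ≤ u → u ≤ x → |logError a k u| ≤ K) :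
    |(((Finset.range (⌊x⌋₊ + 1)).filter fun r => r.Prime ∧ P r).card : ℝ) -
      (∫ t in (2:ℝ)..x, 1 / Real.log t) / D| ≤
      8 * √x + W + 2 * K / (Real.log x / 2) ^ (k + 1) := by
  have hy4 : 4 ≤ √x := Real.le_sqrt_of_sq_le (by linarith)
  have hyx : √x ≤ x := by nlinarith [Real.sq_sqrt (by linarith : 0 ≤ x)]
  have hlogy : Real.log √x = Real.log x / 2 := Real.log_sqrt (by linarith)
  have hly : 1 ≤ Real.log √x := by
    rw [Real.le_log_iff_exp_le (by linarith)]
    linarith [Real.exp_one_lt_d9]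
  have hK : 0 ≤ K := (abs_nonneg _).trans (hE 1 le_rfl (by linarith))
  have hA := abs_sum_sub_integral_inv_log_le hk (by linarith : 1 < √x) hyx
    (fun u hu hu' => hE u (by linarith) hu')
  set b : ℕ → ℝ := fun m => if m.Prime ∧ P m then D * Real.log m else 0 with hb
  have hb0 : ∀ m, 0 ≤ b m := fun m => by
    simp only [hb]
    split_ifs
    · exact mul_nonneg (by linarith) (Real.log_natCast_nonneg m)
    · exact le_rfl
  have hbD : ∀ m, b m ≤ D * ArithmeticFunction.vonMangoldt m := fun m => by
    simp only [hb]
    split_ifs with h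
    · rw [ArithmeticFunction.vonMangoldt_apply_prime h.1]
    · exact mul_nonneg (by linarith) ArithmeticFunction.vonMangoldt_nonneg
  have hC := sum_abs_le_of_prime_eq_zero (e := fun m => b m - a m) (B := B) (K := D) (by linarith)
    (fun m => abs_sub_le_iff.2 ⟨by linarith [ha m, hbD m], by linarith [hb0 m, haD m]⟩)
    (fun r hr hrB => by simp [hb, haP r hr hrB, hr]) (by linarith : 1 ≤ x)
  have hle : ⌊√x⌋₊ ≤ ⌊x⌋₊ := Nat.floor_mono hyx
  have hsub : |∑ m ∈ Finset.Ioc ⌊√x⌋₊ ⌊x⌋₊, b m / Real.log m -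
      ∑ m ∈ Finset.Ioc ⌊√x⌋₊ ⌊x⌋₊, a m / Real.log m| ≤ D * (4 * √x + W) := by
    rw [← Finset.sum_sub_distrib]
    calc _ ≤ ∑ m ∈ Finset.Ioc ⌊√x⌋₊ ⌊x⌋₊, |b m - a m| / Real.log √x := by
          refine (Finset.abs_sum_le_sum_abs _ _).trans (Finset.sum_le_sum fun m hm => ?_)
          have hm1 : √x < m := (Nat.floor_lt (by linarith)).1 (Finset.mem_Ioc.1 hm).1
          have hlm : Real.log √x ≤ Real.log m := Real.log_le_log (by linarith) hm1.le
          rw [← sub_div, abs_div, abs_of_nonneg (by linarith : 0 ≤ Real.log m)]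
          exact div_le_div_of_nonneg_left (abs_nonneg _) (by linarith) hlm
      _ ≤ (∑ m ∈ Finset.Icc 1 ⌊x⌋₊, |b m - a m|) / Real.log √x := by
          rw [← Finset.sum_div]
          refine div_le_div_of_nonneg_right ?_ (by linarith)
          refine Finset.sum_le_sum_of_subset_of_nonneg (fun m hm => ?_) fun _ _ _ => abs_nonneg _
          rw [Finset.mem_Ioc] at hm
          exact Finset.mem_Icc.2 ⟨by omega, hm.2⟩
      _ ≤ D * (2 * √x * Real.log x + ∑ r ∈ B, Real.log r) / Real.log √x :=
          div_le_div_of_nonneg_right hC (zero_le_one.trans hly)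
      _ ≤ D * (4 * √x + W) := by
          rw [div_le_iff₀ (by linarith), mul_assoc D]
          refine mul_le_mul_of_nonneg_left ?_ (by linarith)
          have hW0 : 0 ≤ W := (Finset.sum_nonneg fun r _ => Real.log_natCast_nonneg r).trans hW
          have : Real.log x = 2 * Real.log √x := by rw [hlogy]; ring
          rw [this]
          nlinarith
  have hcard : ((((Finset.range (⌊x⌋₊ + 1)).filter fun r => r.Prime ∧ P r).card : ℕ) : ℝ) * D =
      (∑ m ∈ Finset.range (⌊√x⌋₊ + 1), if m.Prime ∧ P m then D else 0) +
        ∑ m ∈ Finset.Ioc ⌊√x⌋₊ ⌊x⌋₊, b m / Real.log m := by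
    have h1 : ∑ m ∈ Finset.Ioc ⌊√x⌋₊ ⌊x⌋₊, b m / Real.log m =
        ∑ m ∈ Finset.Ioc ⌊√x⌋₊ ⌊x⌋₊, if m.Prime ∧ P m then D else 0 := by
      refine Finset.sum_congr rfl fun m hm => ?_
      have hm1 : √x < m := (Nat.floor_lt (by linarith)).1 (Finset.mem_Ioc.1 hm).1
      have := (Real.log_pos (by linarith : (1:ℝ) < m)).ne'
      simp only [hb]
      split_ifs
      · field_simp
      · simp
    rw [h1, Finset.range_eq_Ico, Finset.range_eq_Ico, ← Finset.Ico_add_one_add_one_eq_Ioc,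
      Finset.sum_Ico_consecutive _ (Nat.zero_le _) (by omega), ← Finset.sum_filter,
      Finset.sum_const, nsmul_eq_mul]
  have hsmall0 : 0 ≤ ∑ m ∈ Finset.range (⌊√x⌋₊ + 1), (if m.Prime ∧ P m then D else 0) :=
    Finset.sum_nonneg fun m _ => by split_ifs <;> linarith
  have hsmall : ∑ m ∈ Finset.range (⌊√x⌋₊ + 1), (if m.Prime ∧ P m then D else 0) ≤ D * (√x + 1) := by
    calc _ ≤ ∑ m ∈ Finset.range (⌊√x⌋₊ + 1), D := Finset.sum_le_sum fun m _ => by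
          split_ifs <;> linarith
      _ = D * (⌊√x⌋₊ + 1) := by
          rw [Finset.sum_const, Finset.card_range, nsmul_eq_mul]
          push_cast
          ring
      _ ≤ _ := by
          refine mul_le_mul_of_nonneg_left ?_ (by linarith)
          linarith [Nat.floor_le (by linarith : 0 ≤ √x)]
  have hii : ∀ u v : ℝ, 2 ≤ u → 2 ≤ v →
      IntervalIntegrable (fun t => 1 / Real.log t) volume u v := fun u v hu hv => by
    refine ContinuousOn.intervalIntegrable fun t ht => ?_
    have ht2 : 2 ≤ t := (le_min hu hv).trans ht.1
    refine (continuousAt_const.div (Real.continuousAt_log (by linarith)) ?_).continuousWithinAt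
    exact (Real.log_pos (by linarith)).ne'
  have hadd := intervalIntegral.integral_add_adjacent_intervals
    (hii 2 √x le_rfl (by linarith)) (hii √x x (by linarith) (by linarith))
  have hI0 : 0 ≤ ∫ t in (2:ℝ)..√x, 1 / Real.log t :=
    intervalIntegral.integral_nonneg (by linarith) fun t ht =>
      div_nonneg zero_le_one (Real.log_nonneg (by linarith [ht.1]))
  have hI1 : ∫ t in (2:ℝ)..√x, 1 / Real.log t ≤ 2 * √x := by
    calc _ ≤ ∫ t in (2:ℝ)..√x, (2:ℝ) := by
          refine intervalIntegral.integral_mono_on (by linarith) (hii 2 √x le_rfl (by linarith))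
            (by simp) fun t ht => ?_
          have : Real.log 2 ≤ Real.log t := Real.log_le_log (by norm_num) ht.1
          rw [div_le_iff₀ (by linarith [Real.log_two_gt_d9])]
          linarith [Real.log_two_gt_d9]
      _ ≤ _ := by
          rw [intervalIntegral.integral_const, smul_eq_mul]
          linarith
  have hD0 : 0 < D := by linarith
  set V := 2 * K / Real.log √x ^ (k + 1) with hV
  have hV0 : 0 ≤ V := by positivity
  rw [← hlogy, ← mul_le_mul_iff_of_pos_right hD0, ← abs_of_pos hD0, ← abs_mul, abs_of_pos hD0,
    sub_mul, div_mul_cancel₀ _ hD0.ne', hcard, ← hadd, ← hV]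
  have hs0 : √x ≤ D * √x := le_mul_of_one_le_left (by linarith) hD
  have hV1 : V ≤ D * V := le_mul_of_one_le_left hV0 hD
  rw [abs_le] at *
  constructor <;> nlinarith [hA.1, hA.2, hsub.1, hsub.2]

end

section
open Filter Real

lemma eventually_log_bound :
    ∀ᶠ X : ℝ in atTop, 400 * (17 + 6 * log X) * (1 + log X) ≤ X ^ (1 / 40 : ℝ) := by
  have h1 := (isLittleO_log_rpow_atTop (r := 1 / 80) (by norm_num)).bound
    (by norm_num : (0:ℝ) < 1 / 100)
  filter_upwards [h1, tendsto_log_atTop.eventually_ge_atTop 17, eventually_ge_atTop 1] with X h1 h2 hX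
  rw [norm_eq_abs, norm_eq_abs, abs_of_nonneg (by linarith), abs_of_nonneg (by positivity)] at h1
  have h3 : X ^ (1 / 40 : ℝ) = X ^ (1 / 80 : ℝ) * X ^ (1 / 80 : ℝ) := by
    rw [← rpow_add (by linarith)]
    norm_num
  rw [h3]
  nlinarith

lemma eventually_sqrt_add_log_le (A : ℝ) :
    ∀ᶠ x : ℝ in atTop, 8 * √x + log x ≤ x / log x ^ A := by
  have h1 := (isLittleO_log_rpow_rpow_atTop (s := 1 / 4) A (by norm_num)).bound one_pos
  have h2 := (isLittleO_log_rpow_atTop (r := 1 / 2) (by norm_num)).bound one_pos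
  filter_upwards [h1, h2, (tendsto_rpow_atTop (by norm_num : (0:ℝ) < 1 / 4)).eventually_ge_atTop 9,
    tendsto_log_atTop.eventually_ge_atTop 1, eventually_ge_atTop 1] with x h1 h2 h3 h4 hx
  have hA : 0 < log x ^ A := rpow_pos_of_pos (by linarith) _
  rw [norm_eq_abs, norm_eq_abs, abs_of_nonneg hA.le, abs_of_nonneg (by positivity), one_mul] at h1
  rw [norm_eq_abs, norm_eq_abs, abs_of_nonneg (by linarith), abs_of_nonneg (by positivity), one_mul,
    ← sqrt_eq_rpow] at h2
  have h5 : √x = x ^ (1 / 4 : ℝ) * x ^ (1 / 4 : ℝ) := by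
    rw [sqrt_eq_rpow, ← rpow_add (by linarith)]
    norm_num
  have h6 : x = √x * √x := (mul_self_sqrt (by linarith)).symm
  have h7 : 0 ≤ √x := sqrt_nonneg x
  calc 8 * √x + log x ≤ 9 * √x := by linarith
    _ ≤ x ^ (1 / 4 : ℝ) * √x := mul_le_mul_of_nonneg_right h3 h7
    _ ≤ x / log x ^ A := by
        rw [le_div_iff₀ hA]
        calc x ^ (1 / 4 : ℝ) * √x * log x ^ A = x ^ (1 / 4 : ℝ) * log x ^ A * √x := by ring
          _ ≤ x ^ (1 / 4 : ℝ) * x ^ (1 / 4 : ℝ) * √x := mul_le_mul_of_nonneg_right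
              (mul_le_mul_of_nonneg_left h1 (by positivity)) h7
          _ = x := by rw [← h5, ← h6]

section
variable {X : ℝ}

lemma mul_log_le_rpow (hX : 1 ≤ X)
    (hlog : 400 * (17 + 6 * log X) * (1 + log X) ≤ X ^ (1 / 40 : ℝ))
    {a c m : ℝ} (ha : a ≤ 7 / 8) (hm : m ≤ X ^ a)
    (hc0 : 0 ≤ c) (hc : c ≤ 400 * (17 + 6 * log X) * (1 + log X)) : m * c ≤ X ^ (9 / 10 : ℝ) := by
  calc m * c ≤ X ^ a * X ^ (1 / 40 : ℝ) := by
        refine mul_le_mul hm (hc.trans hlog) hc0 (by positivity)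
    _ = X ^ (a + 1 / 40) := (rpow_add (by linarith) _ _).symm
    _ ≤ _ := rpow_le_rpow_of_exponent_le hX (by linarith)

lemma conductor_bounds (hX : 1 ≤ X)
    (hlog : 400 * (17 + 6 * log X) * (1 + log X) ≤ X ^ (1 / 40 : ℝ))
    {q : ℕ} (hq : 1 ≤ q) (hqX : (q : ℝ) ≤ 4 * X ^ (5 / 6 : ℝ)) :
    80 * ((q.totient : ℝ) * (6 + log q)) * (1 + log (X ^ (9 / 10 : ℝ))) ≤ X ^ (9 / 10 : ℝ) ∧
    24 * (q : ℝ) ^ (21 / 20 : ℝ) ≤ X ^ (9 / 10 : ℝ) := by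
  have hX0 : 0 < X := by linarith
  have hℓ : 0 ≤ log X := log_nonneg hX
  have hq1 : (1:ℝ) ≤ q := by exact_mod_cast hq
  have hlq : 0 ≤ log q := log_nonneg hq1
  have hlq' : log q ≤ 2 + log X := by
    have h4 : log 4 ≤ 2 := by
      rw [show (4:ℝ) = 2 ^ 2 by norm_num, log_pow]
      push_cast
      linarith [log_two_lt_d9]
    have := log_le_log (by linarith) hqX
    rw [log_mul (by norm_num) (by positivity), log_rpow hX0] at this
    linarith
  constructor
  · have ht : (q.totient : ℝ) ≤ q := by exact_mod_cast q.totient_le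
    rw [log_rpow hX0]
    calc 80 * ((q.totient : ℝ) * (6 + log q)) * (1 + 9 / 10 * log X)
        = q.totient / 4 * (320 * (6 + log q) * (1 + 9 / 10 * log X)) := by ring
      _ ≤ _ := by
          refine mul_log_le_rpow hX hlog (a := 5 / 6) (by norm_num) (by linarith) (by positivity) ?_
          refine mul_le_mul ?_ (by linarith) (by positivity) (by positivity)
          linarith
  · have h1 : (q : ℝ) ^ (21 / 20 : ℝ) ≤ 16 * X ^ (7 / 8 : ℝ) := by
      calc (q : ℝ) ^ (21 / 20 : ℝ) ≤ (4 * X ^ (5 / 6 : ℝ)) ^ (21 / 20 : ℝ) :=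
            rpow_le_rpow (by linarith) hqX (by norm_num)
        _ = 4 ^ (21 / 20 : ℝ) * X ^ (7 / 8 : ℝ) := by
            rw [mul_rpow (by norm_num) (by positivity), ← rpow_mul hX0.le]
            norm_num
        _ ≤ _ := by
            refine mul_le_mul_of_nonneg_right ?_ (by positivity)
            calc (4:ℝ) ^ (21 / 20 : ℝ) ≤ 4 ^ (2 : ℝ) :=
                  rpow_le_rpow_of_exponent_le (by norm_num) (by norm_num)
              _ = 16 := by norm_num
    have h2 := mul_log_le_rpow hX hlog (a := 7 / 8) le_rfl le_rfl (by norm_num : (0:ℝ) ≤ 384)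
      (by nlinarith)
    linarith

lemma degree_bound (hX : 1 ≤ X)
    (hlog : 400 * (17 + 6 * log X) * (1 + log X) ≤ X ^ (1 / 40 : ℝ))
    {D T : ℝ} (hD : 1 ≤ D) (hDX : D ≤ X ^ (1 / 3 : ℝ)) (hT : 1 ≤ T) (hTX : T ≤ 2 * X)
    {N : ℕ} (hN : (N : ℝ) = D) :
    (3 * D + 2 + 2 * log (2 * (36 * D * T ^ 2) ^ N)) / (1 / (4 * D)) *
      (1 + log (X ^ (9 / 10 : ℝ))) ≤ X ^ (9 / 10 : ℝ) := by
  have hX0 : 0 < X := by linarith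
  have hℓ : 0 ≤ log X := log_nonneg hX
  have hl : log (36 * D * T ^ 2) ≤ 6 + 3 * log X := by
    have h1 : log D ≤ log X := by
      refine log_le_log (by linarith) (hDX.trans ?_)
      exact (rpow_le_rpow_of_exponent_le hX (by norm_num)).trans (rpow_one X).le
    have h2 : log T ≤ 1 + log X := by
      have := log_le_log (by linarith) hTX
      rw [log_mul (by norm_num) hX0.ne'] at this
      linarith [log_two_lt_d9]
    have h3 : log 36 ≤ 4 := by
      rw [log_le_iff_le_exp (by norm_num)]
      have : exp 4 = exp 1 ^ 4 := by rw [← exp_nat_mul]; norm_num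
      rw [this]
      calc (36:ℝ) ≤ 2.7 ^ 4 := by norm_num
        _ ≤ _ := pow_le_pow_left₀ (by norm_num) (by linarith [exp_one_gt_d9]) 4
    rw [log_mul (by positivity) (by positivity), log_mul (by norm_num) (by positivity), log_pow]
    push_cast
    linarith
  have hl2 : log (2 * (36 * D * T ^ 2) ^ N) ≤ 1 + D * (6 + 3 * log X) := by
    rw [log_mul (by norm_num) (by positivity), log_pow, hN]
    have := mul_le_mul_of_nonneg_left hl (by linarith : 0 ≤ D)
    linarith [log_two_lt_d9]
  have hDD : D * D ≤ X ^ (2 / 3 : ℝ) := by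
    calc D * D ≤ X ^ (1 / 3 : ℝ) * X ^ (1 / 3 : ℝ) := mul_le_mul hDX hDX (by linarith) (by positivity)
      _ = X ^ (2 / 3 : ℝ) := by rw [← rpow_add hX0]; norm_num
  rw [log_rpow hX0]
  calc _ = (3 * D + 2 + 2 * log (2 * (36 * D * T ^ 2) ^ N)) * (4 * D) * (1 + 9 / 10 * log X) := by
        field_simp
    _ ≤ (D * (19 + 6 * log X)) * (4 * D) * (1 + 9 / 10 * log X) := by
        refine mul_le_mul_of_nonneg_right (mul_le_mul_of_nonneg_right ?_ (by linarith)) (by linarith)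
        nlinarith
    _ = D * D * (4 * (19 + 6 * log X) * (1 + 9 / 10 * log X)) := by ring
    _ ≤ _ := by
        refine mul_log_le_rpow hX hlog (a := 2 / 3) (by norm_num) hDD (by positivity) ?_
        refine mul_le_mul (by linarith) (by linarith) (by positivity) (by positivity)

end
end

section
open NumberField Module Filter
open scoped NNReal

lemma sum_log_primeFactors_le {m : ℕ} (hm : m ≠ 0) :
    ∑ r ∈ m.primeFactors, Real.log r ≤ Real.log m := by
  rw [← Real.log_prod fun r hr => Nat.cast_ne_zero.2 (Nat.prime_of_mem_primeFactors hr).ne_zero,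
    ← Nat.cast_prod]
  exact Real.log_le_log (Nat.cast_pos.2 (Finset.prod_pos fun r hr =>
      (Nat.prime_of_mem_primeFactors hr).pos))
    (by exact_mod_cast Nat.le_of_dvd (Nat.pos_of_ne_zero hm) (Nat.prod_primeFactors_dvd m))

lemma rpow_nine_tenths_pow {X : ℝ} (hX : 0 < X) (B : ℕ) :
    (X ^ (9 / 10 : ℝ)) ^ (20 * B + 27 + 3) / (X ^ B)⁻¹ + (X ^ B)⁻¹ * X ^ (20 * B + 27) =
      2 * X ^ (19 * B + 27) := by
  have h1 : (X ^ (9 / 10 : ℝ)) ^ (20 * B + 27 + 3) = X ^ (18 * B + 27) := by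
    rw [← Real.rpow_natCast, ← Real.rpow_mul hX.le, ← Real.rpow_natCast]
    congr 1
    push_cast
    ring
  rw [h1, div_inv_eq_mul, ← pow_add, show 20 * B + 27 = B + (19 * B + 27) by ring, pow_add X B,
    inv_mul_cancel_left₀ (pow_ne_zero _ hX.ne')]
  rw [show 18 * B + 27 + B = 19 * B + 27 by ring]
  ring

namespace NumberField.IsKummer
variable {L : Type*} [Field L] [NumberField L] [IsGalois ℚ L] {n d p : ℕ} {ζ θ : L}

/-- A zero-free `ZetaLike` function attached to a Kummer field. -/
lemma exists_zetaLike_ne_zero (h : IsKummer n d p ζ θ) {τ : L ≃ₐ[ℚ] L} (hτ : τ ζ = ζ⁻¹)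
    (hτ' : τ θ = θ) {X : ℝ} (hX : 1 ≤ X)
    (hlog : 400 * (17 + 6 * Real.log X) * (1 + Real.log X) ≤ X ^ (1 / 40 : ℝ))
    (hp : (p : ℝ) ≤ X ^ (2 / 3 : ℝ)) (hn : (n : ℝ) ≤ X ^ (1 / 6 : ℝ)) :
    ∃ f R M, ZetaLike f (fieldMangoldt L) R M (X ^ (9 / 10 : ℝ)) ∧
      ∀ ρ : ℂ, ‖ρ - 1‖ < 1 / (10 ^ 4 * X ^ (9 / 10 : ℝ)) → f ρ ≠ 0 := by
  have hX0 : 0 < X := by linarith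
  have hQ : 1 ≤ X ^ (9 / 10 : ℝ) := Real.one_le_rpow hX (by norm_num)
  have hpn : (p : ℝ) * n ≤ X ^ (5 / 6 : ℝ) := by
    calc (p : ℝ) * n ≤ X ^ (2 / 3 : ℝ) * X ^ (1 / 6 : ℝ) :=
          mul_le_mul hp hn (Nat.cast_nonneg _) (by positivity)
      _ = _ := by rw [← Real.rpow_add hX0]; norm_num
  have hdn : (d : ℝ) ≤ n := by exact_mod_cast Nat.le_of_dvd h.n_pos h.d_dvd
  have hnd : (n : ℝ) * d ≤ X ^ (1 / 3 : ℝ) := by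
    calc (n : ℝ) * d ≤ X ^ (1 / 6 : ℝ) * X ^ (1 / 6 : ℝ) :=
          mul_le_mul hn (hdn.trans hn) (Nat.cast_nonneg _) (by positivity)
      _ = _ := by rw [← Real.rpow_add hX0]; norm_num
  have hndp : (n : ℝ) * d * p ≤ X := by
    calc (n : ℝ) * d * p ≤ X ^ (1 / 3 : ℝ) * X ^ (2 / 3 : ℝ) :=
          mul_le_mul hnd hp (Nat.cast_nonneg _) (by positivity)
      _ = _ := by rw [← Real.rpow_add hX0]; norm_num
  have hq0 : 1 ≤ 4 * p * n := Nat.mul_pos (Nat.mul_pos (by norm_num) h.prime.pos) h.n_pos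
  obtain ⟨hc1, hc2⟩ := conductor_bounds hX hlog hq0 (by push_cast; linarith)
  have hD : (1:ℝ) ≤ finrank ℚ L := by exact_mod_cast finrank_pos (R := ℚ) (M := L)
  have hDX : (finrank ℚ L : ℝ) ≤ X ^ (1 / 3 : ℝ) :=
    le_trans (by exact_mod_cast h.finrank_le) hnd
  have hT : ((n * d * p + 1 : ℝ≥0) : ℝ) = n * d * p + 1 := by push_cast; rfl
  obtain ⟨f, hf1, hf⟩ := exists_zetaLike L h.coverRadius (by simp) hQ
    (degree_bound hX hlog hD hDX (by rw [hT]; linarith [show 0 ≤ (n : ℝ) * d * p by positivity])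
      (by rw [hT]; linarith) rfl)
  exact ⟨f, _, _, hf, fun ρ hρ => h.ne_zero hτ hτ' hf hf1 hc1 hc2 hρ⟩

end NumberField.IsKummer

/-- The effective Chebotarev theorem for the primes that split completely in a Kummer field. -/
theorem NumberField.exists_abs_card_sub_le (A : ℝ) : ∃ C > 0, ∃ x0 : ℝ, ∀ x : ℝ, x0 ≤ x →
    ∀ {L : Type} [Field L] [NumberField L] [IsGalois ℚ L] {n d p : ℕ} {ζ θ : L},
    IsKummer n d p ζ θ → ∀ τ : L ≃ₐ[ℚ] L, τ ζ = ζ⁻¹ → τ θ = θ →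
    (p : ℝ) ≤ Real.log x ^ (2 / 3 : ℝ) → (n : ℝ) ≤ Real.log x ^ (1 / 6 : ℝ) →
    |(((Finset.range (⌊x⌋₊ + 1)).filter fun r => r.Prime ∧ r ≠ p ∧ (r : ZMod n) = 1 ∧
      d ∣ (r - 1) / orderOf (p : ZMod r)).card : ℝ) -
        (∫ t in (2:ℝ)..x, 1 / Real.log t) / finrank ℚ L| ≤ C * x / Real.log x ^ A := by
  set B := ⌈A⌉₊ + 1 with hB
  obtain ⟨C, hC, hE⟩ := ZetaLike.abs_logError_le (20 * B + 27)
  refine ⟨1 + 4 * C * 2 ^ (20 * B + 28), by positivity, ?_⟩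
  have hev : ∀ᶠ x : ℝ in atTop, 16 ≤ x ∧ 2 ≤ Real.log x ∧
      400 * (17 + 6 * Real.log (Real.log x)) * (1 + Real.log (Real.log x)) ≤
        Real.log x ^ (1 / 40 : ℝ) ∧ 8 * √x + Real.log x ≤ x / Real.log x ^ A :=
    (eventually_ge_atTop 16).and ((Real.tendsto_log_atTop.eventually_ge_atTop 2).and
      ((Real.tendsto_log_atTop.eventually eventually_log_bound).and (eventually_sqrt_add_log_le A)))
  obtain ⟨x0, hx0⟩ := eventually_atTop.1 hev
  refine ⟨x0, fun x hx => ?_⟩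
  obtain ⟨h16, hX2, hlog, hsq⟩ := hx0 x hx
  intro L _ _ _ n d p ζ θ h τ hτ hτ' hp hn
  set X := Real.log x with hXdef
  have hX0 : 0 < X := by linarith
  obtain ⟨f, R, M, hf, hne⟩ := h.exists_zetaLike_ne_zero hτ hτ' (by linarith) hlog hp hn
  have hXB : (2:ℝ) ≤ X ^ B :=
    hX2.trans (le_self_pow₀ (by linarith) (Nat.succ_ne_zero _))
  have hℓ : 0 ≤ Real.log X := Real.log_nonneg (by linarith)
  have hE' : ∀ u, 1 ≤ u → u ≤ x →
      |logError (fieldMangoldt L) (20 * B + 27) u| ≤ C * x * (2 * X ^ (19 * B + 27)) := by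
    intro u hu hux
    have h1 := hE hf hne x (Real.exp_one_lt_d9.le.trans (by linarith)) ?_ u hu hux (X ^ B)⁻¹
      (by positivity) ?_
    · rw [← hXdef, rpow_nine_tenths_pow hX0] at h1
      exact h1.trans (mul_le_mul_of_nonneg_right (mul_le_mul_of_nonneg_left hux hC.le)
        (by positivity))
    · rw [← hXdef]
      calc Real.log X ≤ 400 * (17 + 6 * Real.log X) * (1 + Real.log X) := by nlinarith
        _ ≤ X ^ (1 / 40 : ℝ) := hlog
        _ ≤ _ := Real.rpow_le_rpow_of_exponent_le (by linarith) (by norm_num)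
    · rw [inv_le_comm₀ (by positivity) (by norm_num)]
      linarith
  have hpn0 : p * n ≠ 0 := mul_ne_zero h.prime.ne_zero h.n_pos.ne'
  have hW : ∑ r ∈ (p * n).primeFactors, Real.log r ≤ X := by
    have hpn1 : (0:ℝ) < (p * n : ℕ) := Nat.cast_pos.2 (Nat.pos_of_ne_zero hpn0)
    refine (sum_log_primeFactors_le hpn0).trans (Real.log_le_log hpn1 ?_)
    push_cast
    calc (p : ℝ) * n ≤ X ^ (2 / 3 : ℝ) * X ^ (1 / 6 : ℝ) :=
          mul_le_mul hp hn (Nat.cast_nonneg _) (by positivity)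
      _ = X ^ (5 / 6 : ℝ) := by rw [← Real.rpow_add hX0]; norm_num
      _ ≤ X ^ (1 : ℝ) := Real.rpow_le_rpow_of_exponent_le (by linarith) (by norm_num)
      _ = X := Real.rpow_one X
      _ ≤ x := Real.log_le_self (by linarith)
  have hmain := abs_card_sub_le (Nat.succ_ne_zero _) (by exact_mod_cast finrank_pos (R := ℚ) (M := L))
    h16 (P := fun r => r ≠ p ∧ (r : ZMod n) = 1 ∧ d ∣ (r - 1) / orderOf (p : ZMod r))
    (fieldMangoldt_nonneg (K := L)) (fieldMangoldt_le (K := L)) (fun r hr hrB => by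
      have hrp : r ≠ p := by
        rintro rfl
        exact hrB (Nat.mem_primeFactors.2 ⟨hr, dvd_mul_right _ _, hpn0⟩)
      rw [h.fieldMangoldt_eq hr hrB]
      simp only [hrp, ne_eq, not_false_eq_true, true_and]) hW hE'
  refine (le_of_eq (by congr!)).trans (hmain.trans ?_)
  have hpow : 2 * (C * x * (2 * X ^ (19 * B + 27))) / (X / 2) ^ (20 * B + 27 + 1) =
      4 * C * 2 ^ (20 * B + 28) * x / X ^ (B + 1) := by
    rw [show 20 * B + 27 + 1 = 20 * B + 28 by ring, div_pow,
      show X ^ (20 * B + 28) = X ^ (B + 1) * X ^ (19 * B + 27) by rw [← pow_add]; congr 1; ring]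
    field_simp
    ring
  have hXA : X ^ A ≤ X ^ (B + 1) := by
    rw [← Real.rpow_natCast]
    refine Real.rpow_le_rpow_of_exponent_le (by linarith) ((Nat.le_ceil A).trans ?_)
    rw [hB]
    push_cast
    linarith
  rw [hpow, add_mul, add_div, one_mul]
  refine add_le_add hsq (div_le_div_of_nonneg_left ?_ (Real.rpow_pos_of_pos hX0 _) hXA)
  have : 0 < x := by linarith
  positivity

end

/-- For every `A > 0` there are `C_A > 0` and `x₀(A)` such that:
for `x ≥ x₀(A)`, a prime `p ≤ (log x)^{2/3}`, and positive integers `d ∣ n` with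
`n ≤ (log x)^{1/6}/log₂ x`, letting `L = ℚ(ζ, p^{1/d}) ⊆ ℂ` (with `ζ` a primitive
`n`-th root of unity) and `D = [L:ℚ]`, the number `ϖ_p(x; n, d)` of primes
`r ≤ x` with `r ≠ p`, `r ≡ 1 (mod n)` and `d ∣ (r−1)/ℓ_p(r)` satisfies
`|ϖ_p(x; n, d) − li(x)/D| ≤ C_A x/(log x)^A`. -/
theorem rank_stats_stmt9 :
    ∀ A : ℝ, 0 < A → ∃ C : ℝ, 0 < C ∧ ∃ x0 : ℝ, ∀ x : ℝ, x0 ≤ x →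
      ∀ p : ℕ, p.Prime → (p : ℝ) ≤ Real.log x ^ ((2 : ℝ) / 3) →
      ∀ n d : ℕ, 0 < n → 0 < d → d ∣ n →
      (n : ℝ) ≤ Real.log x ^ ((1 : ℝ) / 6) / logI 2 x →
      ∀ ζ : ℂ, IsPrimitiveRoot ζ n →
      |((((Finset.range (⌊x⌋₊ + 1)).filter
            (fun r => r.Prime ∧ r ≠ p ∧ (r : ZMod n) = 1 ∧
              d ∣ (r - 1) / orderOf ((p : ZMod r)))).card : ℝ)
          - (∫ t in (2 : ℝ)..x, 1 / Real.log t) /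
            (Module.finrank ℚ
              ↥(IntermediateField.adjoin ℚ
                  ({ζ, ((((p : ℝ) ^ ((1 : ℝ) / (d : ℝ))) : ℝ) : ℂ)} : Set ℂ))))|
        ≤ C * x / Real.log x ^ A := by
  intro A _
  obtain ⟨C, hC, x0, h⟩ := NumberField.exists_abs_card_sub_le A
  refine ⟨C, hC, x0, fun x hx p hp hpx n d hn hd hdn hnx ζ hζ => ?_⟩
  have ht : ((p : ℝ) ^ ((1 : ℝ) / (d : ℝ))) ^ d = p := by
    rw [one_div]
    exact Real.rpow_inv_natCast_pow (Nat.cast_nonneg p) hd.ne'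
  obtain ⟨L, _, _, _, ζ', θ', τ, hL, hτ, hτ', hD⟩ :=
    NumberField.exists_isKummer_adjoin hn hdn hζ hp ht
  have hlog : (0 : ℝ) < Real.log x ^ ((1 : ℝ) / 6) := by
    have h1 : 1 ≤ logI 2 x := le_max_right _ _
    have h2 : (0 : ℝ) < n := Nat.cast_pos.2 hn
    by_contra! hneg
    exact absurd hnx (not_le.2 ((div_nonpos_of_nonpos_of_nonneg hneg (by linarith)).trans_lt h2))
  rw [← hD]
  exact h x hx hL τ hτ hτ' hpx (hnx.trans (div_le_self hlog.le (le_max_right _ _)))
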